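/- Let K be a number field with ring of integers O_K, and let F = (P,Q) with P, Q ∈ O_K[x,y] satisfy ∂P/∂x·∂Q/∂y − ∂P/∂y·∂Q/∂x = 1. If for every k ∈ O_K the set {(a,b) ∈ O_K × O_K : P(a,b) = k} is infinite, then F is invertible over K. -/

import Mathlib

section
open MvPolynomial NumberField

section Endgame

set_option linter.unusedSectionVars false
variable {k : Type*} [Field k] [CharZero k]

/-- The Hamiltonian derivation attached to `P`: `f ↦ P₀ f₁ - P₁ f₀`. -/
noncomputable def hamDer {k : Type*} [Field k] (P : MvPolynomial (Fin 2) k) :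
    Derivation k (MvPolynomial (Fin 2) k) (MvPolynomial (Fin 2) k) :=
  pderiv 0 P • pderiv 1 - pderiv 1 P • pderiv 0

lemma hamDer_apply {k : Type*} [Field k] (P f : MvPolynomial (Fin 2) k) :
    hamDer P f = pderiv 0 P * pderiv 1 f - pderiv 1 P * pderiv 0 f := by
  simp [hamDer]

lemma hamDer_self {k : Type*} [Field k] (P : MvPolynomial (Fin 2) k) : hamDer P P = 0 := by
  rw [hamDer_apply]; ring

lemma pderiv_zero_eq_hamDer {P Q : MvPolynomial (Fin 2) k} (hJ : hamDer P Q = 1)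
    (f : MvPolynomial (Fin 2) k) :
    pderiv 0 f = -hamDer Q f * pderiv 0 P + hamDer P f * pderiv 0 Q := by
  rw [hamDer_apply] at hJ
  simp only [hamDer_apply]
  linear_combination (-pderiv 0 f) * hJ

lemma pderiv_one_eq_hamDer {P Q : MvPolynomial (Fin 2) k} (hJ : hamDer P Q = 1)
    (f : MvPolynomial (Fin 2) k) :
    pderiv 1 f = -hamDer Q f * pderiv 1 P + hamDer P f * pderiv 1 Q := by
  rw [hamDer_apply] at hJ
  simp only [hamDer_apply]
  linear_combination (-pderiv 1 f) * hJ

lemma totalDegree_pderiv_lt {σ : Type*} {f : MvPolynomial σ k} {i : σ} (h : pderiv i f ≠ 0) :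
    (pderiv i f).totalDegree < f.totalDegree := by
  obtain ⟨m, hm, hdeg⟩ := Finset.exists_mem_eq_sup (pderiv i f).support
    (support_nonempty.mpr h) (fun s => s.sum fun _ e => e)
  have hm' : m + Finsupp.single i 1 ∈ f.support := by
    rw [mem_support_iff] at hm ⊢
    intro h0
    rw [coeff_pderiv, h0] at hm
    simp at hm
  have := le_totalDegree hm'
  rw [totalDegree, hdeg]
  rw [Finsupp.sum_add_index' (by simp) (by simp)] at this
  simp at this
  simpa [Finsupp.sum] using this

lemma eq_C_of_pderiv_eq_zero {σ : Type*} {f : MvPolynomial σ k} (h : ∀ i, pderiv i f = 0) :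
    f = C (coeff 0 f) := by
  classical
  ext m
  rw [coeff_C]
  split_ifs with h0
  · rw [h0]
  · obtain ⟨i, hi⟩ : ∃ i, m i ≠ 0 := by
      by_contra! hc
      exact h0 (Finsupp.ext fun i => by simp [hc i])
    have := congrArg (coeff (m - Finsupp.single i 1)) (h i)
    have hle : Finsupp.single i 1 ≤ m := by
      rw [Finsupp.single_le_iff]; omega
    rw [coeff_pderiv, tsub_add_cancel_of_le hle] at this
    simp only [coeff_zero, mul_eq_zero] at this
    rcases this with h1 | h1
    · exact h1
    · exfalso
      exact_mod_cast h1

lemma derivation_aeval_pair {R A : Type*} [CommRing R] [CommRing A] [Algebra R A]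
    (D : Derivation R A A) (a b : A) (U : MvPolynomial (Fin 2) R) :
    D (aeval ![a, b] U) = aeval ![a, b] (pderiv 0 U) * D a + aeval ![a, b] (pderiv 1 U) * D b := by
  induction U using MvPolynomial.induction_on with
  | C r => simp
  | add p q hp hq => simp only [map_add, hp, hq]; ring
  | mul_X p i hp =>
    simp only [map_mul, Derivation.leibniz, hp, smul_eq_mul, map_add, aeval_X]
    fin_cases i <;> simp [pderiv_X, Pi.single_apply] <;> ring

lemma hamDer_swap {P Q : MvPolynomial (Fin 2) k} : hamDer Q P = -hamDer P Q := by
  simp only [hamDer_apply]; ring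

lemma aeval_pair_injective {P Q : MvPolynomial (Fin 2) k} (hJ : hamDer P Q = 1) :
    Function.Injective (aeval ![P, Q] : MvPolynomial (Fin 2) k →ₐ[k] MvPolynomial (Fin 2) k) := by
  rw [injective_iff_map_eq_zero]
  intro U
  induction' hn : U.totalDegree using Nat.strong_induction_on with n ih generalizing U
  intro hU
  have h0 : pderiv 0 U = 0 := by
    by_contra hne
    refine hne (ih _ (hn ▸ totalDegree_pderiv_lt hne) _ rfl ?_)
    have := derivation_aeval_pair (hamDer Q) P Q U
    rw [hU, map_zero, hamDer_self, hamDer_swap, hJ, mul_zero, add_zero] at this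
    simpa only [mul_neg, mul_one, zero_eq_neg] using this
  have h1 : pderiv 1 U = 0 := by
    by_contra hne
    refine hne (ih _ (hn ▸ totalDegree_pderiv_lt hne) _ rfl ?_)
    have := derivation_aeval_pair (hamDer P) P Q U
    rw [hU, map_zero, hamDer_self, hJ, mul_zero, zero_add, mul_one] at this
    exact this.symm
  have hC := eq_C_of_pderiv_eq_zero (f := U) (fun i => by fin_cases i <;> assumption)
  rw [hC] at hU ⊢
  simpa using hU

lemma exists_aeval_eq_of_hamDer_eq_zero {P Q : MvPolynomial (Fin 2) k} (hJ : hamDer P Q = 1)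
    (f : MvPolynomial (Fin 2) k) (hf : hamDer P f = 0) :
    ∃ g : Polynomial k, f = Polynomial.aeval P g := by
  induction' hn : f.totalDegree using Nat.strong_induction_on with n ih generalizing f
  have e0 := pderiv_zero_eq_hamDer hJ f
  have e1 := pderiv_one_eq_hamDer hJ f
  rw [hf, zero_mul, add_zero] at e0 e1
  set u := -hamDer Q f with hu
  by_cases hu0 : u = 0
  · rw [hu0, zero_mul] at e0 e1
    exact ⟨Polynomial.C (coeff 0 f), by
      rw [Polynomial.aeval_C]
      exact eq_C_of_pderiv_eq_zero (fun i => by fin_cases i <;> assumption)⟩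
  have hlt : u.totalDegree < n := by
    have key : ∀ i, pderiv i f = u * pderiv i P → pderiv i P ≠ 0 → u.totalDegree < n := by
      intro i hi hne
      have h1 := totalDegree_mul_of_isDomain hu0 hne
      have h2 := totalDegree_pderiv_lt (f := f) (i := i) (by rw [hi]; exact mul_ne_zero hu0 hne)
      rw [hi] at h2
      omega
    by_cases h0 : pderiv 0 P = 0
    · refine key 1 e1 fun h1 => ?_
      rw [hamDer_apply, h0, h1] at hJ
      simp at hJ
    · exact key 0 e0 h0
  have hDu : hamDer P u = 0 := by
    have h01 : pderiv 1 (pderiv 0 f) = pderiv 0 (pderiv 1 f) := by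
      ext m
      simp only [coeff_pderiv, Finsupp.add_apply]
      rw [add_right_comm]
      simp
      ring
    have h01P : pderiv 1 (pderiv 0 P) = pderiv 0 (pderiv 1 P) := by
      ext m
      simp only [coeff_pderiv, Finsupp.add_apply]
      rw [add_right_comm]
      simp
      ring
    rw [e0, e1] at h01
    simp only [Derivation.leibniz, smul_eq_mul] at h01
    rw [hamDer_apply]
    linear_combination h01 - u * h01P
  obtain ⟨g, hg⟩ := ih _ hlt u hDu rfl
  obtain ⟨G, hG⟩ : ∃ G : Polynomial k, Polynomial.derivative G = g := by
    refine ⟨g.sum fun i a => Polynomial.monomial (i + 1) (a / (i + 1)), ?_⟩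
    conv_rhs => rw [g.as_sum_support]
    rw [Polynomial.sum, Polynomial.derivative_sum]
    refine Finset.sum_congr rfl fun i _ => ?_
    rw [Polynomial.derivative_monomial]
    have : (i : k) + 1 ≠ 0 := by exact_mod_cast Nat.succ_ne_zero i
    simp [div_mul_cancel₀ _ this]
  have hGe : ∀ i, pderiv i (Polynomial.aeval P G) = u * pderiv i P := by
    intro i
    rw [hg, ← hG]
    exact Derivation.map_aeval _ _ _
  have hC := eq_C_of_pderiv_eq_zero (f := f - Polynomial.aeval P G) (fun i => by
    rw [map_sub, hGe]
    fin_cases i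
    · simpa [sub_eq_zero] using e0
    · simpa [sub_eq_zero] using e1)
  refine ⟨G + Polynomial.C (coeff 0 (f - Polynomial.aeval P G)), ?_⟩
  rw [map_add, Polynomial.aeval_C, algebraMap_eq, ← hC]
  ring

lemma iterate_derivation_eq_zero_of_le {A : Type*} [CommRing A] [Algebra k A]
    (D : Derivation k A A) {f : A} {a b : ℕ} (h : D^[a] f = 0) (hab : a ≤ b) : D^[b] f = 0 := by
  obtain ⟨c, rfl⟩ := Nat.exists_eq_add_of_le' hab
  rw [Function.iterate_add_apply, h]
  exact iterate_map_zero D c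

lemma iterate_derivation_smul {A : Type*} [CommRing A] [Algebra k A] (D : Derivation k A A)
    (c : k) (m : ℕ) (u : A) : D^[m] (c • u) = c • D^[m] u := by
  induction m generalizing u with
  | zero => rfl
  | succ m ihm => rw [Function.iterate_succ_apply, Function.iterate_succ_apply,
      Derivation.map_smul, ihm]

lemma iterate_derivation_mul_eq_zero {A : Type*} [CommRing A] [Algebra k A]
    (D : Derivation k A A) : ∀ (n a b : ℕ) (f g : A), a + b ≤ n + 1 → D^[a] f = 0 →
      D^[b] g = 0 → D^[n] (f * g) = 0 := by
  intro n
  induction n with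
  | zero =>
    intro a b f g hab hf hg
    rcases (by omega : a = 0 ∨ b = 0) with rfl | rfl
    · simp at hf; simp [hf]
    · simp at hg; simp [hg]
  | succ n ih =>
    intro a b f g hab hf hg
    rw [Function.iterate_succ_apply, Derivation.leibniz]
    have hadd : ∀ u v : A, D^[n] (u + v) = D^[n] u + D^[n] v := fun u v => iterate_map_add D n u v
    rw [hadd, smul_eq_mul, smul_eq_mul]
    have h1 : D^[n] (f * D g) = 0 := by
      cases b with
      | zero =>
        simp only [Function.iterate_zero, id] at hg
        simp [hg]
      | succ b => exact ih a b f (D g) (by omega) hf (by simpa using hg)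
    have h2 : D^[n] (g * D f) = 0 := by
      cases a with
      | zero =>
        simp only [Function.iterate_zero, id] at hf
        simp [hf]
      | succ a => exact ih b a g (D f) (by omega) hg (by simpa using hf)
    rw [h1, h2, add_zero]

lemma exists_iterate_hamDer_eq_zero {P : MvPolynomial (Fin 2) k} {a : ℕ}
    (h : ∀ i, (hamDer P)^[a] (X i) = 0) (f : MvPolynomial (Fin 2) k) :
    ∃ b, (hamDer P)^[b] f = 0 := by
  induction f using MvPolynomial.induction_on with
  | C r => exact ⟨1, by simp⟩
  | add p q hp hq =>
    obtain ⟨b, hb⟩ := hp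
    obtain ⟨c, hc⟩ := hq
    refine ⟨max b c, ?_⟩
    rw [iterate_map_add, iterate_derivation_eq_zero_of_le _ hb (le_max_left _ _),
      iterate_derivation_eq_zero_of_le _ hc (le_max_right _ _), add_zero]
  | mul_X p i hp =>
    obtain ⟨b, hb⟩ := hp
    exact ⟨b + a, iterate_derivation_mul_eq_zero _ _ b a _ _ (by omega) hb (h i)⟩

lemma aeval_pair_surjective {P Q : MvPolynomial (Fin 2) k} (hJ : hamDer P Q = 1) {a : ℕ}
    (h : ∀ i, (hamDer P)^[a] (X i) = 0) :
    Function.Surjective (aeval ![P, Q] : MvPolynomial (Fin 2) k →ₐ[k] MvPolynomial (Fin 2) k) := by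
  have main : ∀ b f, (hamDer P)^[b] f = 0 →
      f ∈ (aeval ![P, Q] : MvPolynomial (Fin 2) k →ₐ[k] MvPolynomial (Fin 2) k).range := by
    intro b
    induction b with
    | zero =>
      intro f hf
      have : f = 0 := hf
      rw [this]
      exact zero_mem _
    | succ b ih =>
      intro f hf
      obtain ⟨g, hg⟩ := exists_aeval_eq_of_hamDer_eq_zero hJ ((hamDer P)^[b] f)
        ((Function.iterate_succ_apply' (hamDer P) b f).symm.trans hf)
      have hP : P ∈ (aeval ![P, Q] : MvPolynomial (Fin 2) k →ₐ[k] MvPolynomial (Fin 2) k).range :=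
        ⟨X 0, by simp⟩
      have hQ : Q ∈ (aeval ![P, Q] : MvPolynomial (Fin 2) k →ₐ[k] MvPolynomial (Fin 2) k).range :=
        ⟨X 1, by simp⟩
      have hr : (hamDer P)^[b] f ∈
          (aeval ![P, Q] : MvPolynomial (Fin 2) k →ₐ[k] MvPolynomial (Fin 2) k).range := by
        rw [hg]
        exact Algebra.adjoin_le (Set.singleton_subset_iff.mpr hP)
          (Polynomial.aeval_mem_adjoin_singleton k P)
      set r := (hamDer P)^[b] f with hr_def
      have hDr : hamDer P r = 0 := by rw [hr_def]; exact (Function.iterate_succ_apply' (hamDer P) b f).symm.trans hf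
      have hQpow : ∀ m : ℕ, (hamDer P)^[m] (Q ^ m * r) = (m.factorial : MvPolynomial (Fin 2) k) * r := by
        intro m
        induction m with
        | zero => simp
        | succ m ihm =>
          rw [Function.iterate_succ_apply]
          have : hamDer P (Q ^ (m + 1) * r) =
              ((m + 1 : ℕ) : k) • (Q ^ m * r) := by
            rw [Derivation.leibniz, hDr, Derivation.leibniz_pow, hJ]
            simp [Algebra.smul_def]
            ring
          rw [this]
          rw [iterate_derivation_smul, ihm, Nat.factorial_succ]
          simp [Algebra.smul_def]
          ring
      have hfac : (b.factorial : k) ≠ 0 := by exact_mod_cast b.factorial_ne_zero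
      have hsub : f - C ((b.factorial : k)⁻¹) * (Q ^ b * r) ∈
          (aeval ![P, Q] : MvPolynomial (Fin 2) k →ₐ[k] MvPolynomial (Fin 2) k).range := by
        apply ih
        have hCr : hamDer P (C ((b.factorial : k)⁻¹) * r) = 0 := by
          rw [Derivation.leibniz, hDr]; simp
        rw [iterate_map_sub, ← hr_def]
        have : C ((b.factorial : k)⁻¹) * (Q ^ b * r) = (b.factorial : k)⁻¹ • (Q ^ b * r) := by
          rw [MvPolynomial.smul_eq_C_mul]
        rw [this]
        rw [iterate_derivation_smul, hQpow]
        rw [MvPolynomial.smul_eq_C_mul, ← map_natCast (C : k →+* MvPolynomial (Fin 2) k),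
          ← mul_assoc, ← C_mul, inv_mul_cancel₀ hfac]
        simp
      have : f = (f - C ((b.factorial : k)⁻¹) * (Q ^ b * r)) + C ((b.factorial : k)⁻¹) * (Q ^ b * r) := by
        ring
      rw [this]
      refine add_mem hsub (mul_mem ?_ (mul_mem (pow_mem hQ _) hr))
      exact ⟨C ((b.factorial : k)⁻¹), by simp⟩
  intro f
  obtain ⟨b, hb⟩ := exists_iterate_hamDer_eq_zero h f
  obtain ⟨u, hu⟩ := main b f hb
  exact ⟨u, hu⟩

lemma exists_inverse_of_surjective {P Q : MvPolynomial (Fin 2) k} (hJ : hamDer P Q = 1)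
    (hs : Function.Surjective
      (aeval ![P, Q] : MvPolynomial (Fin 2) k →ₐ[k] MvPolynomial (Fin 2) k)) :
    ∃ U V : MvPolynomial (Fin 2) k, aeval ![P, Q] U = X 0 ∧ aeval ![P, Q] V = X 1 ∧
      aeval ![U, V] P = X 0 ∧ aeval ![U, V] Q = X 1 := by
  obtain ⟨U, hU⟩ := hs (X 0)
  obtain ⟨V, hV⟩ := hs (X 1)
  have hcomp : ∀ f, aeval ![P, Q] (aeval ![U, V] f) = f := by
    intro f
    have : (aeval ![P, Q] : MvPolynomial (Fin 2) k →ₐ[k] _).comp (aeval ![U, V]) =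
        AlgHom.id k _ := by
      refine MvPolynomial.algHom_ext fun i => ?_
      rw [AlgHom.comp_apply, aeval_X]
      fin_cases i
      · exact hU
      · exact hV
    exact DFunLike.congr_fun this f
  refine ⟨U, V, hU, hV, aeval_pair_injective hJ ?_, aeval_pair_injective hJ ?_⟩
  · rw [hcomp]; simp
  · rw [hcomp]; simp

end Endgame
end

section
open PowerSeries

section Taylor
variable {k R : Type*} [Field k] [CommRing R] [IsDomain R] [Algebra k R]

/-- The `n`-th Taylor remainder with respect to a uniformiser. -/
noncomputable def taylorShift (res : R →ₐ[k] k) (p : R) (h : ∀ r, res r = 0 → p ∣ r) (r : R) : R :=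
  (h (r - algebraMap k R (res r)) (by simp)).choose

lemma taylorShift_spec (res : R →ₐ[k] k) (p : R) (h : ∀ r, res r = 0 → p ∣ r) (r : R) :
    r = algebraMap k R (res r) + p * taylorShift res p h r := by
  have := (h (r - algebraMap k R (res r)) (by simp)).choose_spec
  rw [taylorShift, ← this]; ring

lemma taylorShift_eq {res : R →ₐ[k] k} {p : R} (hp : p ≠ 0) (h : ∀ r, res r = 0 → p ∣ r) {r s : R}
    (hs : r = algebraMap k R (res r) + p * s) : taylorShift res p h r = s := by
  have := taylorShift_spec res p h r
  rw [hs] at this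
  have h2 : p * s = p * taylorShift res p h r := by
    have h3 := taylorShift_spec res p h r
    exact add_left_cancel (hs.symm.trans h3)
  exact (mul_left_cancel₀ hp h2).symm

/-- Taylor coefficients with respect to a uniformiser. -/
noncomputable def taylorCoeff (res : R →ₐ[k] k) (p : R) (h : ∀ r, res r = 0 → p ∣ r) (n : ℕ) (r : R) : k :=
  res ((taylorShift res p h)^[n] r)

lemma taylorCoeff_succ (res : R →ₐ[k] k) (p : R) (h : ∀ r, res r = 0 → p ∣ r) (n : ℕ) (r : R) :
    taylorCoeff res p h (n+1) r = taylorCoeff res p h n (taylorShift res p h r) := by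
  rw [taylorCoeff, Function.iterate_succ_apply]; rfl

lemma taylorShift_add {res : R →ₐ[k] k} {p : R} (hp : p ≠ 0) (h : ∀ r, res r = 0 → p ∣ r) (r s : R) :
    taylorShift res p h (r + s) = taylorShift res p h r + taylorShift res p h s := by
  apply taylorShift_eq hp
  conv_lhs => rw [taylorShift_spec res p h r, taylorShift_spec res p h s]
  simp; ring

lemma taylorShift_mul {res : R →ₐ[k] k} {p : R} (hp : p ≠ 0) (h : ∀ r, res r = 0 → p ∣ r) (r s : R) :
    taylorShift res p h (r * s) =
      algebraMap k R (res r) * taylorShift res p h s + s * taylorShift res p h r := by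
  apply taylorShift_eq hp
  rw [map_mul, map_mul]
  have h1 := taylorShift_spec res p h r
  have h2 := taylorShift_spec res p h s
  linear_combination s * h1 + algebraMap k R (res r) * h2

lemma taylorShift_algebraMap {res : R →ₐ[k] k} {p : R} (hp : p ≠ 0) (h : ∀ r, res r = 0 → p ∣ r)
    (a : k) : taylorShift res p h (algebraMap k R a) = 0 := by
  apply taylorShift_eq hp; simp

lemma taylorCoeff_add {res : R →ₐ[k] k} {p : R} (hp : p ≠ 0) (h : ∀ r, res r = 0 → p ∣ r) (n : ℕ)
    (r s : R) : taylorCoeff res p h n (r + s) = taylorCoeff res p h n r + taylorCoeff res p h n s := by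
  induction n generalizing r s with
  | zero => simp [taylorCoeff]
  | succ n ih => simp [taylorCoeff_succ, taylorShift_add hp, ih]

lemma taylorCoeff_zero {res : R →ₐ[k] k} {p : R} (hp : p ≠ 0) (h : ∀ r, res r = 0 → p ∣ r) (n : ℕ) :
    taylorCoeff res p h n 0 = 0 := by
  have := taylorCoeff_add hp h n 0 0
  simpa using this

lemma taylorCoeff_smul {res : R →ₐ[k] k} {p : R} (hp : p ≠ 0) (h : ∀ r, res r = 0 → p ∣ r) (n : ℕ)
    (a : k) (r : R) : taylorCoeff res p h n (algebraMap k R a * r) = a * taylorCoeff res p h n r := by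
  induction n generalizing r with
  | zero => simp [taylorCoeff]
  | succ n ih => simp [taylorCoeff_succ, taylorShift_mul hp, taylorShift_algebraMap hp, ih]

/-- Taylor expansion with respect to a uniformiser with rational residue field. -/
noncomputable def taylorHom (res : R →ₐ[k] k) (p : R) (hp : p ≠ 0) (h : ∀ r, res r = 0 → p ∣ r) :
    R →ₐ[k] k⟦X⟧ :=
  AlgHom.ofLinearMap
    { toFun := fun r => PowerSeries.mk fun n => taylorCoeff res p h n r
      map_add' := fun r s => by ext n; simp [taylorCoeff_add hp]
      map_smul' := fun a r => by ext n; simp [Algebra.smul_def, taylorCoeff_smul hp] }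
    (by
      ext n
      cases n with
      | zero => simp [taylorCoeff]
      | succ n =>
        have := taylorShift_algebraMap hp h (1:k)
        rw [map_one] at this
        simp [taylorCoeff_succ, this, taylorCoeff_zero hp, PowerSeries.coeff_one])
    (by
      intro r s
      ext n
      induction n generalizing r s with
      | zero => simp [taylorCoeff, PowerSeries.coeff_mul]
      | succ n ih =>
        simp only [LinearMap.coe_mk, AddHom.coe_mk, PowerSeries.coeff_mk, taylorCoeff_succ] at ih ⊢
        rw [taylorShift_mul hp, taylorCoeff_add hp, taylorCoeff_smul hp, mul_comm s, ih,
          PowerSeries.coeff_mul, PowerSeries.coeff_mul, Finset.Nat.antidiagonal_succ]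
        simp only [Finset.sum_cons, PowerSeries.coeff_mk, Finset.sum_map, Function.Embedding.prodMap,
          Function.Embedding.coeFn_mk, Prod.map, Nat.succ_eq_add_one, taylorCoeff_succ, Function.Embedding.refl_apply]
        simp [taylorCoeff])

variable {res : R →ₐ[k] k} {p : R} (hp : p ≠ 0) (h : ∀ r, res r = 0 → p ∣ r)

lemma coeff_taylorHom (n : ℕ) (r : R) :
    PowerSeries.coeff n (taylorHom res p hp h r) = taylorCoeff res p h n r := by
  simp [taylorHom]

lemma constantCoeff_taylorHom (r : R) :
    PowerSeries.constantCoeff (taylorHom res p hp h r) = res r := by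
  rw [← PowerSeries.coeff_zero_eq_constantCoeff_apply, coeff_taylorHom]; rfl

lemma taylorHom_uniformizer (h1 : res p = 0) : taylorHom res p hp h p = PowerSeries.X := by
  ext n
  rw [coeff_taylorHom]
  have hs : taylorShift res p h p = 1 := by apply taylorShift_eq hp; simp [h1]
  rcases n with _ | n
  · simp [taylorCoeff, h1]
  · rw [taylorCoeff_succ, hs, ← coeff_taylorHom hp, map_one, PowerSeries.coeff_one, PowerSeries.coeff_X]
    simp

lemma taylorHom_injective (h1 : res p = 0) (h2 : ∀ r, r ≠ 0 → ∃ n u, r = p ^ n * u ∧ res u ≠ 0) :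
    Function.Injective (taylorHom res p hp h) := by
  rw [injective_iff_map_eq_zero]
  intro r hr
  by_contra hr0
  obtain ⟨n, u, rfl, hu⟩ := h2 r hr0
  rw [map_mul, map_pow, taylorHom_uniformizer hp h h1] at hr
  have : taylorHom res p hp h u = 0 := by
    rcases mul_eq_zero.1 hr with h | h
    · exact absurd h (pow_ne_zero _ PowerSeries.X_ne_zero)
    · exact h
  apply hu
  rw [← constantCoeff_taylorHom hp h, this, map_zero]

end Taylor
end

section
open PowerSeries IsLocalization

theorem exists_laurent_embedding (k B L : Type*) [Field k] [CommRing B] [IsDedekindDomain B]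
    [Field L] [Algebra B L] [IsFractionRing B L] [Algebra k B] [Algebra k L] [IsScalarTower k B L]
    (P : Ideal B) [hPp : P.IsPrime] (hP : P ≠ ⊥) (hres : Function.Surjective (algebraMap k (B ⧸ P))) :
    ∃ (e : L →+* LaurentSeries k) (p : L), (∀ a, e (algebraMap k L a) = HahnSeries.C a) ∧
      e p = HahnSeries.single 1 1 ∧
      (∀ b ∈ P, b ≠ 0 → 0 < (e (algebraMap B L b)).order) ∧
      (∀ (b : B) (n : ℕ), b ≠ 0 → (n : ℤ) ≤ (e (algebraMap B L b)).order → b ∈ P ^ n) ∧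
      ∀ φ : L, 0 ≤ (e φ).order → ∃ a s : B, s ∉ P ∧ φ * algebraMap B L s = algebraMap B L a := by
  classical
  have hle : P.primeCompl ≤ nonZeroDivisors B := P.primeCompl_le_nonZeroDivisors
  let R := Localization.subalgebra.ofField L P.primeCompl hle
  haveI : IsLocalization.AtPrime R P := Localization.subalgebra.isLocalization_ofField L _ hle
  haveI : IsFractionRing R L := Localization.subalgebra.isFractionRing_ofField L _ hle
  haveI : IsLocalRing R := IsLocalization.AtPrime.isLocalRing R P
  haveI : IsDiscreteValuationRing R :=
    IsLocalization.AtPrime.isDiscreteValuationRing_of_dedekind_domain B hP R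
  haveI : IsScalarTower k B R :=
    IsScalarTower.of_algebraMap_eq fun a => Subtype.ext (IsScalarTower.algebraMap_apply k B L a)
  haveI : IsScalarTower k R L := by
    refine IsScalarTower.of_algebraMap_eq fun a => ?_
    rfl
  -- residue map on B
  let q : k ≃ₐ[k] (B ⧸ P) := AlgEquiv.ofBijective (Algebra.ofId k (B ⧸ P))
    ⟨(algebraMap k (B ⧸ P)).injective, hres⟩
  let f : B →ₐ[k] k := (q.symm : (B ⧸ P) →ₐ[k] k).comp (Ideal.Quotient.mkₐ k P)
  have hf : ∀ b, f b = 0 ↔ b ∈ P := by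
    intro b
    simp only [f, AlgHom.comp_apply, Ideal.Quotient.mkₐ_eq_mk]
    rw [← Ideal.Quotient.eq_zero_iff_mem]
    exact map_eq_zero_iff (q.symm : (B ⧸ P) ≃ₐ[k] k) q.symm.injective
  have hfu : ∀ y : P.primeCompl, IsUnit (f y) := by
    intro y
    rw [isUnit_iff_ne_zero, Ne, hf]; exact y.2
  let res : R →ₐ[k] k := IsLocalization.liftAlgHom (M := P.primeCompl) (f := f) hfu
  have hresB : ∀ b, res (algebraMap B R b) = f b := fun b => by
    simp [res, IsLocalization.liftAlgHom_apply]
  obtain ⟨π, hπ⟩ := IsDiscreteValuationRing.exists_irreducible R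
  have hπ0 : π ≠ 0 := hπ.ne_zero
  have hm : IsLocalRing.maximalIdeal R = Ideal.span {π} := hπ.maximalIdeal_eq
  have hmem : ∀ r, res r = 0 ↔ r ∈ IsLocalRing.maximalIdeal R := by
    intro r
    constructor
    · intro h
      obtain ⟨b, s, rfl⟩ := IsLocalization.exists_mk'_eq P.primeCompl r
      rw [IsLocalRing.mem_maximalIdeal, mem_nonunits_iff]
      intro hu
      exact (hu.map res).ne_zero h
    · intro h
      by_contra h0
      have h1 : r - algebraMap k R (res r) ∈ IsLocalRing.maximalIdeal R := by
        obtain ⟨b, s, hbs⟩ := IsLocalization.exists_mk'_eq P.primeCompl (r - algebraMap k R (res r))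
        have h2 : res (r - algebraMap k R (res r)) = 0 := by simp
        rw [← hbs] at h2 ⊢
        have h3 : IsLocalization.mk' R b s * algebraMap B R s = algebraMap B R b :=
          IsLocalization.mk'_spec R b s
        have h4 : b ∈ P := by
          rw [← hf, ← hresB, ← h3, map_mul, h2, zero_mul]
        rw [IsLocalization.AtPrime.mk'_mem_maximal_iff R P]
        exact h4
      have h2 := (IsLocalRing.maximalIdeal R).sub_mem h h1
      rw [sub_sub_cancel] at h2
      exact (IsLocalRing.mem_maximalIdeal _).1 h2 ((isUnit_iff_ne_zero.2 h0).map (algebraMap k R))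
  have hdvd : ∀ r, res r = 0 → π ∣ r := fun r h => by
    rw [hmem, hm, Ideal.mem_span_singleton] at h; exact h
  have hresπ : res π = 0 := by rw [hmem, hm]; exact Ideal.mem_span_singleton_self π
  have hunit : ∀ u, res u ≠ 0 ↔ IsUnit u := by
    intro u
    rw [Ne, hmem, IsLocalRing.mem_maximalIdeal, mem_nonunits_iff, not_not]
  have hfac : ∀ r, r ≠ 0 → ∃ (n : ℕ) (u : R), r = π ^ n * u ∧ res u ≠ 0 := by
    intro r hr
    obtain ⟨n, u, h⟩ := IsDiscreteValuationRing.eq_unit_mul_pow_irreducible hr hπ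
    exact ⟨n, u, by rw [h, mul_comm], (hunit _).2 u.isUnit⟩
  let T : R →ₐ[k] k⟦X⟧ := taylorHom res π hπ0 hdvd
  have hTinj : Function.Injective T := taylorHom_injective hπ0 hdvd hresπ hfac
  have hTπ : T π = PowerSeries.X := taylorHom_uniformizer hπ0 hdvd hresπ
  let T' : R →+* LaurentSeries k := (HahnSeries.ofPowerSeries ℤ k).comp T.toRingHom
  have hT'inj : Function.Injective T' := by
    intro a b h
    exact hTinj (HahnSeries.ofPowerSeries_injective h)
  let e : L →+* LaurentSeries k := IsFractionRing.lift (K := L) (g := T') hT'inj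
  have heR : ∀ r, e (algebraMap R L r) = T' r := fun r =>
    IsFractionRing.lift_algebraMap hT'inj r
  have hTX : T' π = HahnSeries.single 1 1 := by
    change HahnSeries.ofPowerSeries ℤ k (T π) = _
    rw [hTπ]; exact PowerSeries.coe_X
  have hord : ∀ (n : ℕ) (u : R), IsUnit u → (e (algebraMap R L (π ^ n * u))).order = n := by
    intro n u hu
    rw [heR, map_mul, map_pow, hTX]
    have h1 : (T' u).order = 0 := by
      have h2 : T' u * T' (hu.unit⁻¹ : Rˣ) = 1 := by rw [← map_mul]; simp
      have h3 : ∀ r : R, 0 ≤ (T' r).order := by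
        intro r
        by_cases h0 : T' r = 0
        · simp [h0]
        · refine HahnSeries.le_order_iff_forall (h := h0) |>.2 ?_ 
          intro j hj
          change HahnSeries.coeff (HahnSeries.ofPowerSeries ℤ k (T r)) j = 0
          rw [PowerSeries.coeff_coe, if_pos hj]
      have h4 := HahnSeries.order_mul (x := T' u) (y := T' (hu.unit⁻¹ : Rˣ)) (left_ne_zero_of_mul_eq_one h2)
        (right_ne_zero_of_mul_eq_one h2)
      rw [h2, HahnSeries.order_one] at h4
      have := h3 u; have := h3 (hu.unit⁻¹ : Rˣ); omega
    rw [HahnSeries.order_mul, h1, HahnSeries.order_pow, HahnSeries.order_single one_ne_zero]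
    · simp
    · exact pow_ne_zero _ (by simp)
    · exact (hu.map T').ne_zero
  have halg : ∀ b : B, algebraMap B L b = algebraMap R L (algebraMap B R b) := fun b => rfl
  have hBR : Function.Injective (algebraMap B R) := by
    intro a b h
    apply IsFractionRing.injective B L
    rw [halg, halg, h]
  refine ⟨e, algebraMap R L π, fun a => ?_, (heR π).trans hTX, ?_, ?_, ?_⟩
  · rw [IsScalarTower.algebraMap_apply k R L, heR]
    change HahnSeries.ofPowerSeries ℤ k (T (algebraMap k R a)) = _
    rw [T.commutes, PowerSeries.algebraMap_apply]
    simp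
  · intro b hb hb0
    have h0 : algebraMap B R b ≠ 0 := by
      rw [Ne, map_eq_zero_iff _ hBR]; exact hb0
    obtain ⟨n, u, h, hu⟩ := hfac _ h0
    rw [halg, h, hord n u ((hunit u).1 hu)]
    rcases n with _ | n
    · exfalso
      rw [pow_zero, one_mul] at h
      rw [← h, hresB] at hu
      exact hu ((hf b).2 hb)
    · positivity
  · intro b n hb0 hn
    have h0 : algebraMap B R b ≠ 0 := by
      rw [Ne, map_eq_zero_iff _ hBR]; exact hb0
    obtain ⟨m, u, h, hu⟩ := hfac _ h0
    rw [halg, h, hord m u ((hunit u).1 hu)] at hn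
    have hn' : n ≤ m := by exact_mod_cast hn
    have h1 : algebraMap B R b ∈ (IsLocalRing.maximalIdeal R) ^ n := by
      rw [hm, Ideal.span_singleton_pow, Ideal.mem_span_singleton, h]
      exact (pow_dvd_pow π hn').mul_right u
    rw [← IsLocalization.AtPrime.map_eq_maximalIdeal P R, ← Ideal.map_pow] at h1
    obtain ⟨s, hs, hsb⟩ := (IsLocalization.algebraMap_mem_map_algebraMap_iff P.primeCompl R (P ^ n) b).1 h1
    exact (Ideal.IsPrime.mul_mem_pow P hsb).resolve_left hs
  · intro φ hφ
    have key : ∃ r : R, algebraMap R L r = φ := by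
      rcases ValuationRing.isInteger_or_isInteger R φ with h | h
      · exact h
      · obtain ⟨r, hr⟩ := h
        by_cases hφ0 : φ = 0
        · exact ⟨0, by simp [hφ0]⟩
        have hr0 : r ≠ 0 := by
          rintro rfl
          rw [map_zero] at hr
          exact inv_ne_zero hφ0 hr.symm
        obtain ⟨n, u, h, hu⟩ := hfac _ hr0
        have h5 := hord n u ((hunit u).1 hu)
        rw [← h, hr, map_inv₀] at h5
        have h6 : (e φ) * (e φ)⁻¹ = 1 := mul_inv_cancel₀ (by rwa [Ne, _root_.map_eq_zero])
        have h7 := HahnSeries.order_mul (left_ne_zero_of_mul_eq_one h6) (right_ne_zero_of_mul_eq_one h6)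
        rw [h6, HahnSeries.order_one, h5] at h7
        have hn0 : n = 0 := by omega
        subst hn0
        rw [pow_zero, one_mul] at h
        have hu' : IsUnit r := by rw [h]; exact (hunit u).1 hu
        refine ⟨(hu'.unit⁻¹ : Rˣ), ?_⟩
        have h8 : algebraMap R L r * algebraMap R L (hu'.unit⁻¹ : Rˣ) = 1 := by
          rw [← map_mul]; simp
        rw [hr] at h8
        field_simp at h8
        exact h8
    obtain ⟨r, rfl⟩ := key
    obtain ⟨b, s, rfl⟩ := IsLocalization.exists_mk'_eq P.primeCompl r
    exact ⟨b, s, s.2, by rw [halg, ← map_mul, IsLocalization.mk'_spec, ← halg]⟩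
end

section
open Polynomial

theorem exists_places_of_tower (k K L : Type*) [Field k] [IsAlgClosed k] [CharZero k] [Field K] [Field L]
    [Algebra k[X] K] [IsFractionRing k[X] K] [Algebra k L] [Algebra k[X] L] [IsScalarTower k k[X] L]
    [Algebra K L] [IsScalarTower k[X] K L] [FiniteDimensional K L] :
    ∃ (ι : Type) (_ : Fintype ι) (e : ι → (L →+* LaurentSeries k)) (p : ι → L),
      (∀ c a, e c (algebraMap k L a) = HahnSeries.C a) ∧
      (∀ c, e c (p c) = HahnSeries.single 1 1) ∧
      (∀ c, 0 < (e c (algebraMap k[X] L X)).order) ∧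
      ∑ c, (e c (algebraMap k[X] L X)).order ≤ Module.finrank K L ∧
      ∀ V : ValuationSubring L, (∀ a, algebraMap k L a ∈ V) → algebraMap k[X] L X ∈ V →
        (algebraMap k[X] L X)⁻¹ ∉ V → ∃ c, ∀ φ, 0 ≤ (e c φ).order → φ ∈ V := by
  classical
  haveI : CharZero K := by
    refine ⟨fun a b h => ?_⟩
    have : algebraMap k[X] K (a : k[X]) = algebraMap k[X] K (b : k[X]) := by simpa using h
    exact_mod_cast (IsFractionRing.injective k[X] K this)
  let B := integralClosure k[X] L
  haveI : IsDedekindDomain B := integralClosure.isDedekindDomain k[X] K L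
  haveI : IsFractionRing B L := integralClosure.isFractionRing_of_finite_extension K L
  haveI : Module.Finite k[X] B :=
    IsIntegralClosure.finite k[X] K L B
  have hinjL : Function.Injective (algebraMap k[X] L) := by
    rw [IsScalarTower.algebraMap_eq k[X] K L]
    exact (algebraMap K L).injective.comp (IsFractionRing.injective k[X] K)
  have hinjB : Function.Injective (algebraMap k[X] B) := by
    intro a b h
    exact hinjL (congrArg (algebraMap B L) h)
  haveI : IsScalarTower k B L := IsScalarTower.of_algebraMap_eq fun a => rfl
  haveI : FaithfulSMul k[X] B := (faithfulSMul_iff_algebraMap_injective _ _).2 hinjB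
  haveI : Module.IsTorsionFree k[X] B := Module.isTorsionFree_iff_algebraMap_injective.2 hinjB
  let I : Ideal k[X] := Ideal.span {X}
  have hI0 : I ≠ ⊥ := by simp [I, Ideal.span_singleton_eq_bot]
  haveI hImax : I.IsMaximal :=
    PrincipalIdealRing.isMaximal_of_irreducible Polynomial.irreducible_X
  let s := IsDedekindDomain.primesOverFinset I B
  have hs : ∀ P, P ∈ s ↔ P ∈ Ideal.primesOver I B := fun P =>
    IsDedekindDomain.mem_primesOverFinset_iff hI0 B
  have hX : algebraMap k[X] B X ≠ 0 := by
    rw [Ne, map_eq_zero_iff _ hinjB]; exact X_ne_zero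
  have hXL : algebraMap k[X] L X ≠ 0 := by
    rw [Ne, map_eq_zero_iff _ hinjL]; exact X_ne_zero
  have hXmem : ∀ P ∈ s, algebraMap k[X] B X ∈ P := by
    intro P hP
    have h1 := ((hs P).1 hP).2.over
    have : (X : k[X]) ∈ I := Ideal.mem_span_singleton_self X
    rw [h1] at this
    exact this
  have hP0 : ∀ P ∈ s, P ≠ ⊥ := by
    rintro P hP rfl
    exact hX (by simpa using hXmem _ hP)
  have hres : ∀ P ∈ s, Function.Surjective (algebraMap k (B ⧸ P)) := by
    intro P hP
    haveI : P.IsPrime := ((hs P).1 hP).1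
    have h1 : (algebraMap k[X] (B ⧸ P)) = (algebraMap k (B ⧸ P)).comp (evalRingHom 0) := by
      refine Polynomial.ringHom_ext (fun a => ?_) ?_
      · simp only [RingHom.comp_apply, coe_evalRingHom, eval_C]
        rw [IsScalarTower.algebraMap_apply k k[X] (B ⧸ P)]; rfl
      · simp only [RingHom.comp_apply, coe_evalRingHom, eval_X, map_zero]
        rw [IsScalarTower.algebraMap_apply k[X] B (B ⧸ P)]
        exact Ideal.Quotient.eq_zero_iff_mem.2 (hXmem P hP)
    have h2 : (algebraMap k[X] (B ⧸ P)).IsIntegral := algebraMap_isIntegral_iff.2 inferInstance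
    rw [h1] at h2
    have h3 : (algebraMap k (B ⧸ P)).IsIntegral := RingHom.IsIntegral.tower_top _ _ h2
    haveI : Algebra.IsIntegral k (B ⧸ P) := algebraMap_isIntegral_iff.1 h3
    exact (IsAlgClosed.algebraMap_bijective_of_isIntegral (k := k) (K := B ⧸ P)).2
  have key : ∀ P : s, ∃ (e : L →+* LaurentSeries k) (p : L), (∀ a, e (algebraMap k L a) = HahnSeries.C a) ∧
      e p = HahnSeries.single 1 1 ∧
      (∀ b ∈ P.1, b ≠ 0 → 0 < (e (algebraMap B L b)).order) ∧
      (∀ (b : B) (n : ℕ), b ≠ 0 → (n : ℤ) ≤ (e (algebraMap B L b)).order → b ∈ P.1 ^ n) ∧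
      ∀ φ : L, 0 ≤ (e φ).order → ∃ a s : B, s ∉ P.1 ∧ φ * algebraMap B L s = algebraMap B L a := by
    rintro ⟨P, hP⟩
    haveI : P.IsPrime := ((hs P).1 hP).1
    exact exists_laurent_embedding k B L P (hP0 P hP) (hres P hP)
  choose e p h1 h2 h3 h4 h5 using key
  let E := s.equivFin
  refine ⟨Fin s.card, inferInstance, fun c => e (E.symm c), fun c => p (E.symm c), fun c => h1 _, fun c => h2 _,
    fun c => h3 _ _ (hXmem _ (E.symm c).2) hX, ?_, ?_⟩
  · rw [E.symm.sum_comp (fun P => (e P (algebraMap k[X] L X)).order),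
      ← Ideal.sum_ramification_inertia B K L hI0, Nat.cast_sum, ← Finset.sum_coe_sort s]
    refine Finset.sum_le_sum ?_
    rintro ⟨P, hP⟩ -
    haveI hPp : P.IsPrime := ((hs P).1 hP).1
    haveI : P.LiesOver I := ((hs P).1 hP).2
    have hpos := h3 ⟨P, hP⟩ _ (hXmem _ hP) hX
    change 0 < (e ⟨P, hP⟩ (algebraMap k[X] L X)).order at hpos
    have hin := h4 ⟨P, hP⟩ _ (e ⟨P, hP⟩ (algebraMap k[X] L X)).order.toNat hX
      (Int.toNat_of_nonneg hpos.le).le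
    have hmap : Ideal.map (algebraMap k[X] B) I = Ideal.span {algebraMap k[X] B X} := by
      rw [Ideal.map_span, Set.image_singleton]
    have hmap0 : Ideal.map (algebraMap k[X] B) I ≠ ⊥ := by
      rw [hmap, Ne, Ideal.span_singleton_eq_bot]; exact hX
    have hle : (e ⟨P, hP⟩ (algebraMap k[X] L X)).order.toNat ≤ Ideal.ramificationIdx' I P := by
      rw [Ideal.IsDedekindDomain.ramificationIdx'_eq_multiplicity hmap0 hPp]
      refine FiniteMultiplicity.le_multiplicity_of_pow_dvd ?_ ?_
      · exact FiniteMultiplicity.of_prime_left (Ideal.prime_of_isPrime (hP0 P hP) hPp) hmap0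
      · rw [Ideal.dvd_iff_le, hmap, Ideal.span_singleton_le_iff_mem]
        exact hin
    have hpos2 : 0 < Ideal.inertiaDeg' I P := Ideal.inertiaDeg'_pos I P
    have : (e ⟨P, hP⟩ (algebraMap k[X] L X)).order.toNat ≤ Ideal.ramificationIdx' I P * Ideal.inertiaDeg' I P :=
      hle.trans (Nat.le_mul_of_pos_right _ hpos2)
    change (e ⟨P, hP⟩ (algebraMap k[X] L X)).order ≤
      ((Ideal.ramificationIdx' I P * Ideal.inertiaDeg' I P : ℕ) : ℤ)
    omega
  · intro V hVk hVt hVt'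
    have hVB : ∀ b : B, algebraMap B L b ∈ V := by
      intro b
      have hk : ∀ q : k[X], algebraMap k[X] L q ∈ V := by
        intro q
        induction q using Polynomial.induction_on' with
        | add f g hf hg => rw [map_add]; exact V.add_mem _ _ hf hg
        | monomial n a =>
          rw [← C_mul_X_pow_eq_monomial, map_mul, map_pow]
          refine V.mul_mem _ _ ?_ (pow_mem hVt n)
          have := hVk a
          rwa [IsScalarTower.algebraMap_apply k k[X] L] at this
      have hb : IsIntegral k[X] (algebraMap B L b) := b.2
      obtain ⟨f, hf, hf0⟩ := hb
      have h_intgr : IsIntegral V (algebraMap B L b) := by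
        let g : k[X] →+* V := (algebraMap k[X] L).codRestrict V.toSubring hk
        refine ⟨f.map g, hf.map g, ?_⟩
        rw [eval₂_map]
        exact hf0
      obtain ⟨v, hv⟩ := IsIntegrallyClosed.isIntegral_iff.1 h_intgr
      rw [← hv]; exact v.2
    let g : B →+* V := (algebraMap B L).codRestrict V.toSubring hVB
    let P : Ideal B := (IsLocalRing.maximalIdeal V).comap g
    have hPp : P.IsPrime := Ideal.IsPrime.comap g
    have hmem : ∀ b : B, b ∈ P ↔ (b = 0 ∨ (algebraMap B L b)⁻¹ ∉ V) := by
      intro b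
      have : b ∈ P ↔ g b ∈ IsLocalRing.maximalIdeal V := Iff.rfl
      rw [this, IsLocalRing.mem_maximalIdeal, mem_nonunits_iff]
      by_cases hb : b = 0
      · subst hb; simp
      have hb' : algebraMap B L b ≠ 0 := by
        rw [Ne, map_eq_zero_iff _ (IsFractionRing.injective B L)]; exact hb
      simp only [hb, false_or]
      refine not_congr ⟨fun h => ?_, fun h => ?_⟩
      · obtain ⟨w, hw⟩ := h.exists_right_inv
        have hw' : algebraMap B L b * (w : L) = 1 := congrArg Subtype.val hw
        rw [inv_eq_of_mul_eq_one_right hw']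
        exact w.2
      · exact IsUnit.of_mul_eq_one ⟨_, h⟩ (Subtype.ext (mul_inv_cancel₀ hb'))
    have hXP : algebraMap k[X] B X ∈ P := (hmem _).2 (Or.inr hVt')
    have hPs : P ∈ s := by
      rw [hs]
      refine ⟨hPp, ⟨?_⟩⟩
      refine hImax.eq_of_le ?_ ?_
      · exact (Ideal.IsPrime.comap _ (hK := hPp)).ne_top
      · rw [Ideal.span_singleton_le_iff_mem]; exact hXP
    refine ⟨E ⟨P, hPs⟩, fun φ hφ => ?_⟩
    simp only [Equiv.symm_apply_apply] at hφ
    obtain ⟨a, b, hb, hab⟩ := h5 _ φ hφ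
    have hb2 := mt (hmem b).2 hb
    push Not at hb2
    have : φ = algebraMap B L a * (algebraMap B L b)⁻¹ := by
      rw [← hab, mul_assoc, mul_inv_cancel₀, mul_one]
      rw [Ne, map_eq_zero_iff _ (IsFractionRing.injective B L)]; exact hb2.1
    rw [this]
    exact V.mul_mem _ _ (hVB a) hb2.2
end

section
open MvPolynomial

section Bivariate
variable {k : Type*} [Field k]

/-- Bivariate polynomials as polynomials in `X 0` over polynomials in `X 1`. -/
noncomputable def toBi (k : Type*) [Field k] :
    MvPolynomial (Fin 2) k ≃ₐ[k] Polynomial (Polynomial k) :=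
  AlgEquiv.ofAlgHom (MvPolynomial.aeval ![Polynomial.X, Polynomial.C Polynomial.X])
    ({ Polynomial.eval₂RingHom (Polynomial.aeval (X 1 : MvPolynomial (Fin 2) k)).toRingHom (X 0) with
        commutes' := fun r => by
          simp only [RingHom.toMonoidHom_eq_coe, OneHom.toFun_eq_coe, MonoidHom.toOneHom_coe, MonoidHom.coe_coe]
          rw [Polynomial.coe_eval₂RingHom, IsScalarTower.algebraMap_apply k (Polynomial k) (Polynomial (Polynomial k)),
            Polynomial.algebraMap_apply, Polynomial.eval₂_C]
          simp [MvPolynomial.algebraMap_eq] } : Polynomial (Polynomial k) →ₐ[k] MvPolynomial (Fin 2) k)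
    (by
      apply AlgHom.coe_ringHom_injective
      refine Polynomial.ringHom_ext' (Polynomial.ringHom_ext' ?_ ?_) ?_
      · ext a; simp [Polynomial.algebraMap_eq, MvPolynomial.algebraMap_eq]
      · simp
      · simp)
    (by ext i : 1; fin_cases i <;> simp)

@[simp] lemma toBi_X_zero : toBi k (X 0) = Polynomial.X := by simp [toBi]
@[simp] lemma toBi_X_one : toBi k (X 1) = Polynomial.C Polynomial.X := by simp [toBi]
@[simp] lemma toBi_C (a : k) : toBi k (C a) = Polynomial.C (Polynomial.C a) := by
  simp [toBi]

/-- `p` is, up to a constant, monic of degree `N` in `X 0`. -/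
def MonicIn (p : MvPolynomial (Fin 2) k) (N : ℕ) : Prop :=
  (toBi k p).natDegree = N ∧ ∃ c : k, c ≠ 0 ∧ (toBi k p).leadingCoeff = Polynomial.C c

lemma toBi_symm_C (f : Polynomial k) : (toBi k).symm (Polynomial.C f) = Polynomial.aeval (X 1) f := by
  rw [AlgEquiv.symm_apply_eq, ← Polynomial.aeval_algHom_apply]
  simp only [AlgEquiv.toAlgHom_eq_coe, AlgHom.coe_coe, toBi_X_one]
  have := Polynomial.aeval_algHom_apply (Algebra.ofId (Polynomial k) (Polynomial (Polynomial k)) |>.restrictScalars k) Polynomial.X f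
  simpa using this.symm

lemma MonicIn.eq_zero_of_dvd_C {p : MvPolynomial (Fin 2) k} {N : ℕ} (h : MonicIn p N) (hN : 0 < N)
    {f : Polynomial k} (hf : p ∣ Polynomial.aeval (X 1) f) : f = 0 := by
  rw [← toBi_symm_C] at hf
  have h2 := map_dvd (toBi k) hf
  rw [AlgEquiv.apply_symm_apply] at h2
  by_contra h0
  have := Polynomial.natDegree_le_of_dvd h2 (by simpa using h0)
  rw [h.1, Polynomial.natDegree_C] at this
  omega

end Bivariate
end

section
open MvPolynomial

theorem exists_places_of_monicIn {k : Type*} [Field k] [IsAlgClosed k] [CharZero k]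
    {p : MvPolynomial (Fin 2) k} {N : ℕ} (hp : Irreducible p) (hN : 0 < N) (h : MonicIn p N)
    (L : Type*) [Field L] [Algebra k L] (q : MvPolynomial (Fin 2) k →ₐ[k] L)
    (hker : ∀ φ, q φ = 0 ↔ p ∣ φ) (hfrac : ∀ z : L, ∃ a b, q b ≠ 0 ∧ z = q a / q b) :
    ∃ (ι : Type) (_ : Fintype ι) (e : ι → (L →+* LaurentSeries k)) (π : ι → L),
      (∀ c a, e c (algebraMap k L a) = HahnSeries.C a) ∧
      (∀ c, e c (π c) = HahnSeries.single 1 1) ∧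
      (∀ c, 0 < (e c (q (X 1))⁻¹).order) ∧
      ∑ c, (e c (q (X 1))⁻¹).order ≤ N ∧
      ∀ V : ValuationSubring L, (∀ a, algebraMap k L a ∈ V) → (q (X 1))⁻¹ ∈ V →
        q (X 1) ∉ V → ∃ c, ∀ φ, 0 ≤ (e c φ).order → φ ∈ V := by
  classical
  set t : L := (q (X 1))⁻¹ with ht
  have hx0 : q (X 1) ≠ 0 := by
    intro h0
    have := h.eq_zero_of_dvd_C hN (f := Polynomial.X) (by rw [Polynomial.aeval_X]; exact (hker _).1 h0)
    exact Polynomial.X_ne_zero this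
  have htr : Transcendental k (q (X 1)) := by
    rw [transcendental_iff]
    intro f hf
    rw [Polynomial.aeval_algHom_apply] at hf
    exact h.eq_zero_of_dvd_C hN ((hker _).1 hf)
  have htt : Transcendental k t := by
    intro ha
    exact htr (by simpa [ht] using ha.inv)
  letI : Algebra (Polynomial k) L := (Polynomial.aeval t).toRingHom.toAlgebra
  have hal : ∀ f : Polynomial k, algebraMap (Polynomial k) L f = Polynomial.aeval t f := fun f => rfl
  haveI : IsScalarTower k (Polynomial k) L := IsScalarTower.of_algebraMap_eq fun a => by
    rw [hal, Polynomial.algebraMap_eq, Polynomial.aeval_C]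
  haveI : FaithfulSMul (Polynomial k) L := by
    rw [faithfulSMul_iff_algebraMap_injective, injective_iff_map_eq_zero]
    intro f hf
    exact (transcendental_iff.1 htt) f hf
  let K := FractionRing (Polynomial k)
  letI : Algebra K L := FractionRing.liftAlgebra (Polynomial k) L
  haveI : IsScalarTower (Polynomial k) K L := inferInstance
  haveI : IsScalarTower k K L := by
    refine IsScalarTower.of_algebraMap_eq fun a => ?_
    rw [IsScalarTower.algebraMap_apply k (Polynomial k) L, IsScalarTower.algebraMap_apply (Polynomial k) K L,
      ← IsScalarTower.algebraMap_apply k (Polynomial k) K]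
  let x' : K := (algebraMap (Polynomial k) K Polynomial.X)⁻¹
  have hx' : algebraMap K L x' = q (X 1) := by
    simp only [x', map_inv₀]
    rw [← IsScalarTower.algebraMap_apply, hal, Polynomial.aeval_X, ht, inv_inv]
  let θ : Polynomial k →+* K := (Polynomial.aeval x').toRingHom
  let y : L := q (X 0)
  have hθ : ∀ φ : MvPolynomial (Fin 2) k, Polynomial.aeval y ((toBi k φ).map θ) = q φ := by
    intro φ
    have : ((Polynomial.aeval y : Polynomial K →ₐ[K] L).toRingHom.comp
        ((Polynomial.mapRingHom θ).comp (toBi k).toRingEquiv.toRingHom)) = q.toRingHom := by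
      refine MvPolynomial.ringHom_ext (fun a => ?_) (fun i => ?_)
      · simp [θ]
        rw [← IsScalarTower.algebraMap_apply]
      · fin_cases i
        · simp [y]
        · simp [θ, hx']
    exact RingHom.congr_fun this φ
  obtain ⟨c, hc, hlc⟩ := h.2
  have hθc : θ (Polynomial.C c) ≠ 0 := by
    simp only [θ, AlgHom.toRingHom_eq_coe, RingHom.coe_coe, Polynomial.aeval_C]
    rw [Ne, _root_.map_eq_zero]; exact hc
  let g : Polynomial K := (toBi k p).map θ
  have hgdeg : g.natDegree = N := by
    rw [← h.1]
    exact Polynomial.natDegree_map_of_leadingCoeff_ne_zero _ (by rw [hlc]; exact hθc)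
  have hglc : g.leadingCoeff = θ (Polynomial.C c) := by
    rw [Polynomial.leadingCoeff, hgdeg, ← h.1, Polynomial.coeff_map, ← hlc]; rfl
  have hgroot : Polynomial.aeval y g = 0 := by rw [hθ]; exact (hker p).2 dvd_rfl
  have hg0 : g ≠ 0 := by
    rw [← Polynomial.leadingCoeff_ne_zero, hglc]; exact hθc
  have hyint : IsIntegral K y := isAlgebraic_iff_isIntegral.1 ⟨g, hg0, hgroot⟩
  have htop : IntermediateField.adjoin K {y} = ⊤ := by
    rw [eq_top_iff]
    rintro z -
    obtain ⟨a, b, -, rfl⟩ := hfrac z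
    have : ∀ a, q a ∈ IntermediateField.adjoin K {y} := by
      intro a
      rw [← hθ]
      exact IntermediateField.algebra_adjoin_le_adjoin K {y} (Polynomial.aeval_mem_adjoin_singleton K y)
    exact div_mem (this a) (this b)
  haveI hfd : FiniteDimensional K L := by
    have := IntermediateField.adjoin.finiteDimensional hyint
    rw [htop] at this
    exact (IntermediateField.topEquiv (F := K) (E := L)).toLinearEquiv.finiteDimensional
  have hrank : Module.finrank K L ≤ N := by
    have h1 := IntermediateField.adjoin.finrank hyint
    rw [htop, IntermediateField.finrank_top'] at h1
    rw [h1, ← hgdeg]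
    exact Polynomial.natDegree_le_of_dvd (minpoly.dvd K y hgroot) hg0
  obtain ⟨ι, hι, e, π, h1, h2, h3, h4, h5⟩ := exists_places_of_tower k K L
  have hX : algebraMap (Polynomial k) L Polynomial.X = t := by rw [hal, Polynomial.aeval_X]
  simp only [hX] at h3 h4 h5
  refine ⟨ι, hι, e, π, h1, h2, h3, h4.trans (by exact_mod_cast hrank), fun V hk hV hV' => h5 V hk hV ?_⟩
  rwa [ht, inv_inv]
end

section
open MvPolynomial Filter Topology

/-- The points at infinity of the plane curve `p = 0`, with Laurent expansions of regular functions
and of the behaviour of functions along sequences of points going to infinity. -/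
structure Cusps {k : Type*} [Field k] (p : MvPolynomial (Fin 2) k) (N : ℕ) where
  ι : Type
  fin : Fintype ι
  e : ι → (MvPolynomial (Fin 2) k →+* LaurentSeries k)
  e_C : ∀ c a, e c (C a) = HahnSeries.C a
  ker : ∀ c φ, e c φ = 0 ↔ p ∣ φ
  m : ι → ℕ
  m_pos : ∀ c, 0 < m c
  order_x : ∀ c, (e c (X 1)).order = -(m c : ℤ)
  sum_m : ∑ c, m c ≤ N
  approach : ∀ (σ : k →+* ℂ) (F : Ultrafilter ℕ) (x y : ℕ → k),
    (∀ φ, (∀ᶠ i in F, eval ![y i, x i] φ = 0) ↔ p ∣ φ) →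
    Tendsto (fun i => ‖σ (x i)‖) F atTop →
    ∃ c, ∃ z : ℕ → ℂ, Tendsto z F (𝓝 0) ∧ (∀ᶠ i in F, z i ≠ 0) ∧
      ∀ (φ : MvPolynomial (Fin 2) k) (a M : ℤ), (∀ j < a, (e c φ).coeff j = 0) →
        ∃ K : ℝ, ∀ᶠ i in F, ‖σ (eval ![y i, x i] φ) -
          ∑ j ∈ Finset.Ico a M, σ ((e c φ).coeff j) * z i ^ j‖ ≤ K * ‖z i‖ ^ M

attribute [instance] Cusps.fin

/-- Germs along an ultrafilter that are bounded, pulled back to a field. -/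
def boundedValuationSubring {L : Type*} [Field L] {F : Ultrafilter ℕ}
    (Φ : L →+* Germ (F : Filter ℕ) ℂ) : ValuationSubring L where
  carrier := {φ | ∃ f : ℕ → ℂ, Φ φ = (f : Germ (F : Filter ℕ) ℂ) ∧ ∃ K : ℝ, ∀ᶠ i in F, ‖f i‖ ≤ K}
  mul_mem' := by
    rintro a b ⟨f, hf, K, hK⟩ ⟨g, hg, K', hK'⟩
    refine ⟨f * g, by rw [map_mul, hf, hg]; rfl, |K| * |K'|, ?_⟩
    filter_upwards [hK, hK'] with i h1 h2
    rw [Pi.mul_apply, norm_mul]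
    exact mul_le_mul (h1.trans (le_abs_self _)) (h2.trans (le_abs_self _)) (norm_nonneg _) (abs_nonneg _)
  one_mem' := ⟨1, by rw [map_one]; rfl, 1, by simp⟩
  add_mem' := by
    rintro a b ⟨f, hf, K, hK⟩ ⟨g, hg, K', hK'⟩
    refine ⟨f + g, by rw [map_add, hf, hg]; rfl, K + K', ?_⟩
    filter_upwards [hK, hK'] with i h1 h2
    exact (norm_add_le _ _).trans (add_le_add h1 h2)
  zero_mem' := ⟨0, by rw [map_zero]; rfl, 0, by simp⟩
  neg_mem' := by
    rintro a ⟨f, hf, K, hK⟩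
    exact ⟨-f, by rw [map_neg, hf]; rfl, K, by simpa using hK⟩
  mem_or_inv_mem' := by
    intro φ
    obtain ⟨f, hf⟩ : ∃ f : ℕ → ℂ, Φ φ = (f : Germ (F : Filter ℕ) ℂ) := by
      induction Φ φ using Germ.inductionOn with
      | h f => exact ⟨f, rfl⟩
    rcases F.em (fun i => ‖f i‖ ≤ 1) with h | h
    · exact Or.inl ⟨f, hf, 1, h⟩
    · refine Or.inr ⟨f⁻¹, by rw [map_inv₀, hf]; rfl, 1, ?_⟩
      filter_upwards [h] with i hi
      rw [Pi.inv_apply, norm_inv]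
      exact inv_le_one_of_one_le₀ (not_le.1 hi).le

theorem map_zpow_uniformizer {k L : Type*} [Field k] [Field L] (e : L →+* LaurentSeries k)
    {π : L} (hπ : e π = HahnSeries.single 1 1) (n : ℤ) : e (π ^ n) = HahnSeries.single n 1 := by
  rw [map_zpow₀, hπ, ← RatFunc.single_zpow]

theorem order_mul_zpow_uniformizer {k L : Type*} [Field k] [Field L] (e : L →+* LaurentSeries k)
    {π : L} (hπ : e π = HahnSeries.single 1 1) (φ : L) (hφ : φ ≠ 0) (M : ℤ) :
    (e (φ * π ^ M)).order = (e φ).order + M := by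
  rw [map_mul, HahnSeries.order_mul, map_zpow_uniformizer e hπ, HahnSeries.order_single one_ne_zero]
  · rw [Ne, map_eq_zero]; exact hφ
  · rw [map_zpow_uniformizer e hπ]; exact HahnSeries.single_ne_zero one_ne_zero

theorem exists_cusps {k : Type*} [Field k] [IsAlgClosed k] [CharZero k]
    {p : MvPolynomial (Fin 2) k} {N : ℕ} (hp : Irreducible p) (hN : 0 < N) (h : MonicIn p N) :
    Nonempty (Cusps p N) := by
  classical
  have hpp : Prime p := hp.prime
  haveI : (Ideal.span {p}).IsPrime := (Ideal.span_singleton_prime hp.ne_zero).2 hpp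
  let A := MvPolynomial (Fin 2) k ⧸ Ideal.span {p}
  let L := FractionRing A
  let q : MvPolynomial (Fin 2) k →ₐ[k] L :=
    (Algebra.algHom k A L).comp (Ideal.Quotient.mkₐ k (Ideal.span {p}))
  have hqdef : ∀ φ, q φ = algebraMap A L (Ideal.Quotient.mk _ φ) := fun φ => rfl
  have hker : ∀ φ, q φ = 0 ↔ p ∣ φ := by
    intro φ
    rw [hqdef, map_eq_zero_iff _ (IsFractionRing.injective A L), Ideal.Quotient.eq_zero_iff_mem,
      Ideal.mem_span_singleton]
  have hfrac : ∀ z : L, ∃ a b, q b ≠ 0 ∧ z = q a / q b := by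
    intro z
    obtain ⟨a, b, hb, rfl⟩ := IsFractionRing.div_surjective (A := A) z
    obtain ⟨a, rfl⟩ := Ideal.Quotient.mk_surjective a
    obtain ⟨b, rfl⟩ := Ideal.Quotient.mk_surjective b
    refine ⟨a, b, ?_, rfl⟩
    rw [hqdef]
    exact IsFractionRing.to_map_ne_zero_of_mem_nonZeroDivisors hb
  obtain ⟨ι, hι, e, π, h1, h2, h3, h4, h5⟩ := exists_places_of_monicIn hp hN h L q hker hfrac
  have hx0 : ∀ c, e c (q (X 1)) ≠ 0 := by
    intro c h0
    have := h3 c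
    rw [map_inv₀, h0, inv_zero, HahnSeries.order_zero] at this
    exact lt_irrefl _ this
  have hxo : ∀ c, (e c (q (X 1))).order = -(e c (q (X 1))⁻¹).order := by
    intro c
    have h6 : (e c (q (X 1))) * (e c (q (X 1))⁻¹) = 1 := by
      rw [map_inv₀, mul_inv_cancel₀ (hx0 c)]
    have h7 := HahnSeries.order_mul (left_ne_zero_of_mul_eq_one h6) (right_ne_zero_of_mul_eq_one h6)
    rw [h6, HahnSeries.order_one] at h7
    omega
  refine ⟨⟨ι, hι, fun c => (e c).comp q.toRingHom, fun c a => ?_, fun c φ => ?_,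
    fun c => (e c (q (X 1))⁻¹).order.toNat, fun c => ?_, fun c => ?_, ?_, ?_⟩⟩
  · rw [← MvPolynomial.algebraMap_eq]
    simp only [RingHom.comp_apply, AlgHom.toRingHom_eq_coe, RingHom.coe_coe, AlgHom.commutes]
    exact h1 c a
  · simp only [RingHom.comp_apply, AlgHom.toRingHom_eq_coe, RingHom.coe_coe]
    rw [_root_.map_eq_zero, hker]
  · have := h3 c; omega
  · have := h3 c
    have h6 := hxo c
    simp only [RingHom.comp_apply, AlgHom.toRingHom_eq_coe, RingHom.coe_coe]
    omega
  · zify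
    refine le_trans (le_of_eq ?_) h4
    exact Finset.sum_congr rfl fun c _ => Int.toNat_of_nonneg (h3 c).le
  · intro σ F x y hF hx
    let Φ0 : MvPolynomial (Fin 2) k →+* Germ (F : Filter ℕ) ℂ :=
      (Germ.coeRingHom (F : Filter ℕ)).comp (Pi.ringHom fun i => σ.comp (eval ![y i, x i]))
    have hΦ0 : ∀ φ, Φ0 φ = ((fun i => σ (eval ![y i, x i] φ) : ℕ → ℂ) : Germ (F : Filter ℕ) ℂ) := fun φ => rfl
    have hΦker : ∀ φ, Φ0 φ = 0 ↔ p ∣ φ := by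
      intro φ
      rw [← hF, hΦ0]
      change ((_ : ℕ → ℂ) : Germ (F : Filter ℕ) ℂ) = ((0 : ℕ → ℂ) : Germ (F : Filter ℕ) ℂ) ↔ _
      rw [Germ.coe_eq]
      refine eventually_congr (Eventually.of_forall fun i => ?_)
      rw [Pi.zero_apply, _root_.map_eq_zero]
    let Φ1 : A →+* Germ (F : Filter ℕ) ℂ := Ideal.Quotient.lift _ Φ0 (by
      intro a ha
      rw [hΦker, ← Ideal.mem_span_singleton]; exact ha)
    have hΦ1 : Function.Injective Φ1 := by
      rw [injective_iff_map_eq_zero]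
      intro a ha
      obtain ⟨a, rfl⟩ := Ideal.Quotient.mk_surjective a
      rw [Ideal.Quotient.eq_zero_iff_mem, Ideal.mem_span_singleton, ← hΦker]
      exact ha
    let Φ : L →+* Germ (F : Filter ℕ) ℂ := IsFractionRing.lift hΦ1
    have hΦ : ∀ φ, Φ (q φ) = Φ0 φ := by
      intro φ
      rw [hqdef]
      exact (IsFractionRing.lift_algebraMap hΦ1 _)
    have hrep : ∀ g : L, ∃ f : ℕ → ℂ, Φ g = (f : Germ (F : Filter ℕ) ℂ) := by
      intro g
      induction Φ g using Germ.inductionOn with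
      | h f => exact ⟨f, rfl⟩
    let V := boundedValuationSubring Φ
    have hV : ∀ g (f : ℕ → ℂ), g ∈ V → Φ g = (f : Germ (F : Filter ℕ) ℂ) → ∃ K : ℝ, ∀ᶠ i in F, ‖f i‖ ≤ K := by
      rintro g f ⟨f', hf', K, hK⟩ hf
      rw [hf', Germ.coe_eq] at hf
      refine ⟨K, ?_⟩
      filter_upwards [hK, hf] with i h1 h2
      rw [← h2]; exact h1
    have hΦa : ∀ a : k, Φ (algebraMap k L a) = ((fun _ => σ a : ℕ → ℂ) : Germ (F : Filter ℕ) ℂ) := by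
      intro a
      rw [← q.commutes, hΦ, hΦ0, MvPolynomial.algebraMap_eq]
      simp only [eval_C]
    have hΦx : Φ (q (X 1)) = ((fun i => σ (x i) : ℕ → ℂ) : Germ (F : Filter ℕ) ℂ) := by
      rw [hΦ, hΦ0]; simp
    obtain ⟨c, hc⟩ := h5 V (fun a => ⟨_, hΦa a, ‖σ a‖, by simp⟩)
      ⟨(fun i => σ (x i))⁻¹, by rw [map_inv₀, hΦx]; rfl, 1, by
        filter_upwards [hx.eventually_ge_atTop 1] with i hi
        rw [Pi.inv_apply, norm_inv]
        exact inv_le_one_of_one_le₀ hi⟩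
      (by
        intro hmem
        obtain ⟨K, hK⟩ := hV _ _ hmem hΦx
        obtain ⟨i, hi1, hi2⟩ := (hK.and (hx.eventually_gt_atTop K)).exists
        exact absurd hi1 (not_le.2 hi2))
    have hπ0 : π c ≠ 0 := by
      intro h0
      have := h2 c
      rw [h0, map_zero] at this
      exact (HahnSeries.single_ne_zero one_ne_zero) this.symm
    obtain ⟨z, hz⟩ := hrep (π c)
    have hz0 : ∀ᶠ i in F, z i ≠ 0 := by
      rw [Ultrafilter.eventually_not]
      intro h0
      apply hπ0
      rw [← map_eq_zero_iff Φ Φ.injective, hz]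
      exact Germ.coe_eq.2 h0
    have hΦz : ∀ n : ℤ, Φ (π c ^ n) = ((fun i => z i ^ n : ℕ → ℂ) : Germ (F : Filter ℕ) ℂ) := by
      intro n
      rw [map_zpow₀, hz]; rfl
    refine ⟨c, z, ?_, hz0, ?_⟩
    · set m := (e c (q (X 1))⁻¹).order with hm
      have hm0 : 0 < m := h3 c
      have hxL : q (X 1) ≠ 0 := fun h0 => hx0 c (by rw [h0, map_zero])
      have hmem : q (X 1) * π c ^ m ∈ V := by
        apply hc
        rw [order_mul_zpow_uniformizer _ (h2 c) _ hxL, hxo c]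
        simp [hm]
      obtain ⟨K, hK⟩ := hV _ (fun i => σ (x i) * z i ^ m) hmem (by
        rw [map_mul, hΦx, hΦz]; rfl)
      obtain ⟨n, hn⟩ : ∃ n : ℕ, m = (n : ℤ) := ⟨m.toNat, by omega⟩
      have hn0 : n ≠ 0 := by rintro rfl; omega
      rw [tendsto_zero_iff_norm_tendsto_zero]
      have hlim : Tendsto (fun i => ‖z i‖ ^ n) F (𝓝 0) := by
        have h6 : Tendsto (fun i => K / ‖σ (x i)‖) F (𝓝 0) := Tendsto.const_div_atTop hx K
        refine squeeze_zero' (Eventually.of_forall fun i => by positivity) ?_ h6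
        filter_upwards [hK, hx.eventually_gt_atTop 0] with i hi hi2
        rw [le_div_iff₀ hi2]
        rw [hn, zpow_natCast, norm_mul, norm_pow] at hi
        linarith
      rw [Metric.tendsto_nhds]
      intro ε hε
      filter_upwards [hlim.eventually_lt_const (pow_pos hε n)] with i hi
      rw [dist_zero_right, norm_norm]
      exact lt_of_pow_lt_pow_left₀ n hε.le hi
    · intro φ a M ha
      let T : L := ∑ j ∈ Finset.Ico a M, algebraMap k L ((e c (q φ)).coeff j) * π c ^ j
      let g : L := (q φ - T) * π c ^ (-M)
      have hΦT : Φ T = ((fun i => ∑ j ∈ Finset.Ico a M, σ ((e c (q φ)).coeff j) * z i ^ j : ℕ → ℂ) :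
          Germ (F : Filter ℕ) ℂ) := by
        have : (fun i => ∑ j ∈ Finset.Ico a M, σ ((e c (q φ)).coeff j) * z i ^ j) =
          ∑ j ∈ Finset.Ico a M, fun i => σ ((e c (q φ)).coeff j) * z i ^ j := by
          ext i; simp
        rw [this]
        change _ = Germ.coeRingHom (F : Filter ℕ) _
        rw [map_sum, map_sum]
        refine Finset.sum_congr rfl fun j _ => ?_
        rw [map_mul, hΦa, hΦz]; rfl
      have hg : g ∈ V := by
        apply hc
        by_cases h0 : q φ - T = 0
        · simp [g, h0]
        rw [order_mul_zpow_uniformizer _ (h2 c) _ h0, ← sub_eq_add_neg, sub_nonneg,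
          HahnSeries.le_order_iff_forall (by rw [Ne, _root_.map_eq_zero]; exact h0)]
        intro j hj
        have hT : (e c T).coeff j = ∑ i ∈ Finset.Ico a M, if j = i then (e c (q φ)).coeff i else 0 := by
          simp only [T, map_sum, map_mul, h1, map_zpow_uniformizer _ (h2 c)]
          rw [HahnSeries.coeff_sum]
          refine Finset.sum_congr rfl fun i _ => ?_
          rw [HahnSeries.C_mul_eq_smul, HahnSeries.coeff_smul, HahnSeries.coeff_single]
          simp
        rw [map_sub, HahnSeries.coeff_sub, hT, Finset.sum_ite_eq]
        split_ifs with hmem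
        · rw [sub_self]
        · rw [sub_zero]
          rw [Finset.mem_Ico, not_and_or, not_le] at hmem
          rcases hmem with hmem | hmem
          · exact ha j hmem
          · exact absurd hj hmem
      obtain ⟨K, hK⟩ := hV g (fun i => (σ (eval ![y i, x i] φ) -
          ∑ j ∈ Finset.Ico a M, σ ((e c (q φ)).coeff j) * z i ^ j) * z i ^ (-M)) hg (by
        rw [map_mul, map_sub, hΦ, hΦT, hΦz, hΦ0]; rfl)
      refine ⟨K, ?_⟩
      filter_upwards [hK, hz0] with i hi hi0
      rw [norm_mul, zpow_neg, norm_inv, norm_zpow, ← div_eq_mul_inv, div_le_iff₀] at hi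
      · exact hi
      · have := norm_pos_iff.2 hi0
        positivity
end

section
open MvPolynomial

section Euler
variable {k : Type*} [Field k]

/-- A Laurent series has order at least `a`. -/
def OrdGe (f : LaurentSeries k) (a : ℤ) : Prop := ∀ j < a, f.coeff j = 0

lemma OrdGe.mono {f : LaurentSeries k} {a b : ℤ} (h : OrdGe f a) (hb : b ≤ a) : OrdGe f b :=
  fun j hj => h j (hj.trans_le hb)

lemma ordGe_zero (a : ℤ) : OrdGe (0 : LaurentSeries k) a := fun _ _ => rfl

lemma OrdGe.add {f g : LaurentSeries k} {a : ℤ} (hf : OrdGe f a) (hg : OrdGe g a) :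
    OrdGe (f + g) a := fun j hj => by rw [HahnSeries.coeff_add, hf j hj, hg j hj, add_zero]

lemma OrdGe.neg {f : LaurentSeries k} {a : ℤ} (hf : OrdGe f a) : OrdGe (-f) a :=
  fun j hj => by rw [HahnSeries.coeff_neg, hf j hj, neg_zero]

lemma OrdGe.sub {f g : LaurentSeries k} {a : ℤ} (hf : OrdGe f a) (hg : OrdGe g a) :
    OrdGe (f - g) a := by rw [sub_eq_add_neg]; exact hf.add hg.neg

lemma OrdGe.sum {ι : Type*} {s : Finset ι} {f : ι → LaurentSeries k} {a : ℤ}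
    (h : ∀ i ∈ s, OrdGe (f i) a) : OrdGe (∑ i ∈ s, f i) a := by
  classical
  induction s using Finset.induction_on with
  | empty => exact ordGe_zero a
  | insert i s hi ih =>
    rw [Finset.sum_insert hi]
    exact (h i (by simp)).add (ih fun j hj => h j (by simp [hj]))

lemma ordGe_iff {f : LaurentSeries k} (hf : f ≠ 0) {a : ℤ} : OrdGe f a ↔ a ≤ f.order := by
  constructor
  · intro h
    by_contra hc
    exact (mt HahnSeries.coeff_order_eq_zero.1 hf) (h _ (not_le.1 hc))
  · intro h j hj
    exact HahnSeries.coeff_eq_zero_of_lt_order (hj.trans_le h)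

lemma OrdGe.mul {f g : LaurentSeries k} {a b : ℤ} (hf : OrdGe f a) (hg : OrdGe g b) :
    OrdGe (f * g) (a + b) := by
  by_cases h0 : f = 0
  · rw [h0, zero_mul]; exact ordGe_zero _
  by_cases h1 : g = 0
  · rw [h1, mul_zero]; exact ordGe_zero _
  rw [ordGe_iff (mul_ne_zero h0 h1), HahnSeries.order_mul h0 h1]
  exact add_le_add ((ordGe_iff h0).1 hf) ((ordGe_iff h1).1 hg)

lemma ordGe_C (a : k) : OrdGe (HahnSeries.C a : LaurentSeries k) 0 := fun j hj => by
  rw [HahnSeries.C_apply, HahnSeries.coeff_single_of_ne hj.ne]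

lemma OrdGe.pow {f : LaurentSeries k} {a : ℤ} (hf : OrdGe f a) (n : ℕ) : OrdGe (f ^ n) (n * a) := by
  induction n with
  | zero => simpa using ordGe_C (1 : k)
  | succ n ih => rw [pow_succ]; simpa [add_mul] using ih.mul hf

lemma OrdGe.coeff_mul {f g : LaurentSeries k} {a b : ℤ} (hf : OrdGe f a) (hg : OrdGe g b) :
    (f * g).coeff (a + b) = f.coeff a * g.coeff b := by
  classical
  rw [HahnSeries.coeff_mul]
  by_cases h : f.coeff a * g.coeff b = 0
  · rw [h]
    refine Finset.sum_eq_zero fun ij hij => ?_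
    rw [Finset.mem_addAntidiagonal] at hij
    obtain ⟨h1, h2, h3⟩ := hij
    have h4 : a ≤ ij.1 := by by_contra hc; exact h1 (hf _ (not_le.1 hc))
    have h5 : b ≤ ij.2 := by by_contra hc; exact h2 (hg _ (not_le.1 hc))
    obtain ⟨rfl, rfl⟩ : ij.1 = a ∧ ij.2 = b := by omega
    exact h
  · rw [Finset.sum_eq_single (a, b)]
    · intro ij hij hne
      rw [Finset.mem_addAntidiagonal] at hij
      obtain ⟨h1, h2, h3⟩ := hij
      have h4 : a ≤ ij.1 := by by_contra hc; exact h1 (hf _ (not_le.1 hc))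
      have h5 : b ≤ ij.2 := by by_contra hc; exact h2 (hg _ (not_le.1 hc))
      exact absurd (Prod.ext (by show ij.1 = a; omega) (by show ij.2 = b; omega)) hne
    · intro h6
      exact absurd (Finset.mem_addAntidiagonal.2
        ⟨left_ne_zero_of_mul h, right_ne_zero_of_mul h, rfl⟩) h6

/-- The Euler operator `z d/dz` on Laurent series. -/
noncomputable def euler (f : LaurentSeries k) : LaurentSeries k where
  coeff n := (n : k) * f.coeff n
  isPWO_support' := f.isPWO_support.mono fun n hn h0 => hn (by simp [h0])

lemma euler_coeff (f : LaurentSeries k) (n : ℤ) : (euler f).coeff n = n * f.coeff n := rfl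

lemma euler_add (f g : LaurentSeries k) : euler (f + g) = euler f + euler g := by
  ext n; simp [euler_coeff, mul_add]

lemma euler_C (a : k) : euler (HahnSeries.C a : LaurentSeries k) = 0 := by
  ext n
  rw [euler_coeff, HahnSeries.C_apply, HahnSeries.coeff_single]
  split_ifs with h
  · simp [h]
  · simp

lemma euler_mul (f g : LaurentSeries k) : euler (f * g) = euler f * g + f * euler g := by
  classical
  have hs : ∀ f : LaurentSeries k, (euler f).support ⊆ f.support := fun f n hn h0 =>
    hn (by rw [euler_coeff, h0, mul_zero])
  ext n
  rw [euler_coeff, HahnSeries.coeff_add, HahnSeries.coeff_mul,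
    HahnSeries.coeff_mul_left' f.isPWO_support (hs f),
    HahnSeries.coeff_mul_right' g.isPWO_support (hs g), Finset.mul_sum, ← Finset.sum_add_distrib]
  refine Finset.sum_congr rfl fun ij hij => ?_
  rw [Finset.mem_addAntidiagonal] at hij
  rw [euler_coeff, euler_coeff, ← hij.2.2]
  push_cast
  ring

lemma OrdGe.euler {f : LaurentSeries k} {a : ℤ} (hf : OrdGe f a) : OrdGe (euler f) a :=
  fun j hj => by rw [euler_coeff, hf j hj, mul_zero]

end Euler

namespace Cusps
variable {k : Type*} [Field k] [CharZero k] {p Q : MvPolynomial (Fin 2) k} {N : ℕ}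

lemma euler_e (A : Cusps p N) (c : A.ι) (φ : MvPolynomial (Fin 2) k) :
    euler (A.e c φ) = A.e c (pderiv 0 φ) * euler (A.e c (X 0)) +
      A.e c (pderiv 1 φ) * euler (A.e c (X 1)) := by
  induction φ using MvPolynomial.induction_on with
  | C a => rw [A.e_C, euler_C]; simp
  | add f g hf hg => simp only [map_add, euler_add, hf, hg]; ring
  | mul_X f i hf =>
    rw [map_mul, euler_mul, hf, Derivation.leibniz, Derivation.leibniz]
    fin_cases i <;>
      simp only [Fin.mk_zero, Fin.mk_one, Fin.isValue, pderiv_X_self, pderiv_X_of_ne (R := k) (one_ne_zero : (1 : Fin 2) ≠ 0),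
        pderiv_X_of_ne (R := k) (zero_ne_one : (0 : Fin 2) ≠ 1), smul_eq_mul, map_add, map_mul, map_zero, map_one] <;> ring

lemma hamDer_mul_euler (A : Cusps p N) (hJ : hamDer p Q = 1) (c : A.ι)
    (φ : MvPolynomial (Fin 2) k) :
    A.e c (hamDer p φ) * euler (A.e c Q) = euler (A.e c φ) := by
  have h0 := A.euler_e c p
  rw [(A.ker c p).2 dvd_rfl, ← map_zero HahnSeries.C, euler_C] at h0
  rw [A.euler_e c φ, A.euler_e c Q, hamDer_apply]
  rw [hamDer_apply] at hJ
  have h1 := congrArg (A.e c) hJ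
  simp only [map_sub, map_mul, map_one] at h1 ⊢
  linear_combination (A.e c (pderiv 1 φ) * euler (A.e c (X 1)) + A.e c (pderiv 0 φ) * euler (A.e c (X 0))) * h1
    - (A.e c (pderiv 1 φ) * A.e c (pderiv 0 Q) - A.e c (pderiv 0 φ) * A.e c (pderiv 1 Q)) * h0

lemma e_ne_zero (A : Cusps p N) {φ : MvPolynomial (Fin 2) k} (h : ¬ p ∣ φ) (c : A.ι) :
    A.e c φ ≠ 0 := fun h0 => h ((A.ker c φ).1 h0)

lemma not_dvd_sub_C (hp : Irreducible p) (hJ : hamDer p Q = 1) (a : k) : ¬ p ∣ Q - C a := by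
  rintro ⟨u, hu⟩
  have h1 : hamDer p (Q - C a) = 1 := by
    rw [map_sub, hJ, ← algebraMap_eq, Derivation.map_algebraMap, sub_zero]
  rw [hu, Derivation.leibniz, hamDer_self, smul_zero, add_zero, smul_eq_mul] at h1
  exact hp.not_isUnit (isUnit_of_dvd_one ⟨_, h1.symm⟩)

/-- The exponent of `Q` at a cusp: order of `Q - β` if `Q` is finite with value `β`, or the
(negative) order of `Q` at a pole. -/
lemma exists_exponent (A : Cusps p N) (hp : Irreducible p) (hJ : hamDer p Q = 1) (c : A.ι) :
    ∃ (b : ℤ) (β : k), b ≠ 0 ∧ OrdGe (A.e c (Q - C β)) b ∧ (A.e c (Q - C β)).coeff b ≠ 0 ∧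
      (b < 0 → β = 0) := by
  by_cases h : (A.e c Q).order < 0
  · have h1 : A.e c Q ≠ 0 := by
      intro h0; rw [h0, HahnSeries.order_zero] at h; exact lt_irrefl _ h
    refine ⟨_, 0, h.ne, ?_, ?_, fun _ => rfl⟩
    · rw [C_0, sub_zero]; exact (ordGe_iff h1).2 le_rfl
    · rw [C_0, sub_zero]; exact mt HahnSeries.coeff_order_eq_zero.1 h1
  · set β := (A.e c Q).coeff 0
    have h1 := A.e_ne_zero (not_dvd_sub_C hp hJ β) c
    have h2 : OrdGe (A.e c (Q - C β)) 1 := by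
      intro j hj
      rw [map_sub, A.e_C, HahnSeries.coeff_sub, HahnSeries.C_apply]
      rcases (show j ≤ 0 by omega).lt_or_eq with h3 | rfl
      · rw [HahnSeries.coeff_single_of_ne h3.ne, sub_zero]
        exact HahnSeries.coeff_eq_zero_of_lt_order (h3.trans_le (not_lt.1 h))
      · rw [HahnSeries.coeff_single_same, sub_self]
    have h3 := (ordGe_iff h1).1 h2
    exact ⟨_, β, by omega, (ordGe_iff h1).2 le_rfl, mt HahnSeries.coeff_order_eq_zero.1 h1,
      fun h => by omega⟩

/-- The (signed) ramification exponent of `Q` at a cusp. -/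
noncomputable def exponent (A : Cusps p N) (hp : Irreducible p) (hJ : hamDer p Q = 1) (c : A.ι) : ℤ :=
  (A.exists_exponent hp hJ c).choose

/-- The value of `Q` at a cusp (zero at poles). -/
noncomputable def value (A : Cusps p N) (hp : Irreducible p) (hJ : hamDer p Q = 1) (c : A.ι) : k :=
  (A.exists_exponent hp hJ c).choose_spec.choose

variable (A : Cusps p N) (hp : Irreducible p) (hJ : hamDer p Q = 1)

lemma exponent_spec (c : A.ι) : A.exponent hp hJ c ≠ 0 ∧
    OrdGe (A.e c (Q - C (A.value hp hJ c))) (A.exponent hp hJ c) ∧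
    (A.e c (Q - C (A.value hp hJ c))).coeff (A.exponent hp hJ c) ≠ 0 ∧
    (A.exponent hp hJ c < 0 → A.value hp hJ c = 0) :=
  (A.exists_exponent hp hJ c).choose_spec.choose_spec

/-- `D` lowers orders by the exponent, multiplying leading coefficients by multiples of the order. -/
lemma exists_hamDer_coeff (c : A.ι) : ∃ κ : k, κ ≠ 0 ∧ ∀ (φ : MvPolynomial (Fin 2) k) (a : ℤ),
    OrdGe (A.e c φ) a → OrdGe (A.e c (hamDer p φ)) (a - A.exponent hp hJ c) ∧
      (A.e c (hamDer p φ)).coeff (a - A.exponent hp hJ c) = κ * a * (A.e c φ).coeff a := by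
  obtain ⟨h0, h1, h2, -⟩ := A.exponent_spec hp hJ c
  set b := A.exponent hp hJ c
  set β := A.value hp hJ c
  have h3 : euler (A.e c Q) = euler (A.e c (Q - C β)) := by
    conv_lhs => rw [← sub_add_cancel Q (C β), map_add, euler_add, A.e_C, euler_C, add_zero]
  have h4 : (euler (A.e c Q)).coeff b ≠ 0 := by
    rw [h3, euler_coeff]; exact mul_ne_zero (by exact_mod_cast h0) h2
  have h5 : OrdGe (euler (A.e c Q)) b := by rw [h3]; exact h1.euler
  refine ⟨((euler (A.e c Q)).coeff b)⁻¹, inv_ne_zero h4, fun φ a h => ?_⟩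
  have h6 := A.hamDer_mul_euler hJ c φ
  have h7 : OrdGe (A.e c (hamDer p φ)) (a - b) := by
    by_cases h8 : A.e c (hamDer p φ) = 0
    · rw [h8]; exact ordGe_zero _
    have h9 : euler (A.e c Q) ≠ 0 := fun h => h4 (by rw [h]; rfl)
    have h10 : (euler (A.e c Q)).order ≤ b := by
      by_contra hc
      exact h4 ((ordGe_iff h9).2 le_rfl b (not_le.1 hc))
    have h11 := h.euler
    rw [← h6, ordGe_iff (mul_ne_zero h8 h9), HahnSeries.order_mul h8 h9] at h11
    rw [ordGe_iff h8]
    omega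
  refine ⟨h7, ?_⟩
  have h8 := h7.coeff_mul h5
  rw [h6, sub_add_cancel, euler_coeff] at h8
  rw [mul_assoc, h8]
  field_simp

end Cusps
end

section
open MvPolynomial

section Monomials
variable {k : Type*} [Field k]

/-- Indices of the monomials `x ^ i * y ^ j` with `j < N` and `i + κ * j ≤ D`. -/
abbrev MonIx (N κ D : ℕ) : Type := Σ j : Fin N, Fin (D + 1 - κ * j)

/-- The monomial attached to an index. -/
noncomputable def monFn (k : Type*) [Field k] {N κ D : ℕ} (s : MonIx N κ D) : MvPolynomial (Fin 2) k :=
  X 1 ^ (s.2 : ℕ) * X 0 ^ (s.1 : ℕ)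

lemma le_card_monIx (N κ D : ℕ) : N * D ≤ Fintype.card (MonIx N κ D) + κ * N ^ 2 := by
  rw [Fintype.card_sigma]
  simp only [Fintype.card_fin]
  have : ∑ j : Fin N, D ≤ ∑ j : Fin N, ((D + 1 - κ * j) + κ * N) := by
    refine Finset.sum_le_sum fun j _ => ?_
    have : κ * (j : ℕ) ≤ κ * N := Nat.mul_le_mul_left _ j.2.le
    omega
  rw [Finset.sum_add_distrib] at this
  simp only [Finset.sum_const, Finset.card_univ, Fintype.card_fin, smul_eq_mul] at this
  nlinarith

lemma card_monIx_le (N κ D : ℕ) : Fintype.card (MonIx N κ D) ≤ N * (D + 1) := by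
  rw [Fintype.card_sigma]
  simp only [Fintype.card_fin]
  refine (Finset.sum_le_sum fun j _ => Nat.sub_le _ _).trans ?_
  simp

lemma MonicIn.monFn_indep {p : MvPolynomial (Fin 2) k} {N : ℕ} (h : MonicIn p N)
    {κ D : ℕ} (a : MonIx N κ D → k) (hd : p ∣ ∑ s, C (a s) * monFn k s) : a = 0 := by
  have h1 := map_dvd (toBi k) hd
  set q := toBi k (∑ s, C (a s) * monFn k s) with hq
  have hqs : q = ∑ s : MonIx N κ D, Polynomial.monomial s.1 (Polynomial.monomial s.2 (a s)) := by
    rw [hq, map_sum]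
    refine Finset.sum_congr rfl fun s _ => ?_
    rw [monFn, map_mul, map_mul, map_pow, map_pow, toBi_C, toBi_X_one, toBi_X_zero,
      ← Polynomial.C_mul_X_pow_eq_monomial, ← Polynomial.C_mul_X_pow_eq_monomial, Polynomial.C_mul,
      Polynomial.C_pow, mul_assoc]
  have hq0 : q = 0 := by
    by_contra h0
    have h2 := Polynomial.natDegree_le_of_dvd h1 h0
    rw [h.1] at h2
    rcases N.eq_zero_or_pos with rfl | hN
    · exact h0 (by rw [hqs]; exact Finset.sum_eq_zero fun s _ => s.1.elim0)
    have h3 : q.natDegree ≤ N - 1 := by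
      rw [hqs]
      refine Polynomial.natDegree_sum_le_of_forall_le _ _ fun s _ => ?_
      exact (Polynomial.natDegree_monomial_le _).trans (by have := s.1.2; omega)
    omega
  funext ⟨j, i⟩
  have h4 := congrArg (fun q => (q.coeff (j : ℕ)).coeff (i : ℕ)) (hqs.symm.trans hq0)
  simp only [Polynomial.finset_sum_coeff, Polynomial.coeff_monomial, Polynomial.coeff_zero] at h4
  rw [Finset.sum_eq_single ⟨j, i⟩] at h4
  · simpa [Polynomial.coeff_monomial] using h4
  · rintro ⟨j', i'⟩ - hne
    dsimp only
    split_ifs with hj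
    · rw [Polynomial.coeff_monomial, if_neg]
      intro hi
      apply hne
      have : j' = j := Fin.ext hj
      subst this
      rw [Fin.ext hi]
    · simp
  · simp

end Monomials

namespace Cusps
variable {k : Type*} [Field k] {p : MvPolynomial (Fin 2) k} {N : ℕ}

lemma e_aeval_X_one (A : Cusps p N) (c : A.ι) {f : Polynomial k} {κ : ℕ} (hf : f.natDegree ≤ κ) :
    OrdGe (A.e c (Polynomial.aeval (X 1) f)) (-(κ * A.m c : ℤ)) := by
  rw [Polynomial.aeval_eq_sum_range, map_sum]
  refine OrdGe.sum fun i hi => ?_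
  rw [MvPolynomial.smul_eq_C_mul, map_mul, map_pow, A.e_C]
  have h1 : OrdGe (A.e c (X 1)) (-(A.m c : ℤ)) := by
    rw [ordGe_iff, A.order_x]
    intro h0
    have := A.order_x c
    rw [h0, HahnSeries.order_zero] at this
    have := A.m_pos c
    omega
  refine ((ordGe_C _).mul (h1.pow i)).mono ?_
  rw [Finset.mem_range] at hi
  have h2 : (i : ℤ) ≤ κ := by omega
  nlinarith [A.m c]

lemma ordGe_X_one (A : Cusps p N) (c : A.ι) : OrdGe (A.e c (X 1)) (-(A.m c : ℤ)) := by
  have := A.e_aeval_X_one c (f := Polynomial.X) (κ := 1) Polynomial.natDegree_X_le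
  simpa using this

lemma ordGe_X_zero (A : Cusps p N) (h : MonicIn p N) (hN : 0 < N) {κ : ℕ}
    (hκ : ∀ j, ((toBi k p).coeff j).natDegree ≤ κ) (c : A.ι) :
    OrdGe (A.e c (X 0)) (-(κ * A.m c : ℤ)) := by
  by_cases hy : A.e c (X 0) = 0
  · rw [hy]; exact ordGe_zero _
  rw [ordGe_iff hy]
  by_contra hlt
  rw [not_le] at hlt
  set v := (A.e c (X 0)).order with hv
  have hvy : OrdGe (A.e c (X 0)) v := (ordGe_iff hy).2 le_rfl
  have hv0 : v < 0 := lt_of_lt_of_le hlt (by have := A.m_pos c; simp only [Left.neg_nonpos_iff]; positivity)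
  obtain ⟨a, ha, hlead⟩ := h.2
  have hp : p = ∑ j ∈ Finset.range (N + 1), Polynomial.aeval (X 1) ((toBi k p).coeff j) * X 0 ^ j := by
    conv_lhs => rw [← (toBi k).symm_apply_apply p, (toBi k p).as_sum_range_C_mul_X_pow, h.1, map_sum]
    refine Finset.sum_congr rfl fun j _ => ?_
    rw [map_mul, map_pow, toBi_symm_C, ← toBi_X_zero (k := k), (toBi k).symm_apply_apply]
  have hlead' : (toBi k p).coeff N = Polynomial.C a := by rw [← hlead, Polynomial.leadingCoeff, h.1]
  have h0 : A.e c p = 0 := (A.ker c p).2 dvd_rfl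
  replace h0 : A.e c (∑ j ∈ Finset.range (N + 1), Polynomial.aeval (X 1) ((toBi k p).coeff j) * X 0 ^ j) = 0 :=
    (congrArg (A.e c) hp).symm.trans h0
  rw [Finset.sum_range_succ, hlead', map_add, Polynomial.aeval_C, algebraMap_eq, map_mul, A.e_C,
    map_pow] at h0
  have h1 : OrdGe (A.e c (∑ j ∈ Finset.range N, Polynomial.aeval (X 1) ((toBi k p).coeff j) * X 0 ^ j))
      (N * v + 1) := by
    rw [map_sum]
    refine OrdGe.sum fun j hj => ?_
    rw [map_mul, map_pow]
    refine ((A.e_aeval_X_one c (hκ j)).mul (hvy.pow j)).mono ?_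
    rw [Finset.mem_range] at hj
    have h2 : (j : ℤ) + 1 ≤ N := by omega
    nlinarith
  have h2 := (ordGe_C (k := k) a).coeff_mul (hvy.pow N)
  rw [eq_neg_of_add_eq_zero_right h0, HahnSeries.coeff_neg, h1 _ (by omega)] at h2
  have h3 : (A.e c (X 0) ^ N).order = N * v := by
    rw [HahnSeries.order_pow, nsmul_eq_mul]
  have h4 := mt HahnSeries.coeff_order_eq_zero.1 (pow_ne_zero N hy)
  rw [h3] at h4
  simp [HahnSeries.C_apply, ha, h4] at h2

lemma ordGe_monFn (A : Cusps p N) (h : MonicIn p N) (hN : 0 < N) {κ D : ℕ}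
    (hκ : ∀ j, ((toBi k p).coeff j).natDegree ≤ κ) (c : A.ι) (s : MonIx N κ D) :
    OrdGe (A.e c (monFn k s)) (-(A.m c * D : ℤ)) := by
  rw [monFn, map_mul, map_pow, map_pow]
  refine (((A.ordGe_X_one c).pow _).mul ((A.ordGe_X_zero h hN hκ c).pow _)).mono ?_
  have h1 : (s.2 : ℕ) + κ * (s.1 : ℕ) ≤ D := by have := s.2.2; omega
  have h2 : ((s.2 : ℕ) : ℤ) + κ * (s.1 : ℕ) ≤ D := by exact_mod_cast h1
  have := A.m_pos c
  have h3 : (0 : ℤ) < A.m c := by exact_mod_cast this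
  nlinarith

lemma coeff_e_sum (A : Cusps p N) {I : Type*} (s : Finset I) (c : A.ι) (a : I → k)
    (f : I → MvPolynomial (Fin 2) k) (j : ℤ) :
    (A.e c (∑ i ∈ s, C (a i) * f i)).coeff j = ∑ i ∈ s, a i * (A.e c (f i)).coeff j := by
  rw [map_sum, HahnSeries.coeff_sum]
  refine Finset.sum_congr rfl fun i _ => ?_
  rw [map_mul, A.e_C, HahnSeries.C_mul_eq_smul, HahnSeries.coeff_smul, smul_eq_mul]

/-- There are many functions with prescribed orders at the cusps. -/
theorem exists_many (A : Cusps p N) (h : MonicIn p N) (hN : 0 < N) {κ : ℕ}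
    (hκ : ∀ j, ((toBi k p).coeff j).natDegree ≤ κ) (o : A.ι → ℤ) (L : ℕ)
    (hL : (L : ℤ) ≤ -∑ c, o c - κ * N ^ 2) :
    ∃ f : Fin L → MvPolynomial (Fin 2) k,
      (∀ a : Fin L → k, p ∣ ∑ i, C (a i) * f i → a = 0) ∧ ∀ i c, OrdGe (A.e c (f i)) (o c) := by
  classical
  set D : ℕ := ∑ c, (o c).natAbs with hD
  have hoD : ∀ c, 0 ≤ o c + A.m c * D := by
    intro c
    have h1 : (o c).natAbs ≤ D := Finset.single_le_sum (f := fun c => (o c).natAbs) (fun _ _ => Nat.zero_le _) (Finset.mem_univ c)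
    have h2 := A.m_pos c
    have h3 : (D : ℤ) ≤ A.m c * D := by exact_mod_cast Nat.le_mul_of_pos_left D h2
    omega
  let T : (MonIx N κ D → k) →ₗ[k] ((Σ c, Fin (o c + A.m c * D).toNat) → k) :=
    { toFun := fun a u => ∑ s, a s * (A.e u.1 (monFn k s)).coeff (-(A.m u.1 * D : ℤ) + (u.2 : ℕ))
      map_add' := fun a b => by funext u; simp [add_mul, Finset.sum_add_distrib]
      map_smul' := fun r a => by funext u; simp [mul_assoc, Finset.mul_sum] }
  have h1 := T.finrank_range_add_finrank_ker
  have h2 : Module.finrank k (LinearMap.range T) ≤ ∑ c, (o c + A.m c * D).toNat := by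
    refine (Submodule.finrank_le _).trans ?_
    rw [Module.finrank_fintype_fun_eq_card, Fintype.card_sigma]
    simp
  rw [Module.finrank_fintype_fun_eq_card] at h1
  have h3 : L ≤ Module.finrank k (LinearMap.ker T) := by
    have h4 := le_card_monIx N κ D
    have h5 : ((∑ c, (o c + A.m c * D).toNat : ℕ) : ℤ) ≤ ∑ c, o c + N * D := by
      push_cast
      rw [Finset.sum_congr rfl fun c _ => Int.toNat_of_nonneg (hoD c), Finset.sum_add_distrib,
        ← Finset.sum_mul]
      have := A.sum_m
      have h6 : (∑ c, (A.m c : ℤ)) ≤ N := by exact_mod_cast this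
      have : (0 : ℤ) ≤ D := by positivity
      nlinarith
    zify at h1 h2 h4 ⊢
    push_cast at h5
    linarith
  let b := Module.finBasis k (LinearMap.ker T)
  let v : Fin L → (MonIx N κ D → k) := fun i => (b (Fin.castLE h3 i) : MonIx N κ D → k)
  have hv : LinearIndependent k v :=
    ((b.linearIndependent.comp _ (Fin.castLE_injective h3)).map' (LinearMap.ker T).subtype
      (Submodule.ker_subtype _))
  have hvT : ∀ i, T (v i) = 0 := fun i => (b (Fin.castLE h3 i)).2
  refine ⟨fun i => ∑ s, C (v i s) * monFn k s, fun a ha => ?_, fun i c j hj => ?_⟩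
  · have h4 : ∑ i, C (a i) * ∑ s, C (v i s) * monFn k s =
        ∑ s : MonIx N κ D, C ((∑ i, a i • v i) s) * monFn k s := by
      simp only [Finset.mul_sum, Finset.sum_apply, Pi.smul_apply, smul_eq_mul, map_sum, map_mul,
        Finset.sum_mul]
      rw [Finset.sum_comm]
      simp only [mul_assoc]
    rw [h4] at ha
    have h5 := h.monFn_indep _ ha
    exact funext (Fintype.linearIndependent_iff.1 hv a h5)
  · rw [A.coeff_e_sum]
    by_cases hj2 : j < -(A.m c * D : ℤ)
    · exact Finset.sum_eq_zero fun s _ => by rw [A.ordGe_monFn h hN hκ c s j hj2, mul_zero]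
    · have h4 := congrFun (hvT i) ⟨c, ⟨(j + A.m c * D).toNat, by omega⟩⟩
      simp only [T, LinearMap.coe_mk, AddHom.coe_mk, Pi.zero_apply] at h4
      rw [← h4]
      refine Finset.sum_congr rfl fun s _ => ?_
      congr 2
      omega

/-- If no nonzero regular function vanishes at all cusps, no nonzero regular function has
a divisor at infinity of positive degree. -/
theorem dvd_of_sum_pos (A : Cusps p N) (hp : Irreducible p) (h : MonicIn p N) (hN : 0 < N)
    (hA : ∀ φ, (∀ c, OrdGe (A.e c φ) 1) → p ∣ φ) (τ : A.ι → ℤ) (hτ : 0 < ∑ c, τ c)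
    (φ : MvPolynomial (Fin 2) k) (hφ : ∀ c, OrdGe (A.e c φ) (τ c)) : p ∣ φ := by
  classical
  by_contra hn
  obtain ⟨κ, hκ⟩ : ∃ κ : ℕ, ∀ j, ((toBi k p).coeff j).natDegree ≤ κ := by
    refine ⟨∑ j ∈ (toBi k p).support, ((toBi k p).coeff j).natDegree, fun j => ?_⟩
    by_cases hj : j ∈ (toBi k p).support
    · exact Finset.single_le_sum (f := fun j => ((toBi k p).coeff j).natDegree)
        (fun _ _ => Nat.zero_le _) hj
    · rw [Polynomial.notMem_support_iff.1 hj]; simp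
  set r := Fintype.card A.ι
  set n := r + 1 + κ * N ^ 2 with hndef
  obtain ⟨f, hf1, hf2⟩ := A.exists_many h hN hκ (fun c => -(n * τ c)) (r + 1) (by
    rw [Finset.sum_neg_distrib, neg_neg, ← Finset.mul_sum]
    have : (n : ℤ) ≤ n * ∑ c, τ c := le_mul_of_one_le_right (by positivity) hτ
    have h2 : (n : ℤ) = r + 1 + κ * N ^ 2 := by rw [hndef]; push_cast; ring
    push_cast
    omega)
  let T : (Fin (r + 1) → k) →ₗ[k] (A.ι → k) :=
    { toFun := fun a c => ∑ i, a i * (A.e c (f i * φ ^ n)).coeff 0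
      map_add' := fun a b => by funext u; simp [add_mul, Finset.sum_add_distrib]
      map_smul' := fun r a => by funext u; simp [mul_assoc, Finset.mul_sum] }
  obtain ⟨a, ha, ha0⟩ : ∃ a, T a = 0 ∧ a ≠ 0 := by
    have h1 := LinearMap.ker_ne_bot_of_finrank_lt (f := T) (by simp [r])
    obtain ⟨a, h2, h3⟩ := (Submodule.ne_bot_iff _).1 h1
    exact ⟨a, h2, h3⟩
  have h0 : p ∣ ∑ i, C (a i) * (f i * φ ^ n) := by
    refine hA _ fun c j hj => ?_
    rw [A.coeff_e_sum]
    rcases (show j ≤ 0 by omega).lt_or_eq with h1 | rfl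
    · refine Finset.sum_eq_zero fun i _ => ?_
      rw [map_mul, map_pow, ((hf2 i c).mul ((hφ c).pow n)) j (by omega), mul_zero]
    · exact congrFun ha c
  have h1 : ∑ i, C (a i) * (f i * φ ^ n) = (∑ i, C (a i) * f i) * φ ^ n := by
    rw [Finset.sum_mul]; exact Finset.sum_congr rfl fun i _ => by ring
  rw [h1] at h0
  rcases hp.prime.dvd_or_dvd h0 with h2 | h2
  · exact ha0 (hf1 a h2)
  · exact hn (hp.prime.dvd_of_dvd_pow h2)

end Cusps
end

section
open MvPolynomial

section Wronskian
variable {k : Type*} [Field k]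

lemma exists_distinct_orders (L : ℕ) : ∀ (f : Fin L → LaurentSeries k) (o : ℤ),
    (∀ s : Fin L → k, ∑ i, HahnSeries.C (s i) * f i = 0 → s = 0) → (∀ i, OrdGe (f i) o) →
    ∃ (T : Matrix (Fin L) (Fin L) k) (j : Fin L → ℤ), StrictMono j ∧ (∀ i, o ≤ j i) ∧
      ∀ i, OrdGe (∑ l, HahnSeries.C (T i l) * f l) (j i) ∧
        (∑ l, HahnSeries.C (T i l) * f l).coeff (j i) ≠ 0 := by
  classical
  induction L with
  | zero =>
    intro f o _ _
    exact ⟨1, fun i => i.elim0, fun i => i.elim0, fun i => i.elim0, fun i => i.elim0⟩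
  | succ L ih =>
    intro f o hf ho
    have hne : ∀ i, f i ≠ 0 := by
      intro i h0
      have h1 := congrFun (hf (Pi.single i 1) (by
        rw [Finset.sum_eq_single i]
        · simp [h0]
        · intro b _ hb; rw [Pi.single_eq_of_ne hb, map_zero, zero_mul]
        · simp)) i
      simp at h1
    obtain ⟨l0, -, hl0⟩ := Finset.exists_min_image Finset.univ (fun i => (f i).order) ⟨0, Finset.mem_univ _⟩
    set j0 := (f l0).order with hj0
    have h1 : ∀ i, OrdGe (f i) j0 := fun i => (ordGe_iff (hne i)).2 (hl0 i (Finset.mem_univ _))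
    have h2 : (f l0).coeff j0 ≠ 0 := mt HahnSeries.coeff_order_eq_zero.1 (hne l0)
    let ρ : Fin L → k := fun l => (f (l0.succAbove l)).coeff j0 / (f l0).coeff j0
    have key : ∀ s : Fin L → k, ∑ l, HahnSeries.C (s l) * (f (l0.succAbove l) - HahnSeries.C (ρ l) * f l0) =
        ∑ l, HahnSeries.C ((l0.insertNth (-∑ l, s l * ρ l) s : Fin (L + 1) → k) l) * f l := by
      intro s
      rw [Fin.sum_univ_succAbove _ l0, Fin.insertNth_apply_same]
      simp only [Fin.insertNth_apply_succAbove, mul_sub, Finset.sum_sub_distrib, map_neg, map_sum, map_mul,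
        neg_mul, Finset.sum_mul, mul_assoc]
      ring
    obtain ⟨T, j, hj1, hj2, hj3⟩ := ih (fun l => f (l0.succAbove l) - HahnSeries.C (ρ l) * f l0) (j0 + 1)
      (by
        intro s hs
        rw [key] at hs
        have := hf _ hs
        funext l
        have h3 := congrFun this (l0.succAbove l)
        rwa [Fin.insertNth_apply_succAbove] at h3)
      (by
        intro l i hi
        have h3 : OrdGe (HahnSeries.C (ρ l) * f l0) j0 := by simpa using (ordGe_C (ρ l)).mul (h1 l0)
        have h4 := (ordGe_C (ρ l)).coeff_mul (h1 l0)
        rw [zero_add] at h4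
        rcases (show i ≤ j0 by omega).lt_or_eq with h | rfl
        · exact ((h1 _).sub h3) i h
        · rw [HahnSeries.coeff_sub, h4, HahnSeries.C_apply, HahnSeries.coeff_single_same]
          simp only [ρ]
          field_simp
          ring)
    simp only [key] at hj3
    refine ⟨Matrix.of (Fin.cons (Pi.single l0 1) fun i => l0.insertNth (-∑ l, T i l * ρ l) (T i)), Fin.cons j0 j, ?_, ?_, ?_⟩
    · intro a b hab
      induction b using Fin.cases with
      | zero => exact absurd hab (Fin.not_lt_zero a)
      | succ b =>
        induction a using Fin.cases with
        | zero => simp only [Fin.cons_zero, Fin.cons_succ]; have := hj2 b; omega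
        | succ a => simp only [Fin.cons_succ]; exact hj1 (Fin.succ_lt_succ_iff.1 hab)
    · have h3 := (ordGe_iff (hne l0)).1 (ho l0)
      intro i
      induction i using Fin.cases with
      | zero => exact h3
      | succ i => simp only [Fin.cons_succ]; have := hj2 i; omega
    · intro i
      induction i using Fin.cases with
      | zero =>
        have : ∑ l, HahnSeries.C ((Pi.single l0 1 : Fin (L + 1) → k) l) * f l = f l0 := by
          rw [Finset.sum_eq_single l0]
          · simp
          · intro b _ hb; rw [Pi.single_eq_of_ne hb, map_zero, zero_mul]
          · simp
        simp only [Matrix.of_apply, Fin.cons_zero]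
        rw [this]
        exact ⟨h1 l0, h2⟩
      | succ i => simpa only [Matrix.of_apply, Fin.cons_succ] using hj3 i

lemma OrdGe.prod {I : Type*} (s : Finset I) {f : I → LaurentSeries k} {a : I → ℤ}
    (h : ∀ i ∈ s, OrdGe (f i) (a i)) : OrdGe (∏ i ∈ s, f i) (∑ i ∈ s, a i) ∧
      (∏ i ∈ s, f i).coeff (∑ i ∈ s, a i) = ∏ i ∈ s, (f i).coeff (a i) := by
  classical
  induction s using Finset.induction_on with
  | empty => simpa using ordGe_C (1 : k)
  | insert i s hi ih =>
    obtain ⟨h1, h2⟩ := ih fun j hj => h j (by simp [hj])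
    have h3 := h i (by simp)
    rw [Finset.prod_insert hi, Finset.sum_insert hi, Finset.prod_insert hi]
    exact ⟨h3.mul h1, by rw [h3.coeff_mul h1, h2]⟩

lemma ordGe_det {L : ℕ} (M : Matrix (Fin L) (Fin L) (LaurentSeries k)) (r s : Fin L → ℤ)
    (h : ∀ i a, OrdGe (M i a) (r i + s a)) : OrdGe M.det (∑ i, r i + ∑ i, s i) ∧
      M.det.coeff (∑ i, r i + ∑ i, s i) = (Matrix.of fun i a => (M i a).coeff (r i + s a)).det := by
  have h1 : ∀ σ : Equiv.Perm (Fin L), ∑ i, r i + ∑ i, s i = ∑ i, (r (σ i) + s i) := by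
    intro σ
    rw [Finset.sum_add_distrib, Equiv.sum_comp σ r]
  have h2 := fun σ : Equiv.Perm (Fin L) => OrdGe.prod Finset.univ (f := fun i => M (σ i) i)
    (a := fun i => r (σ i) + s i) fun i _ => h _ _
  rw [Matrix.det_apply, Matrix.det_apply]
  constructor
  · refine OrdGe.sum fun σ _ => ?_
    rw [h1 σ]
    intro j hj
    have := (h2 σ).1 j hj
    rcases Int.units_eq_one_or (Equiv.Perm.sign σ) with h3 | h3 <;> rw [h3] <;> simp [this]
  · rw [HahnSeries.coeff_sum]
    refine Finset.sum_congr rfl fun σ _ => ?_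
    have := (h2 σ).2
    rw [← h1 σ] at this
    rcases Int.units_eq_one_or (Equiv.Perm.sign σ) with h3 | h3 <;> rw [h3] <;> simp [this]

/-- Nonvanishing and order of generalized Wronskians. -/
theorem wronskian_order [CharZero k] {L : ℕ} (M : Matrix (Fin L) (Fin L) (LaurentSeries k)) (hL : 0 < L)
    (g : (Fin L → k) → ℕ → LaurentSeries k)
    (hg : ∀ s (a : Fin L), g s a = ∑ i, HahnSeries.C (s i) * M i a)
    (hind : ∀ s, g s 0 = 0 → s = 0) (κ : k) (hκ : κ ≠ 0) (b : ℤ)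
    (hD : ∀ s (a : ℕ) (j : ℤ), OrdGe (g s a) j → OrdGe (g s (a + 1)) (j - b) ∧
      (g s (a + 1)).coeff (j - b) = κ * j * (g s a).coeff j)
    (o : ℤ) (ho : ∀ s, OrdGe (g s 0) o) :
    M.det ≠ 0 ∧ OrdGe M.det (∑ i : Fin L, (o + (i : ℕ)) - b * ∑ i : Fin L, ((i : ℕ) : ℤ)) := by
  classical
  haveI : NeZero L := ⟨hL.ne'⟩
  have hg0 : ∀ s, g s 0 = ∑ i, HahnSeries.C (s i) * M i 0 := fun s => hg s 0
  have hM0 : ∀ i, M i 0 = g (Pi.single i 1) 0 := by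
    intro i
    rw [hg0, Finset.sum_eq_single i]
    · simp
    · intro b _ hb; rw [Pi.single_eq_of_ne hb, map_zero, zero_mul]
    · simp
  obtain ⟨T, j, hj1, hj2, hj3⟩ := exists_distinct_orders L (fun i => M i 0) o
    (fun s hs => hind s ((hg0 s).trans hs)) (fun i => by rw [hM0]; exact ho _)
  simp only [← hg0] at hj3
  have hiter : ∀ i (a : ℕ), OrdGe (g (T i) a) (j i - a * b) ∧ (g (T i) a).coeff (j i - a * b) =
      κ ^ a * (∏ t ∈ Finset.range a, ((j i : k) - t * b)) * (g (T i) 0).coeff (j i) := by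
    intro i a
    induction a with
    | zero => simpa using (hj3 i).1
    | succ a ih =>
      have h1 := hD (T i) a _ ih.1
      have h2 : j i - (a : ℤ) * b - b = j i - ((a + 1 : ℕ) : ℤ) * b := by push_cast; ring
      rw [h2] at h1
      refine ⟨h1.1, ?_⟩
      rw [h1.2, ih.2, Finset.prod_range_succ, pow_succ]
      push_cast
      ring
  set M' : Matrix (Fin L) (Fin L) (LaurentSeries k) := T.map HahnSeries.C * M with hM'
  have hM'a : ∀ i a, M' i a = g (T i) a := by
    intro i a
    rw [hM', Matrix.mul_apply, hg]
    rfl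
  have hdet : M'.det = HahnSeries.C T.det * M.det := by
    rw [hM', Matrix.det_mul, RingHom.map_det]
    rfl
  obtain ⟨hd1, hd2⟩ := ordGe_det M' j (fun a => -((a : ℕ) * b)) (fun i a => by
    rw [hM'a, ← sub_eq_add_neg]; exact (hiter i a).1)
  set J := ∑ i, j i + ∑ a : Fin L, -(((a : ℕ) : ℤ) * b) with hJ
  have hc : M'.det.coeff J ≠ 0 := by
    rw [hd2]
    have h3 : (Matrix.of fun i a : Fin L => (M' i a).coeff (j i + -(((a : ℕ) : ℤ) * b))) =
        Matrix.of fun i a : Fin L => (g (T i) 0).coeff (j i) *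
          (Matrix.of fun i a : Fin L => κ ^ (a : ℕ) *
            (Matrix.of fun i a : Fin L => (∏ t ∈ Finset.range a, (Polynomial.X - Polynomial.C ((t : k) * b))).eval (j i : k)) i a) i a := by
      ext i a
      rw [Matrix.of_apply, Matrix.of_apply, Matrix.of_apply, Matrix.of_apply, hM'a, ← sub_eq_add_neg, (hiter i a).2, Polynomial.eval_prod]
      simp only [Polynomial.eval_sub, Polynomial.eval_X, Polynomial.eval_C]
      ring
    rw [h3, Matrix.det_mul_column, Matrix.det_mul_row]
    refine mul_ne_zero (Finset.prod_ne_zero_iff.2 fun i _ => (hj3 i).2)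
      (mul_ne_zero (Finset.prod_ne_zero_iff.2 fun i _ => pow_ne_zero _ hκ) ?_)
    rw [← Matrix.det_eval_matrixOfPolynomials_eq_det_vandermonde (fun i => (j i : k))
      (fun a : Fin L => ∏ t ∈ Finset.range a, (Polynomial.X - Polynomial.C ((t : k) * b)))]
    · rw [Matrix.det_vandermonde_ne_zero_iff]
      intro a b hab
      exact hj1.injective (Int.cast_injective (α := k) hab)
    · intro a
      rw [Polynomial.natDegree_prod_of_monic _ _ fun _ _ => Polynomial.monic_X_sub_C _]
      simp only [Polynomial.natDegree_X_sub_C, Finset.sum_const, Finset.card_range, smul_eq_mul, mul_one]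
    · intro a
      exact Polynomial.monic_prod_of_monic _ _ fun _ _ => Polynomial.monic_X_sub_C _
  have hT : T.det ≠ 0 := by
    intro h0; apply hc; rw [hdet, h0, map_zero, zero_mul]; rfl
  have hMd : M.det = HahnSeries.C (T.det)⁻¹ * M'.det := by
    rw [hdet, ← mul_assoc, ← map_mul, inv_mul_cancel₀ hT, map_one, one_mul]
  refine ⟨fun h0 => hc (by rw [hdet, h0, mul_zero]; rfl), ?_⟩
  rw [hMd]
  refine ((ordGe_C _).mul hd1).mono ?_
  rw [zero_add, hJ, Finset.sum_neg_distrib, ← Finset.sum_mul, mul_comm b, ← sub_eq_add_neg]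
  refine sub_le_sub_right (Finset.sum_le_sum fun i _ => ?_) _
  have : ∀ n (hn : n < L), o + (n : ℤ) ≤ j ⟨n, hn⟩ := by
    intro n
    induction n with
    | zero => intro hn; simpa using hj2 _
    | succ n ih =>
      intro hn
      have h1 := ih (by omega)
      have h2 : j ⟨n, by omega⟩ < j ⟨n + 1, hn⟩ := hj1 (by simp)
      push_cast
      omega
  exact this i i.2

end Wronskian
end

section
open MvPolynomial

namespace Cusps
variable {k : Type*} [Field k] [CharZero k] {p Q : MvPolynomial (Fin 2) k} {N : ℕ}
variable (A : Cusps p N) (hp : Irreducible p) (hJ : hamDer p Q = 1)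

lemma ordGe_iterate (c : A.ι) {φ : MvPolynomial (Fin 2) k} {o : ℤ} (h : OrdGe (A.e c φ) o) (a : ℕ) :
    OrdGe (A.e c ((hamDer p)^[a] φ)) (o - a * A.exponent hp hJ c) := by
  obtain ⟨κ, -, hκ⟩ := A.exists_hamDer_coeff hp hJ c
  induction a with
  | zero => simpa using h
  | succ a ih =>
    rw [Function.iterate_succ_apply']
    refine (hκ _ _ ih).1.mono (le_of_eq ?_)
    push_cast; ring

theorem dvd_iterate_X (h : MonicIn p N) (hN : 0 < N)
    (hA : ∀ φ, (∀ c, OrdGe (A.e c φ) 1) → p ∣ φ) {κ : ℕ} (hκ1 : 1 ≤ κ)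
    (hκ : ∀ j, ((toBi k p).coeff j).natDegree ≤ κ)
    (hE : ∑ c, A.exponent hp hJ c < 0) (i : Fin 2) : p ∣ (hamDer p)^[κ * N + 1] (X i) := by
  have h1 : ∀ c, OrdGe (A.e c (X i)) (-(κ * A.m c : ℤ)) := by
    intro c
    fin_cases i
    · exact A.ordGe_X_zero h hN hκ c
    · refine (A.ordGe_X_one c).mono ?_
      have : (1 : ℤ) ≤ κ := by exact_mod_cast hκ1
      nlinarith [A.m c]
  refine A.dvd_of_sum_pos hp h hN hA _ ?_ _ fun c => A.ordGe_iterate hp hJ c (h1 c) _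
  rw [Finset.sum_sub_distrib, Finset.sum_neg_distrib, ← Finset.mul_sum, ← Finset.mul_sum]
  have h2 : (∑ c, (A.m c : ℤ)) ≤ N := by exact_mod_cast A.sum_m
  push_cast
  have h3 : (κ : ℤ) * ∑ c, (A.m c : ℤ) ≤ κ * N := mul_le_mul_of_nonneg_left h2 (by positivity)
  have h4 : (0 : ℤ) ≤ κ * N := by positivity
  nlinarith

lemma iterate_hamDer_sum {I : Type*} (s : Finset I) (a : I → k) (f : I → MvPolynomial (Fin 2) k) (n : ℕ) :
    (hamDer p)^[n] (∑ i ∈ s, C (a i) * f i) = ∑ i ∈ s, C (a i) * (hamDer p)^[n] (f i) := by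
  induction n with
  | zero => rfl
  | succ n ih =>
    simp only [Function.iterate_succ_apply', ih, map_sum]
    refine Finset.sum_congr rfl fun i _ => ?_
    rw [← smul_eq_C_mul, ← smul_eq_C_mul, Derivation.map_smul]

theorem card_le_two (h : MonicIn p N) (hN : 0 < N)
    (hA : ∀ φ, (∀ c, OrdGe (A.e c φ) 1) → p ∣ φ)
    (hE : ∑ c, A.exponent hp hJ c ≤ 0) : Fintype.card A.ι ≤ 2 := by
  classical
  by_contra hr
  rw [not_le] at hr
  obtain ⟨κ, hκ⟩ : ∃ κ : ℕ, ∀ j, ((toBi k p).coeff j).natDegree ≤ κ := by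
    refine ⟨∑ j ∈ (toBi k p).support, ((toBi k p).coeff j).natDegree, fun j => ?_⟩
    by_cases hj : j ∈ (toBi k p).support
    · exact Finset.single_le_sum (f := fun j => ((toBi k p).coeff j).natDegree)
        (fun _ _ => Nat.zero_le _) hj
    · rw [Polynomial.notMem_support_iff.1 hj]; simp
  set d : ℕ := κ * N ^ 2 + 2 with hd
  set r := Fintype.card A.ι with hrdef
  obtain ⟨f, hf1, hf2⟩ := A.exists_many h hN hκ (fun _ => -(d : ℤ)) (2 * d + 2) (by
    simp only [Finset.sum_const, Finset.card_univ, nsmul_eq_mul]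
    rw [← hrdef]
    have h1 : (3 : ℤ) ≤ r := by exact_mod_cast hr
    have h2 : (d : ℤ) = κ * N ^ 2 + 2 := by rw [hd]; push_cast; ring
    push_cast
    have h3 : (0 : ℤ) ≤ κ * N ^ 2 := by positivity
    nlinarith)
  set M : Matrix (Fin (2 * d + 2)) (Fin (2 * d + 2)) (MvPolynomial (Fin 2) k) :=
    Matrix.of fun i a => (hamDer p)^[a] (f i)
  have key : ∀ c, A.e c M.det ≠ 0 ∧ OrdGe (A.e c M.det)
      (∑ i : Fin (2 * d + 2), (-(d : ℤ) + (i : ℕ)) - A.exponent hp hJ c * ∑ i : Fin (2 * d + 2), ((i : ℕ) : ℤ)) := by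
    intro c
    obtain ⟨κ', hκ'0, hκ'⟩ := A.exists_hamDer_coeff hp hJ c
    rw [RingHom.map_det]
    refine wronskian_order _ (by omega) (fun s a => A.e c ((hamDer p)^[a] (∑ i, C (s i) * f i))) ?_ ?_ κ' hκ'0 _ ?_ _ ?_
    · intro s a
      rw [iterate_hamDer_sum, map_sum]
      refine Finset.sum_congr rfl fun i _ => ?_
      rw [map_mul, A.e_C]
      rfl
    · intro s hs
      exact hf1 s ((A.ker c _).1 hs)
    · intro s a j hj
      simp only [Function.iterate_succ_apply']
      exact hκ' _ _ hj
    · intro s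
      simp only [Function.iterate_zero, id_eq]
      rw [map_sum]
      refine OrdGe.sum fun i _ => ?_
      rw [map_mul, A.e_C]
      simpa using (ordGe_C (s i)).mul (hf2 i c)
  have hc : Nonempty A.ι := Fintype.card_pos_iff.1 (by omega)
  obtain ⟨c⟩ := hc
  refine (key c).1 ((A.ker c _).2 (A.dvd_of_sum_pos hp h hN hA _ ?_ _ fun c => (key c).2))
  rw [Finset.sum_sub_distrib, ← Finset.sum_mul]
  simp only [Finset.sum_add_distrib, Finset.sum_const, Finset.card_univ, Fintype.card_fin, nsmul_eq_mul]
  rw [← hrdef]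
  have hT : (∑ i : Fin (2 * d + 2), ((i : ℕ) : ℤ)) * 2 = (2 * d + 2) * (2 * d + 1) := by
    rw [Fin.sum_univ_eq_sum_range (fun i => (i : ℤ))]
    have := Finset.sum_range_id_mul_two (2 * d + 2)
    have h2 : 2 * d + 2 - 1 = 2 * d + 1 := by omega
    rw [h2] at this
    have := congrArg (Nat.cast : ℕ → ℤ) this
    push_cast at this
    exact this
  set T := ∑ i : Fin (2 * d + 2), ((i : ℕ) : ℤ)
  have hT0 : 0 ≤ T := Finset.sum_nonneg fun i _ => by positivity
  have h1 : (3 : ℤ) ≤ r := by exact_mod_cast hr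
  have h2 : (∑ c, A.exponent hp hJ c) * T ≤ 0 := mul_nonpos_of_nonpos_of_nonneg hE hT0
  have h3 : T = (d + 1) * (2 * d + 1) := by linarith
  have h4 : ((2 * d + 2 : ℕ) : ℤ) * -(d : ℤ) + T = d + 1 := by rw [h3]; push_cast; ring
  rw [← mul_add, h4]
  have : (0 : ℤ) < r * (d + 1) := by positivity
  linarith

/-- If the exponents sum to zero then `Q` omits a value on the curve. -/
theorem exists_omitted (h : MonicIn p N) (hN : 0 < N)
    (hA : ∀ φ, (∀ c, OrdGe (A.e c φ) 1) → p ∣ φ)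
    (hE : ∑ c, A.exponent hp hJ c = 0) : ∃ (β : k) (u : MvPolynomial (Fin 2) k),
      p ∣ u * (Q - C β) - 1 := by
  classical
  have hcard := A.card_le_two hp hJ h hN hA hE.le
  have hne : Nonempty A.ι := by
    by_contra hc
    rw [not_nonempty_iff] at hc
    exact hp.not_isUnit (isUnit_of_dvd_one (hA 1 fun c => hc.elim c))
  have hspec := fun c => A.exponent_spec hp hJ c
  obtain ⟨c0, hc0⟩ : ∃ c, 0 < A.exponent hp hJ c := by
    by_contra! hc
    obtain ⟨c⟩ := hne
    have := (Finset.sum_eq_zero_iff_of_nonpos fun c _ => hc c).1 hE c (Finset.mem_univ _)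
    exact (hspec c).1 this
  obtain ⟨c1, hc1⟩ : ∃ c, A.exponent hp hJ c < 0 := by
    by_contra! hc
    have := (Finset.sum_eq_zero_iff_of_nonneg fun c _ => hc c).1 hE c0 (Finset.mem_univ _)
    exact (hspec c0).1 this
  have hc01 : c0 ≠ c1 := by rintro rfl; omega
  have huniv : (Finset.univ : Finset A.ι) = {c0, c1} := by
    symm
    apply Finset.eq_univ_of_card
    rw [Finset.card_pair hc01]
    have : ({c0, c1} : Finset A.ι).card ≤ Fintype.card A.ι := Finset.card_le_univ _
    rw [Finset.card_pair hc01] at this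
    omega
  have hall : ∀ c, c = c0 ∨ c = c1 := fun c => by
    have : c ∈ ({c0, c1} : Finset A.ι) := huniv ▸ Finset.mem_univ c
    simpa using this
  have hE1 : A.exponent hp hJ c1 = -A.exponent hp hJ c0 := by
    rw [huniv, Finset.sum_pair hc01] at hE; omega
  set b := A.exponent hp hJ c0
  set β := A.value hp hJ c0
  set q := Q - C β with hq
  have hq0 : OrdGe (A.e c0 q) b := (hspec c0).2.1
  have hq0c : (A.e c0 q).coeff b ≠ 0 := (hspec c0).2.2.1
  have hv1 := (hspec c1).2.2.2 hc1
  have hQ1 := (hspec c1).2.1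
  have hQ1c := (hspec c1).2.2.1
  rw [hv1, C_0, sub_zero, hE1] at hQ1 hQ1c
  have hβ : OrdGe (A.e c1 (C β)) (-b + 1) := by
    rw [A.e_C]; exact (ordGe_C β).mono (by omega)
  have hq1 : OrdGe (A.e c1 q) (-b) := by
    rw [hq, map_sub]; exact hQ1.sub (hβ.mono (by omega))
  have hq1c : (A.e c1 q).coeff (-b) ≠ 0 := by
    rw [hq, map_sub, HahnSeries.coeff_sub, hβ _ (by omega), sub_zero]; exact hQ1c
  -- the operator `q D`
  have hδ0 : ∃ μ : k, μ ≠ 0 ∧ ∀ φ (a : ℤ), OrdGe (A.e c0 φ) a →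
      OrdGe (A.e c0 (q * hamDer p φ)) a ∧ (A.e c0 (q * hamDer p φ)).coeff a = μ * a * (A.e c0 φ).coeff a := by
    obtain ⟨κ, hκ0, hκ⟩ := A.exists_hamDer_coeff hp hJ c0
    refine ⟨(A.e c0 q).coeff b * κ, mul_ne_zero hq0c hκ0, fun φ a hφ => ?_⟩
    obtain ⟨h1, h2⟩ := hκ φ a hφ
    have h3 := hq0.mul h1
    have h4 := hq0.coeff_mul h1
    rw [add_sub_cancel, ← map_mul] at h3 h4
    exact ⟨h3, by rw [h4, h2]; ring⟩
  have hδ1 : ∃ μ : k, μ ≠ 0 ∧ ∀ φ (a : ℤ), OrdGe (A.e c1 φ) a →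
      OrdGe (A.e c1 (q * hamDer p φ)) a ∧ (A.e c1 (q * hamDer p φ)).coeff a = μ * a * (A.e c1 φ).coeff a := by
    obtain ⟨κ, hκ0, hκ⟩ := A.exists_hamDer_coeff hp hJ c1
    rw [hE1] at hκ
    refine ⟨(A.e c1 q).coeff (-b) * κ, mul_ne_zero hq1c hκ0, fun φ a hφ => ?_⟩
    obtain ⟨h1, h2⟩ := hκ φ a hφ
    have h3 := hq1.mul h1
    have h4 := hq1.coeff_mul h1
    rw [add_sub_cancel, ← map_mul] at h3 h4
    exact ⟨h3, by rw [h4, h2]; ring⟩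
  obtain ⟨μ0, hμ0, hδ0⟩ := hδ0
  obtain ⟨μ1, hμ1, hδ1⟩ := hδ1
  have hsum : ∀ τ0 τ1 : ℤ, 0 < τ0 + τ1 → ∀ φ, OrdGe (A.e c0 φ) τ0 → OrdGe (A.e c1 φ) τ1 → p ∣ φ := by
    intro τ0 τ1 hτ φ h0 h1
    refine A.dvd_of_sum_pos hp h hN hA (fun c => if c = c0 then τ0 else τ1) ?_ φ fun c => ?_
    · rw [huniv, Finset.sum_pair hc01, if_pos rfl, if_neg hc01.symm]; exact hτ
    · rcases hall c with rfl | rfl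
      · rw [if_pos rfl]; exact h0
      · rw [if_neg hc01.symm]; exact h1
  have hconst : ∀ φ, OrdGe (A.e c0 φ) 0 → OrdGe (A.e c1 φ) 0 → p ∣ φ - C ((A.e c0 φ).coeff 0) := by
    intro φ h0 h1
    refine hsum 1 0 (by norm_num) _ (fun j hj => ?_) ?_
    · rw [map_sub, A.e_C, HahnSeries.coeff_sub, HahnSeries.C_apply]
      rcases (show j ≤ 0 by omega).lt_or_eq with h2 | rfl
      · rw [h0 j h2, HahnSeries.coeff_single_of_ne h2.ne, sub_zero]
      · rw [HahnSeries.coeff_single_same, sub_self]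
    · rw [map_sub, A.e_C]; exact h1.sub (ordGe_C _)
  -- a function with a pole of minimal order at `c0`
  let good : ℕ → Prop := fun n => 0 < n ∧ ∃ φ, OrdGe (A.e c1 φ) 0 ∧ OrdGe (A.e c0 φ) (-(n : ℤ)) ∧
    (A.e c0 φ).coeff (-(n : ℤ)) ≠ 0
  have hgood : ∃ n, good n := by
    obtain ⟨κ, hκ⟩ : ∃ κ : ℕ, ∀ j, ((toBi k p).coeff j).natDegree ≤ κ := by
      refine ⟨∑ j ∈ (toBi k p).support, ((toBi k p).coeff j).natDegree, fun j => ?_⟩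
      by_cases hj : j ∈ (toBi k p).support
      · exact Finset.single_le_sum (f := fun j => ((toBi k p).coeff j).natDegree)
          (fun _ _ => Nat.zero_le _) hj
      · rw [Polynomial.notMem_support_iff.1 hj]; simp
    obtain ⟨f, hf1, hf2⟩ := A.exists_many h hN hκ (fun c => if c = c0 then -((κ * N ^ 2 + 2 : ℕ) : ℤ) else 0) 2 (by
      rw [huniv, Finset.sum_pair hc01, if_pos rfl, if_neg hc01.symm]; push_cast; omega)
    have h1 : ∀ i, OrdGe (A.e c1 (f i)) 0 := fun i => by
      have := hf2 i c1; rwa [if_neg hc01.symm] at this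
    by_contra hc
    have h2 : ∀ i, OrdGe (A.e c0 (f i)) 0 := by
      intro i
      by_cases h0 : A.e c0 (f i) = 0
      · rw [h0]; exact ordGe_zero _
      rw [ordGe_iff h0]
      by_contra hneg
      refine hc ⟨(-(A.e c0 (f i)).order).toNat, by omega, f i, h1 i, ?_⟩
      have h3 : -(((-(A.e c0 (f i)).order).toNat : ℕ) : ℤ) = (A.e c0 (f i)).order := by omega
      rw [h3]
      exact ⟨(ordGe_iff h0).2 le_rfl, mt HahnSeries.coeff_order_eq_zero.1 h0⟩
    have h3 := fun i => hconst _ (h2 i) (h1 i)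
    set g := fun i => (A.e c0 (f i)).coeff 0
    have h5 : ∀ i, g i ≠ 0 := by
      intro i h0
      have h6 := h3 i
      change p ∣ f i - C (g i) at h6
      rw [h0, C_0, sub_zero] at h6
      have := congrFun (hf1 (Pi.single i 1) (by
        refine Finset.dvd_sum fun j _ => ?_
        rcases eq_or_ne j i with rfl | hj
        · exact h6.mul_left _
        · rw [Pi.single_eq_of_ne hj, C_0, zero_mul]; exact dvd_zero _)) i
      simp at this
    have h4 := hf1 ![g 1, -g 0] (by
      rw [Fin.sum_univ_two]
      have h6 := ((h3 0).mul_left (C (g 1))).sub ((h3 1).mul_left (C (g 0)))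
      refine h6.trans (dvd_of_eq ?_)
      simp only [Matrix.cons_val_zero, Matrix.cons_val_one, map_neg, g]
      ring)
    exact h5 1 (congrFun h4 0)
  obtain ⟨hj0, φ, hφ1, hφ0, hφc⟩ := Nat.find_spec hgood
  have hmin : ∀ m, 0 < m → m < Nat.find hgood → ∀ φ, OrdGe (A.e c1 φ) 0 → OrdGe (A.e c0 φ) (-(m : ℤ)) →
      (A.e c0 φ).coeff (-(m : ℤ)) = 0 := by
    intro m hm0 hm φ h1 h2
    by_contra h3
    exact Nat.find_min hgood hm ⟨hm0, φ, h1, h2, h3⟩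
  set n := Nat.find hgood
  have hmin' : ∀ φ, OrdGe (A.e c1 φ) 0 → OrdGe (A.e c0 φ) (-(n : ℤ) + 1) → OrdGe (A.e c0 φ) 0 := by
    intro φ h1 h2
    by_cases h0 : A.e c0 φ = 0
    · rw [h0]; exact ordGe_zero _
    rw [ordGe_iff h0] at h2 ⊢
    by_contra hneg
    have h3 : -(((-(A.e c0 φ).order).toNat : ℕ) : ℤ) = (A.e c0 φ).order := by omega
    refine mt HahnSeries.coeff_order_eq_zero.1 h0 ?_
    rw [← h3]
    refine hmin _ (by omega) (by omega) φ h1 ?_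
    rw [h3]; exact (ordGe_iff h0).2 le_rfl
  set lam : k := μ0 * (-(n : ℤ) : ℤ) with hlam
  have hlam0 : lam ≠ 0 := mul_ne_zero hμ0 (by exact_mod_cast (by omega : -(n : ℤ) ≠ 0))
  have hCe : ∀ c (a : k) φ o, OrdGe (A.e c φ) o → OrdGe (A.e c (C a * φ)) o ∧
      ∀ j, (A.e c (C a * φ)).coeff j = a * (A.e c φ).coeff j := by
    intro c a φ o hφ
    have h1 : ∀ j, (A.e c (C a * φ)).coeff j = a * (A.e c φ).coeff j := by
      intro j
      rw [map_mul, A.e_C, HahnSeries.C_mul_eq_smul, HahnSeries.coeff_smul, smul_eq_mul]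
    exact ⟨fun j hj => by rw [h1, hφ j hj, mul_zero], h1⟩
  obtain ⟨γ, hγ⟩ : ∃ γ, p ∣ q * hamDer p φ - C lam * φ - C γ := by
    have h1 : OrdGe (A.e c1 (q * hamDer p φ - C lam * φ)) 0 := by
      rw [map_sub]; exact (hδ1 φ 0 hφ1).1.sub (hCe c1 lam φ 0 hφ1).1
    refine ⟨_, hconst _ (hmin' _ h1 fun j hj => ?_) h1⟩
    rw [map_sub, HahnSeries.coeff_sub, (hCe c0 lam φ _ hφ0).2]
    rcases (show j ≤ -(n : ℤ) by omega).lt_or_eq with h2 | rfl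
    · rw [(hδ0 φ _ hφ0).1 j h2, hφ0 j h2, mul_zero, sub_zero]
    · rw [(hδ0 φ _ hφ0).2, hlam, sub_self]
  set ψ := φ + C (γ / lam) with hψ
  have hDψ : p ∣ q * hamDer p ψ - C lam * ψ := by
    refine hγ.trans (dvd_of_eq ?_)
    have : hamDer p (C (γ / lam)) = 0 := by rw [← algebraMap_eq]; exact Derivation.map_algebraMap _ _
    rw [hψ, map_add, this, add_zero, mul_add, ← C_mul, mul_div_cancel₀ _ hlam0]
    ring
  have hψ0 : OrdGe (A.e c0 ψ) (-(n : ℤ)) := by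
    rw [hψ, map_add, A.e_C]; exact hφ0.add ((ordGe_C _).mono (by omega))
  have hψ0c : (A.e c0 ψ).coeff (-(n : ℤ)) ≠ 0 := by
    rw [hψ, map_add, A.e_C, HahnSeries.coeff_add, ordGe_C _ _ (by omega), add_zero]; exact hφc
  -- an eigenfunction of weight zero
  set e := b.toNat with he
  have hb : (e : ℤ) = b := Int.toNat_of_nonneg hc0.le
  set Ψ := ψ ^ e * q ^ n with hΨ
  have hΨ0 : OrdGe (A.e c0 Ψ) 0 := by
    rw [hΨ, map_mul, map_pow, map_pow]
    refine ((hψ0.pow e).mul (hq0.pow n)).mono (le_of_eq ?_)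
    rw [hb]; ring
  have hpowc : ∀ (f : LaurentSeries k) (o : ℤ) (m : ℕ), OrdGe f o → (f ^ m).coeff (m * o) = f.coeff o ^ m := by
    intro f o m hf
    have := (OrdGe.prod (Finset.range m) (f := fun _ => f) (a := fun _ => o) fun _ _ => hf).2
    simpa using this
  have hΨc : (A.e c0 Ψ).coeff 0 ≠ 0 := by
    have h1 := (hψ0.pow e).coeff_mul (hq0.pow n)
    have h2 : (e : ℤ) * -(n : ℤ) + n * b = 0 := by rw [hb]; ring
    rw [h2, hpowc _ _ _ hψ0, hpowc _ _ _ hq0] at h1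
    rw [hΨ, map_mul, map_pow, map_pow, h1]
    exact mul_ne_zero (pow_ne_zero _ hψ0c) (pow_ne_zero _ hq0c)
  have hDq : hamDer p q = 1 := by
    rw [hq, map_sub, hJ, ← algebraMap_eq, Derivation.map_algebraMap, sub_zero]
  have hΨD : p ∣ q * hamDer p Ψ - C (e * lam + n) * Ψ := by
    obtain ⟨w, hw⟩ := hDψ
    have hw' : q * hamDer p ψ = C lam * ψ + p * w := by rw [← hw]; ring
    have he1 : e = (e - 1) + 1 := by omega
    have hn1 : n = (n - 1) + 1 := by omega
    refine ⟨(e : MvPolynomial (Fin 2) k) * ψ ^ (e - 1) * q ^ n * w, ?_⟩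
    rw [hΨ, Derivation.leibniz, Derivation.leibniz_pow, Derivation.leibniz_pow, hDq]
    simp only [smul_eq_mul, nsmul_eq_mul, map_add, map_mul, map_natCast, mul_one]
    have h3 : ψ ^ e = ψ ^ (e - 1) * ψ := by rw [← pow_succ, ← he1]
    have h4 : q ^ n = q ^ (n - 1) * q := by rw [← pow_succ, ← hn1]
    rw [h3, h4]
    linear_combination ((e : MvPolynomial (Fin 2) k) * ψ ^ (e - 1) * (q ^ (n - 1) * q)) * hw'
  have hcoef : ∀ c j, (A.e c (q * hamDer p Ψ)).coeff j = (e * lam + n) * (A.e c Ψ).coeff j := by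
    intro c j
    have := (A.ker c _).2 hΨD
    rw [map_sub, sub_eq_zero] at this
    rw [this, map_mul, A.e_C, HahnSeries.C_mul_eq_smul, HahnSeries.coeff_smul, smul_eq_mul]
  have hzero : (e : k) * lam + n = 0 := by
    have h1 := (hδ0 Ψ 0 hΨ0).2
    rw [hcoef, Int.cast_zero, mul_zero, zero_mul] at h1
    exact (mul_eq_zero.1 h1).resolve_right hΨc
  have hΨ1 : OrdGe (A.e c1 Ψ) 0 := by
    by_cases h0 : A.e c1 Ψ = 0
    · rw [h0]; exact ordGe_zero _
    rw [ordGe_iff h0]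
    have h1 := (hδ1 Ψ _ ((ordGe_iff h0).2 le_rfl)).2
    rw [hcoef, hzero, zero_mul] at h1
    have h2 := (mul_eq_zero.1 h1.symm).resolve_right (mt HahnSeries.coeff_order_eq_zero.1 h0)
    have h3 := (mul_eq_zero.1 h2).resolve_left hμ1
    exact (Int.cast_eq_zero.1 h3).ge
  have hfin := hconst Ψ hΨ0 hΨ1
  set s := (A.e c0 Ψ).coeff 0
  refine ⟨β, C s⁻¹ * (ψ ^ e * q ^ (n - 1)), ?_⟩
  refine (hfin.mul_left (C s⁻¹)).trans (dvd_of_eq ?_)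
  have h4 : q ^ n = q ^ (n - 1) * q := by rw [← pow_succ]; congr 1; omega
  rw [mul_sub, ← C_mul, inv_mul_cancel₀ hΨc, C_1, hΨ, h4]
  ring

end Cusps
end

section
open Polynomial

section Index

open Filter MeasureTheory Set Real in
lemma mahlerMeasure_le_of_circle (p : ℂ[X]) (B : ℝ) (hB : 0 < B)
    (h : ∀ z : ℂ, ‖z‖ = 1 → ‖p.eval z‖ ≤ B) : p.mahlerMeasure ≤ B := by
  by_cases hp : p = 0
  · simp [hp, hB.le]
  rw [show B = rexp (circleAverage (fun _ ↦ log B) 0 1)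
    by simp [circleAverage_def, mul_assoc, exp_log hB], mahlerMeasure_def_of_ne_zero hp,
    circleAverage_def, smul_eq_mul]
  gcongr
  apply intervalIntegral.integral_mono_ae_restrict (by positivity)
    p.intervalIntegrable_mahlerMeasure (by simp)
  rw [EventuallyLE, eventually_iff_exists_mem]
  use {x : ℝ | eval (circleMap 0 1 x) p ≠ 0}
  constructor
  · rw [mem_ae_iff, compl_def, Measure.restrict_apply' (by simp)]
    apply (Finite.of_sdiff _ <| finite_singleton (2 * π)).measure_zero
    simp only [ne_eq, mem_ofPred_eq, Decidable.not_not, inter_sdiff_assoc, Icc_sdiff_right]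
    rw [ofPred_inter_eq_sep]
    apply Finite.of_finite_image (f := circleMap 0 1) ((Multiset.finite_toSet p.roots).subset _)
      <| fun _ h _ k l ↦ injOn_circleMap_of_abs_sub_le' one_ne_zero (by linarith) h.1 k.1 l
    simp [hp]
  · intro x _
    gcongr
    exact h _ (by simp)

variable {F : Type*} [Field F]

lemma det_iterate_derivative_ne_zero [CharZero F] {L : ℕ} (g : Fin L → F[X])
    (hg : LinearIndependent F g) :
    (Matrix.of fun i a : Fin L => (derivative^[a] (g i))).det ≠ 0 := by
  rcases Nat.eq_zero_or_pos L with rfl | hL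
  · simp
  set ψ : F[X] →+* LaurentSeries F :=
    (HahnSeries.ofPowerSeries ℤ F).comp (Polynomial.coeToPowerSeries.ringHom) with hψ
  have hψ' : ∀ f, ψ f = HahnSeries.ofPowerSeries ℤ F (f : PowerSeries F) := fun f => rfl
  have hcoeff : ∀ (f : F[X]) (n : ℕ), (ψ f).coeff n = f.coeff n := by
    intro f n
    rw [hψ']
    simp
  have hneg : ∀ (f : F[X]) (j : ℤ), j < 0 → (ψ f).coeff j = 0 := by
    intro f j hj
    rw [hψ', HahnSeries.ofPowerSeries_apply]
    apply HahnSeries.embDomain_notin_range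
    rintro ⟨n, hn⟩
    simp at hn
    omega
  have hinj : ∀ f, ψ f = 0 → f = 0 := by
    intro f hf
    ext n
    rw [← hcoeff, hf]; simp
  have hC : ∀ c : F, ψ (C c) = HahnSeries.C c := by
    intro c
    rw [hψ']
    simp
  have hder : ∀ (f : F[X]) (j : ℤ), (ψ (derivative f)).coeff (j - 1) = j * (ψ f).coeff j := by
    intro f j
    rcases lt_trichotomy j 0 with hj | rfl | hj
    · rw [hneg _ _ (by omega), hneg _ _ hj, mul_zero]
    · rw [hneg _ _ (by omega)]; simp
    · obtain ⟨n, rfl⟩ : ∃ n : ℕ, j = n + 1 := ⟨(j - 1).toNat, by omega⟩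
      rw [add_sub_cancel_right, hcoeff, coeff_derivative]
      have : ((n : ℤ) + 1) = ((n + 1 : ℕ) : ℤ) := by push_cast; ring
      rw [this, hcoeff]; push_cast; ring
  intro h0
  have key := (wronskian_order (k := F) (ψ.mapMatrix (Matrix.of fun i a : Fin L => (derivative^[a] (g i)))) hL
    (fun s a => ψ (derivative^[a] (∑ i, C (s i) * g i))) ?_ ?_ 1 one_ne_zero 1 ?_ 0 ?_).1
  · apply key
    rw [← RingHom.map_det, h0, map_zero]
  · intro s a
    rw [iterate_derivative_sum, map_sum]
    refine Finset.sum_congr rfl fun i _ => ?_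
    rw [iterate_derivative_C_mul, map_mul, hC]
    rfl
  · intro s hs
    have := hinj _ hs
    simp only [Function.iterate_zero, id] at this
    funext i
    exact Fintype.linearIndependent_iff.1 hg s (by simpa [smul_eq_C_mul] using this) i
  · intro s a j hj
    simp only [Function.iterate_succ_apply']
    refine ⟨fun i hi => ?_, by rw [hder]; ring⟩
    have := hder (derivative^[a] (∑ i, C (s i) * g i)) (i + 1)
    rw [add_sub_cancel_right] at this
    rw [this, hj _ (by omega), mul_zero]
  · intro s i hi
    exact hneg _ _ hi

lemma pow_dvd_det_iterate_derivative {L : ℕ} (g : Fin L → F[X]) (c : Fin L → F)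
    (hc : c ≠ 0) (q : F) (m : ℕ) (h : (X - C q) ^ m ∣ ∑ i, C (c i) * g i) :
    (X - C q) ^ (m + 1 - L) ∣ (Matrix.of fun i a : Fin L => (derivative^[a] (g i))).det := by
  classical
  obtain ⟨i0, hi0⟩ := Function.ne_iff.1 hc
  set M := (Matrix.of fun i a : Fin L => (derivative^[a] (g i))) with hM
  have h1 : (M.updateRow i0 (∑ k, C (c k) • M k)).det = C (c i0) * M.det := by
    rw [Matrix.det_updateRow_sum]
    rfl
  have h2 : (X - C q) ^ (m + 1 - L) ∣ C (c i0) * M.det := by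
    rw [← h1, Matrix.det_apply]
    refine Finset.dvd_sum fun σ _ => ?_
    rw [Units.smul_def, zsmul_eq_mul]
    refine Dvd.dvd.mul_left ?_ _
    refine Dvd.dvd.trans ?_ (Finset.dvd_prod_of_mem _ (Finset.mem_univ (σ⁻¹ i0)))
    rw [show σ (σ⁻¹ i0) = i0 by simp, Matrix.updateRow_self]
    have h3 : (∑ k, C (c k) • M k) (σ⁻¹ i0) = derivative^[(σ⁻¹ i0 : Fin L)] (∑ k, C (c k) * g k) := by
      rw [iterate_derivative_sum, Finset.sum_apply]
      refine Finset.sum_congr rfl fun i _ => ?_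
      rw [iterate_derivative_C_mul]
      rfl
    rw [h3]
    refine Dvd.dvd.trans (pow_dvd_pow _ ?_) (pow_sub_dvd_iterate_derivative_of_pow_dvd _ h)
    have := (σ⁻¹ i0).2
    omega
  have hu : IsUnit (C (c i0)) := isUnit_C.2 (isUnit_iff_ne_zero.2 hi0)
  exact (IsUnit.dvd_mul_left hu).1 h2

lemma norm_eval_iterate_derivative_le (f : ℂ[X]) (d a L : ℕ) (ha : a ≤ L) (hd : f.natDegree ≤ d) (A : ℝ)
    (hA : ∀ i, ‖f.coeff i‖ ≤ A) (z : ℂ) (hz : ‖z‖ = 1) :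
    ‖(derivative^[a] f).eval z‖ ≤ (d + 1) ^ (L + 1) * A := by
  have hA0 : 0 ≤ A := (norm_nonneg _).trans (hA 0)
  have hd' : (derivative^[a] f).natDegree < d + 1 := by
    have := natDegree_iterate_derivative f a
    omega
  rw [eval_eq_sum_range' hd']
  have h1 : ∀ i ∈ Finset.range (d + 1), ‖(derivative^[a] f).coeff i * z ^ i‖ ≤ (d + 1) ^ L * A := by
    intro i _
    rw [norm_mul, norm_pow, hz, one_pow, mul_one, coeff_iterate_derivative, nsmul_eq_mul, norm_mul]
    by_cases hia : i + a ≤ d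
    · refine mul_le_mul ?_ (hA _) (norm_nonneg _) (by positivity)
      rw [Complex.norm_natCast]
      have h2 : (i + a).descFactorial a ≤ (d + 1) ^ L :=
        (Nat.descFactorial_le_pow _ _).trans ((Nat.pow_le_pow_left (by omega) _).trans
          (Nat.pow_le_pow_right (by omega) ha))
      exact_mod_cast h2
    · rw [coeff_eq_zero_of_natDegree_lt (by omega), norm_zero, mul_zero]
      positivity
  refine (norm_sum_le_of_le _ h1).trans ?_
  rw [Finset.sum_const, Finset.card_range, nsmul_eq_mul]
  push_cast
  rw [pow_succ]
  exact le_of_eq (by ring)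

open NumberField Real in
lemma sum_log_embeddings_nonneg {F : Type*} [Field F] [NumberField F] (a : 𝓞 F) (ha : a ≠ 0) :
    0 ≤ ∑ w : F →+* ℂ, log ‖w (a : F)‖ := by
  have ha' : (a : F) ≠ 0 := fun h => ha (RingOfIntegers.coe_injective (by rw [map_zero]; exact h))
  rw [← log_prod (fun w _ => by rw [norm_ne_zero_iff]; exact (_root_.map_ne_zero w).2 ha'), ← norm_prod]
  apply log_nonneg
  have h1 := Algebra.norm_eq_prod_embeddings ℚ ℂ (a : F)
  have h2 : ∏ w : F →+* ℂ, w (a : F) = ∏ w : F →ₐ[ℚ] ℂ, w (a : F) :=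
    Fintype.prod_equiv (RingHom.equivRatAlgHom F ℂ) _ _ fun w => rfl
  rw [h2, ← h1, ← Algebra.coe_norm_int]
  have h3 : Algebra.norm ℤ a ≠ 0 := Algebra.norm_ne_zero_iff.2 ha
  simp only [map_intCast, Complex.norm_intCast]
  exact_mod_cast Int.one_le_abs h3

open NumberField Real in
theorem index_bound {F : Type*} [Field F] [NumberField F] {Λ : Type*} [Fintype Λ]
    (g : Λ → (𝓞 F)[X]) (d : ℕ) (hd : ∀ l, (g l).natDegree ≤ d) (A : ℝ) (hA1 : 1 ≤ A)
    (hA : ∀ l i (w : F →+* ℂ), ‖w ((g l).coeff i : F)‖ ≤ A) (φ : Λ → 𝓞 F) (q : 𝓞 F) (m : ℕ)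
    (hne : ∑ l, C (φ l) * g l ≠ 0) (hdvd : (X - C q) ^ m ∣ ∑ l, C (φ l) * g l) :
    ((m : ℝ) + 1 - Fintype.card Λ) * ∑ w : F →+* ℂ, log⁺ ‖w q‖ ≤
      Module.finrank ℚ F * (Fintype.card Λ *
        log (Fintype.card Λ * ((d + 1) ^ (Fintype.card Λ + 1) * A))) := by
  classical
  set ν := Fintype.card Λ with hν
  have hΛ : 1 ≤ ν := by
    by_contra hc
    have : IsEmpty Λ := Fintype.card_eq_zero_iff.1 (by omega)
    exact hne (by simp)
  have hν1 : (1 : ℝ) ≤ ν := by exact_mod_cast hΛ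
  set x : ℝ := (d + 1) ^ (ν + 1) * A with hx
  have hx1 : 1 ≤ x := by
    rw [hx]
    exact one_le_mul_of_one_le_of_one_le (one_le_pow₀ (by linarith [Nat.cast_nonneg (α := ℝ) d])) hA1
  have hνx : 1 ≤ ν * x := one_le_mul_of_one_le_of_one_le hν1 hx1
  have hS0 : 0 ≤ ∑ w : F →+* ℂ, log⁺ ‖w q‖ := Finset.sum_nonneg fun w _ => posLog_nonneg
  have hR0 : 0 ≤ Module.finrank ℚ F * (ν * log (ν * x)) := by
    have := log_nonneg hνx
    positivity
  set η := algebraMap (𝓞 F) F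
  have hη : Function.Injective η := RingOfIntegers.coe_injective
  obtain ⟨κ, a, ha, hspan, hind⟩ := exists_linearIndependent' (K := F) (fun l => (g l).map η)
  haveI : Finite κ := Finite.of_injective a ha
  haveI := Fintype.ofFinite κ
  set L := Fintype.card κ with hL
  have hLν : L ≤ ν := Fintype.card_le_of_injective a ha
  let eq : Fin L ≃ κ := (Fintype.equivFin κ).symm
  set b : Fin L → (𝓞 F)[X] := fun i => g (a (eq i)) with hb
  have hind' : LinearIndependent F (fun i => (b i).map η) := hind.comp eq eq.injective
  have hmem : (∑ l, C (φ l) * g l).map η ∈ Submodule.span F (Set.range (fun i => (b i).map η)) := by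
    have : Set.range (fun i => (b i).map η) = Set.range ((fun l => (g l).map η) ∘ a) := by
      ext y; constructor
      · rintro ⟨i, rfl⟩; exact ⟨eq i, rfl⟩
      · rintro ⟨i, rfl⟩; exact ⟨eq.symm i, by simp [hb]⟩
    rw [this, hspan, Polynomial.map_sum]
    refine Submodule.sum_mem _ fun l _ => ?_
    rw [Polynomial.map_mul, map_C, ← smul_eq_C_mul]
    exact Submodule.smul_mem _ _ (Submodule.subset_span ⟨l, rfl⟩)
  obtain ⟨c, hc⟩ := (Submodule.mem_span_range_iff_exists_fun F).1 hmem
  simp only [smul_eq_C_mul] at hc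
  have hF0 : (∑ l, C (φ l) * g l).map η ≠ 0 := (Polynomial.map_ne_zero_iff hη).2 hne
  have hc0 : c ≠ 0 := by
    rintro rfl
    apply hF0
    rw [← hc]; simp
  set WO := (Matrix.of fun i a : Fin L => (derivative^[a] (b i))).det with hWO
  have hWmap : WO.map η = (Matrix.of fun i a : Fin L => (derivative^[a] ((b i).map η))).det := by
    rw [hWO, ← coe_mapRingHom, RingHom.map_det]
    congr 1
    ext1 i j
    simp [iterate_derivative_map]
  have hW0 : WO.map η ≠ 0 := by
    rw [hWmap]; exact det_iterate_derivative_ne_zero _ hind'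
  have hWO0 : WO ≠ 0 := fun h => hW0 (by rw [h]; simp)
  obtain ⟨H, hH⟩ : (X - C (q : F)) ^ (m + 1 - L) ∣ WO.map η := by
    rw [hWmap]
    refine pow_dvd_det_iterate_derivative _ c hc0 _ m ?_
    rw [hc]
    simpa using Polynomial.map_dvd η hdvd
  rcases Nat.lt_or_ge (m + 1) ν with hm | hm
  · refine le_trans ?_ hR0
    refine mul_nonpos_of_nonpos_of_nonneg ?_ hS0
    have : ((m + 1 : ℕ) : ℝ) ≤ ν := by exact_mod_cast hm.le
    push_cast at this
    linarith
  -- estimates at each place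
  have hlc : WO.leadingCoeff ≠ 0 := leadingCoeff_ne_zero.2 hWO0
  have hHlc : H.leadingCoeff = (WO.leadingCoeff : F) := by
    have := congrArg leadingCoeff hH
    rw [leadingCoeff_mul, ((monic_X_sub_C _).pow _).leadingCoeff, one_mul,
      leadingCoeff_map_of_injective hη] at this
    exact this.symm
  have hplace : ∀ w : F →+* ℂ, ((m : ℝ) + 1 - ν) * log⁺ ‖w q‖ + log ‖w (WO.leadingCoeff : F)‖ ≤
      ν * log (ν * x) := by
    intro w
    have h1 : (WO.map η).map w = (X - C (w q)) ^ (m + 1 - L) * H.map w := by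
      rw [hH]; simp
    have hHlc' : ‖w (WO.leadingCoeff : F)‖ ≤ (H.map w).mahlerMeasure := by
      rw [← hHlc, ← leadingCoeff_map w]
      exact leadingCoeff_le_mahlerMeasure _
    have hw0 : 0 < ‖w (WO.leadingCoeff : F)‖ := by
      rw [norm_pos_iff, _root_.map_ne_zero]
      exact fun h => hlc (hη (by rw [map_zero]; exact h))
    have h2 : ((WO.map η).map w).mahlerMeasure ≤ (ν * x) ^ ν := by
      refine mahlerMeasure_le_of_circle _ _ (by positivity) fun z hz => ?_
      have h3 : eval z ((WO.map η).map w) =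
          (Matrix.of fun i a : Fin L => eval z (derivative^[a] (((b i).map η).map w))).det := by
        rw [hWmap]
        have := RingHom.map_det ((evalRingHom z).comp (mapRingHom w))
          (Matrix.of fun i a : Fin L => (derivative^[a] ((b i).map η)))
        simp only [RingHom.comp_apply, coe_mapRingHom, coe_evalRingHom] at this
        rw [this]
        congr 1
        ext1 i j
        simp [iterate_derivative_map]
      rw [h3]
      have h4 := Matrix.det_le (abv := NormedField.toAbsoluteValue ℂ) (x := x)
        (A := Matrix.of fun i a : Fin L => eval z (derivative^[a] (((b i).map η).map w))) ?_
      · refine h4.trans ?_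
        rw [nsmul_eq_mul, Fintype.card_fin, mul_pow (ν : ℝ) x]
        have h5 : (L.factorial : ℝ) ≤ (ν : ℝ) ^ ν := by
          have h6 : L.factorial ≤ ν ^ ν := (Nat.factorial_le hLν).trans (Nat.factorial_le_pow _)
          exact_mod_cast h6
        exact mul_le_mul h5 (pow_le_pow_right₀ hx1 hLν) (by positivity) (by positivity)
      · intro i j
        refine norm_eval_iterate_derivative_le _ d _ ν (j.2.le.trans hLν) ?_ A ?_ z hz
        · exact (natDegree_map_le.trans natDegree_map_le).trans (hd _)
        · intro n
          rw [coeff_map, coeff_map]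
          exact hA _ _ w
    rw [h1, mahlerMeasure_mul] at h2
    have h7 : ((X - C (w q)) ^ (m + 1 - L)).mahlerMeasure = (max 1 ‖w q‖) ^ (m + 1 - L) := by
      have : ∀ n : ℕ, ((X - C (w q)) ^ n).mahlerMeasure = (max 1 ‖w q‖) ^ n := by
        intro n
        induction n with
        | zero => simp
        | succ n ih => rw [pow_succ, mahlerMeasure_mul, ih, mahlerMeasure_X_sub_C, pow_succ]
      exact this _
    rw [h7] at h2
    have h8 : (max 1 ‖w q‖) ^ (m + 1 - ν) * ‖w (WO.leadingCoeff : F)‖ ≤ (ν * x) ^ ν := by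
      refine le_trans ?_ h2
      gcongr
      exact le_max_left _ _
    have h9 := log_le_log (by positivity) h8
    rw [log_mul (by positivity) hw0.ne', log_pow, log_pow] at h9
    have h10 : log (max 1 ‖w q‖) = log⁺ ‖w q‖ := by
      rw [posLog_eq_log_max_one (norm_nonneg _)]
    rw [h10, Nat.cast_sub hm] at h9
    push_cast at h9
    exact h9
  have hsum := Finset.sum_le_sum fun w (_ : w ∈ Finset.univ) => hplace w
  rw [Finset.sum_add_distrib, ← Finset.mul_sum, Finset.sum_const, Finset.card_univ, Embeddings.card,
    nsmul_eq_mul] at hsum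
  have hnorm : 0 ≤ ∑ w : F →+* ℂ, log ‖w (WO.leadingCoeff : F)‖ := by
    exact sum_log_embeddings_nonneg _ hlc
  linarith

end Index
end

section
open Polynomial NumberField

section SiegelStep

/-- The expansion of a polynomial of degree at most `d` at a point of the projective line. -/
noncomputable def jet {F : Type*} [Field F] (β : Option F) (d : ℕ) : F[X] →ₗ[F] F[X] :=
  match β with
  | some b => taylor b
  | none =>
    { toFun := reflect d
      map_add' := fun f g => reflect_add f g d
      map_smul' := fun c f => by simp [smul_eq_C_mul, reflect_C_mul] }

lemma jet_some {F : Type*} [Field F] (b : F) (d : ℕ) (f : F[X]) : jet (some b) d f = taylor b f := rfl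

lemma jet_none {F : Type*} [Field F] (d : ℕ) (f : F[X]) : jet none d f = reflect d f := rfl

lemma jet_X_pow_coeff {F : Type*} [Field F] (β : Option F) (d b k : ℕ) :
    (jet β d (X ^ b)).coeff k = β.elim (if k = revAt d b then 1 else 0)
      (fun x => x ^ (b - k) * b.choose k) := by
  rcases β with _ | x
  · rw [jet_none, ← mul_one (X ^ b), ← C_1, mul_comm, reflect_C_mul_X_pow, C_1, one_mul, coeff_X_pow]
    rfl
  · rw [jet_some, taylor_X_pow, coeff_X_add_C_pow]
    rfl

variable {F : Type*} [Field F] [NumberField F]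

lemma house_one_le_one : house (1 : F) ≤ 1 := by
  simpa using (house_intCast (K := F) 1).le

lemma exists_common_denominator {I : Type*} [Finite I] (x : I → F) :
    ∃ D : ℕ, 0 < D ∧ ∀ i, IsIntegral ℤ ((D : F) * x i) := by
  classical
  cases nonempty_fintype I
  haveI : Algebra.IsAlgebraic ℤ F := (IsFractionRing.comap_isAlgebraic_iff (A := ℤ) (K := ℚ) (C := F)).2 inferInstance
  obtain ⟨y, hy, hyx⟩ := Algebra.IsAlgebraic.exists_integral_multiples ℤ (Finset.univ.image x)
  refine ⟨y.natAbs, Int.natAbs_pos.2 hy, fun i => ?_⟩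
  have h1 := hyx (x i) (Finset.mem_image_of_mem _ (Finset.mem_univ _))
  rw [zsmul_eq_mul] at h1
  rcases Int.natAbs_eq y with h | h
  · rw [h, Int.cast_natCast] at h1; exact h1
  · rw [h] at h1
    push_cast at h1
    rw [neg_mul] at h1
    simpa using h1.neg

lemma house_natCast_le (n : ℕ) : house (n : F) ≤ n := by
  simpa using (house_intCast (K := F) n).le

/-- An underdetermined system with algebraic integer coefficients has a small solution. -/
lemma exists_small_solution : ∃ c : ℝ, 1 ≤ c ∧ ∀ {α β : Type} [Fintype α] [Fintype β]
    (a : Matrix α β (𝓞 F)) (_ : 0 < Fintype.card α) (_ : Fintype.card α < Fintype.card β)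
    (A : ℝ) (_ : 1 ≤ A) (_ : ∀ k l, house (a k l : F) ≤ A) (s : ℕ)
    (_ : Fintype.card α ≤ s * (Fintype.card β - Fintype.card α)),
    ∃ ξ : β → 𝓞 F, ξ ≠ 0 ∧ a.mulVec ξ = 0 ∧ ∀ l, house (ξ l : F) ≤ c * (c * Fintype.card β * A) ^ s := by
  classical
  obtain ⟨c, hc⟩ : ∃ c : ℝ, ∀ {α β : Type} (a : Matrix α β (𝓞 F)) (ha : a ≠ 0) (p q : ℕ)
      (h0p : 0 < p) (hpq : p < q) [Fintype β] (cardβ : Fintype.card β = q) (A : ℝ)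
      (habs : ∀ k l, house (algebraMap (𝓞 F) F (a k l)) ≤ A) [Fintype α] (cα : Fintype.card α = p),
      ∃ (ξ : β → 𝓞 F), ξ ≠ 0 ∧ a.mulVec ξ = 0 ∧
        ∀ l, house (ξ l : F) ≤ c * ((c * q * A) ^ ((p : ℝ) / (q - p))) := by
    exact ⟨_, fun {α β} a ha p q h0p hpq _ cb A hA _ ca =>
      NumberField.house.exists_ne_zero_int_vec_house_le F a ha h0p hpq cb hA ca⟩
  refine ⟨max 1 |c|, le_max_left _ _, ?_⟩
  intro α β _ _ a h0 hlt A hA1 hA s hs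
  have hβ : 0 < Fintype.card β := by omega
  set C := max 1 |c| with hC
  have hC1 : 1 ≤ C := le_max_left _ _
  have hβ1 : (1 : ℝ) ≤ Fintype.card β := by exact_mod_cast hβ
  have hx1 : 1 ≤ C * Fintype.card β * A :=
    one_le_mul_of_one_le_of_one_le (one_le_mul_of_one_le_of_one_le hC1 hβ1) hA1
  by_cases ha : a = 0
  · refine ⟨fun _ => 1, ?_, by rw [ha, Matrix.zero_mulVec], fun l => ?_⟩
    · obtain ⟨b⟩ := Fintype.card_pos_iff.1 hβ
      exact fun h => one_ne_zero (congrFun h b)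
    · have h1 : house (((1 : 𝓞 F) : 𝓞 F) : F) ≤ 1 := by simpa using house_one_le_one (F := F)
      exact h1.trans (one_le_mul_of_one_le_of_one_le hC1 (one_le_pow₀ hx1))
  · obtain ⟨ξ, h1, h2, h3⟩ := hc a ha _ _ h0 hlt rfl A hA rfl
    refine ⟨ξ, h1, h2, fun l => (h3 l).trans ?_⟩
    have hsub : (0 : ℝ) < (Fintype.card β : ℝ) - Fintype.card α := by
      rw [sub_pos]; exact_mod_cast hlt
    have hexp : (Fintype.card α : ℝ) / (Fintype.card β - Fintype.card α) ≤ s := by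
      rw [div_le_iff₀ hsub, ← Nat.cast_sub hlt.le]
      exact_mod_cast hs
    have hexp0 : 0 ≤ (Fintype.card α : ℝ) / (Fintype.card β - Fintype.card α) := by positivity
    have h4 : |(c * Fintype.card β * A) ^ ((Fintype.card α : ℝ) / (Fintype.card β - Fintype.card α))| ≤
        (C * Fintype.card β * A) ^ s := by
      refine (Real.abs_rpow_le_abs_rpow _ _).trans ?_
      rw [abs_mul, abs_mul, abs_of_pos (lt_of_lt_of_le one_pos hβ1), abs_of_pos (lt_of_lt_of_le one_pos hA1)]
      calc (|c| * Fintype.card β * A) ^ ((Fintype.card α : ℝ) / (Fintype.card β - Fintype.card α))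
          ≤ (C * Fintype.card β * A) ^ ((Fintype.card α : ℝ) / (Fintype.card β - Fintype.card α)) := by
            apply Real.rpow_le_rpow (by positivity) _ hexp0
            gcongr
            exact le_max_right _ _
        _ ≤ (C * Fintype.card β * A) ^ (s : ℝ) := Real.rpow_le_rpow_of_exponent_le hx1 hexp
        _ = _ := Real.rpow_natCast _ _
    refine (le_abs_self _).trans ?_
    rw [abs_mul]
    exact mul_le_mul (le_max_right _ _) h4 (abs_nonneg _) (by positivity)

lemma jet_X_pow_integral (β : Option F) (D : ℕ) (hD : IsIntegral ℤ ((D : F) * β.getD 0)) (E : ℝ)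
    (hE1 : 1 ≤ E) (hE : house (β.getD 0) ≤ E) (d b k : ℕ) (hb : b ≤ d) :
    IsIntegral ℤ ((D : F) ^ d * (jet β d (X ^ b)).coeff k) ∧
      house ((jet β d (X ^ b)).coeff k) ≤ (2 * E) ^ d := by
  have h2E : (1 : ℝ) ≤ (2 * E) ^ d := one_le_pow₀ (by linarith)
  have hnat : ∀ n : ℕ, IsIntegral ℤ (n : F) := fun n => by
    simpa using (isIntegral_algebraMap (R := ℤ) (A := F) (x := (n : ℤ)))
  rw [jet_X_pow_coeff]
  rcases β with _ | x
  · simp only [Option.elim_none]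
    split_ifs
    · exact ⟨by rw [mul_one]; exact (hnat D).pow d, house_one_le_one.trans h2E⟩
    · refine ⟨by rw [mul_zero]; exact isIntegral_zero, (le_of_eq ?_).trans (zero_le_one.trans h2E)⟩
      simpa using house_intCast (K := F) 0
  · simp only [Option.elim_some, Option.getD_some] at hD hE ⊢
    constructor
    · have : (D : F) ^ d * (x ^ (b - k) * (b.choose k : F)) =
          (D : F) ^ (d - (b - k)) * (D * x) ^ (b - k) * b.choose k := by
        rw [mul_pow, ← mul_assoc, ← mul_assoc, ← pow_add, Nat.sub_add_cancel (by omega)]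
      rw [this]
      exact (((hnat D).pow _).mul (hD.pow _)).mul (hnat _)
    · refine (house_mul_le _ _).trans ?_
      rw [mul_comm, mul_pow]
      have h1 : house ((b.choose k : ℕ) : F) ≤ 2 ^ d := by
        refine (house_natCast_le _).trans ?_
        have h2 : b.choose k ≤ 2 ^ d := (Nat.choose_le_two_pow b k).trans (Nat.pow_le_pow_right (by norm_num) hb)
        exact_mod_cast h2
      have h3 : house (x ^ (b - k)) ≤ E ^ d :=
        (house_pow_le _ _).trans ((pow_le_pow_left₀ (house_nonneg _) hE _).trans
          (pow_le_pow_right₀ hE1 (by omega)))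
      exact mul_le_mul h1 h3 (house_nonneg _) (by positivity)

open Finset in
/-- Siegel's lemma for polynomials in one variable with values in functions on a curve: there is a
nonzero family of polynomials whose weighted expansions vanish to high order. -/
theorem exists_auxiliary {ι Λ : Type} [Fintype ι] [Fintype Λ] [Nonempty ι]
    (β : ι → Option F) (e : ι → ℕ) (he : ∀ c, 0 < e c) (a : ι → ℤ) (ε : ι → Λ → ℤ → F)
    (μ Y : ℕ) (hμ : 0 < μ) (hcount : (∑ c, e c) * ∑ u : Fin μ, (μ - u) < Y * Fintype.card Λ) :
    ∃ C : ℝ, 1 ≤ C ∧ ∀ R : ℕ, 0 < R → ∃ g : Λ → (𝓞 F)[X], g ≠ 0 ∧ (∀ l, (g l).natDegree ≤ Y * R) ∧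
      (∀ l i (w : F →+* ℂ), ‖w ((g l).coeff i : F)‖ ≤ C ^ R) ∧
      ∀ c u r k, u < μ → r < e c → k < R * (μ - u) →
        (jet (β c) (Y * R) (∑ l, Polynomial.C (ε c l (a c + e c * u + r)) *
          (g l).map (algebraMap (𝓞 F) F))).coeff k = 0 := by
  classical
  obtain ⟨c₁, hc₁, hsol⟩ := exists_small_solution (F := F)
  obtain ⟨D, hD0, hD⟩ := exists_common_denominator (F := F) (I := ι ⊕ (Σ c : ι, Λ × Fin μ × Fin (e c)))
    (fun i => i.elim (fun c => (β c).getD 0) (fun x => ε x.1 x.2.1 (a x.1 + e x.1 * (x.2.2.1 : ℕ) + (x.2.2.2 : ℕ))))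
  obtain ⟨E, hE1, hE⟩ : ∃ E : ℝ, 1 ≤ E ∧ (∀ c, house ((β c).getD 0) ≤ E) ∧
      ∀ c l (u : Fin μ) (r : Fin (e c)), house (ε c l (a c + e c * (u : ℕ) + (r : ℕ))) ≤ E := by
    obtain ⟨E, hE⟩ := (Set.finite_range (fun i : ι ⊕ (Σ c : ι, Λ × Fin μ × Fin (e c)) => house (i.elim (fun c => (β c).getD 0) (fun x => ε x.1 x.2.1 (a x.1 + e x.1 * (x.2.2.1 : ℕ) + (x.2.2.2 : ℕ)))))).bddAbove
    refine ⟨max 1 E, le_max_left _ _, fun c => ?_, fun c l u r => ?_⟩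
    · exact (hE ⟨Sum.inl c, rfl⟩).trans (le_max_right _ _)
    · exact (hE ⟨Sum.inr ⟨c, l, u, r⟩, rfl⟩).trans (le_max_right _ _)
  set p0 := (∑ c, e c) * ∑ u : Fin μ, (μ - u) with hp0
  have hp0pos : 0 < p0 := by
    refine Nat.mul_pos (Finset.sum_pos (fun c _ => he c) univ_nonempty) ?_
    refine Finset.sum_pos (fun u _ => by have := u.2; omega) ⟨⟨0, hμ⟩, mem_univ _⟩
  set ν := Fintype.card Λ with hν
  have hν0 : 0 < ν := by
    by_contra hc
    rw [Nat.eq_zero_of_not_pos hc, mul_zero] at hcount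
    omega
  have hD1 : (1 : ℝ) ≤ D := by exact_mod_cast hD0
  have hν1 : (1 : ℝ) ≤ ν := by exact_mod_cast hν0
  have hY1 : (1 : ℝ) ≤ Y + 1 := by linarith [Nat.cast_nonneg (α := ℝ) Y]
  have hB1 : (1 : ℝ) ≤ c₁ * (ν * (Y + 1)) * ((D : ℝ) ^ (Y + 1) * (2 * E) ^ Y * E) := by
    refine one_le_mul_of_one_le_of_one_le (one_le_mul_of_one_le_of_one_le hc₁
      (one_le_mul_of_one_le_of_one_le hν1 hY1)) (one_le_mul_of_one_le_of_one_le
      (one_le_mul_of_one_le_of_one_le (one_le_pow₀ hD1) (one_le_pow₀ (by linarith))) hE1)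
  refine ⟨c₁ * (c₁ * (ν * (Y + 1)) * ((D : ℝ) ^ (Y + 1) * (2 * E) ^ Y * E)) ^ p0,
    one_le_mul_of_one_le_of_one_le hc₁ (one_le_pow₀ hB1), fun R hR => ?_⟩
  set d := Y * R with hd
  have hentry : ∀ (x : Σ c : ι, Σ u : Fin μ, Fin (e c) × Fin (R * (μ - u))) (y : Λ × Fin (d + 1)),
      ∃ z : 𝓞 F, (z : F) = (D : F) ^ (d + 1) * ((jet (β x.1) d (X ^ (y.2 : ℕ))).coeff x.2.2.2 *
        ε x.1 y.1 (a x.1 + e x.1 * (x.2.1 : ℕ) + (x.2.2.1 : ℕ))) := by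
    rintro ⟨c, u, r, k⟩ ⟨l, b⟩
    have h1 := (jet_X_pow_integral (β c) D (hD (Sum.inl c)) E hE1 (hE.1 c) d b k (by have := b.2; omega)).1
    have h2 := hD (Sum.inr ⟨c, l, u, r⟩)
    have h3 := h1.mul h2
    refine ⟨⟨_, h3⟩, ?_⟩
    simp only [RingOfIntegers.map_mk, Sum.elim_inr]
    ring
  choose M hM using hentry
  have hcardα : Fintype.card (Σ c : ι, Σ u : Fin μ, Fin (e c) × Fin (R * (μ - u))) = R * p0 := by
    simp only [Fintype.card_sigma, Fintype.card_prod, Fintype.card_fin]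
    rw [hp0, Finset.sum_mul, Finset.mul_sum]
    refine Finset.sum_congr rfl fun c _ => ?_
    rw [Finset.mul_sum, Finset.mul_sum]
    exact Finset.sum_congr rfl fun u _ => by ring
  have hcardβ : Fintype.card (Λ × Fin (d + 1)) = ν * (Y * R + 1) := by
    rw [Fintype.card_prod, Fintype.card_fin]
  have hgap : R * p0 + R ≤ ν * (Y * R + 1) := by
    have : R * (p0 + 1) ≤ R * (Y * ν) := Nat.mul_le_mul_left _ hcount
    nlinarith
  have hAle : ∀ x y, house ((M x y : 𝓞 F) : F) ≤ ((D : ℝ) ^ (Y + 1) * (2 * E) ^ Y * E) ^ R := by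
    rintro ⟨c, u, r, k⟩ ⟨l, b⟩
    rw [hM]
    have h1 := (jet_X_pow_integral (β c) D (hD (Sum.inl c)) E hE1 (hE.1 c) d b k (by have := b.2; omega)).2
    have h2 := hE.2 c l u r
    have h3 : house ((D : F) ^ (d + 1)) ≤ ((D : ℝ) ^ (Y + 1)) ^ R := by
      refine (house_pow_le _ _).trans ((pow_le_pow_left₀ (house_nonneg _) (house_natCast_le D) _).trans ?_)
      rw [← pow_mul]
      exact pow_le_pow_right₀ hD1 (by rw [hd]; nlinarith)
    refine (house_mul_le _ _).trans ?_
    rw [mul_pow, mul_pow, mul_assoc]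
    refine mul_le_mul h3 ((house_mul_le _ _).trans ?_) (house_nonneg _) (by positivity)
    refine mul_le_mul (h1.trans (le_of_eq ?_)) (h2.trans (le_self_pow₀ hE1 hR.ne')) (house_nonneg _) (by positivity)
    rw [← pow_mul]
  obtain ⟨ξ, hξ0, hξ1, hξ2⟩ := hsol M (by rw [hcardα]; positivity) (by rw [hcardα, hcardβ]; omega)
    _ (one_le_pow₀ (one_le_mul_of_one_le_of_one_le
      (one_le_mul_of_one_le_of_one_le (one_le_pow₀ hD1) (one_le_pow₀ (by linarith))) hE1)) hAle p0 (by
        rw [hcardα, hcardβ]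
        have : R ≤ ν * (Y * R + 1) - R * p0 := by omega
        rw [mul_comm R p0]
        exact Nat.mul_le_mul_left _ (by rw [mul_comm p0 R]; exact this))
  set g : Λ → (𝓞 F)[X] := fun l => ∑ b : Fin (d + 1), monomial (b : ℕ) (ξ (l, b)) with hg
  have hcoeff : ∀ l (b : Fin (d + 1)), (g l).coeff b = ξ (l, b) := by
    intro l b
    rw [hg]
    simp only [finset_sum_coeff, coeff_monomial]
    rw [Finset.sum_eq_single b]
    · simp
    · intro b' _ hb'
      rw [if_neg]
      exact fun h => hb' (Fin.ext h)
    · simp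
  have hdeg : ∀ l, (g l).natDegree ≤ d := by
    intro l
    refine natDegree_sum_le_of_forall_le _ _ fun b _ => (natDegree_monomial_le _).trans ?_
    have := b.2; omega
  refine ⟨g, ?_, hdeg, ?_, ?_⟩
  · intro h
    apply hξ0
    funext y
    rw [← hcoeff y.1 y.2, h]
    simp
  · intro l i w
    have hfin : c₁ * (c₁ * ((ν * (Y * R + 1) : ℕ) : ℝ) * ((D : ℝ) ^ (Y + 1) * (2 * E) ^ Y * E) ^ R) ^ p0 ≤
        (c₁ * (c₁ * (ν * (Y + 1)) * ((D : ℝ) ^ (Y + 1) * (2 * E) ^ Y * E)) ^ p0) ^ R := by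
      clear_value p0
      rw [mul_pow c₁, ← pow_mul _ p0 R, mul_comm p0 R, pow_mul]
      have h1 : ((ν * (Y * R + 1) : ℕ) : ℝ) ≤ (ν * (Y + 1)) ^ R := by
        push_cast
        rw [mul_pow]
        have h2 := one_add_mul_le_pow (a := (Y : ℝ)) (by linarith [Nat.cast_nonneg (α := ℝ) Y]) R
        refine mul_le_mul (le_self_pow₀ hν1 hR.ne') (le_trans (le_of_eq (by ring)) (h2.trans (le_of_eq (by ring)))) (by positivity) (by positivity)
      have hc₁R : c₁ ≤ c₁ ^ R := le_self_pow₀ hc₁ hR.ne'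
      apply mul_le_mul hc₁R _ (by positivity) (by positivity)
      apply pow_le_pow_left₀ (by positivity)
      rw [mul_pow (c₁ * _), mul_pow c₁]
      apply mul_le_mul_of_nonneg_right _ (by positivity)
      exact mul_le_mul hc₁R h1 (by positivity) (by positivity)
    refine le_trans ?_ hfin
    by_cases hi : i ≤ d
    · have h1 := hcoeff l ⟨i, by omega⟩
      simp only at h1
      rw [h1]
      refine (norm_embedding_le_house _ _).trans ((hξ2 _).trans (le_of_eq ?_))
      rw [hcardβ]
    · rw [coeff_eq_zero_of_natDegree_lt ((hdeg l).trans_lt (by omega)),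
        show ((0 : 𝓞 F) : F) = 0 from map_zero _, _root_.map_zero, norm_zero]
      positivity
  · intro c u r k hu hr hk
    have h1 := congrFun hξ1 ⟨c, ⟨u, hu⟩, ⟨r, hr⟩, ⟨k, hk⟩⟩
    have h2 := congrArg (algebraMap (𝓞 F) F) h1
    simp only [Matrix.mulVec, dotProduct, map_sum, map_mul, Pi.zero_apply, map_zero, hM] at h2
    have hD0' : ((D : F) ^ (d + 1)) ≠ 0 := pow_ne_zero _ (by exact_mod_cast hD0.ne')
    have h3 : (D : F) ^ (d + 1) * (jet (β c) d (∑ l, Polynomial.C (ε c l (a c + e c * u + r)) *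
          (g l).map (algebraMap (𝓞 F) F))).coeff k = 0 := by
      rw [← h2, Fintype.sum_prod_type, map_sum, finset_sum_coeff, Finset.mul_sum]
      refine Finset.sum_congr rfl fun l _ => ?_
      rw [← smul_eq_C_mul, map_smul, coeff_smul, hg]
      simp only [Polynomial.map_sum, map_monomial, map_sum, finset_sum_coeff, smul_eq_mul]
      rw [Finset.mul_sum, Finset.mul_sum]
      refine Finset.sum_congr rfl fun b _ => ?_
      rw [← C_mul_X_pow_eq_monomial, ← smul_eq_C_mul, map_smul, coeff_smul, smul_eq_mul]
      ring
    exact (mul_eq_zero.1 h3).resolve_left hD0'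

end SiegelStep
end

section
open Polynomial NumberField

section JetBounds

lemma norm_eval_hasseDeriv_le (f : ℂ[X]) (d m : ℕ) (x : ℂ) (B : ℝ) (hB : 0 ≤ B) (hd : f.natDegree ≤ d)
    (h : ∀ k ≤ d, m ≤ k → ‖f.coeff k‖ * ‖x‖ ^ (k - m) ≤ B) :
    ‖(hasseDeriv m f).eval x‖ ≤ 4 ^ d * B := by
  rw [hasseDeriv_apply, sum_over_range' _ (by simp) (d + 1) (by omega), eval_finset_sum]
  have h1 : ∀ k ∈ Finset.range (d + 1), ‖(monomial (k - m) ((k.choose m : ℂ) * f.coeff k)).eval x‖ ≤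
      2 ^ d * B := by
    intro k hk
    have hk' : k ≤ d := by simpa [Nat.lt_succ_iff] using hk
    rw [eval_monomial, norm_mul, norm_mul, norm_pow, mul_assoc, Complex.norm_natCast]
    rcases lt_or_ge k m with hkm | hkm
    · rw [Nat.choose_eq_zero_of_lt hkm]; simp; positivity
    · refine mul_le_mul ?_ (h k hk' hkm) (by positivity) (by positivity)
      exact_mod_cast (Nat.choose_le_two_pow k m).trans (Nat.pow_le_pow_right (by norm_num) hk')
  refine (norm_sum_le_of_le _ h1).trans ?_
  rw [Finset.sum_const, Finset.card_range, nsmul_eq_mul, ← mul_assoc]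
  refine mul_le_mul_of_nonneg_right ?_ hB
  have : d + 1 ≤ 2 ^ d := Nat.succ_le_of_lt Nat.lt_two_pow_self
  calc ((d + 1 : ℕ) : ℝ) * 2 ^ d ≤ 2 ^ d * 2 ^ d := by
        gcongr; exact_mod_cast this
    _ = 4 ^ d := by rw [← mul_pow]; norm_num

variable {F : Type*} [Field F]

lemma hasseDeriv_map' {R S : Type*} [CommRing R] [CommRing S] (f : R →+* S) (m : ℕ) (p : R[X]) :
    hasseDeriv m (p.map f) = (hasseDeriv m p).map f := by
  ext k; simp [hasseDeriv_coeff]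

lemma eval_hasseDeriv_map {S : Type*} [Field S] (w : F →+* S) (m : ℕ) (G : F[X]) (x : F) :
    w ((hasseDeriv m G).eval x) = (hasseDeriv m (G.map w)).eval (w x) := by
  rw [hasseDeriv_map', eval_map, eval₂_at_apply]

lemma eval_hasseDeriv_taylor (m : ℕ) (G : F[X]) (b x : F) :
    (hasseDeriv m (taylor b G)).eval (x - b) = (hasseDeriv m G).eval x := by
  rw [← taylor_coeff, ← taylor_coeff, taylor_taylor]
  congr 2; ring

lemma norm_eval_hasseDeriv_le_of_jet (w : F →+* ℂ) (β : Option F) (d n m : ℕ) (G : F[X]) (A E K : ℝ)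
    (hA0 : 0 ≤ A) (hE : 1 ≤ E) (hEb : ‖w (β.getD 0)‖ ≤ E) (hK : 1 ≤ K)
    (hd : G.natDegree ≤ d) (hA : ∀ k, ‖w (G.coeff k)‖ ≤ A)
    (hj : ∀ k < n, (jet β d G).coeff k = 0) (hn : n ≤ d) (x : F) (s : ℝ) (hs0 : 0 < s) (hs1 : s ≤ 1)
    (hx : ‖w x - w (β.getD 0)‖ ≤ K * (if β.isSome then s else s⁻¹)) :
    ‖w ((hasseDeriv m G).eval x)‖ ≤
      (16 * E * K) ^ d * A * s ^ ((n : ℤ) - m - (if β.isSome then 0 else d)) := by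
  rcases β with _ | b
  · simp only [Option.isSome_none, Bool.false_eq_true, if_false, Option.getD_none, map_zero, sub_zero] at *
    rw [eval_hasseDeriv_map]
    refine (norm_eval_hasseDeriv_le (G.map w) d m (w x) (K ^ d * A * s ^ ((n : ℤ) - m - d))
      (by positivity) (natDegree_map_le.trans hd) ?_).trans ?_
    · intro k hk hmk
      rw [coeff_map]
      by_cases hkn : d < k + n
      · have h0 : G.coeff k = 0 := by
          have := hj (d - k) (by omega)
          rwa [jet_none, coeff_reflect, revAt_le (by omega), Nat.sub_sub_self hk] at this
        rw [h0]; simp; positivity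
      · have h1 : ‖w x‖ ^ (k - m) ≤ K ^ d * s ^ ((n : ℤ) - m - d) := by
          calc ‖w x‖ ^ (k - m) ≤ (K * s⁻¹) ^ (k - m) := by gcongr
            _ = K ^ (k - m) * s ^ (-((k - m : ℕ) : ℤ)) := by rw [mul_pow, zpow_neg, zpow_natCast, inv_pow]
            _ ≤ _ := by
              refine mul_le_mul (pow_le_pow_right₀ hK (by omega)) ?_ (by positivity) (by positivity)
              exact zpow_le_zpow_right_of_le_one₀ hs0 hs1 (by omega)
        calc _ ≤ A * (K ^ d * s ^ ((n : ℤ) - m - d)) := mul_le_mul (hA k) h1 (by positivity) hA0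
          _ = _ := by ring
    · have h2 : (4 : ℝ) ^ d * K ^ d ≤ (16 * E * K) ^ d := by
        rw [← mul_pow]
        refine pow_le_pow_left₀ (by positivity) ?_ _
        nlinarith
      calc _ = (4 ^ d * K ^ d) * (A * s ^ ((n : ℤ) - m - d)) := by ring
        _ ≤ (16 * E * K) ^ d * (A * s ^ ((n : ℤ) - m - d)) := by gcongr
        _ = _ := by ring
  · simp only [Option.isSome_some, if_true, Option.getD_some, sub_zero] at *
    rw [← eval_hasseDeriv_taylor m G b, eval_hasseDeriv_map, map_sub]
    refine (norm_eval_hasseDeriv_le ((taylor b G).map w) d m (w x - w b)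
      (K ^ d * (4 ^ d * (A * E ^ d)) * s ^ ((n : ℤ) - m))
      (by positivity) (natDegree_map_le.trans (by rwa [natDegree_taylor])) ?_).trans ?_
    · intro k hk hmk
      rw [coeff_map]
      by_cases hkn : k < n
      · have := hj k hkn
        rw [jet_some] at this
        rw [this]; simp; positivity
      · have h1 : ‖w x - w b‖ ^ (k - m) ≤ K ^ d * s ^ ((n : ℤ) - m) := by
          calc ‖w x - w b‖ ^ (k - m) ≤ (K * s) ^ (k - m) := by gcongr
            _ = K ^ (k - m) * s ^ ((k - m : ℕ) : ℤ) := by rw [mul_pow, zpow_natCast]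
            _ ≤ _ := by
              refine mul_le_mul (pow_le_pow_right₀ hK (by omega)) ?_ (by positivity) (by positivity)
              exact zpow_le_zpow_right_of_le_one₀ hs0 hs1 (by omega)
        have h2 : ‖w ((taylor b G).coeff k)‖ ≤ 4 ^ d * (A * E ^ d) := by
          rw [taylor_coeff, eval_hasseDeriv_map]
          refine norm_eval_hasseDeriv_le _ d k _ _ (by positivity) (natDegree_map_le.trans hd) ?_
          intro i hi hki
          rw [coeff_map]
          refine mul_le_mul (hA i) ?_ (by positivity) hA0
          calc ‖w b‖ ^ (i - k) ≤ E ^ (i - k) := by gcongr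
            _ ≤ E ^ d := pow_le_pow_right₀ hE (by omega)
        calc _ ≤ (4 ^ d * (A * E ^ d)) * (K ^ d * s ^ ((n : ℤ) - m)) :=
              mul_le_mul h2 h1 (by positivity) (by positivity)
          _ = _ := by ring
    · refine le_of_eq ?_
      have : (16 : ℝ) ^ d = 4 ^ d * 4 ^ d := by rw [← mul_pow]; norm_num
      rw [mul_pow, mul_pow, this]; ring

end JetBounds
end

section
open Polynomial NumberField

section PlaceBound

variable {F : Type*} [Field F] {Λ : Type*} [Fintype Λ]

lemma norm_leading_le (w : F →+* ℂ) (β : Option F) (e : ℕ) (he : 0 < e) (a : ℤ) (ε : Λ → ℤ → F)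
    (μ Y R m : ℕ) (hμY : μ ≤ Y) (C E K X t₁ : ℝ) (hC : 1 ≤ C) (hE : 1 ≤ E) (hK : 1 ≤ K)
    (hEb : ‖w (β.getD 0)‖ ≤ E) (hEε : ∀ l, ∀ j ∈ Finset.Ico a (a + e * μ), ‖w (ε l j)‖ ≤ E)
    (ht₁ : 0 < t₁) (ht₁' : t₁ ≤ 1) (z₂ : ℂ) (hz₂ : z₂ ≠ 0) (hz₂' : ‖z₂‖ ≤ 1)
    (x : F) (hx : ‖w x - w (β.getD 0)‖ ≤ K * (if β.isSome then t₁ ^ e else (t₁ ^ e)⁻¹))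
    (φ : Λ → F) (hφ : ∀ l, ‖w (φ l) - ∑ j ∈ Finset.Ico a (a + e * μ), w (ε l j) * z₂ ^ j‖ ≤
      K * ‖z₂‖ ^ (a + e * μ))
    (g : Λ → F[X]) (hd : ∀ l, (g l).natDegree ≤ Y * R) (hg : ∀ l i, ‖w ((g l).coeff i)‖ ≤ C ^ R)
    (hjet : ∀ u r k, u < μ → r < e → k < R * (μ - u) →
      (jet β (Y * R) (∑ l, Polynomial.C (ε l (a + e * u + r)) * g l)).coeff k = 0)
    (hX : ∀ u : ℕ, u ≤ μ → t₁ ^ (e * ((R : ℤ) * (μ - u) - m - (if β.isSome then 0 else Y * R))) *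
      ‖z₂‖ ^ (a + e * u) ≤ X) :
    ‖w (∑ l, (hasseDeriv m (g l)).eval x * φ l)‖ ≤
      (e * μ * (Fintype.card Λ * E) + Fintype.card Λ * K) * ((16 * E * K) ^ Y * C) ^ R * X := by
  set ν := Fintype.card Λ with hν
  set d := Y * R with hd'
  set H : Λ → F := fun l => (hasseDeriv m (g l)).eval x with hH
  have hs0 : 0 < t₁ ^ e := by positivity
  have hs1 : t₁ ^ e ≤ 1 := pow_le_one₀ ht₁.le ht₁'
  have hz0 : 0 < ‖z₂‖ := norm_pos_iff.2 hz₂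
  have hpow : ∀ i : ℤ, (t₁ ^ e) ^ i = t₁ ^ (e * i) := fun i => by rw [zpow_mul, zpow_natCast]
  have hX0 : 0 ≤ X := le_trans (by positivity) (hX 0 (Nat.zero_le _))
  set T : ℝ := ((16 * E * K) ^ Y * C) ^ R with hT
  have hTe : (16 * E * K) ^ d * C ^ R = T := by rw [hT, mul_pow (_ ^ Y), ← pow_mul]
  have hT0 : 0 ≤ T := by positivity
  have herr : ∀ l, ‖w (H l) * (w (φ l) - ∑ j ∈ Finset.Ico a (a + e * μ), w (ε l j) * z₂ ^ j)‖ ≤ K * T * X := by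
    intro l
    have h1 := norm_eval_hasseDeriv_le_of_jet w β d 0 m (g l) (C ^ R) E K (by positivity) hE hEb hK (hd l)
      (hg l) (by simp) (Nat.zero_le _) x (t₁ ^ e) hs0 hs1 hx
    rw [norm_mul]
    calc _ ≤ ((16 * E * K) ^ d * C ^ R * (t₁ ^ e) ^ (((0 : ℕ) : ℤ) - m - (if β.isSome then 0 else d : ℤ))) *
          (K * ‖z₂‖ ^ (a + e * μ)) := by
            refine mul_le_mul ?_ (hφ l) (norm_nonneg _) (by positivity)
            exact_mod_cast h1
      _ = K * T * (t₁ ^ (e * ((R : ℤ) * (μ - μ) - m - (if β.isSome then 0 else Y * R))) *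
        ‖z₂‖ ^ (a + e * (μ : ℕ))) := by
          rw [hTe, hpow, hd']
          push_cast
          rw [sub_self, mul_zero]; ring
      _ ≤ K * T * X := by
          refine mul_le_mul_of_nonneg_left (hX μ le_rfl) (by positivity)
  have hmain : ∀ j ∈ Finset.Ico a (a + e * μ), ‖z₂ ^ j * w (∑ l, ε l j * H l)‖ ≤ ν * E * T * X := by
    intro j hj
    have hj' := Finset.mem_Ico.1 hj
    obtain ⟨i, hi⟩ : ∃ i : ℕ, j = a + i := ⟨(j - a).toNat, by omega⟩
    have hieq : j = a + e * (i / e : ℕ) + (i % e : ℕ) := by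
      have := Nat.div_add_mod i e
      rw [hi, add_assoc]; exact_mod_cast congrArg (a + ·) (congrArg (Nat.cast : ℕ → ℤ) this.symm)
    have hiu : i / e < μ := by
      rw [Nat.div_lt_iff_lt_mul he, mul_comm]; zify; linarith [hj'.2]
    set u := i / e with hu
    have hr : i % e < e := Nat.mod_lt _ he
    set r := i % e with hrr
    have h0 : ∑ l, ε l j * H l = (hasseDeriv m (∑ l, Polynomial.C (ε l j) * g l)).eval x := by
      rw [map_sum, eval_finset_sum]
      refine Finset.sum_congr rfl fun l _ => ?_
      rw [← smul_eq_C_mul, map_smul, eval_smul, smul_eq_mul]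
    have h1 := norm_eval_hasseDeriv_le_of_jet w β d (R * (μ - u)) m (∑ l, Polynomial.C (ε l j) * g l)
      (ν * E * C ^ R) E K (by positivity) hE hEb hK ?_ ?_ ?_ ?_ x (t₁ ^ e) hs0 hs1 hx
    · rw [h0, norm_mul, norm_zpow]
      calc _ ≤ ‖z₂‖ ^ (a + e * u) * ((16 * E * K) ^ d * (ν * E * C ^ R) *
            (t₁ ^ e) ^ (((R * (μ - u) : ℕ) : ℤ) - m - (if β.isSome then 0 else d : ℤ))) := by
              refine mul_le_mul ?_ (by exact_mod_cast h1) (norm_nonneg _) (by positivity)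
              exact zpow_le_zpow_right_of_le_one₀ hz0 hz₂' (by omega)
        _ = ν * E * T * (t₁ ^ (e * ((R : ℤ) * (μ - u) - m - (if β.isSome then 0 else Y * R))) *
              ‖z₂‖ ^ (a + e * u)) := by
            rw [hpow, ← hTe, hd', Nat.cast_mul R, Nat.cast_sub hiu.le]
            push_cast
            ring
        _ ≤ _ := mul_le_mul_of_nonneg_left (hX u hiu.le) (by positivity)
    · refine natDegree_sum_le_of_forall_le _ _ fun l _ => (natDegree_C_mul_le _ _).trans (hd l)
    · intro k
      rw [finset_sum_coeff, map_sum]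
      refine (norm_sum_le_of_le _ fun l _ => (?_ : _ ≤ E * C ^ R)).trans ?_
      · rw [coeff_C_mul, map_mul, norm_mul]
        exact mul_le_mul (hEε l j hj) (hg l k) (norm_nonneg _) (by positivity)
      · rw [Finset.sum_const, Finset.card_univ, nsmul_eq_mul, mul_assoc]
    · intro k hk
      rw [hieq]
      exact hjet u r k hiu hr hk
    · rw [hd', mul_comm Y]
      exact Nat.mul_le_mul_left _ ((Nat.sub_le _ _).trans hμY)
  have hdec : w (∑ l, H l * φ l) =
      ∑ l, w (H l) * (w (φ l) - ∑ j ∈ Finset.Ico a (a + e * μ), w (ε l j) * z₂ ^ j) +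
      ∑ j ∈ Finset.Ico a (a + e * μ), z₂ ^ j * w (∑ l, ε l j * H l) := by
    simp only [mul_sub, Finset.sum_sub_distrib, map_sum, map_mul, Finset.mul_sum]
    rw [Finset.sum_comm (s := Finset.Ico a (a + e * μ))]
    rw [← Finset.sum_sub_distrib, ← Finset.sum_add_distrib]
    refine Finset.sum_congr rfl fun l _ => ?_
    rw [sub_add, eq_comm, sub_eq_self, sub_eq_zero]
    exact Finset.sum_congr rfl fun j _ => by ring
  rw [hdec]
  refine (norm_add_le _ _).trans ?_
  refine (add_le_add (norm_sum_le_of_le _ fun l _ => herr l) (norm_sum_le_of_le _ hmain)).trans ?_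
  rw [Finset.sum_const, Finset.sum_const, Finset.card_univ, Int.card_Ico, nsmul_eq_mul, nsmul_eq_mul]
  have : ((a + e * μ - a).toNat : ℝ) = e * μ := by
    rw [add_sub_cancel_left]; exact_mod_cast congrArg (Nat.cast : ℕ → ℝ) (Int.toNat_natCast (e * μ))
  rw [this]
  refine le_of_eq ?_
  ring

lemma norm_leading_le_of_bounded (w : F →+* ℂ) (d m : ℕ) (A B : ℝ) (hA : 1 ≤ A) (hB : 1 ≤ B)
    (x : F) (hx : ‖w x‖ ≤ B) (φ : Λ → F) (hφ : ∀ l, ‖w (φ l)‖ ≤ B)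
    (g : Λ → F[X]) (hd : ∀ l, (g l).natDegree ≤ d) (hg : ∀ l i, ‖w ((g l).coeff i)‖ ≤ A) :
    ‖w (∑ l, (hasseDeriv m (g l)).eval x * φ l)‖ ≤ Fintype.card Λ * ((4 * B) ^ d * A * B) := by
  rw [map_sum]
  refine (norm_sum_le_of_le _ fun l _ => (?_ : _ ≤ (4 * B) ^ d * A * B)).trans
    (by rw [Finset.sum_const, Finset.card_univ, nsmul_eq_mul])
  rw [map_mul, norm_mul]
  refine mul_le_mul ?_ (hφ l) (norm_nonneg _) (by positivity)
  rw [eval_hasseDeriv_map, mul_pow, mul_assoc]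
  refine norm_eval_hasseDeriv_le _ d m _ _ (by positivity) (natDegree_map_le.trans (hd l)) ?_
  intro k hk hmk
  rw [coeff_map, mul_comm]
  refine mul_le_mul ?_ (hg l k) (norm_nonneg _) (by positivity)
  calc ‖w x‖ ^ (k - m) ≤ B ^ (k - m) := by gcongr
    _ ≤ B ^ d := pow_le_pow_right₀ hB (by omega)

end PlaceBound
end

section
open Polynomial NumberField

section PlaceAsymptotics

open Filter Topology Real

lemma exponent_estimate {e a μ Y L θ s h₁ h₂ l₁ l₂ R m u κ : ℝ} (he : 0 ≤ e) (hY : 0 ≤ Y) (hL : 0 ≤ L)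
    (hθ : 0 ≤ θ) (hs : 0 < s) (hs1 : s ≤ 1) (hh₁ : 0 < h₁) (hh : h₁ ≤ s * h₂) (hR0 : 0 ≤ R)
    (hR : R * h₁ ≤ h₂) (hR' : h₂ ≤ R * h₁ + h₁) (hl₁ : |l₁ - θ * h₁| ≤ s * h₁)
    (hl₂ : |l₂ - θ * h₂| ≤ s * h₂) (hm0 : 0 ≤ m) (hm : m ≤ L + s * (Y * R)) (hu0 : 0 ≤ u) (hu : u ≤ μ)
    (hμY : μ ≤ Y) (hκ : 0 ≤ κ) (hκY : κ ≤ Y) :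
    -l₁ * (e * (R * (μ - u) - m - κ * R)) - l₂ * (a + e * u) ≤
      (-((a + e * μ - e * κ) * θ) + s * (e * (1 + θ) * Y + e * (θ + 1) * (L + Y) + (|a| + e * μ))) * h₂ := by
  have hh₂ : 0 < h₂ := by
    by_contra hc
    nlinarith
  have h1 : |l₁ * R - θ * h₂| ≤ s * (1 + θ) * h₂ := by
    have e1 : l₁ * R - θ * h₂ = (l₁ - θ * h₁) * R + θ * (R * h₁ - h₂) := by ring
    rw [e1]
    refine (abs_add_le _ _).trans ?_
    rw [abs_mul, abs_mul, abs_of_nonneg hR0, abs_of_nonneg hθ]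
    have e2 : |R * h₁ - h₂| ≤ s * h₂ := by rw [abs_le]; constructor <;> nlinarith
    have e3 : |l₁ - θ * h₁| * R ≤ s * h₁ * R := mul_le_mul_of_nonneg_right hl₁ hR0
    have e4 : s * (R * h₁) ≤ s * h₂ := mul_le_mul_of_nonneg_left hR hs.le
    nlinarith [mul_le_mul_of_nonneg_left e2 hθ]
  have h2 : |(l₁ * R - θ * h₂) * (e * (μ - u - κ))| ≤ s * (e * (1 + θ) * Y) * h₂ := by
    rw [abs_mul, abs_mul e, abs_of_nonneg he]
    have : |μ - u - κ| ≤ Y := by rw [abs_le]; constructor <;> linarith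
    calc _ ≤ (s * (1 + θ) * h₂) * (e * Y) := by gcongr
      _ = _ := by ring
  have h3 : l₁ * (e * m) ≤ s * (e * (θ + 1) * (L + Y)) * h₂ := by
    have e1 : l₁ ≤ (θ + 1) * h₁ := by nlinarith [(abs_le.1 hl₁).2]
    have e2 : h₁ * m ≤ s * (L + Y) * h₂ := by
      have : h₁ * m ≤ h₁ * (L + s * (Y * R)) := by gcongr
      have e3 : h₁ * L ≤ s * h₂ * L := by gcongr
      have e4 : s * Y * (R * h₁) ≤ s * Y * h₂ := by gcongr
      nlinarith
    calc l₁ * (e * m) ≤ ((θ + 1) * h₁) * (e * m) := by gcongr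
      _ = e * (θ + 1) * (h₁ * m) := by ring
      _ ≤ e * (θ + 1) * (s * (L + Y) * h₂) := by gcongr
      _ = _ := by ring
  have h4 : |(l₂ - θ * h₂) * (a + e * u)| ≤ s * (|a| + e * μ) * h₂ := by
    rw [abs_mul]
    have : |a + e * u| ≤ |a| + e * μ := by
      refine (abs_add_le _ _).trans ?_
      rw [abs_of_nonneg (mul_nonneg he hu0)]
      gcongr
    calc _ ≤ (s * h₂) * (|a| + e * μ) := by gcongr
      _ = _ := by ring
  have h2' := (abs_le.1 h2).1
  have h4' := (abs_le.1 h4).1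
  nlinarith

variable {F : Type*} [Field F] {Λ : Type*} [Fintype Λ]

lemma exists_norm_leading_le (w : F →+* ℂ) (β : Option F) (e : ℕ) (he : 0 < e) (a : ℤ) (ε : Λ → ℤ → F)
    (μ Y : ℕ) (hμY : μ ≤ Y) (L C θ : ℝ) (hL : 0 ≤ L) (hC : 1 ≤ C) (hθ : 0 ≤ θ)
    (U : Filter ℕ) (h : ℕ → ℝ) (hh : Tendsto h U atTop) (z : ℕ → ℂ) (hz : Tendsto z U (𝓝 0))
    (hz0 : ∀ᶠ n in U, z n ≠ 0) (hzθ : Tendsto (fun n => -log ‖z n‖ / h n) U (𝓝 θ))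
    (q : ℕ → F) (φ : Λ → ℕ → F)
    (hq : ∃ K : ℝ, ∀ᶠ n in U, ‖w (q n) - w (β.getD 0)‖ ≤
      K * (if β.isSome then ‖z n‖ ^ e else (‖z n‖ ^ e)⁻¹))
    (hφ : ∀ l, ∃ K : ℝ, ∀ᶠ n in U, ‖w (φ l n) - ∑ j ∈ Finset.Ico a (a + e * μ), w (ε l j) * z n ^ j‖ ≤
      K * ‖z n‖ ^ (a + e * μ)) :
    ∃ B : ℝ, ∀ s : ℝ, 0 < s → s ≤ 1 → ∀ᶠ n₁ in U, ∀ᶠ n₂ in U, ∀ (g : Λ → F[X]) (R m : ℕ),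
      R = ⌊h n₂ / h n₁⌋₊ → (∀ l, (g l).natDegree ≤ Y * R) → (∀ l i, ‖w ((g l).coeff i)‖ ≤ C ^ R) →
      (∀ u r k, u < μ → r < e → k < R * (μ - u) →
        (jet β (Y * R) (∑ l, Polynomial.C (ε l (a + e * u + r)) * g l)).coeff k = 0) →
      (m : ℝ) ≤ L + s * (Y * R) →
      ‖w (∑ l, (hasseDeriv m (g l)).eval (q n₁) * φ l n₂)‖ ≤
        exp ((-((a + e * μ - e * (if β.isSome then 0 else Y)) * θ) + s * B) * h n₂) := by
  classical
  obtain ⟨Kq, hKq⟩ := hq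
  choose Kφ hKφ using hφ
  obtain ⟨E, hE1, hEb, hEε⟩ : ∃ E : ℝ, 1 ≤ E ∧ ‖w (β.getD 0)‖ ≤ E ∧
      ∀ l, ∀ j ∈ Finset.Ico a (a + e * μ), ‖w (ε l j)‖ ≤ E := by
    refine ⟨1 + ‖w (β.getD 0)‖ + ∑ l, ∑ j ∈ Finset.Ico a (a + e * μ), ‖w (ε l j)‖, ?_, ?_, ?_⟩
    · have : 0 ≤ ∑ l, ∑ j ∈ Finset.Ico a (a + e * μ), ‖w (ε l j)‖ := by positivity
      linarith [norm_nonneg (w (β.getD 0))]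
    · have : 0 ≤ ∑ l, ∑ j ∈ Finset.Ico a (a + e * μ), ‖w (ε l j)‖ := by positivity
      linarith
    · intro l j hj
      have h1 := Finset.single_le_sum (f := fun j => ‖w (ε l j)‖) (fun _ _ => norm_nonneg _) hj
      have h2 := Finset.single_le_sum (f := fun l => ∑ j ∈ Finset.Ico a (a + e * μ), ‖w (ε l j)‖)
        (fun _ _ => Finset.sum_nonneg fun _ _ => norm_nonneg _) (Finset.mem_univ l)
      linarith [norm_nonneg (w (β.getD 0))]
  obtain ⟨K, hK1, hKqK, hKφK⟩ : ∃ K : ℝ, 1 ≤ K ∧ Kq ≤ K ∧ ∀ l, Kφ l ≤ K := by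
    refine ⟨1 + |Kq| + ∑ l, |Kφ l|, ?_, ?_, fun l => ?_⟩
    · have : 0 ≤ ∑ l, |Kφ l| := by positivity
      linarith [abs_nonneg Kq]
    · have : 0 ≤ ∑ l, |Kφ l| := by positivity
      linarith [le_abs_self Kq]
    · have h1 := Finset.single_le_sum (f := fun l => |Kφ l|) (fun _ _ => abs_nonneg _) (Finset.mem_univ l)
      linarith [abs_nonneg Kq, le_abs_self (Kφ l)]
  set c₁ : ℝ := e * μ * (Fintype.card Λ * E) + Fintype.card Λ * K with hc₁
  set c₂ : ℝ := (16 * E * K) ^ Y * C with hc₂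
  have hc₁0 : 0 ≤ c₁ := by positivity
  have hc₂0 : 0 ≤ c₂ := by positivity
  set B₁ : ℝ := e * (1 + θ) * Y + e * (θ + 1) * (L + Y) + (|(a:ℝ)| + e * μ) with hB₁
  refine ⟨B₁ + c₁ + c₂, fun s hs hs1 => ?_⟩
  have hlog : ∀ᶠ n in U, |-log ‖z n‖ - θ * h n| ≤ s * h n := by
    have := (Metric.tendsto_nhds.1 hzθ) s hs
    filter_upwards [this, hh.eventually_gt_atTop 0] with n hn hpos
    rw [dist_eq_norm, Real.norm_eq_abs] at hn
    have e1 : -log ‖z n‖ - θ * h n = (-log ‖z n‖ / h n - θ) * h n := by field_simp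
    rw [e1, abs_mul, abs_of_pos hpos]
    exact mul_le_mul_of_nonneg_right hn.le hpos.le
  have hsmall : ∀ᶠ n in U, ‖z n‖ ≤ 1 := by
    have := (Metric.tendsto_nhds.1 hz) 1 one_pos
    filter_upwards [this] with n hn
    simpa using hn.le
  filter_upwards [hlog, hsmall, hz0, hKq, hh.eventually_ge_atTop (1 / s)] with n₁ a1 a2 a3 a4 a5
  have hpos₁ : 0 < h n₁ := lt_of_lt_of_le (by positivity) a5
  filter_upwards [hlog, hsmall, hz0, eventually_all.2 hKφ, hh.eventually_ge_atTop (h n₁ / s)]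
    with n₂ b1 b2 b3 b4 b5 g R m hR hd hg hjet hm
  have hh₁₂ : h n₁ ≤ s * h n₂ := by
    rw [div_le_iff₀ hs] at b5; linarith
  have hs₁ : 1 ≤ s * h n₁ := by
    rw [div_le_iff₀ hs] at a5; linarith
  have hs₂ : 1 ≤ s * h n₂ := ((one_le_one_div hs hs1).trans a5).trans hh₁₂
  have hpos₂ : 0 < h n₂ := (mul_pos_iff_of_pos_left hs).1 (by linarith)
  have hR1 : (R : ℝ) * h n₁ ≤ h n₂ := by
    rw [← le_div_iff₀ hpos₁, hR]
    exact Nat.floor_le (by positivity)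
  have hR2 : h n₂ ≤ R * h n₁ + h n₁ := by
    have := (Nat.lt_floor_add_one (h n₂ / h n₁)).le
    rw [← hR, div_le_iff₀ hpos₁] at this
    linarith
  have t₁0 : 0 < ‖z n₁‖ := norm_pos_iff.2 a3
  have t₂0 : 0 < ‖z n₂‖ := norm_pos_iff.2 b3
  set κ : ℝ := if β.isSome then 0 else Y with hκ
  have hκ0 : 0 ≤ κ := by rw [hκ]; split_ifs <;> positivity
  have hκY : κ ≤ Y := by rw [hκ]; split_ifs <;> simp
  have hκc : (((if β.isSome then 0 else (Y : ℤ) * R : ℤ)) : ℝ) = κ * R := by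
    rw [hκ]; split_ifs <;> simp
  have hq' : ‖w (q n₁) - w (β.getD 0)‖ ≤ K * (if β.isSome then ‖z n₁‖ ^ e else (‖z n₁‖ ^ e)⁻¹) := by
    refine a4.trans (mul_le_mul_of_nonneg_right hKqK ?_)
    split_ifs <;> positivity
  have key := norm_leading_le w β e he a ε μ Y R m hμY C E K
    (exp ((-((a + e * μ - e * κ) * θ) + s * B₁) * h n₂)) ‖z n₁‖ hC hE1 hK1 hEb hEε t₁0 a2 (z n₂) b3 b2
    (q n₁) hq' (fun l => φ l n₂)
    (fun l => (b4 l).trans (mul_le_mul_of_nonneg_right (hKφK l) (by positivity))) g hd hg hjet ?_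
  · refine key.trans ?_
    have hc₁' : c₁ ≤ exp (c₁ * (s * h n₂)) := by
      have h1 := mul_le_mul_of_nonneg_left hs₂ hc₁0
      have h2 := add_one_le_exp (c₁ * (s * h n₂))
      linarith
    have hc₂' : c₂ ^ R ≤ exp (c₂ * (s * h n₂)) := by
      have h2 : c₂ ≤ exp c₂ := by linarith [add_one_le_exp c₂]
      have hRs : (R : ℝ) ≤ s * h n₂ := by
        calc (R : ℝ) = R * 1 := (mul_one _).symm
          _ ≤ R * (s * h n₁) := by gcongr
          _ = s * (R * h n₁) := by ring
          _ ≤ s * h n₂ := by gcongr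
      calc c₂ ^ R ≤ (exp c₂) ^ R := by gcongr
        _ = exp (c₂ * R) := by rw [← exp_nat_mul]; ring_nf
        _ ≤ _ := by gcongr
    calc c₁ * c₂ ^ R * exp ((-((a + e * μ - e * κ) * θ) + s * B₁) * h n₂)
        ≤ exp (c₁ * (s * h n₂)) * exp (c₂ * (s * h n₂)) *
          exp ((-((a + e * μ - e * κ) * θ) + s * B₁) * h n₂) := by gcongr
      _ = _ := by
        rw [← exp_add, ← exp_add]; congr 1
        rw [hB₁, show (((if β.isSome then 0 else Y : ℕ)) : ℝ) = κ by rw [hκ]; split_ifs <;> simp]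
        ring
  · intro u hu
    have hu' : (u : ℝ) ≤ μ := by exact_mod_cast hu
    have est := exponent_estimate (e := e) (a := a) (μ := μ) (Y := Y) (L := L) (θ := θ) (s := s)
      (h₁ := h n₁) (h₂ := h n₂) (l₁ := -log ‖z n₁‖) (l₂ := -log ‖z n₂‖) (R := R) (m := m) (u := u)
      (κ := κ) (by positivity) (by positivity) hL hθ hs hs1 hpos₁ hh₁₂ (by positivity) hR1 hR2 a1 b1
      (by positivity) hm (by positivity) hu' (by exact_mod_cast hμY) hκ0 hκY
    rw [← exp_log (zpow_pos t₁0 _), ← exp_log (zpow_pos t₂0 _), ← exp_add, exp_le_exp, log_zpow, log_zpow]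
    refine le_trans (le_of_eq ?_) est
    push_cast [hκc]
    ring

lemma exists_norm_leading_le_of_bounded (w : F →+* ℂ) (Y : ℕ) (C : ℝ) (hC : 1 ≤ C)
    (U : Filter ℕ) (h : ℕ → ℝ) (hh : Tendsto h U atTop) (q : ℕ → F) (φ : Λ → ℕ → F)
    (hq : ∃ K : ℝ, ∀ᶠ n in U, ‖w (q n)‖ ≤ K) (hφ : ∀ l, ∃ K : ℝ, ∀ᶠ n in U, ‖w (φ l n)‖ ≤ K) :
    ∃ B : ℝ, ∀ s : ℝ, 0 < s → s ≤ 1 → ∀ᶠ n₁ in U, ∀ᶠ n₂ in U, ∀ (g : Λ → F[X]) (R m : ℕ),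
      R = ⌊h n₂ / h n₁⌋₊ → (∀ l, (g l).natDegree ≤ Y * R) → (∀ l i, ‖w ((g l).coeff i)‖ ≤ C ^ R) →
      ‖w (∑ l, (hasseDeriv m (g l)).eval (q n₁) * φ l n₂)‖ ≤ exp (s * B * h n₂) := by
  classical
  obtain ⟨Kq, hKq⟩ := hq
  choose Kφ hKφ using hφ
  obtain ⟨K, hK1, hKqK, hKφK⟩ : ∃ K : ℝ, 1 ≤ K ∧ Kq ≤ K ∧ ∀ l, Kφ l ≤ K := by
    refine ⟨1 + |Kq| + ∑ l, |Kφ l|, ?_, ?_, fun l => ?_⟩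
    · have : 0 ≤ ∑ l, |Kφ l| := by positivity
      linarith [abs_nonneg Kq]
    · have : 0 ≤ ∑ l, |Kφ l| := by positivity
      linarith [le_abs_self Kq]
    · have h1 := Finset.single_le_sum (f := fun l => |Kφ l|) (fun _ _ => abs_nonneg _) (Finset.mem_univ l)
      linarith [abs_nonneg Kq, le_abs_self (Kφ l)]
  set c₁ : ℝ := Fintype.card Λ * K with hc₁
  set c₂ : ℝ := (4 * K) ^ Y * C with hc₂
  have hc₁0 : 0 ≤ c₁ := by positivity
  have hc₂0 : 0 ≤ c₂ := by positivity
  refine ⟨c₁ + c₂, fun s hs hs1 => ?_⟩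
  filter_upwards [hKq, hh.eventually_ge_atTop (1 / s)] with n₁ a4 a5
  have hpos₁ : 0 < h n₁ := lt_of_lt_of_le (by positivity) a5
  filter_upwards [eventually_all.2 hKφ, hh.eventually_ge_atTop (h n₁ / s)] with n₂ b4 b5 g R m hR hd hg
  have hh₁₂ : h n₁ ≤ s * h n₂ := by
    rw [div_le_iff₀ hs] at b5; linarith
  have hs₁ : 1 ≤ s * h n₁ := by
    rw [div_le_iff₀ hs] at a5; linarith
  have hs₂ : 1 ≤ s * h n₂ := ((one_le_one_div hs hs1).trans a5).trans hh₁₂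
  have hpos₂ : 0 < h n₂ := (mul_pos_iff_of_pos_left hs).1 (by linarith)
  have hR1 : (R : ℝ) * h n₁ ≤ h n₂ := by
    rw [← le_div_iff₀ hpos₁, hR]
    exact Nat.floor_le (by positivity)
  refine (norm_leading_le_of_bounded w (Y * R) m (C ^ R) K (one_le_pow₀ hC) hK1 (q n₁) (a4.trans hKqK)
    (fun l => φ l n₂) (fun l => (b4 l).trans (hKφK l)) g hd hg).trans ?_
  have hc₁' : c₁ ≤ exp (c₁ * (s * h n₂)) := by
    have h1 := mul_le_mul_of_nonneg_left hs₂ hc₁0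
    have h2 := add_one_le_exp (c₁ * (s * h n₂))
    linarith
  have hc₂' : c₂ ^ R ≤ exp (c₂ * (s * h n₂)) := by
    have h2 : c₂ ≤ exp c₂ := by linarith [add_one_le_exp c₂]
    have hRs : (R : ℝ) ≤ s * h n₂ := by
      calc (R : ℝ) = R * 1 := (mul_one _).symm
        _ ≤ R * (s * h n₁) := by gcongr
        _ = s * (R * h n₁) := by ring
        _ ≤ s * h n₂ := by gcongr
    calc c₂ ^ R ≤ (exp c₂) ^ R := by gcongr
      _ = exp (c₂ * R) := by rw [← exp_nat_mul]; ring_nf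
      _ ≤ _ := by gcongr
  calc _ = c₁ * c₂ ^ R := by rw [hc₁, hc₂, pow_mul, mul_pow]; ring
    _ ≤ exp (c₁ * (s * h n₂)) * exp (c₂ * (s * h n₂)) := by gcongr
    _ = _ := by rw [← exp_add]; ring_nf

end PlaceAsymptotics
end

section
open Polynomial NumberField

section Nonvanishing

open Filter Topology Real

variable {F : Type*} [Field F] [NumberField F] {Λ : Type*} [Fintype Λ]

lemma one_le_pow_mul_norm_of_isIntegral (α : F) (hα : α ≠ 0) (h_intgr : IsIntegral ℤ α) (B : ℝ) (hB : 1 ≤ B)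
    (h : ∀ w : F →+* ℂ, ‖w α‖ ≤ B) (w : F →+* ℂ) : 1 ≤ B ^ Module.finrank ℚ F * ‖w α‖ := by
  classical
  have h1 := sum_log_embeddings_nonneg (⟨α, h_intgr⟩ : 𝓞 F) (fun hc => hα (congrArg Subtype.val hc))
  have h1' : 0 ≤ ∑ w : F →+* ℂ, log ‖w α‖ := h1
  rw [← Finset.add_sum_erase _ _ (Finset.mem_univ w)] at h1'
  have hw : 0 < ‖w α‖ := norm_pos_iff.2 ((_root_.map_ne_zero w).2 hα)
  have h2 : ∑ x ∈ Finset.univ.erase w, log ‖x α‖ ≤ Module.finrank ℚ F * log B := by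
    calc _ ≤ ∑ x ∈ Finset.univ.erase w, log B :=
          Finset.sum_le_sum fun x _ => log_le_log (norm_pos_iff.2 ((_root_.map_ne_zero x).2 hα)) (h x)
      _ ≤ ∑ x : F →+* ℂ, log B := Finset.sum_le_sum_of_subset_of_nonneg (Finset.erase_subset _ _)
          fun _ _ _ => log_nonneg hB
      _ = _ := by rw [Finset.sum_const, Finset.card_univ, Embeddings.card, nsmul_eq_mul]
  rw [← log_nonneg_iff (by positivity), log_mul (by positivity) hw.ne', log_pow]
  linarith

lemma exists_lower_bound (ε : Λ → ℤ → F) (a J : ℤ) : ∃ c : ℝ, 1 ≤ c ∧ ∀ (A : ℝ) (γ : Λ → 𝓞 F),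
    1 ≤ A → (∀ l (w : F →+* ℂ), ‖w (γ l : F)‖ ≤ A) → ∀ j ∈ Finset.Ico a J, ∑ l, (γ l : F) * ε l j ≠ 0 →
      ∀ w : F →+* ℂ, 1 ≤ c * A ^ Module.finrank ℚ F * ‖w (∑ l, (γ l : F) * ε l j)‖ := by
  classical
  obtain ⟨D, hD0, hD⟩ := exists_common_denominator (F := F) (I := Λ × Finset.Ico a J) (fun x => ε x.1 x.2)
  set E : ℝ := 1 + ∑ w : F →+* ℂ, ∑ l, ∑ j ∈ Finset.Ico a J, ‖w (ε l j)‖ with hE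
  have hEε : ∀ w : F →+* ℂ, ∀ j ∈ Finset.Ico a J, ∑ l, ‖w (ε l j)‖ ≤ E := by
    intro w j hj
    calc ∑ l, ‖w (ε l j)‖ ≤ ∑ l, ∑ j ∈ Finset.Ico a J, ‖w (ε l j)‖ := Finset.sum_le_sum fun l _ =>
          Finset.single_le_sum (f := fun j => ‖w (ε l j)‖) (fun _ _ => norm_nonneg _) hj
      _ ≤ ∑ w : F →+* ℂ, ∑ l, ∑ j ∈ Finset.Ico a J, ‖w (ε l j)‖ :=
          Finset.single_le_sum (f := fun w : F →+* ℂ => ∑ l, ∑ j ∈ Finset.Ico a J, ‖w (ε l j)‖)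
            (fun _ _ => by positivity) (Finset.mem_univ w)
      _ ≤ E := by rw [hE]; linarith
  have hE1 : 1 ≤ E := by
    rw [hE]
    have : 0 ≤ ∑ w : F →+* ℂ, ∑ l, ∑ j ∈ Finset.Ico a J, ‖w (ε l j)‖ := by positivity
    linarith
  have hD1 : (1 : ℝ) ≤ D := by exact_mod_cast hD0
  refine ⟨(D * E) ^ Module.finrank ℚ F * D, ?_, fun A γ hA hγ j hj hne w => ?_⟩
  · exact one_le_mul_of_one_le_of_one_le (one_le_pow₀ (one_le_mul_of_one_le_of_one_le hD1 hE1)) hD1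
  · have hB : ∀ w : F →+* ℂ, ‖w ((D : F) * ∑ l, (γ l : F) * ε l j)‖ ≤ D * E * A := by
      intro w
      rw [map_mul, norm_mul, map_natCast, Complex.norm_natCast, mul_assoc]
      refine mul_le_mul_of_nonneg_left ?_ (by positivity)
      rw [map_sum]
      refine (norm_sum_le_of_le _ fun l _ => (?_ : _ ≤ ‖w (ε l j)‖ * A)).trans ?_
      · rw [map_mul, norm_mul, mul_comm]
        exact mul_le_mul_of_nonneg_left (hγ l w) (norm_nonneg _)
      · rw [← Finset.sum_mul]
        exact mul_le_mul_of_nonneg_right (hEε w j hj) (by linarith)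
    have hDne : (D : F) ≠ 0 := by exact_mod_cast hD0.ne'
    have h_intgr : IsIntegral ℤ ((D : F) * ∑ l, (γ l : F) * ε l j) := by
      rw [Finset.mul_sum]
      refine IsIntegral.sum _ fun l _ => ?_
      rw [mul_left_comm]
      exact (γ l).2.mul (hD (l, ⟨j, hj⟩))
    have := one_le_pow_mul_norm_of_isIntegral _ (mul_ne_zero hDne hne) h_intgr (D * E * A)
      (one_le_mul_of_one_le_of_one_le (one_le_mul_of_one_le_of_one_le hD1 hE1) hA) hB w
    rw [map_mul, norm_mul, map_natCast, Complex.norm_natCast, mul_pow (D * E)] at this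
    linarith

lemma eventually_sum_ne_zero (w : F →+* ℂ) (a J : ℤ) (ε : Λ → ℤ → F) (C θ : ℝ) (hC : 1 ≤ C) (hθ : 0 < θ)
    (U : Filter ℕ) (h : ℕ → ℝ) (hh : Tendsto h U atTop) (z : ℕ → ℂ) (hz : Tendsto z U (𝓝 0))
    (hz0 : ∀ᶠ n in U, z n ≠ 0) (hzθ : Tendsto (fun n => -log ‖z n‖ / h n) U (𝓝 θ))
    (φ : Λ → ℕ → F)
    (hφ : ∀ l, ∃ K : ℝ, ∀ᶠ n in U, ‖w (φ l n) - ∑ j ∈ Finset.Ico a J, w (ε l j) * z n ^ j‖ ≤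
      K * ‖z n‖ ^ J)
    (hJ : ∀ γ : Λ → 𝓞 F, γ ≠ 0 → ∃ j ∈ Finset.Ico a J, ∑ l, (γ l : F) * ε l j ≠ 0) :
    ∀ᶠ n₁ in U, ∀ᶠ n₂ in U, ∀ (R : ℕ) (γ : Λ → 𝓞 F), R = ⌊h n₂ / h n₁⌋₊ → γ ≠ 0 →
      (∀ l (w : F →+* ℂ), ‖w (γ l : F)‖ ≤ C ^ R) → ∑ l, (γ l : F) * φ l n₂ ≠ 0 := by
  classical
  choose Kφ hKφ using hφ
  obtain ⟨c, hc1, hc⟩ := exists_lower_bound ε a J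
  set n := Module.finrank ℚ F with hn
  set E : ℝ := ∑ l, |Kφ l| + ∑ j ∈ Finset.Ico a J, ∑ l, ‖w (ε l j)‖ with hE
  have hE0 : 0 ≤ E := by positivity
  have hc0 : 0 ≤ c := by linarith
  set X : ℝ := 8 * (C ^ (n + 1)) / θ with hX
  filter_upwards [hh.eventually_ge_atTop X, hh.eventually_gt_atTop 0] with n₁ a1 hpos₁
  have hsmall : ∀ᶠ n in U, ‖z n‖ ≤ 1 := by
    have := (Metric.tendsto_nhds.1 hz) 1 one_pos
    filter_upwards [this] with n hn
    simpa using hn.le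
  have hlog : ∀ᶠ n in U, θ / 2 * h n ≤ -log ‖z n‖ := by
    filter_upwards [hzθ.eventually_const_lt (half_lt_self hθ), hh.eventually_gt_atTop 0] with n hn hpos
    exact ((lt_div_iff₀ hpos).1 hn).le
  filter_upwards [hlog, hsmall, hz0, eventually_all.2 hKφ, hh.eventually_gt_atTop 0,
    hh.eventually_ge_atTop (8 * (c * E) / θ)] with n₂ b1 b2 b3 b4 hpos₂ b5 R γ hR hγ hγC h0
  have hR1 : (R : ℝ) * h n₁ ≤ h n₂ := by
    rw [← le_div_iff₀ hpos₁, hR]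
    exact Nat.floor_le (by positivity)
  obtain ⟨j₁, hj₁, hj₁ne⟩ := hJ γ hγ
  obtain ⟨j₀, hj₀, hmin⟩ := Finset.exists_min_image
    ((Finset.Ico a J).filter fun j => ∑ l, (γ l : F) * ε l j ≠ 0) id ⟨j₁, Finset.mem_filter.2 ⟨hj₁, hj₁ne⟩⟩
  rw [Finset.mem_filter] at hj₀
  have hj₀' := Finset.mem_Ico.1 hj₀.1
  have t0 : 0 < ‖z n₂‖ := norm_pos_iff.2 b3
  have hdec : w (∑ l, (γ l : F) * φ l n₂) =
      ∑ l, w (γ l) * (w (φ l n₂) - ∑ j ∈ Finset.Ico a J, w (ε l j) * z n₂ ^ j) +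
      ∑ j ∈ Finset.Ico a J, w (∑ l, (γ l : F) * ε l j) * z n₂ ^ j := by
    simp only [mul_sub, Finset.sum_sub_distrib, map_sum, map_mul, Finset.mul_sum, Finset.sum_mul]
    rw [Finset.sum_comm (s := Finset.Ico a J)]
    rw [← Finset.sum_sub_distrib, ← Finset.sum_add_distrib]
    refine Finset.sum_congr rfl fun l _ => ?_
    rw [sub_add, eq_comm, sub_eq_self, sub_eq_zero]
    exact Finset.sum_congr rfl fun j _ => by ring
  rw [h0, map_zero, ← Finset.add_sum_erase _ _ hj₀.1] at hdec
  have e1 : ‖∑ l, w (γ l) * (w (φ l n₂) - ∑ j ∈ Finset.Ico a J, w (ε l j) * z n₂ ^ j)‖ ≤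
      (∑ l, |Kφ l|) * (C ^ R * ‖z n₂‖ ^ (j₀ + 1)) := by
    rw [Finset.sum_mul]
    refine norm_sum_le_of_le _ fun l _ => ?_
    rw [norm_mul]
    calc _ ≤ C ^ R * (|Kφ l| * ‖z n₂‖ ^ (j₀ + 1)) := by
          refine mul_le_mul (hγC l w) ((b4 l).trans ?_) (norm_nonneg _) (by positivity)
          refine mul_le_mul (le_abs_self _) ?_ (by positivity) (abs_nonneg _)
          exact zpow_le_zpow_right_of_le_one₀ t0 b2 (by omega)
      _ = _ := by ring
  have e2 : ‖∑ j ∈ (Finset.Ico a J).erase j₀, w (∑ l, (γ l : F) * ε l j) * z n₂ ^ j‖ ≤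
      (∑ j ∈ Finset.Ico a J, ∑ l, ‖w (ε l j)‖) * (C ^ R * ‖z n₂‖ ^ (j₀ + 1)) := by
    rw [Finset.sum_mul]
    refine le_trans (norm_sum_le_of_le _ fun j hj => (?_ : _ ≤ (∑ l, ‖w (ε l j)‖) *
      (C ^ R * ‖z n₂‖ ^ (j₀ + 1)))) (Finset.sum_le_sum_of_subset_of_nonneg (Finset.erase_subset _ _)
        fun _ _ _ => by positivity)
    rw [Finset.mem_erase] at hj
    by_cases hz : ∑ l, (γ l : F) * ε l j = 0
    · rw [hz, map_zero, zero_mul, norm_zero]; positivity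
    have hlt : j₀ + 1 ≤ j := by
      have := hmin j (Finset.mem_filter.2 ⟨hj.2, hz⟩)
      simp only [id] at this
      have := hj.1
      omega
    rw [norm_mul, norm_zpow, ← mul_assoc]
    refine mul_le_mul ?_ (zpow_le_zpow_right_of_le_one₀ t0 b2 hlt) (by positivity) (by positivity)
    rw [map_sum, Finset.sum_mul]
    refine norm_sum_le_of_le _ fun l _ => ?_
    rw [map_mul, norm_mul, mul_comm]
    exact mul_le_mul_of_nonneg_left (hγC l w) (norm_nonneg _)
  have e3 : ‖w (∑ l, (γ l : F) * ε l j₀)‖ ≤ E * C ^ R * ‖z n₂‖ := by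
    have : ‖w (∑ l, (γ l : F) * ε l j₀) * z n₂ ^ j₀‖ ≤ E * (C ^ R * ‖z n₂‖ ^ (j₀ + 1)) := by
      have h1 : w (∑ l, (γ l : F) * ε l j₀) * z n₂ ^ j₀ =
        -(∑ l, w (γ l) * (w (φ l n₂) - ∑ j ∈ Finset.Ico a J, w (ε l j) * z n₂ ^ j) +
          ∑ j ∈ (Finset.Ico a J).erase j₀, w (∑ l, (γ l : F) * ε l j) * z n₂ ^ j) := by
        linear_combination -hdec
      rw [h1, norm_neg, hE, add_mul]
      exact (norm_add_le _ _).trans (add_le_add e1 e2)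
    rw [norm_mul, norm_zpow, zpow_add_one₀ t0.ne'] at this
    have t1 : 0 < ‖z n₂‖ ^ j₀ := by positivity
    refine le_of_mul_le_mul_right (this.trans (le_of_eq ?_)) t1
    ring
  have e4 := hc (C ^ R) γ (one_le_pow₀ hC) hγC j₀ hj₀.1 hj₀.2 w
  have e5 : 1 ≤ c * E * (C ^ (n + 1)) ^ R * ‖z n₂‖ := by
    calc (1 : ℝ) ≤ _ := e4
      _ ≤ c * (C ^ R) ^ n * (E * C ^ R * ‖z n₂‖) := by gcongr
      _ = _ := by ring
  have e6 : ‖z n₂‖ ≤ exp (-(θ / 2 * h n₂)) := by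
    rw [← log_le_iff_le_exp t0]; linarith
  have e7 : c * E < exp (c * E) := by linarith [add_one_le_exp (c * E)]
  have e8 : (C ^ (n + 1)) ^ R ≤ exp (C ^ (n + 1) * R) := by
    have : C ^ (n + 1) ≤ exp (C ^ (n + 1)) := by linarith [add_one_le_exp (C ^ (n + 1))]
    calc _ ≤ (exp (C ^ (n + 1))) ^ R := by gcongr
      _ = _ := by rw [← exp_nat_mul]; ring_nf
  have e9 : C ^ (n + 1) * R ≤ θ / 8 * h n₂ := by
    have h1 : 8 * C ^ (n + 1) ≤ θ * h n₁ := by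
      rw [hX, div_le_iff₀ hθ] at a1; linarith
    have h2 : 8 * C ^ (n + 1) * R ≤ θ * h n₁ * R := by gcongr
    have h3 : θ * (R * h n₁) ≤ θ * h n₂ := by gcongr
    nlinarith
  have e10 : c * E ≤ θ / 8 * h n₂ := by
    rw [div_le_iff₀ hθ] at b5; linarith
  have : c * E * (C ^ (n + 1)) ^ R * ‖z n₂‖ ≤
      exp (θ / 8 * h n₂) * exp (θ / 8 * h n₂) * exp (-(θ / 2 * h n₂)) := by
    refine mul_le_mul (mul_le_mul (e7.le.trans ?_) (e8.trans ?_) (by positivity) (by positivity)) e6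
      (by positivity) (by positivity)
    · exact exp_le_exp.2 e10
    · exact exp_le_exp.2 e9
  rw [← exp_add, ← exp_add] at this
  have hlt : exp (θ / 8 * h n₂ + θ / 8 * h n₂ + -(θ / 2 * h n₂)) < 1 := by
    rw [exp_lt_one_iff]
    have := mul_pos hθ hpos₂
    linarith
  linarith

end Nonvanishing
end

section
open Polynomial NumberField

section ThueContradiction

open Filter Topology Real

lemma eval_hasseDeriv_rootMultiplicity_ne_zero {R : Type*} [CommRing R] [IsDomain R] (p : R[X]) (hp : p ≠ 0)
    (a : R) : (hasseDeriv (p.rootMultiplicity a) p).eval a ≠ 0 := by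
  rw [← taylor_coeff, rootMultiplicity_eq_natTrailingDegree, ← taylor_apply]
  exact trailingCoeff_nonzero_iff_nonzero.2 (fun hc => hp (taylor_injective a (by rw [hc, map_zero])))

variable {F : Type*} [Field F] [NumberField F]

lemma rootMultiplicity_le_of_index {Λ : Type*} [Fintype Λ] (Y : ℕ) (C : ℝ) (hC : 1 ≤ C) (ρ : ℝ) (hρ : 0 < ρ)
    (s : ℝ) (hs : 0 < s) : ∃ H : ℝ, ∀ h₁ : ℝ, H ≤ h₁ → ∀ (R : ℕ) (g : Λ → (𝓞 F)[X]) (φ : Λ → 𝓞 F) (q : 𝓞 F),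
      0 < R → 0 < Y → (∀ l, (g l).natDegree ≤ Y * R) → (∀ l i (w : F →+* ℂ), ‖w ((g l).coeff i : F)‖ ≤ C ^ R) →
      ∑ l, Polynomial.C (φ l) * g l ≠ 0 → ρ * h₁ ≤ ∑ w : F →+* ℂ, log⁺ ‖w (q : F)‖ →
      (((∑ l, Polynomial.C (φ l) * g l).rootMultiplicity q : ℕ) : ℝ) ≤ Fintype.card Λ + s * (Y * R) := by
  set ν := Fintype.card Λ with hν
  set n := Module.finrank ℚ F with hn
  set G : ℝ := n * (ν * (ν + (ν + 1) + C)) with hG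
  have hG0 : 0 ≤ G := by positivity
  refine ⟨(G + 1) / (s * ρ), fun h₁ hh₁ R g φ q hR hY hd hg hne hq => ?_⟩
  have hpos : 0 < h₁ := lt_of_lt_of_le (by positivity) hh₁
  set m := (∑ l, Polynomial.C (φ l) * g l).rootMultiplicity q with hm
  have key := index_bound g (Y * R) hd (C ^ R) (one_le_pow₀ hC) hg φ q m hne
    (pow_rootMultiplicity_dvd _ _)
  rw [← hν, ← hn] at key
  have hd1 : (1 : ℝ) ≤ (Y * R : ℕ) := by exact_mod_cast Nat.mul_pos hY hR
  have hν0 : 0 < ν := by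
    rw [hν, Fintype.card_pos_iff]
    by_contra hc
    rw [not_nonempty_iff] at hc
    exact hne (by simp)
  have hν0' : (0 : ℝ) < ν := by exact_mod_cast hν0
  have hlog : log (ν * (((Y * R : ℕ) + 1) ^ (ν + 1) * C ^ R)) ≤ (ν + (ν + 1) + C) * (Y * R : ℕ) := by
    rw [log_mul (by positivity) (by positivity), log_mul (by positivity) (by positivity), log_pow, log_pow]
    have h1 : log ν ≤ ν := (log_le_sub_one_of_pos hν0').trans (by linarith)
    have h2 : log ((Y * R : ℕ) + 1) ≤ (Y * R : ℕ) := (log_le_sub_one_of_pos (by positivity)).trans (by linarith)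
    have h3 : log C ≤ C := (log_le_sub_one_of_pos (by linarith)).trans (by linarith)
    have h4 : (R : ℝ) ≤ (Y * R : ℕ) := by exact_mod_cast Nat.le_mul_of_pos_left R hY
    have h5 : (R : ℝ) * log C ≤ (Y * R : ℕ) * C := mul_le_mul h4 h3 (log_nonneg hC) (by positivity)
    have h6 : ((ν + 1 : ℕ) : ℝ) * log ((Y * R : ℕ) + 1) ≤ (ν + 1 : ℕ) * (Y * R : ℕ) := by gcongr
    push_cast at *
    nlinarith
  have hub : ((m : ℝ) + 1 - ν) * (∑ w : F →+* ℂ, log⁺ ‖w (q : F)‖) ≤ G * (Y * R : ℕ) := by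
    refine key.trans ?_
    rw [hG, mul_assoc, mul_assoc]
    gcongr
  by_contra hcon
  push Not at hcon
  have h1 : s * (Y * R : ℕ) ≤ (m : ℝ) + 1 - ν := by push_cast; linarith
  have h2 : s * (Y * R : ℕ) * (ρ * h₁) ≤ ((m : ℝ) + 1 - ν) * (∑ w : F →+* ℂ, log⁺ ‖w (q : F)‖) :=
    mul_le_mul h1 hq (by positivity) (le_trans (by positivity) h1)
  have h3 : G + 1 ≤ s * ρ * h₁ := by
    rw [div_le_iff₀ (by positivity)] at hh₁; linarith
  have h4 : (G + 1) * (Y * R : ℕ) ≤ s * ρ * h₁ * (Y * R : ℕ) := by gcongr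
  nlinarith

/-- The Diophantine contradiction behind finiteness of integral points: sections with too much
vanishing at the cusps cannot take algebraic integer values along a sequence of points. -/
theorem false_of_cusp_expansions {ι Λ : Type} [Fintype ι] [Fintype Λ] [Nonempty ι]
    (β : ι → Option F) (e : ι → ℕ) (he : ∀ c, 0 < e c) (a : ι → ℤ) (ε : ι → Λ → ℤ → F)
    (μ Y : ℕ) (hμ : 0 < μ) (hμY : μ ≤ Y)
    (hcount : (∑ c, e c) * ∑ u : Fin μ, (μ - u) < Y * Fintype.card Λ)
    (U : Filter ℕ) [U.NeBot] (h : ℕ → ℝ) (hh : Tendsto h U atTop) (q : ℕ → 𝓞 F) (φ : Λ → ℕ → 𝓞 F)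
    (T : (F →+* ℂ) → Option ι) (θ : (F →+* ℂ) → ℝ) (z : (F →+* ℂ) → ℕ → ℂ)
    (hz : ∀ w c, T w = some c → 0 ≤ θ w ∧ Tendsto (z w) U (𝓝 0) ∧ (∀ᶠ n in U, z w n ≠ 0) ∧
      Tendsto (fun n => -log ‖z w n‖ / h n) U (𝓝 (θ w)))
    (hq : ∀ w c, T w = some c → ∃ K : ℝ, ∀ᶠ n in U, ‖w (q n : F) - w ((β c).getD 0)‖ ≤
      K * (if (β c).isSome then ‖z w n‖ ^ e c else (‖z w n‖ ^ e c)⁻¹))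
    (J : ℤ) (hJμ : ∀ c, a c + e c * μ ≤ J)
    (hφ : ∀ w c, T w = some c → ∀ (l : Λ) (M : ℤ), M ≤ J → ∃ K : ℝ, ∀ᶠ n in U,
      ‖w (φ l n : F) - ∑ j ∈ Finset.Ico (a c) M, w (ε c l j) * z w n ^ j‖ ≤ K * ‖z w n‖ ^ M)
    (hbdd : ∀ w, T w = none → (∃ K : ℝ, ∀ᶠ n in U, ‖w (q n : F)‖ ≤ K) ∧
      ∀ l, ∃ K : ℝ, ∀ᶠ n in U, ‖w (φ l n : F)‖ ≤ K)
    (w₀ : F →+* ℂ) (c₀ : ι) (hw₀ : T w₀ = some c₀) (hθ₀ : 0 < θ w₀)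
    (hJ : ∀ γ : Λ → 𝓞 F, γ ≠ 0 → ∃ j ∈ Finset.Ico (a c₀) J, ∑ l, (γ l : F) * ε c₀ l j ≠ 0)
    (hq₀ : ∃ K : ℝ, ∀ᶠ n in U, (‖z w₀ n‖ ^ e c₀)⁻¹ ≤ K * ‖w₀ (q n : F)‖)
    (hτ : 0 < ∑ w : F →+* ℂ, (T w).elim 0 fun c =>
      ((a c : ℝ) + e c * μ - e c * ((if (β c).isSome then 0 else Y : ℕ) : ℝ)) * θ w) : False := by
  classical
  obtain ⟨C, hC, haux⟩ := exists_auxiliary β e he a ε μ Y hμ hcount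
  set ν := Fintype.card Λ with hν
  set τ : (F →+* ℂ) → ℝ := fun w => (T w).elim 0 fun c =>
      ((a c : ℝ) + e c * μ - e c * ((if (β c).isSome then 0 else Y : ℕ) : ℝ)) * θ w with hτdef
  have hplace : ∀ w : F →+* ℂ, ∃ B : ℝ, ∀ s : ℝ, 0 < s → s ≤ 1 → ∀ᶠ n₁ in U, ∀ᶠ n₂ in U,
      ∀ (g : Λ → F[X]) (R m : ℕ),
      R = ⌊h n₂ / h n₁⌋₊ → (∀ l, (g l).natDegree ≤ Y * R) → (∀ l i, ‖w ((g l).coeff i)‖ ≤ C ^ R) →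
      (∀ c u r k, u < μ → r < e c → k < R * (μ - u) →
        (jet (β c) (Y * R) (∑ l, Polynomial.C (ε c l (a c + e c * u + r)) * g l)).coeff k = 0) →
      (m : ℝ) ≤ ν + s * (Y * R) →
      ‖w (∑ l, (hasseDeriv m (g l)).eval (q n₁ : F) * (φ l n₂ : F))‖ ≤ exp ((-τ w + s * B) * h n₂) := by
    intro w
    rcases hT : T w with _ | c
    · obtain ⟨B, hB⟩ := exists_norm_leading_le_of_bounded w Y C hC U h hh (fun n => (q n : F))
        (fun l n => (φ l n : F)) (hbdd w hT).1 (hbdd w hT).2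
      refine ⟨B, fun s hs hs1 => ?_⟩
      filter_upwards [hB s hs hs1] with n₁ h1
      filter_upwards [h1] with n₂ h2 g R m hR hd hg _ _
      refine (h2 g R m hR hd hg).trans (le_of_eq ?_)
      simp [hτdef, hT]
    · obtain ⟨z1, z2, z3, z4⟩ := hz w c hT
      obtain ⟨B, hB⟩ := exists_norm_leading_le w (β c) (e c) (he c) (a c) (ε c) μ Y hμY ν C (θ w)
        (by positivity) hC z1 U h hh (z w) z2 z3 z4 (fun n => (q n : F)) (fun l n => (φ l n : F))
        (hq w c hT) (fun l => hφ w c hT l _ (hJμ c))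
      refine ⟨B, fun s hs hs1 => ?_⟩
      filter_upwards [hB s hs hs1] with n₁ h1
      filter_upwards [h1] with n₂ h2 g R m hR hd hg hj hm
      refine (h2 g R m hR hd hg (hj c) hm).trans (le_of_eq ?_)
      simp [hτdef, hT]
  choose B hB using hplace
  set S := ∑ w, τ w with hS
  set s : ℝ := min 1 (S / (2 * (|∑ w, B w| + 1))) with hs
  have hs0 : 0 < s := lt_min one_pos (by positivity)
  have hs1 : s ≤ 1 := min_le_left _ _
  have hsB : s * ∑ w, B w < S := by
    have h1 : s ≤ S / (2 * (|∑ w, B w| + 1)) := min_le_right _ _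
    rw [le_div_iff₀ (by positivity)] at h1
    have h2 : s * ∑ w, B w ≤ s * |∑ w, B w| := mul_le_mul_of_nonneg_left (le_abs_self _) hs0.le
    nlinarith [abs_nonneg (∑ w, B w)]
  obtain ⟨z1, z2, z3, z4⟩ := hz w₀ c₀ hw₀
  set ρ : ℝ := θ w₀ / 4 with hρ
  have hρ0 : 0 < ρ := by positivity
  obtain ⟨H, hH⟩ := rootMultiplicity_le_of_index (F := F) (Λ := Λ) Y C hC ρ hρ0 s hs0
  have hheight : ∀ᶠ n in U, ρ * h n ≤ ∑ w : F →+* ℂ, log⁺ ‖w (q n : F)‖ := by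
    obtain ⟨K, hK⟩ := hq₀
    have hsm := (Metric.tendsto_nhds.1 z2) 1 one_pos
    filter_upwards [hK, z3, z4.eventually_const_lt (half_lt_self hθ₀), hh.eventually_gt_atTop 0,
      hh.eventually_ge_atTop (4 * |log K| / θ w₀), hsm] with n a1 a2 a3 a4 a5 a6
    have t0 : 0 < ‖z w₀ n‖ := norm_pos_iff.2 a2
    have a6' : ‖z w₀ n‖ < 1 := by simpa using a6
    have p0 : 0 < (‖z w₀ n‖ ^ e c₀)⁻¹ := by positivity
    have p1 := p0.trans_le a1
    have K0 : 0 < K := by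
      by_contra hc
      push Not at hc
      exact absurd p1 (not_lt.2 (mul_nonpos_of_nonpos_of_nonneg hc (norm_nonneg _)))
    have q0 : 0 < ‖w₀ (q n : F)‖ := (pos_iff_pos_of_mul_pos p1).1 K0
    have l1 := log_le_log p0 a1
    rw [log_inv, log_pow, log_mul K0.ne' q0.ne'] at l1
    have l2 : (1 : ℝ) ≤ e c₀ := by exact_mod_cast he c₀
    have l3 : θ w₀ / 2 * h n ≤ -log ‖z w₀ n‖ := ((lt_div_iff₀ a4).1 a3).le
    have l4 : 0 ≤ -log ‖z w₀ n‖ := by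
      have := log_neg t0 a6'
      linarith
    have l5 : log ‖w₀ (q n : F)‖ ≤ log⁺ ‖w₀ (q n : F)‖ := le_max_right _ _
    have l6 : log⁺ ‖w₀ (q n : F)‖ ≤ ∑ w : F →+* ℂ, log⁺ ‖w (q n : F)‖ :=
      Finset.single_le_sum (f := fun w : F →+* ℂ => log⁺ ‖w (q n : F)‖) (fun _ _ => posLog_nonneg)
        (Finset.mem_univ w₀)
    rw [div_le_iff₀ hθ₀] at a5
    have l7 := le_abs_self (log K)
    have l8 := mul_le_mul_of_nonneg_right l2 l4
    rw [hρ]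
    linarith
  have hnonv := eventually_sum_ne_zero w₀ (a c₀) J (ε c₀) C (θ w₀) hC hθ₀ U h hh (z w₀) z2 z3 z4
    (fun l n => (φ l n : F)) (fun l => hφ w₀ c₀ hw₀ l J le_rfl) hJ
  obtain ⟨n₁, b1, b2, b3, b4, b5⟩ := ((eventually_all.2 fun w => hB w s hs0 hs1).and
    (hnonv.and (hheight.and ((hh.eventually_ge_atTop H).and (hh.eventually_gt_atTop 0))))).exists
  obtain ⟨n₂, d1, d2, d3⟩ := ((eventually_all.2 b1).and
    (b2.and (hh.eventually_ge_atTop (h n₁)))).exists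
  set R := ⌊h n₂ / h n₁⌋₊ with hR
  have hR0 : 0 < R := Nat.floor_pos.2 ((one_le_div b5).2 d3)
  have hpos₂ : 0 < h n₂ := b5.trans_le d3
  obtain ⟨g, hg0, hgd, hgC, hgj⟩ := haux R hR0
  set G : (𝓞 F)[X] := ∑ l, Polynomial.C (φ l n₂) * g l with hG
  have hGne : G ≠ 0 := by
    obtain ⟨l₀, hl₀⟩ := Function.ne_iff.1 hg0
    obtain ⟨i, hi⟩ : ∃ i, (g l₀).coeff i ≠ 0 := by
      by_contra hc
      push Not at hc
      exact hl₀ (Polynomial.ext (by simpa using hc))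
    intro hGz
    refine d2 R (fun l => (g l).coeff i) rfl (fun hc => hi (congrFun hc l₀)) (fun l w => hgC l i w) ?_
    have := congrArg (fun p => ((Polynomial.coeff p i : 𝓞 F) : F)) hGz
    simp only [hG, finset_sum_coeff, coeff_C_mul, Polynomial.coeff_zero, map_sum, map_mul, map_zero] at this
    rw [← this]
    exact Finset.sum_congr rfl fun l _ => mul_comm _ _
  set m := G.rootMultiplicity (q n₁) with hm
  have hmle : (m : ℝ) ≤ ν + s * (Y * R) :=
    hH (h n₁) b4 R g (fun l => φ l n₂) (q n₁) hR0 (hμ.trans_le hμY) hgd hgC hGne b3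
  set V : 𝓞 F := (hasseDeriv m G).eval (q n₁) with hV
  have hVne : V ≠ 0 := eval_hasseDeriv_rootMultiplicity_ne_zero G hGne _
  have hVeq : (V : F) = ∑ l, (hasseDeriv m ((g l).map (algebraMap (𝓞 F) F))).eval (q n₁ : F) *
      (φ l n₂ : F) := by
    change algebraMap (𝓞 F) F V = ∑ l, (hasseDeriv m ((g l).map (algebraMap (𝓞 F) F))).eval
      (algebraMap (𝓞 F) F (q n₁)) * algebraMap (𝓞 F) F (φ l n₂)
    rw [hV, hG, map_sum, eval_finset_sum, map_sum]
    refine Finset.sum_congr rfl fun l _ => ?_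
    rw [← smul_eq_C_mul, map_smul, eval_smul, smul_eq_mul, map_mul, mul_comm, hasseDeriv_map', eval_map,
      eval₂_at_apply]
  have hbound : ∀ w : F →+* ℂ, log ‖w (V : F)‖ ≤ (-τ w + s * B w) * h n₂ := by
    intro w
    have h1 := d1 w (fun l => (g l).map (algebraMap (𝓞 F) F)) R m rfl
      (fun l => natDegree_map_le.trans (hgd l)) (fun l i => by rw [coeff_map]; exact hgC l i w) hgj hmle
    rw [← hVeq] at h1
    have h2 : 0 < ‖w (V : F)‖ := norm_pos_iff.2 ((_root_.map_ne_zero w).2 (by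
      simpa using hVne))
    rwa [log_le_iff_le_exp h2]
  have hsum := sum_log_embeddings_nonneg V hVne
  have := hsum.trans (Finset.sum_le_sum fun w _ => hbound w)
  rw [← Finset.sum_mul, Finset.sum_add_distrib, Finset.sum_neg_distrib, ← Finset.mul_sum, ← hS] at this
  have h2 : (-S + s * ∑ w, B w) * h n₂ < 0 := mul_neg_of_neg_of_pos (by linarith) hpos₂
  linarith

end ThueContradiction
end

section
open MvPolynomial

section Resultant
variable {k : Type*} [Field k]

lemma eval_eq_eval_toBi (a b : k) (φ : MvPolynomial (Fin 2) k) :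
    eval ![a, b] φ = ((toBi k φ).map (Polynomial.evalRingHom b)).eval a := by
  have : (eval ![a, b] : MvPolynomial (Fin 2) k →+* k) =
      ((Polynomial.evalRingHom a).comp (Polynomial.mapRingHom (Polynomial.evalRingHom b))).comp
        (toBi k : MvPolynomial (Fin 2) k →+* Polynomial (Polynomial k)) := by
    refine MvPolynomial.ringHom_ext (fun r => ?_) fun i => ?_
    · simp
    · fin_cases i <;> simp
  exact RingHom.congr_fun this φ

lemma eval_aeval_X_one (a b : k) (α : Polynomial k) :
    eval ![a, b] (Polynomial.aeval (X 1) α) = α.eval b := by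
  rw [← toBi_symm_C, eval_eq_eval_toBi]
  simp

lemma MonicIn.map_ne_zero {p : MvPolynomial (Fin 2) k} {N : ℕ} (h : MonicIn p N) (b : k) :
    (toBi k p).map (Polynomial.evalRingHom b) ≠ 0 := by
  obtain ⟨-, c, hc, hl⟩ := h
  intro h0
  have := congrArg (fun q => q.coeff (toBi k p).natDegree) h0
  simp only [Polynomial.coeff_map, Polynomial.coeff_natDegree, hl] at this
  simp at this
  exact hc this

lemma MonicIn.finite_fiber {p : MvPolynomial (Fin 2) k} {N : ℕ} (h : MonicIn p N) (b : k) :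
    {a | eval ![a, b] p = 0}.Finite := by
  refine (Polynomial.finite_setOf_isRoot (h.map_ne_zero b)).subset fun a ha => ?_
  rw [Set.mem_setOf_eq, eval_eq_eval_toBi] at ha
  exact ha

theorem MonicIn.exists_eliminant {p : MvPolynomial (Fin 2) k} {N : ℕ} (hp : Irreducible p)
    (hN : 0 < N) (h : MonicIn p N) {φ : MvPolynomial (Fin 2) k} (hφ : ¬ p ∣ φ) :
    ∃ α : Polynomial k, α ≠ 0 ∧ ∃ u v, Polynomial.aeval (X 1) α = u * p + v * φ := by
  classical
  haveI : (Ideal.span {p}).IsPrime := (Ideal.span_singleton_prime hp.ne_zero).2 hp.prime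
  let mk := Ideal.Quotient.mk (Ideal.span {p})
  let r : Polynomial k →+* MvPolynomial (Fin 2) k ⧸ Ideal.span {p} :=
    mk.comp (Polynomial.aeval (X 1 : MvPolynomial (Fin 2) k)).toRingHom
  have hr : ∀ f, r f = mk (Polynomial.aeval (X 1) f) := fun f => rfl
  have hmk : ∀ f, mk f = 0 ↔ p ∣ f := fun f => by
    rw [Ideal.Quotient.eq_zero_iff_mem, Ideal.mem_span_singleton]
  letI := r.toAlgebra
  have h_intgr : ∀ f, IsIntegral (Polynomial k) (mk f) := by
    intro f
    induction f using MvPolynomial.induction_on with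
    | C a =>
      have : mk (C a) = algebraMap (Polynomial k) _ (Polynomial.C a) := by
        change _ = r _
        rw [hr, Polynomial.aeval_C]; rfl
      rw [this]; exact isIntegral_algebraMap
    | add f g hf hg => rw [map_add]; exact hf.add hg
    | mul_X f i hf =>
      rw [map_mul]
      refine hf.mul ?_
      fin_cases i
      · obtain ⟨-, c, hc, hl⟩ := h
        refine ⟨Polynomial.C (Polynomial.C c⁻¹) * toBi k p, ?_, ?_⟩
        · rw [Polynomial.Monic, Polynomial.leadingCoeff_mul, hl, Polynomial.leadingCoeff_C, ← Polynomial.C_mul,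
            inv_mul_cancel₀ hc, Polynomial.C_1]
        · change Polynomial.eval₂ r (mk (X 0)) _ = 0
          rw [Polynomial.eval₂_mul]
          refine mul_eq_zero_of_right _ ?_
          have : ∀ q, Polynomial.eval₂ r (mk (X 0)) q = mk ((toBi k).symm q) := by
            intro q
            induction q using Polynomial.induction_on' with
            | add a b ha hb => rw [Polynomial.eval₂_add, ha, hb, map_add, map_add]
            | monomial n a =>
              rw [Polynomial.eval₂_monomial, hr, ← toBi_symm_C, ← Polynomial.C_mul_X_pow_eq_monomial,
                map_mul, map_mul, map_pow, map_pow]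
              congr 3
              rw [AlgEquiv.eq_symm_apply, toBi_X_zero]
          rw [this, AlgEquiv.symm_apply_apply, hmk]
      · have : mk (X 1) = algebraMap (Polynomial k) _ Polynomial.X := by
          change _ = r _
          rw [hr, Polynomial.aeval_X]
        exact this ▸ isIntegral_algebraMap
  have hb := Ideal.comap_ne_bot_of_integral_mem (R := Polynomial k) (x := mk φ) (I := Ideal.span {mk φ})
    (fun h0 => hφ ((hmk _).1 h0)) (Ideal.mem_span_singleton_self _) (h_intgr φ)
  obtain ⟨α, hα, hα0⟩ := Submodule.exists_mem_ne_zero_of_ne_bot hb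
  refine ⟨α, hα0, ?_⟩
  rw [Ideal.mem_comap, Ideal.mem_span_singleton] at hα
  obtain ⟨v, hv⟩ := hα
  obtain ⟨v, rfl⟩ := Ideal.Quotient.mk_surjective v
  have h1 : mk (Polynomial.aeval (X 1) α - φ * v) = 0 := by
    rw [map_sub, map_mul, sub_eq_zero]; exact hv
  obtain ⟨u, hu⟩ := (hmk _).1 h1
  exact ⟨u, v, by linear_combination hu⟩

theorem MonicIn.finite_common_zeros {p : MvPolynomial (Fin 2) k} {N : ℕ} (hp : Irreducible p)
    (hN : 0 < N) (h : MonicIn p N) {φ : MvPolynomial (Fin 2) k} (hφ : ¬ p ∣ φ) :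
    {a : k × k | eval ![a.1, a.2] p = 0 ∧ eval ![a.1, a.2] φ = 0}.Finite := by
  obtain ⟨α, hα, u, v, huv⟩ := h.exists_eliminant hp hN hφ
  have hf := Polynomial.finite_setOf_isRoot hα
  refine (hf.biUnion fun b _ => (h.finite_fiber b).image fun a => (a, b)).subset ?_
  rintro ⟨a, b⟩ ⟨h1, h2⟩
  simp only [Set.mem_iUnion, Set.mem_image]
  refine ⟨b, ?_, a, h1, rfl⟩
  have := congrArg (eval ![a, b]) huv
  rw [eval_aeval_X_one] at this
  simp only [map_add, map_mul] at this
  rw [Set.mem_setOf_eq, Polynomial.IsRoot.def, this, h1, h2]; simp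

end Resultant
end

section
open MvPolynomial

section CuspLimits
open Filter Topology Real

/-- A sequence of points on the curve `p = 0`, followed along an ultrafilter: for each embedding
into `ℂ` it either stays bounded or approaches a cusp, at a rate measured against `h`. -/
structure CuspLimits {k : Type*} [Field k] {p : MvPolynomial (Fin 2) k} {N : ℕ} (A : Cusps p N)
    (U : Ultrafilter ℕ) (x y : ℕ → k) (h : ℕ → ℝ) where
  tendsto_h : Tendsto h U atTop
  T : (k →+* ℂ) → Option A.ι
  θ : (k →+* ℂ) → ℝ
  z : (k →+* ℂ) → ℕ → ℂ
  θ_nonneg : ∀ σ, 0 ≤ θ σ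
  tendsto_z : ∀ σ c, T σ = some c → Tendsto (z σ) U (𝓝 0)
  z_ne : ∀ σ c, T σ = some c → ∀ᶠ n in (U : Filter ℕ), z σ n ≠ 0
  tendsto_log : ∀ σ c, T σ = some c → Tendsto (fun n => -log ‖z σ n‖ / h n) U (𝓝 (θ σ))
  expansion : ∀ σ c, T σ = some c → ∀ (φ : MvPolynomial (Fin 2) k) (a M : ℤ), OrdGe (A.e c φ) a →
    ∃ K : ℝ, ∀ᶠ n in (U : Filter ℕ), ‖σ (eval ![y n, x n] φ) -
      ∑ j ∈ Finset.Ico a M, σ ((A.e c φ).coeff j) * z σ n ^ j‖ ≤ K * ‖z σ n‖ ^ M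
  bounded : ∀ σ, T σ = none → ∀ φ : MvPolynomial (Fin 2) k,
    ∃ K : ℝ, ∀ᶠ n in (U : Filter ℕ), ‖σ (eval ![y n, x n] φ)‖ ≤ K

variable {k : Type*} [Field k] {p : MvPolynomial (Fin 2) k} {N : ℕ}

lemma tendsto_of_expansion {U : Filter ℕ} {f z : ℕ → ℂ} {a : ℤ} {b : ℂ} {K : ℝ}
    (hz : Tendsto z U (𝓝 0)) (hz0 : ∀ᶠ n in U, z n ≠ 0)
    (h : ∀ᶠ n in U, ‖f n - b * z n ^ a‖ ≤ K * ‖z n‖ ^ (a + 1)) :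
    Tendsto (fun n => f n * z n ^ (-a)) U (𝓝 b) := by
  rw [tendsto_iff_norm_sub_tendsto_zero]
  have h1 : Tendsto (fun n => K * ‖z n‖) U (𝓝 0) := by
    simpa using (hz.norm).const_mul K
  refine squeeze_zero' (Eventually.of_forall fun n => norm_nonneg _) ?_ h1
  filter_upwards [h, hz0] with n hn h0
  have e1 : f n * z n ^ (-a) - b = (f n - b * z n ^ a) * z n ^ (-a) := by
    rw [sub_mul, mul_assoc, ← zpow_add₀ h0]; simp
  have hpos : 0 < ‖z n‖ := norm_pos_iff.2 h0
  rw [e1, norm_mul, norm_zpow]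
  refine (mul_le_mul_of_nonneg_right hn (zpow_nonneg hpos.le _)).trans (le_of_eq ?_)
  rw [mul_assoc, ← zpow_add₀ hpos.ne']; simp

lemma log_div_tendsto {U : Filter ℕ} {f z : ℕ → ℂ} {h : ℕ → ℝ} {a : ℤ} {b : ℂ} {t : ℝ}
    (hh : Tendsto h U atTop) (hz0 : ∀ᶠ n in U, z n ≠ 0) (hb : b ≠ 0)
    (hf : Tendsto (fun n => f n * z n ^ (-a)) U (𝓝 b)) (hf0 : ∀ᶠ n in U, f n ≠ 0)
    (ht : Tendsto (fun n => -log ‖z n‖ / h n) U (𝓝 t)) :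
    Tendsto (fun n => log ‖f n‖ / h n) U (𝓝 (-(a * t))) := by
  have h1 : Tendsto (fun n => log ‖f n * z n ^ (-a)‖ / h n) U (𝓝 0) :=
    ((hf.norm).log (norm_ne_zero_iff.2 hb)).div_atTop hh
  have h2 : Tendsto (fun n => log ‖f n * z n ^ (-a)‖ / h n - a * (-log ‖z n‖ / h n)) U
      (𝓝 (0 - a * t)) := h1.sub (ht.const_mul _)
  rw [zero_sub] at h2
  refine h2.congr' ?_
  filter_upwards [hz0, hf0] with n h0 hf0
  rw [norm_mul, norm_zpow, log_mul (norm_ne_zero_iff.2 hf0) (zpow_ne_zero _ (norm_ne_zero_iff.2 h0)),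
    log_zpow]
  push_cast
  ring

lemma MonicIn.bounded_of_bounded (h : MonicIn p N) (hN : 0 < N) {U : Filter ℕ} {x y : ℕ → k}
    (σ : k →+* ℂ) (hp0 : ∀ᶠ n in U, eval ![y n, x n] p = 0) {B : ℝ}
    (hx : ∀ᶠ n in U, ‖σ (x n)‖ ≤ B) (φ : MvPolynomial (Fin 2) k) :
    ∃ K : ℝ, ∀ᶠ n in U, ‖σ (eval ![y n, x n] φ)‖ ≤ K := by
  have hpoly : ∀ f : Polynomial k, ∃ K : ℝ, 0 ≤ K ∧ ∀ᶠ n in U, ‖σ (f.eval (x n))‖ ≤ K := by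
    intro f
    refine ⟨∑ i ∈ Finset.range (f.natDegree + 1), ‖σ (f.coeff i)‖ * |B| ^ i, by positivity, ?_⟩
    filter_upwards [hx] with n hn
    rw [Polynomial.eval_eq_sum_range, map_sum]
    refine (norm_sum_le _ _).trans (Finset.sum_le_sum fun i _ => ?_)
    rw [map_mul, map_pow, norm_mul, norm_pow]
    gcongr
    exact hn.trans (le_abs_self _)
  have hy : ∃ K : ℝ, ∀ᶠ n in U, ‖σ (y n)‖ ≤ K := by
    obtain ⟨hd, c, hc, hl⟩ := h
    choose K hK0 hK using fun j => hpoly ((toBi k p).coeff j)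
    have hσc : 0 < ‖σ c‖ := norm_pos_iff.2 ((_root_.map_ne_zero σ).2 hc)
    refine ⟨max 1 ((∑ j ∈ Finset.range N, K j) / ‖σ c‖), ?_⟩
    filter_upwards [hp0, (eventually_all_finset (Finset.range N)).2 fun j _ => hK j] with n h0 hn
    by_contra! hlt
    have hy1 : 1 < ‖σ (y n)‖ := (le_max_left _ _).trans_lt hlt
    have hy2 := (le_max_right _ _).trans_lt hlt
    rw [div_lt_iff₀ hσc] at hy2
    rw [eval_eq_eval_toBi, Polynomial.eval_map, Polynomial.eval₂_eq_sum_range, hd,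
      Finset.sum_range_succ] at h0
    have h1 : (toBi k p).coeff N = Polynomial.C c := by rw [← hl, ← hd]; rfl
    simp only [h1, Polynomial.coe_evalRingHom, Polynomial.eval_C] at h0
    have h2 : σ c * σ (y n) ^ N = -∑ j ∈ Finset.range N, σ (((toBi k p).coeff j).eval (x n)) * σ (y n) ^ j := by
      have := congrArg σ h0
      simp only [map_add, map_mul, map_sum, map_pow, _root_.map_zero] at this
      linear_combination this
    have h3 : ‖σ c‖ * ‖σ (y n)‖ ^ N ≤ (∑ j ∈ Finset.range N, K j) * ‖σ (y n)‖ ^ (N - 1) := by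
      rw [← norm_pow, ← norm_mul, h2, norm_neg, Finset.sum_mul]
      refine (norm_sum_le _ _).trans (Finset.sum_le_sum fun j hj => ?_)
      rw [norm_mul, norm_pow]
      refine mul_le_mul (hn j hj) (pow_le_pow_right₀ hy1.le ?_) (by positivity) (hK0 j)
      have := Finset.mem_range.1 hj; omega
    obtain ⟨N', rfl⟩ : ∃ N', N = N' + 1 := ⟨N - 1, by omega⟩
    rw [Nat.add_sub_cancel, pow_succ] at h3
    have : 0 < ‖σ (y n)‖ ^ N' := by positivity
    nlinarith
  obtain ⟨Ky, hKy⟩ := hy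
  induction φ using MvPolynomial.induction_on with
  | C a => exact ⟨‖σ a‖, by simp⟩
  | add f g hf hg =>
    obtain ⟨K, hK⟩ := hf
    obtain ⟨L, hL⟩ := hg
    refine ⟨K + L, ?_⟩
    filter_upwards [hK, hL] with n h1 h2
    rw [map_add, map_add]
    exact (norm_add_le _ _).trans (add_le_add h1 h2)
  | mul_X f i hf =>
    obtain ⟨K, hK⟩ := hf
    have hi : ∃ L : ℝ, ∀ᶠ n in U, ‖σ (eval ![y n, x n] (X i))‖ ≤ L := by
      fin_cases i
      · exact ⟨Ky, by simpa using hKy⟩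
      · exact ⟨B, by simpa using hx⟩
    obtain ⟨L, hL⟩ := hi
    refine ⟨|K| * |L|, ?_⟩
    filter_upwards [hK, hL] with n h1 h2
    rw [map_mul, map_mul, norm_mul]
    exact mul_le_mul (h1.trans (le_abs_self _)) (h2.trans (le_abs_self _)) (norm_nonneg _) (abs_nonneg _)

lemma Cusps.tendsto_of_spec [CharZero k] (A : Cusps p N) {U : Filter ℕ} {x y : ℕ → k} (σ : k →+* ℂ) (c : A.ι)
    {z : ℕ → ℂ} (hz : Tendsto z U (𝓝 0)) (hz0 : ∀ᶠ n in U, z n ≠ 0)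
    {φ : MvPolynomial (Fin 2) k} {a : ℤ} (h : ∀ M : ℤ,
      ∃ K : ℝ, ∀ᶠ n in U, ‖σ (eval ![y n, x n] φ) -
      ∑ j ∈ Finset.Ico a M, σ ((A.e c φ).coeff j) * z n ^ j‖ ≤ K * ‖z n‖ ^ M) :
    Tendsto (fun n => σ (eval ![y n, x n] φ) * z n ^ (-a)) U (𝓝 (σ ((A.e c φ).coeff a))) := by
  obtain ⟨K, hK⟩ := h (a + 1)
  refine tendsto_of_expansion hz hz0 (K := K) ?_
  have : Finset.Ico a (a + 1) = {a} := by ext; simp; omega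
  simpa [this] using hK

theorem exists_cuspLimits [CharZero k] (A : Cusps p N) (hm : MonicIn p N) (hN : 0 < N)
    (U : Ultrafilter ℕ) (x y : ℕ → k) (h : ℕ → ℝ) (hh : Tendsto h U atTop)
    (hker : ∀ φ, (∀ᶠ i in (U : Filter ℕ), eval ![y i, x i] φ = 0) ↔ p ∣ φ)
    (hxh : ∀ (σ : k →+* ℂ) n, log ‖σ (x n)‖ ≤ h n) : Nonempty (CuspLimits A U x y h) := by
  classical
  have key : ∀ σ : k →+* ℂ, ∃ (T : Option A.ι) (θ : ℝ) (z : ℕ → ℂ), 0 ≤ θ ∧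
      (∀ c, T = some c → Tendsto z U (𝓝 0) ∧ (∀ᶠ n in (U : Filter ℕ), z n ≠ 0) ∧
        Tendsto (fun n => -log ‖z n‖ / h n) U (𝓝 θ) ∧
        ∀ (φ : MvPolynomial (Fin 2) k) (a M : ℤ), OrdGe (A.e c φ) a →
          ∃ K : ℝ, ∀ᶠ n in (U : Filter ℕ), ‖σ (eval ![y n, x n] φ) -
          ∑ j ∈ Finset.Ico a M, σ ((A.e c φ).coeff j) * z n ^ j‖ ≤ K * ‖z n‖ ^ M) ∧
      (T = none → ∀ φ : MvPolynomial (Fin 2) k,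
        ∃ K : ℝ, ∀ᶠ n in (U : Filter ℕ), ‖σ (eval ![y n, x n] φ)‖ ≤ K) := by
    intro σ
    by_cases hx : Tendsto (fun i => ‖σ (x i)‖) U atTop
    · obtain ⟨c, z, hz, hz0, hexp⟩ := A.approach σ U x y hker hx
      have hlim := A.tendsto_of_spec σ c hz hz0 (φ := X 1) (a := -(A.m c : ℤ)) fun M =>
        hexp (X 1) _ M (A.ordGe_X_one c)
      set b := σ ((A.e c (X 1)).coeff (-(A.m c : ℤ))) with hb
      have hX0 : A.e c (X 1) ≠ 0 := by
        intro h0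
        have := A.order_x c
        rw [h0, HahnSeries.order_zero] at this
        have := A.m_pos c
        omega
      have hb0 : b ≠ 0 := by
        rw [hb, _root_.map_ne_zero, ← A.order_x c]
        exact HahnSeries.coeff_order_eq_zero.not.2 hX0
      have hmpos : (0 : ℝ) < A.m c := by exact_mod_cast A.m_pos c
      have hlog := (hlim.norm).log (norm_ne_zero_iff.2 hb0)
      have hbd : ∀ᶠ n in (U : Filter ℕ), -log ‖z n‖ / h n ∈ Set.Icc (0 : ℝ) (2 / A.m c) := by
        have hlogz : Tendsto (fun n => log ‖z n‖) U atBot := by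
          refine tendsto_log_nhdsGT_zero.comp ?_
          rw [tendsto_nhdsWithin_iff]
          refine ⟨by simpa using hz.norm, ?_⟩
          filter_upwards [hz0] with n hn using norm_pos_iff.2 hn
        filter_upwards [hlog.eventually (eventually_ge_nhds (sub_one_lt _)), hlogz.eventually_le_atBot 0,
          hh.eventually_ge_atTop (1 - log ‖b‖), hh.eventually_gt_atTop 0, hz0,
          hx.eventually_gt_atTop 0] with n h1 h2 h3 h4 h5 h6
        refine ⟨div_nonneg (by linarith) h4.le, ?_⟩
        rw [div_le_div_iff₀ h4 hmpos]
        have e1 : eval ![y n, x n] (X 1 : MvPolynomial (Fin 2) k) = x n := by simp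
        rw [e1, norm_mul, norm_zpow, log_mul h6.ne' (zpow_ne_zero _ (norm_ne_zero_iff.2 h5)), log_zpow] at h1
        have h7 := hxh σ n
        push_cast at h1
        linarith
      obtain ⟨θ, hθ, hle⟩ := (isCompact_Icc (a := (0 : ℝ)) (b := 2 / A.m c)).ultrafilter_le_nhds
        (U.map fun n => -log ‖z n‖ / h n) (by
          rw [Filter.le_principal_iff]; exact hbd)
      refine ⟨some c, θ, z, hθ.1, ?_, by simp⟩
      rintro c' hc'
      cases hc'
      exact ⟨hz, hz0, hle, hexp⟩
    · have : ∃ B : ℝ, ∀ᶠ n in (U : Filter ℕ), ‖σ (x n)‖ ≤ B := by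
        rw [tendsto_atTop] at hx
        push Not at hx
        obtain ⟨B, hB⟩ := hx
        refine ⟨B, ?_⟩
        filter_upwards [hB] with n hn using hn.le
      obtain ⟨B, hB⟩ := this
      exact ⟨none, 0, 0, le_rfl, by simp, fun _ φ =>
        hm.bounded_of_bounded hN σ ((hker p).2 dvd_rfl) hB φ⟩
  choose T θ z h0 h1 h2 using key
  exact ⟨⟨hh, T, θ, z, h0, fun σ c hc => (h1 σ c hc).1, fun σ c hc => (h1 σ c hc).2.1,
    fun σ c hc => (h1 σ c hc).2.2.1, fun σ c hc => (h1 σ c hc).2.2.2, h2⟩⟩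

namespace CuspLimits
variable {A : Cusps p N} {U : Ultrafilter ℕ} {x y : ℕ → k} {h : ℕ → ℝ} (W : CuspLimits A U x y h)
include W

lemma norm_le {σ : k →+* ℂ} {c : A.ι} (hc : W.T σ = some c) {φ : MvPolynomial (Fin 2) k} {a : ℤ}
    (ha : OrdGe (A.e c φ) a) :
    ∃ K : ℝ, ∀ᶠ n in (U : Filter ℕ), ‖σ (eval ![y n, x n] φ)‖ ≤ K * ‖W.z σ n‖ ^ a := by
  simpa using W.expansion σ c hc φ a a ha

lemma tendsto_mul_zpow [CharZero k] {σ : k →+* ℂ} {c : A.ι} (hc : W.T σ = some c)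
    {φ : MvPolynomial (Fin 2) k} {a : ℤ} (ha : OrdGe (A.e c φ) a) :
    Tendsto (fun n => σ (eval ![y n, x n] φ) * W.z σ n ^ (-a)) U (𝓝 (σ ((A.e c φ).coeff a))) :=
  A.tendsto_of_spec σ c (W.tendsto_z σ c hc) (W.z_ne σ c hc) fun M => W.expansion σ c hc φ a M ha

/-- The asymptotic size of a function at the points, relative to `h`. -/
lemma exists_log_le {φ : MvPolynomial (Fin 2) k} {v : A.ι → ℤ} (hv : ∀ c, OrdGe (A.e c φ) (v c))
    (h0 : ∀ᶠ n in (U : Filter ℕ), eval ![y n, x n] φ ≠ 0) (σ : k →+* ℂ) :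
    ∃ g : ℕ → ℝ, Tendsto g U (𝓝 (-(W.T σ).elim 0 fun c => v c * W.θ σ)) ∧
      ∀ᶠ n in (U : Filter ℕ), log ‖σ (eval ![y n, x n] φ)‖ / h n ≤ g n := by
  have hC : ∀ C : ℝ, Tendsto (fun n => C / h n) U (𝓝 0) := fun C =>
    tendsto_const_nhds.div_atTop W.tendsto_h
  rcases hc : W.T σ with _ | c
  · obtain ⟨K, hK⟩ := W.bounded σ hc φ
    refine ⟨fun n => log K / h n, by simpa using hC _, ?_⟩
    filter_upwards [hK, h0, W.tendsto_h.eventually_gt_atTop 0] with n h1 h2 h3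
    have := norm_pos_iff.2 ((_root_.map_ne_zero σ).2 h2)
    gcongr
  · obtain ⟨K, hK⟩ := W.norm_le hc (hv c)
    refine ⟨fun n => log K / h n + (-(v c) : ℝ) * (-log ‖W.z σ n‖ / h n), ?_, ?_⟩
    · simpa using (hC (log K)).add ((W.tendsto_log σ c hc).const_mul (-(v c) : ℝ))
    filter_upwards [hK, h0, W.z_ne σ c hc, W.tendsto_h.eventually_gt_atTop 0] with n h1 h2 h4 h3
    have h5 := norm_pos_iff.2 ((_root_.map_ne_zero σ).2 h2)
    have h6 : 0 < ‖W.z σ n‖ ^ v c := zpow_pos (norm_pos_iff.2 h4) _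
    have hKpos : 0 < K := by
      by_contra hK0
      have := mul_nonpos_of_nonpos_of_nonneg (not_lt.1 hK0) h6.le
      linarith
    have h7 := log_le_log h5 h1
    rw [log_mul hKpos.ne' h6.ne', log_zpow] at h7
    rw [mul_div_assoc', ← add_div]
    gcongr
    linarith

end CuspLimits
end CuspLimits
end

section
open MvPolynomial NumberField

section ProductFormula
open Filter Topology Real

variable {Ω : Type} [Field Ω] [CharZero Ω] [Algebra.IsAlgebraic ℚ Ω]

lemma exists_embedding_extension {F : Type*} [Field F] (i : F →+* Ω) (w : F →+* ℂ) :
    ∃ σ : Ω →+* ℂ, σ.comp i = w := by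
  haveI : CharZero F := i.charZero
  letI := i.toAlgebra
  letI := w.toAlgebra
  haveI : Algebra.IsAlgebraic F Ω := Algebra.IsAlgebraic.tower_top (K := ℚ) F
  refine ⟨(IsAlgClosed.lift : Ω →ₐ[F] ℂ).toRingHom, RingHom.ext fun a => ?_⟩
  exact (IsAlgClosed.lift : Ω →ₐ[F] ℂ).commutes a

/-- A chosen extension of an embedding. -/
noncomputable def extendEmbedding {F : Type*} [Field F] (i : F →+* Ω) (w : F →+* ℂ) : Ω →+* ℂ :=
  (exists_embedding_extension i w).choose

lemma extendEmbedding_apply {F : Type*} [Field F] (i : F →+* Ω) (w : F →+* ℂ) (a : F) :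
    extendEmbedding i w (i a) = w a :=
  RingHom.congr_fun (exists_embedding_extension i w).choose_spec a

lemma exists_numberField_containing {K : Type*} [Field K] [NumberField K] (j : K →+* Ω) (E : Set Ω)
    (hE : E.Finite) : ∃ (F : Type) (_ : Field F) (_ : NumberField F) (i : F →+* Ω) (r : K →+* F),
      i.comp r = j ∧ ∀ e ∈ E, e ∈ i.range := by
  let jA : K →ₐ[ℚ] Ω := j.toRatAlgHom
  haveI : FiniteDimensional ℚ jA.fieldRange := by
    exact LinearEquiv.finiteDimensional (AlgEquiv.ofInjectiveField jA).toLinearEquiv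
  haveI : FiniteDimensional ℚ (IntermediateField.adjoin ℚ E) := by
    haveI := hE.to_subtype
    exact IntermediateField.finiteDimensional_adjoin fun e _ => (Algebra.IsAlgebraic.isAlgebraic e).isIntegral
  let F := jA.fieldRange ⊔ IntermediateField.adjoin ℚ E
  haveI : NumberField F := { to_charZero := inferInstance, to_finiteDimensional := inferInstance }
  refine ⟨F, inferInstance, inferInstance, algebraMap F Ω,
    ((IntermediateField.inclusion (le_sup_left : jA.fieldRange ≤ F)).toRingHom).comp
      jA.rangeRestrict.toRingHom, ?_, fun e he => ?_⟩
  · ext a; rfl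
  · exact ⟨⟨e, (le_sup_right : IntermediateField.adjoin ℚ E ≤ F) (IntermediateField.subset_adjoin ℚ E he)⟩, rfl⟩

lemma exists_pos_isIntegral_eval {F : Type*} [Field F] [NumberField F] (f : MvPolynomial (Fin 2) F) :
    ∃ D : ℕ, 0 < D ∧ ∀ a : Fin 2 → F, (∀ s, IsIntegral ℤ (a s)) → IsIntegral ℤ (D * eval a f) := by
  obtain ⟨D, hD, h⟩ := exists_common_denominator (F := F) (I := f.support) fun d => f.coeff d
  refine ⟨D, hD, fun a ha => ?_⟩
  rw [eval_eq', Finset.mul_sum]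
  refine IsIntegral.sum _ fun d hd => ?_
  rw [← mul_assoc]
  exact (h ⟨d, hd⟩).mul (IsIntegral.prod _ fun s _ => (ha s).pow _)

lemma eval_map_pair {F L : Type*} [CommRing F] [CommRing L] (i : F →+* L) (a b : F) (f : MvPolynomial (Fin 2) F) :
    eval ![i a, i b] (map i f) = i (eval ![a, b] f) := by
  rw [eval_map, ← coe_eval₂Hom, ← RingHom.comp_apply i]
  refine RingHom.congr_fun (MvPolynomial.ringHom_ext (fun r => ?_) fun s => ?_) f
  · simp
  · fin_cases s <;> simp

namespace CuspLimits
variable {p : MvPolynomial (Fin 2) Ω} {N : ℕ}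
variable {A : Cusps p N} {U : Ultrafilter ℕ} {x y : ℕ → Ω} {h : ℕ → ℝ} (W : CuspLimits A U x y h)

/-- The weighted contribution of an embedding. -/
noncomputable def weight (τ : A.ι → ℤ) (σ : Ω →+* ℂ) : ℝ := (W.T σ).elim 0 fun c => τ c * W.θ σ

theorem sum_weight_nonpos {F : Type} [Field F] [NumberField F] (i : F →+* Ω)
    (hx : ∀ n, ∃ a : 𝓞 F, i a = x n) (hy : ∀ n, ∃ a : 𝓞 F, i a = y n)
    (f : MvPolynomial (Fin 2) F) (h0 : ∀ᶠ n in (U : Filter ℕ), eval ![y n, x n] (map i f) ≠ 0)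
    (v : A.ι → ℤ) (hv : ∀ c, OrdGe (A.e c (map i f)) (v c)) :
    ∑ w : F →+* ℂ, W.weight v (extendEmbedding i w) ≤ 0 := by
  classical
  choose a ha using hx
  choose b hb using hy
  obtain ⟨D, hD, h_intgr⟩ := exists_pos_isIntegral_eval f
  choose g hg hle using fun w : F →+* ℂ => W.exists_log_le hv h0 (extendEmbedding i w)
  have hC : Tendsto (fun n => ∑ w : F →+* ℂ, (log D / h n + g w n)) U
      (𝓝 (∑ w : F →+* ℂ, (0 + -W.weight v (extendEmbedding i w)))) :=
    tendsto_finsetSum _ fun w _ => (tendsto_const_nhds.div_atTop W.tendsto_h).add (hg w)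
  have hnn : 0 ≤ ∑ w : F →+* ℂ, (0 + -W.weight v (extendEmbedding i w)) := by
    refine ge_of_tendsto hC ?_
    filter_upwards [h0, eventually_all.2 hle, W.tendsto_h.eventually_gt_atTop 0] with n hn hlen hh
    have hval : eval ![y n, x n] (map i f) = i (eval ![(b n : F), (a n : F)] f) := by
      rw [← eval_map_pair, ha, hb]
    have hne : eval ![(b n : F), (a n : F)] f ≠ 0 := by
      intro h1; rw [hval, h1, _root_.map_zero] at hn; exact hn rfl
    have hDF : (D : F) ≠ 0 := by exact_mod_cast hD.ne'
    have h2 := sum_log_embeddings_nonneg (⟨_, h_intgr ![(b n : F), (a n : F)] (by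
      intro s; fin_cases s
      · exact (b n).2
      · exact (a n).2)⟩ : 𝓞 F) (fun hc => mul_ne_zero hDF hne (congrArg Subtype.val hc))
    have h2' : 0 ≤ ∑ w : F →+* ℂ, log ‖w (D * eval ![(b n : F), (a n : F)] f)‖ := h2
    refine (div_nonneg h2' hh.le).trans ?_
    rw [Finset.sum_div]
    refine Finset.sum_le_sum fun w _ => ?_
    have h3 := hlen w
    rw [hval, extendEmbedding_apply] at h3
    rw [map_mul, map_natCast, norm_mul, Complex.norm_natCast, log_mul (by exact_mod_cast hD.ne')
      (norm_ne_zero_iff.2 ((_root_.map_ne_zero w).2 hne)), add_div]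
    linarith
  simp only [zero_add, Finset.sum_neg_distrib] at hnn
  linarith

/-- Some embedding of the base field always sees the points go to infinity. -/
def Active {K : Type*} [Field K] (j : K →+* Ω) : Prop :=
  ∃ v : K →+* ℂ, ∀ σ : Ω →+* ℂ, σ.comp j = v → ∃ c, W.T σ = some c ∧ 0 < W.θ σ

lemma Active.exists_embedding {W : CuspLimits A U x y h} {K : Type*} [Field K] {j : K →+* Ω} (hj : W.Active j) {F : Type*} [Field F]
    {i : F →+* Ω} {r : K →+* F} (hr : i.comp r = j) :
    ∃ (w : F →+* ℂ) (c : A.ι), W.T (extendEmbedding i w) = some c ∧ 0 < W.θ (extendEmbedding i w) := by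
  obtain ⟨v, hv⟩ := hj
  obtain ⟨σ, hσ⟩ := exists_embedding_extension j v
  refine ⟨σ.comp i, hv _ ?_⟩
  rw [← hσ, ← hr]
  ext a
  simp [extendEmbedding_apply]

theorem active {K : Type*} [Field K] [NumberField K] (j : K →+* Ω) (xK : ℕ → K)
    (hxK : ∀ n, j (xK n) = x n) (hh : ∀ n, h n ≤ ∑ v : K →+* ℂ, log⁺ ‖v (xK n)‖) : W.Active j := by
  classical
  have hcard : 0 < (Fintype.card (K →+* ℂ) : ℝ) := by
    have : Nonempty (K →+* ℂ) := inferInstance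
    exact_mod_cast Fintype.card_pos
  obtain ⟨v, hv⟩ : ∃ v : K →+* ℂ, ∀ᶠ n in (U : Filter ℕ), h n / Fintype.card (K →+* ℂ) ≤ log⁺ ‖v (xK n)‖ := by
    by_contra! hcon
    have h1 := eventually_all.2 fun v => hcon v
    obtain ⟨n, hn⟩ := h1.exists
    have : ∑ v : K →+* ℂ, log⁺ ‖v (xK n)‖ < ∑ v : K →+* ℂ, h n / Fintype.card (K →+* ℂ) :=
      Finset.sum_lt_sum_of_nonempty Finset.univ_nonempty fun v _ => hn v
    rw [Finset.sum_const, Finset.card_univ, nsmul_eq_mul, mul_div_cancel₀ _ hcard.ne'] at this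
    linarith [hh n]
  refine ⟨v, fun σ hσ => ?_⟩
  have hσx : ∀ n, σ (eval ![y n, x n] (X 1)) = v (xK n) := by
    intro n; rw [← hσ]; simp [hxK]
  have hbig : ∀ᶠ n in (U : Filter ℕ), 0 < h n ∧ h n / Fintype.card (K →+* ℂ) ≤ log ‖σ (eval ![y n, x n] (X 1))‖ := by
    filter_upwards [hv, W.tendsto_h.eventually_gt_atTop 0] with n hn h0
    refine ⟨h0, ?_⟩
    rw [hσx]
    rcases le_total 0 (log ‖v (xK n)‖) with h1 | h1
    · rwa [show log⁺ ‖v (xK n)‖ = max 0 (log ‖v (xK n)‖) from rfl, max_eq_right h1] at hn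
    · rw [posLog_apply, max_eq_left h1] at hn
      have : 0 < h n / Fintype.card (K →+* ℂ) := by positivity
      linarith
  rcases hc : W.T σ with _ | c
  · exfalso
    obtain ⟨B, hB⟩ := W.bounded σ hc (X 1)
    have h1 := (W.tendsto_h.eventually_gt_atTop (Fintype.card (K →+* ℂ) * log B)).and (hB.and hbig)
    obtain ⟨n, h2, h3, h4, h5⟩ := h1.exists
    have h6 : 0 < ‖σ (eval ![y n, x n] (X 1))‖ := by
      rcases (norm_nonneg (σ (eval ![y n, x n] (X 1)))).eq_or_lt with h7 | h7
      · rw [← h7, log_zero] at h5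
        have : 0 < h n / Fintype.card (K →+* ℂ) := by positivity
        linarith
      · exact h7
    have h7 := h5.trans (log_le_log h6 h3)
    rw [div_le_iff₀ hcard] at h7
    linarith
  · refine ⟨c, rfl, ?_⟩
    have hne : ∀ᶠ n in (U : Filter ℕ), eval ![y n, x n] (X 1 : MvPolynomial (Fin 2) Ω) ≠ 0 := by
      filter_upwards [hbig] with n hn h0
      rw [h0, _root_.map_zero, norm_zero, log_zero] at hn
      have : 0 < h n / Fintype.card (K →+* ℂ) := div_pos hn.1 hcard
      linarith [hn.2]
    obtain ⟨g, hg, hle⟩ := W.exists_log_le (v := fun c => -(A.m c : ℤ)) A.ordGe_X_one hne σ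
    rw [hc] at hg
    have : 1 / (Fintype.card (K →+* ℂ) : ℝ) ≤ -(Option.elim (some c) 0 fun c => ((-(A.m c : ℤ) : ℤ) : ℝ) * W.θ σ) := by
      refine ge_of_tendsto hg ?_
      filter_upwards [hle, hbig] with n h1 h2
      refine le_trans ?_ h1
      rw [le_div_iff₀ h2.1]
      calc _ = h n / Fintype.card (K →+* ℂ) := by ring
        _ ≤ _ := h2.2
    have h3 : 0 < 1 / (Fintype.card (K →+* ℂ) : ℝ) := by positivity
    have h4 : (0 : ℝ) < A.m c * W.θ σ := by
      refine h3.trans_le (this.trans (le_of_eq ?_))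
      simp
    exact pos_of_mul_pos_right h4 (Nat.cast_nonneg _)

lemma exists_map_eq {F : Type*} [Field F] (i : F →+* Ω) (φ : MvPolynomial (Fin 2) Ω)
    (h : ∀ d ∈ φ.support, φ.coeff d ∈ i.range) : ∃ f, MvPolynomial.map i f = φ := by
  have : φ ∈ Set.range (MvPolynomial.map (σ := Fin 2) i) := by
    rw [mem_range_map_iff_coeffs_subset]
    intro r hr
    rw [Finset.mem_coe, mem_coeffs_iff] at hr
    obtain ⟨d, hd, rfl⟩ := hr
    exact h d hd
  exact this

variable {K : Type*} [Field K] [NumberField K] {j : K →+* Ω} {xK yK : ℕ → 𝓞 K}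
  (hx : ∀ n, j (xK n) = x n) (hy : ∀ n, j (yK n) = y n)

include hx in
omit [CharZero Ω] [Algebra.IsAlgebraic ℚ Ω] in
lemma exists_ringOfIntegers {F : Type*} [Field F] [NumberField F] {i : F →+* Ω} {r : K →+* F}
    (hr : i.comp r = j) (n : ℕ) : ∃ a : 𝓞 F, i a = x n := by
  refine ⟨⟨r (xK n), ((xK n).2.map r.toIntAlgHom)⟩, ?_⟩
  rw [← hx, ← hr]; rfl

include hx hy in
theorem dvd_of_ordGe_one (hker : ∀ φ, ¬ p ∣ φ → ∀ᶠ n in (U : Filter ℕ), eval ![y n, x n] φ ≠ 0)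
    (hW : W.Active j) (φ : MvPolynomial (Fin 2) Ω) (hφ : ∀ c, OrdGe (A.e c φ) 1) : p ∣ φ := by
  classical
  by_contra hn
  obtain ⟨F, _, _, i, r, hr, hE⟩ := exists_numberField_containing j _ ((φ.support.image φ.coeff).finite_toSet)
  obtain ⟨f, rfl⟩ := exists_map_eq i φ fun d hd => hE _ (by
    simpa using ⟨d, by simpa using hd, rfl⟩)
  have h1 := W.sum_weight_nonpos i (exists_ringOfIntegers hx hr) (exists_ringOfIntegers hy hr) f
    (hker _ hn) 1 hφ
  obtain ⟨w, c, hc, hθ⟩ := hW.exists_embedding hr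
  have h2 : 0 < ∑ w : F →+* ℂ, W.weight 1 (extendEmbedding i w) := by
    refine Finset.sum_pos' (fun w _ => ?_) ⟨w, Finset.mem_univ _, ?_⟩
    · rw [weight]
      cases W.T (extendEmbedding i w) <;> simp [W.θ_nonneg]
    · simpa [weight, hc] using hθ
  linarith

include hx hy in
theorem exists_weight_pos [IsAlgClosed Ω] (hm : MonicIn p N) (hN : 0 < N)
    (hker : ∀ φ, ¬ p ∣ φ → ∀ᶠ n in (U : Filter ℕ), eval ![y n, x n] φ ≠ 0)
    (hW : W.Active j) {κ : ℕ} (hκ : ∀ j, ((toBi Ω p).coeff j).natDegree ≤ κ)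
    (τ : A.ι → ℤ) (hτ : 0 < ∑ c, τ c) :
    ∃ E : Set Ω, E.Finite ∧ ∀ (F : Type) [Field F] [NumberField F] (i : F →+* Ω) (r : K →+* F),
      i.comp r = j → (∀ e ∈ E, e ∈ i.range) → 0 < ∑ w : F →+* ℂ, W.weight τ (extendEmbedding i w) := by
  classical
  set t : ℤ := κ * N ^ 2 + 1 + Fintype.card A.ι with ht
  have ht0 : 0 < t := by positivity
  obtain ⟨ψ, hψ, hψo⟩ := A.exists_many hm hN hκ (fun c => 1 - t * τ c) 1 (by
    rw [Finset.sum_sub_distrib, ← Finset.mul_sum, Finset.sum_const, Finset.card_univ]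
    push_cast [nsmul_eq_mul]
    nlinarith)
  have hψ0 : ¬ p ∣ ψ 0 := by
    intro hd
    have := hψ (fun _ => 1) (by simpa using hd)
    simpa using congrFun this 0
  refine ⟨_, ((ψ 0).support.image (ψ 0).coeff).finite_toSet, fun F _ _ i r hr hE => ?_⟩
  obtain ⟨f, hf⟩ := exists_map_eq i (ψ 0) fun d hd => hE _ (by
    simpa using ⟨d, by simpa using hd, rfl⟩)
  have h1 := W.sum_weight_nonpos i (exists_ringOfIntegers hx hr) (exists_ringOfIntegers hy hr) f
    (hf ▸ hker _ hψ0) _ (hf ▸ hψo 0)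
  obtain ⟨w, c, hc, hθ⟩ := hW.exists_embedding hr
  have h2 : 0 < ∑ w : F →+* ℂ, W.weight 1 (extendEmbedding i w) := by
    refine Finset.sum_pos' (fun w _ => ?_) ⟨w, Finset.mem_univ _, ?_⟩
    · rw [weight]
      cases W.T (extendEmbedding i w) <;> simp [W.θ_nonneg]
    · simpa [weight, hc] using hθ
  have h3 : ∀ σ, W.weight (fun c => 1 - t * τ c) σ = W.weight 1 σ - t * W.weight τ σ := by
    intro σ
    simp only [weight]
    cases W.T σ
    · simp
    · simp; ring
  simp only [h3, Finset.sum_sub_distrib, ← Finset.mul_sum] at h1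
  have ht' : (0 : ℝ) < t := by exact_mod_cast ht0
  by_contra! hle
  nlinarith
end CuspLimits
end ProductFormula
end

section
open MvPolynomial NumberField

section Points
open Filter Topology Real

variable {Ω : Type} [Field Ω] [CharZero Ω] [Algebra.IsAlgebraic ℚ Ω]

theorem exists_cuspLimits_of_infinite {p : MvPolynomial (Fin 2) Ω} {N : ℕ} (A : Cusps p N)
    (hp : Irreducible p) (hm : MonicIn p N) (hN : 0 < N)
    {K : Type*} [Field K] [NumberField K] (j : K →+* Ω)
    (hinf : {a : 𝓞 K × 𝓞 K | eval ![j a.1, j a.2] p = 0}.Infinite) :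
    ∃ (U : Ultrafilter ℕ) (xK yK : ℕ → 𝓞 K) (h : ℕ → ℝ)
      (W : CuspLimits A U (fun n => j (xK n)) (fun n => j (yK n)) h),
      W.Active j ∧ ∀ φ, ¬ p ∣ φ → ∀ᶠ n in (U : Filter ℕ), eval ![j (yK n), j (xK n)] φ ≠ 0 := by
  classical
  let pt := hinf.natEmbedding
  let xK : ℕ → 𝓞 K := fun n => (pt n).1.2
  let yK : ℕ → 𝓞 K := fun n => (pt n).1.1
  have hp0 : ∀ n, eval ![j (yK n), j (xK n)] p = 0 := fun n => (pt n).2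
  have hjinj : Function.Injective fun n => (j (yK n), j (xK n)) := by
    intro n m hnm
    obtain ⟨h1, h2⟩ := Prod.mk.inj hnm
    refine pt.injective (Subtype.ext (Prod.ext ?_ ?_))
    · exact RingOfIntegers.coe_injective (j.injective h1)
    · exact RingOfIntegers.coe_injective (j.injective h2)
  let h : ℕ → ℝ := fun n => ∑ v : K →+* ℂ, log⁺ ‖v (xK n)‖
  have hh : Tendsto h cofinite atTop := by
    rw [tendsto_atTop]
    intro B
    rw [eventually_cofinite]
    have hfin := Embeddings.finite_of_norm_le K ℂ (exp B)
    have h2 := hfin.biUnion fun a _ => ((hm.finite_fiber (j a)).image fun b => (b, j a))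
    refine (h2.preimage hjinj.injOn).subset fun n hn => ?_
    simp only [Set.mem_preimage, Set.mem_iUnion, Set.mem_image]
    refine ⟨xK n, ⟨(xK n).2, fun v => ?_⟩, j (yK n), hp0 n, rfl⟩
    have h3 : log⁺ ‖v (xK n)‖ ≤ h n :=
      Finset.single_le_sum (f := fun v : K →+* ℂ => log⁺ ‖v (xK n : K)‖) (fun _ _ => posLog_nonneg) (Finset.mem_univ v)
    have h4 : log ‖v (xK n)‖ ≤ B := (le_max_right _ _).trans (h3.trans (not_le.1 hn).le)
    exact le_exp_of_log_le h4
  let U := hyperfilter ℕ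
  have hU : (U : Filter ℕ) ≤ cofinite := hyperfilter_le_cofinite
  have hker : ∀ φ, ¬ p ∣ φ → ∀ᶠ n in (U : Filter ℕ), eval ![j (yK n), j (xK n)] φ ≠ 0 := by
    intro φ hφ
    refine hU ?_
    rw [mem_cofinite]
    refine ((hm.finite_common_zeros hp hN hφ).preimage hjinj.injOn).subset fun n hn => ?_
    exact ⟨hp0 n, by simpa using hn⟩
  have hker' : ∀ φ, (∀ᶠ i in (U : Filter ℕ), eval ![j (yK i), j (xK i)] φ = 0) ↔ p ∣ φ := by
    refine fun φ => ⟨fun h0 => ?_, ?_⟩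
    · by_contra hn
      obtain ⟨n, h1, h2⟩ := (h0.and (hker φ hn)).exists
      exact h2 h1
    · rintro ⟨q, rfl⟩
      exact Eventually.of_forall fun n => by rw [map_mul, hp0, zero_mul]
  obtain ⟨W⟩ := exists_cuspLimits A hm hN U (fun n => j (xK n)) (fun n => j (yK n)) h (hh.mono_left hU)
    hker' fun σ n => by
      have h3 : log⁺ ‖(σ.comp j) (xK n)‖ ≤ h n :=
        Finset.single_le_sum (f := fun v : K →+* ℂ => log⁺ ‖v (xK n : K)‖) (fun _ _ => posLog_nonneg)
          (Finset.mem_univ (σ.comp j))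
      exact (le_max_right _ _).trans h3
  exact ⟨U, xK, yK, h, W, W.active j (fun n => xK n) (fun n => rfl) (fun n => le_rfl), hker⟩

end Points
end

section
open MvPolynomial NumberField

section Parameters

lemma thue_parameters_count {N κ n S card : ℕ} (hN : 0 < N) (hn : 0 < n) (hS : 2 * n + 1 ≤ S)
    (hc : N * (n * S * (κ * N + 4)) ≤ card + κ * N ^ 2) :
    S * ∑ u : Fin (2 * N * n * (κ * N + 4) + 1), (2 * N * n * (κ * N + 4) + 1 - (u : ℕ)) <
      N * S * (κ * N + 4) * card := by
  set t := κ * N + 4 with ht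
  have hsum : ∑ u : Fin (2 * N * n * t + 1), (2 * N * n * t + 1 - (u : ℕ)) =
      (2 * N * n * t + 1) * (N * n * t + 1) := by
    rw [Fin.sum_univ_eq_sum_range (fun u => 2 * N * n * t + 1 - u),
      Finset.sum_range_reflect (fun u => u + 1) (2 * N * n * t + 1) |>.symm.trans
        (Finset.sum_congr rfl fun u hu => by have := Finset.mem_range.1 hu; omega) |>.symm]
    rw [Finset.sum_add_distrib, Finset.sum_const, Finset.card_range]
    have := Finset.sum_range_id_mul_two (2 * N * n * t + 1)
    simp only [Nat.add_sub_cancel, smul_eq_mul, mul_one] at this ⊢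
    nlinarith
  rw [hsum]
  have hS0 : 0 < S := by omega
  have h1 : (2 * N * n * t + 1) * (N * n * t + 1) < N * t * card := by
    have e1 : N * t * (N * (n * (2 * n + 1) * t)) ≤ N * t * (card + κ * N ^ 2) := by
      refine Nat.mul_le_mul_left _ (le_trans ?_ hc)
      gcongr
    have hNn : 1 ≤ N * n := Nat.mul_pos hN hn
    have e2 : N * t * (N * n * t) ≥ 3 * (N * n * t) + 2 + N * t * (κ * N ^ 2) := by
      have h4 : N * n * t * (N * t) = N * n * t * (N * (κ * N)) + 4 * (N * n * t) * N := by rw [ht]; ring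
      have h5 : N * t * (κ * N ^ 2) ≤ N * n * t * (N * (κ * N)) := by
        calc N * t * (κ * N ^ 2) = 1 * (N * t * (κ * N ^ 2)) := (one_mul _).symm
          _ ≤ n * (N * t * (κ * N ^ 2)) := Nat.mul_le_mul_right _ hn
          _ = _ := by ring
      have h6 : 4 * (N * n * t) ≤ 4 * (N * n * t) * N := Nat.le_mul_of_pos_right _ hN
      have h7 : 4 ≤ N * n * t := by
        calc 4 ≤ t := by omega
          _ ≤ N * n * t := Nat.le_mul_of_pos_left _ hNn
      nlinarith
    nlinarith
  calc S * ((2 * N * n * t + 1) * (N * n * t + 1)) < S * (N * t * card) := Nat.mul_lt_mul_of_pos_left h1 hS0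
    _ = _ := by ring

end Parameters

section Monomials
variable {k : Type*} [Field k] {p : MvPolynomial (Fin 2) k} {N : ℕ}

lemma Cusps.exists_coeff_bound (A : Cusps p N) (hm : MonicIn p N) (κ D : ℕ) (c : A.ι) (a : ℤ)
    (ha : ∀ s : MonIx N κ D, OrdGe (A.e c (monFn k s)) a) :
    ∃ J₀ : ℤ, ∀ γ : MonIx N κ D → k, γ ≠ 0 → ∃ i ∈ Finset.Ico a J₀,
      ∑ s, γ s * (A.e c (monFn k s)).coeff i ≠ 0 := by
  classical
  let V : ℕ →o (Submodule k (MonIx N κ D → k))ᵒᵈ :=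
    { toFun := fun n => OrderDual.toDual
        { carrier := {γ | ∀ i < a + n, ∑ s, γ s * (A.e c (monFn k s)).coeff i = 0}
          add_mem' := by
            intro γ δ h1 h2 i hi
            simp [add_mul, Finset.sum_add_distrib, h1 i hi, h2 i hi]
          zero_mem' := by intro i hi; simp
          smul_mem' := by
            intro r γ h1 i hi
            simp only [Pi.smul_apply, smul_eq_mul, mul_assoc, ← Finset.mul_sum]
            rw [h1 i hi, mul_zero] }
      monotone' := by
        intro n m hnm γ hγ i hi
        exact hγ i (hi.trans_le (by have : (n : ℤ) ≤ m := by exact_mod_cast hnm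
                                    omega)) }
  obtain ⟨n, hn⟩ := IsArtinian.monotone_stabilizes V
  refine ⟨a + n, fun γ hγ => ?_⟩
  by_contra! hcon
  have hlow : ∀ i < a, ∑ s, γ s * (A.e c (monFn k s)).coeff i = 0 := fun i hi =>
    Finset.sum_eq_zero fun s _ => by rw [ha s i hi, mul_zero]
  have hmem : ∀ m, n ≤ m → γ ∈ OrderDual.ofDual (V m) := by
    intro m hm
    rw [← hn m hm]
    intro i hi
    by_cases h1 : i < a
    · exact hlow i h1
    · exact hcon i (Finset.mem_Ico.2 ⟨not_lt.1 h1, hi⟩)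
  refine hγ (hm.monFn_indep γ ((A.ker c _).1 ?_))
  ext i
  rw [A.coeff_e_sum, HahnSeries.coeff_zero]
  exact hmem (max n (i - a + 1).toNat) (le_max_left _ _) i (by push_cast; omega)

end Monomials
end

section
open MvPolynomial NumberField

section Thue
open Filter Topology Real

variable {Ω : Type} [Field Ω] [CharZero Ω] [Algebra.IsAlgebraic ℚ Ω]

namespace CuspLimits
variable {p Q : MvPolynomial (Fin 2) Ω} {N : ℕ}
variable {A : Cusps p N} {U : Ultrafilter ℕ} {x y : ℕ → Ω} {h : ℕ → ℝ} (W : CuspLimits A U x y h)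
variable (hp : Irreducible p) (hJ : hamDer p Q = 1)
variable {K : Type*} [Field K] [NumberField K] {j : K →+* Ω} {xK yK : ℕ → 𝓞 K}
  (hx : ∀ n, j (xK n) = x n) (hy : ∀ n, j (yK n) = y n)
  (hker : ∀ φ, ¬ p ∣ φ → ∀ᶠ n in (U : Filter ℕ), eval ![y n, x n] φ ≠ 0) (hW : W.Active j)

include hx hy hker hW in
theorem exists_embedding_exponent_neg (QK : MvPolynomial (Fin 2) K) (hQ : map j QK = Q)
    {F : Type} [Field F] [NumberField F] {i : F →+* Ω} {r : K →+* F} (hr : i.comp r = j)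
    (hval : ∀ c, A.value hp hJ c ∈ i.range) :
    ∃ (w : F →+* ℂ) (c : A.ι), W.T (extendEmbedding i w) = some c ∧
      A.exponent hp hJ c < 0 ∧ 0 < W.θ (extendEmbedding i w) := by
  classical
  by_contra! hcon
  obtain ⟨w, c, hc, hθ⟩ := hW.exists_embedding hr
  have hle : ∀ w c, W.T (extendEmbedding i w) = some c → A.exponent hp hJ c < 0 →
      W.θ (extendEmbedding i w) = 0 := fun w c h1 h2 => le_antisymm (hcon w c h1 h2) (W.θ_nonneg _)
  have hpos : 0 < A.exponent hp hJ c := by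
    rcases lt_trichotomy (A.exponent hp hJ c) 0 with h1 | h1 | h1
    · rw [hle w c hc h1] at hθ; exact absurd hθ (lt_irrefl _)
    · exact absurd h1 (A.exponent_spec hp hJ c).1
    · exact h1
  obtain ⟨b, hb⟩ := hval c
  have hf : map i (map r QK - C b) = Q - C (A.value hp hJ c) := by
    rw [map_sub, MvPolynomial.map_map, hr, hQ, map_C, hb]
  set v : A.ι → ℤ := fun d => if d = c then 1 else if 0 < A.exponent hp hJ d then 0
    else A.exponent hp hJ d with hv
  have h1 := W.sum_weight_nonpos i (exists_ringOfIntegers hx hr) (exists_ringOfIntegers hy hr)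
    (map r QK - C b) (by rw [hf]; exact hker _ (Cusps.not_dvd_sub_C hp hJ _)) v (by
      intro d
      rw [hf]
      obtain ⟨e0, e1, -, e3⟩ := A.exponent_spec hp hJ d
      rw [hv]
      dsimp only
      split_ifs with g1 g2
      · subst g1; exact e1.mono (by omega)
      · have : Q - C (A.value hp hJ c) = (Q - C (A.value hp hJ d)) + C (A.value hp hJ d - A.value hp hJ c) := by
          rw [map_sub]; ring
        rw [this, map_add, A.e_C]
        exact (e1.mono g2.le).add (ordGe_C _)
      · have : Q - C (A.value hp hJ c) = (Q - C (A.value hp hJ d)) + C (A.value hp hJ d - A.value hp hJ c) := by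
          rw [map_sub]; ring
        rw [this, map_add, A.e_C]
        exact e1.add ((ordGe_C _).mono (not_lt.1 g2)))
  have h2 : 0 < ∑ w : F →+* ℂ, W.weight v (extendEmbedding i w) := by
    refine Finset.sum_pos' (fun w _ => ?_) ⟨w, Finset.mem_univ _, ?_⟩
    · rw [weight]
      rcases hd : W.T (extendEmbedding i w) with _ | d
      · simp
      · simp only [Option.elim_some, hv]
        split_ifs with g1 g2
        · simpa using W.θ_nonneg _
        · simp
        · rw [hle w d hd (lt_of_le_of_ne (not_lt.1 g2) (A.exponent_spec hp hJ d).1), mul_zero]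
    · simpa [weight, hc, hv] using hθ
  linarith

include hx hy hker hW in
theorem sum_exponent_nonpos [IsAlgClosed Ω] (hm : MonicIn p N) (hN : 0 < N)
    {κ : ℕ} (hκ : ∀ j, ((toBi Ω p).coeff j).natDegree ≤ κ)
    (QK : MvPolynomial (Fin 2) (𝓞 K)) (hQ : map (j.comp (algebraMap (𝓞 K) K)) QK = Q) :
    ∑ c, A.exponent hp hJ c ≤ 0 := by
  classical
  by_contra! hsum
  have hQK : map j (map (algebraMap (𝓞 K) K) QK) = Q := by rw [MvPolynomial.map_map, hQ]
  set E : A.ι → ℤ := A.exponent hp hJ with hE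
  set val : A.ι → Ω := A.value hp hJ with hval
  have hE0 : ∀ c, E c ≠ 0 := fun c => (A.exponent_spec hp hJ c).1
  have hEord : ∀ c, OrdGe (A.e c (Q - C (val c))) (E c) := fun c => (A.exponent_spec hp hJ c).2.1
  have hElead : ∀ c, (A.e c (Q - C (val c))).coeff (E c) ≠ 0 := fun c => (A.exponent_spec hp hJ c).2.2.1
  have hEval : ∀ c, E c < 0 → val c = 0 := fun c => (A.exponent_spec hp hJ c).2.2.2
  obtain ⟨c₁, hc₁⟩ : ∃ c, E c < 0 := by
    obtain ⟨F, _, _, i, r, hr, hF⟩ := exists_numberField_containing j _ (Set.finite_range val)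
    obtain ⟨w, c, -, hc, -⟩ := W.exists_embedding_exponent_neg hp hJ hx hy hker hW _ hQK hr
      fun c => hF _ ⟨c, rfl⟩
    exact ⟨c, hc⟩
  haveI : Nonempty A.ι := ⟨c₁⟩
  set n : ℕ := ∑ c, (-E c).toNat with hn
  set S : ℕ := ∑ c, (E c).natAbs with hS
  have hn0 : 0 < n := Finset.sum_pos' (fun _ _ => Nat.zero_le _) ⟨c₁, Finset.mem_univ _, by omega⟩
  have hSn : (S : ℤ) = 2 * n + ∑ c, E c := by
    rw [hS, hn, Nat.cast_sum, Nat.cast_sum, Finset.mul_sum, ← Finset.sum_add_distrib]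
    exact Finset.sum_congr rfl fun c _ => by omega
  have hS2 : 2 * n + 1 ≤ S := by omega
  set t : ℕ := κ * N + 4 with ht
  set D : ℕ := n * S * t with hD
  set Y : ℕ := N * S * t with hY
  set μ : ℕ := 2 * N * n * t + 1 with hμ
  have hμY : μ ≤ Y := by
    have h1 : N * (2 * n + 1) * t ≤ N * S * t := by gcongr
    have h2 : 1 ≤ N * t := Nat.mul_pos hN (by omega)
    rw [hμ, hY]
    nlinarith
  set a : A.ι → ℤ := fun c => -(A.m c * D : ℤ) with ha
  have haord : ∀ c (s : MonIx N κ D), OrdGe (A.e c (monFn Ω s)) (a c) := fun c s =>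
    A.ordGe_monFn hm hN hκ c s
  choose J₀ hJ₀ using fun c => A.exists_coeff_bound hm κ D c (a c) (haord c)
  obtain ⟨J, hJle⟩ := Finset.exists_le (Finset.univ.image J₀ ∪
    Finset.univ.image fun c => a c + (E c).natAbs * μ)
  set τ : A.ι → ℤ := fun c => a c + (E c).natAbs * μ - (E c).natAbs * ((if 0 < E c then 0 else Y : ℕ) : ℤ) with hτ
  have hτsum : 0 < ∑ c, τ c := by
    have h1 : ∑ c, τ c = -((∑ c, A.m c : ℕ) * D : ℤ) + S * μ - n * Y := by
      rw [hτ, hS, hn]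
      push_cast
      rw [Finset.sum_sub_distrib, Finset.sum_add_distrib, Finset.sum_mul, Finset.sum_mul, Finset.sum_mul,
        Finset.sum_neg_distrib]
      congr 1
      refine Finset.sum_congr rfl fun c _ => ?_
      split_ifs with h2
      · have : (-E c).toNat = 0 := by omega
        have h3 : max (-E c) 0 = 0 := by omega
        simp [h3]
      · have h3 : max (-E c) 0 = |E c| := by
          rw [abs_of_nonpos (by omega)]; omega
        simp [h3]
    have h2 : ((∑ c, A.m c : ℕ) * D : ℤ) ≤ N * D := by
      exact_mod_cast Nat.mul_le_mul_right D A.sum_m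
    rw [h1]
    have h3 : (N * D : ℤ) + n * Y + S = S * μ := by
      rw [hD, hY, hμ]; push_cast; ring
    have : (0 : ℤ) < S := by omega
    linarith
  obtain ⟨E₁, hE₁, hpos⟩ := W.exists_weight_pos hx hy hm hN hker hW hκ τ hτsum
  let E₂ : Set Ω := E₁ ∪ Set.range val ∪ Set.range
    fun u : (c : A.ι) × MonIx N κ D × Finset.Ico (a c) J => (A.e u.1 (monFn Ω u.2.1)).coeff u.2.2
  obtain ⟨F, _, _, i, r, hr, hF⟩ := exists_numberField_containing j E₂
    ((hE₁.union (Set.finite_range _)).union (Set.finite_range _))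
  have hpos' := hpos F i r hr fun e he => hF e (Or.inl (Or.inl he))
  have hvalF : ∀ c, val c ∈ i.range := fun c => hF _ (Or.inl (Or.inr ⟨c, rfl⟩))
  have hcoefF : ∀ c (s : MonIx N κ D) l, l ∈ Finset.Ico (a c) J →
      (A.e c (monFn Ω s)).coeff l ∈ i.range := fun c s l hl =>
    hF _ (Or.inr ⟨⟨c, s, ⟨l, hl⟩⟩, rfl⟩)
  obtain ⟨w₀, c₀, hw₀, hc₀, hθ₀⟩ := W.exists_embedding_exponent_neg hp hJ hx hy hker hW _ hQK hr hvalF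
  choose vF hvF using hvalF
  choose xF hxF using exists_ringOfIntegers (i := i) hx hr
  choose yF hyF using exists_ringOfIntegers (i := i) hy hr
  have hQev : ∀ n, j (eval ![yK n, xK n] QK : 𝓞 K) = eval ![y n, x n] Q := by
    intro n
    rw [← hQ, ← hx, ← hy]
    exact (eval_map_pair (j.comp (algebraMap (𝓞 K) K)) (yK n) (xK n) QK).symm
  choose q hq using exists_ringOfIntegers (i := i) hQev hr
  choose! ε hε using hcoefF
  let β : A.ι → Option F := fun c => if 0 < E c then some (vF c) else none
  have hβ : ∀ c, i ((β c).getD 0) = val c := by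
    intro c
    by_cases h1 : 0 < E c
    · simp [β, h1, hvF]
    · simp [β, h1, hEval c (lt_of_le_of_ne (not_lt.1 h1) (hE0 c))]
  have hβs : ∀ c, (β c).isSome = true ↔ 0 < E c := by
    intro c; by_cases h1 : 0 < E c <;> simp [β, h1]
  let φ : MonIx N κ D → ℕ → 𝓞 F := fun s n => xF n ^ (s.2 : ℕ) * yF n ^ (s.1 : ℕ)
  have hφ : ∀ s n, i (φ s n) = eval ![y n, x n] (monFn Ω s) := by
    intro s n
    simp only [φ, monFn, map_mul, map_pow, eval_X]
    rw [hxF, hyF]; rfl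
  have hext : ∀ (w : F →+* ℂ) (b : F), w b = extendEmbedding i w (i b) := fun w b =>
    (extendEmbedding_apply i w b).symm
  have hQsub : ∀ c n, eval ![y n, x n] (Q - C (val c)) = i (q n) - i ((β c).getD 0) := by
    intro c n; rw [hβ, hq, map_sub, eval_C]
  refine false_of_cusp_expansions β (fun c => (E c).natAbs) (fun c => Int.natAbs_pos.2 (hE0 c)) a ε
    μ Y (by omega) hμY ?_ (U : Filter ℕ) h W.tendsto_h q φ (fun w => W.T (extendEmbedding i w))
    (fun w => W.θ (extendEmbedding i w)) (fun w => W.z (extendEmbedding i w)) ?_ ?_ J ?_ ?_ ?_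
    w₀ c₀ hw₀ hθ₀ ?_ ?_ ?_
  · refine thue_parameters_count (κ := κ) hN hn0 hS2 ?_
    exact le_card_monIx N κ D
  · exact fun w c hc => ⟨W.θ_nonneg _, W.tendsto_z _ c hc, W.z_ne _ c hc, W.tendsto_log _ c hc⟩
  · intro w c hc
    obtain ⟨B, hB⟩ := W.norm_le hc (hEord c)
    refine ⟨B, ?_⟩
    filter_upwards [hB] with n h1
    rw [hext w, hext w, ← map_sub, ← hQsub]
    refine h1.trans (le_of_eq ?_)
    congr 1
    by_cases h2 : 0 < E c
    · rw [if_pos ((hβs c).2 h2), ← zpow_natCast, Int.natCast_natAbs, abs_of_pos h2]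
    · rw [if_neg (fun h3 => h2 ((hβs c).1 h3)), ← zpow_natCast, ← zpow_neg, Int.natCast_natAbs,
        abs_of_nonpos (not_lt.1 h2), neg_neg]
  · exact fun c => hJle _ (Finset.mem_union_right _ (Finset.mem_image_of_mem _ (Finset.mem_univ c)))
  · intro w c hc s M hM
    obtain ⟨B, hB⟩ := W.expansion _ c hc (monFn Ω s) (a c) M (haord c s)
    refine ⟨B, ?_⟩
    filter_upwards [hB] with n h1
    convert h1 using 3
    · rw [hext w, hφ]
    · refine Finset.sum_congr rfl fun l hl => ?_
      rw [Finset.mem_Ico] at hl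
      rw [hext w, hε c s l (Finset.mem_Ico.2 ⟨hl.1, hl.2.trans_le hM⟩)]
  · intro w hw
    refine ⟨?_, fun s => ?_⟩
    · obtain ⟨B, hB⟩ := W.bounded _ hw Q
      refine ⟨B, ?_⟩
      filter_upwards [hB] with n h1
      rwa [hext w, hq]
    · obtain ⟨B, hB⟩ := W.bounded _ hw (monFn Ω s)
      refine ⟨B, ?_⟩
      filter_upwards [hB] with n h1
      rwa [hext w, hφ]
  · intro γ hγ
    have hγ' : (fun s => i (γ s : F)) ≠ 0 := by
      intro h0
      refine hγ (funext fun s => RingOfIntegers.coe_injective ?_)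
      exact i.injective (by simpa using congrFun h0 s)
    obtain ⟨l, hl, hne⟩ := hJ₀ c₀ _ hγ'
    have hlJ : l ∈ Finset.Ico (a c₀) J := by
      rw [Finset.mem_Ico] at hl ⊢
      exact ⟨hl.1, hl.2.trans_le
        (hJle _ (Finset.mem_union_left _ (Finset.mem_image_of_mem _ (Finset.mem_univ c₀))))⟩
    refine ⟨l, hlJ, fun h0 => hne ?_⟩
    have := congrArg i h0
    rw [map_sum, _root_.map_zero] at this
    rw [← this]
    refine Finset.sum_congr rfl fun s _ => ?_
    rw [map_mul, hε c₀ s l hlJ]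
  · have hlim := (W.tendsto_mul_zpow hw₀ (hEord c₀)).norm
    set b := ‖extendEmbedding i w₀ ((A.e c₀ (Q - C (val c₀))).coeff (E c₀))‖ with hb
    have hb0 : 0 < b := norm_pos_iff.2 ((_root_.map_ne_zero _).2 (hElead c₀))
    refine ⟨(b / 2)⁻¹, ?_⟩
    filter_upwards [hlim.eventually (eventually_ge_nhds (half_lt_self hb0)), W.z_ne _ _ hw₀] with n h1 h2
    have h3 : i ((β c₀).getD 0) = 0 := by rw [hβ, hEval c₀ hc₀]
    rw [hQsub, h3, sub_zero, extendEmbedding_apply, norm_mul, norm_zpow] at h1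
    have h4 : ‖W.z (extendEmbedding i w₀) n‖ ^ (-E c₀) = ‖W.z (extendEmbedding i w₀) n‖ ^ (E c₀).natAbs := by
      rw [← zpow_natCast, Int.natCast_natAbs, abs_of_neg hc₀]
    rw [h4] at h1
    have h5 : 0 < ‖W.z (extendEmbedding i w₀) n‖ ^ (E c₀).natAbs := pow_pos (norm_pos_iff.2 h2) _
    rw [← div_eq_inv_mul, inv_le_comm₀ h5 (div_pos (by
      by_contra h6
      have := mul_nonpos_of_nonpos_of_nonneg (not_lt.1 h6) h5.le
      linarith) (by positivity)), inv_div, div_le_iff₀' (by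
      by_contra h6
      have := mul_nonpos_of_nonpos_of_nonneg (not_lt.1 h6) h5.le
      linarith)]
    exact h1
  · refine hpos'.trans_le (le_of_eq (Finset.sum_congr rfl fun w _ => ?_))
    rw [weight]
    rcases W.T (extendEmbedding i w) with _ | c
    · rfl
    · simp only [Option.elim_some, hτ, hβs]
      rw [Int.cast_sub, Int.cast_add, Int.cast_mul, Int.cast_mul, Int.cast_natCast, Int.cast_natCast,
        Int.cast_natCast]
end CuspLimits
end Thue
end

section
open MvPolynomial NumberField

section GenericIrreducibility

/-- A finitely generated submodule of the source is mapped to torsion of the cokernel of `D`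
with a uniform annihilator. -/
lemma exists_uniform_multiple {R M : Type*} [CommRing R] [IsDomain R] [IsNoetherianRing R]
    [AddCommGroup M] [Module R M] (D : M →ₗ[R] M) (B : Submodule R M) (hB : B.FG) :
    ∃ d : R, d ≠ 0 ∧ ∀ u ∈ B, (∃ r : R, r ≠ 0 ∧ ∃ v, D v = r • u) → ∃ v, D v = d • u := by
  let T : Submodule R M :=
    { carrier := {u | u ∈ B ∧ ∃ r : R, r ≠ 0 ∧ ∃ v, D v = r • u}
      zero_mem' := ⟨B.zero_mem, 1, one_ne_zero, 0, by simp⟩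
      add_mem' := by
        rintro a b ⟨ha, r, hr, v, hv⟩ ⟨hb, s, hs, w, hw⟩
        refine ⟨B.add_mem ha hb, r * s, mul_ne_zero hr hs, s • v + r • w, ?_⟩
        rw [map_add, map_smul, map_smul, hv, hw, smul_smul, smul_smul, smul_add, mul_comm s r]
      smul_mem' := by
        rintro c a ⟨ha, r, hr, v, hv⟩
        refine ⟨B.smul_mem c ha, r, hr, c • v, ?_⟩
        rw [map_smul, hv, smul_comm] }
  have hT : T.FG := by
    have : IsNoetherian R B := isNoetherian_of_fg_of_noetherian B hB
    exact isNoetherian_submodule.mp this T fun u hu => hu.1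
  have key : ∀ N : Submodule R M, N.FG → N ≤ T → ∃ d : R, d ≠ 0 ∧ ∀ u ∈ N, ∃ v, D v = d • u := by
    intro N hN
    induction N, hN using Submodule.fg_induction with
    | singleton x =>
      intro hx
      obtain ⟨-, r, hr, v, hv⟩ := hx (Submodule.mem_span_singleton_self x)
      refine ⟨r, hr, fun u hu => ?_⟩
      obtain ⟨c, rfl⟩ := Submodule.mem_span_singleton.mp hu
      exact ⟨c • v, by rw [map_smul, hv, smul_comm]⟩
    | sup N₁ N₂ _ _ h₁ h₂ =>
      intro h
      obtain ⟨d, hd, h1⟩ := h₁ (le_sup_left.trans h)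
      obtain ⟨e, he, h2⟩ := h₂ (le_sup_right.trans h)
      refine ⟨d * e, mul_ne_zero hd he, fun u hu => ?_⟩
      obtain ⟨y, hy, z, hz, rfl⟩ := Submodule.mem_sup.mp hu
      obtain ⟨v, hv⟩ := h1 y hy
      obtain ⟨w, hw⟩ := h2 z hz
      exact ⟨e • v + d • w, by
        rw [map_add, map_smul, map_smul, hv, hw, smul_smul, smul_smul, smul_add, mul_comm e d]⟩
  obtain ⟨d, hd, h⟩ := key T hT le_rfl
  exact ⟨d, hd, fun u hu hr => h u ⟨hu, hr⟩⟩

variable {k : Type*} [Field k] [CharZero k]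

lemma hamDer_aeval_self (P : MvPolynomial (Fin 2) k) (r : Polynomial k) :
    hamDer P (Polynomial.aeval P r) = 0 := by
  rw [Derivation.map_aeval, hamDer_self, smul_zero]

lemma hamDer_aeval_mul (P : MvPolynomial (Fin 2) k) (r : Polynomial k)
    (f : MvPolynomial (Fin 2) k) :
    hamDer P (Polynomial.aeval P r * f) = Polynomial.aeval P r * hamDer P f := by
  rw [Derivation.leibniz, hamDer_aeval_self]; simp

/-- For all but finitely many `s`, functions which are constant along `P = s` to first order
with bounded cofactor are constant on the fibre. -/
lemma exists_dvd_sub_C_of_hamDer_eq {P Q : MvPolynomial (Fin 2) k} (hJ : hamDer P Q = 1) (n : ℕ) :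
    ∃ d : Polynomial k, d ≠ 0 ∧ ∀ (s : k) (f g : MvPolynomial (Fin 2) k), d.eval s ≠ 0 →
      g.totalDegree ≤ n → hamDer P f = (P - C s) * g → ∃ a : k, P - C s ∣ f - C a := by
  classical
  let φ : Polynomial k →ₐ[k] MvPolynomial (Fin 2) k := Polynomial.aeval P
  letI : Module (Polynomial k) (MvPolynomial (Fin 2) k) :=
    Module.compHom (MvPolynomial (Fin 2) k) φ.toRingHom
  have hsm : ∀ (r : Polynomial k) (f : MvPolynomial (Fin 2) k), r • f = φ r * f := fun _ _ => rfl
  let D : MvPolynomial (Fin 2) k →ₗ[Polynomial k] MvPolynomial (Fin 2) k :=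
    { toFun := hamDer P
      map_add' := map_add _
      map_smul' := fun r f => hamDer_aeval_mul P r f }
  let S : Finset (MvPolynomial (Fin 2) k) :=
    (Finset.Iic (Finsupp.equivFunOnFinite.symm (fun _ : Fin 2 => n))).image
      fun m => monomial m (1 : k)
  let B : Submodule (Polynomial k) (MvPolynomial (Fin 2) k) := Submodule.span _ (S : Set _)
  obtain ⟨d, hd, h⟩ := exists_uniform_multiple D B ⟨S, rfl⟩
  refine ⟨d, hd, fun s f g hs hg hfg => ?_⟩
  have hgB : g ∈ B := by
    rw [g.as_sum]
    refine Submodule.sum_mem _ fun m hm => ?_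
    have : (monomial m (coeff m g) : MvPolynomial (Fin 2) k)
        = Polynomial.C (coeff m g) • monomial m (1 : k) := by
      rw [hsm]
      simp [φ, algebraMap_eq, C_mul_monomial]
    rw [this]
    refine Submodule.smul_mem _ _ (Submodule.subset_span ?_)
    simp only [S, Finset.coe_image, Set.mem_image, Finset.mem_coe, Finset.mem_Iic]
    refine ⟨m, fun i => ?_, rfl⟩
    refine le_trans ?_ ((le_totalDegree hm).trans hg)
    rw [Finsupp.sum_fintype _ _ (by simp)]
    exact Finset.single_le_sum (f := fun i => m i) (fun _ _ => Nat.zero_le _) (Finset.mem_univ i)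
  have hφs : φ (Polynomial.X - Polynomial.C s) = P - C s := by simp [φ, algebraMap_eq]
  have hDf : D f = (Polynomial.X - Polynomial.C s) • g := by rw [hsm, hφs]; exact hfg
  obtain ⟨v, hv⟩ := h g hgB ⟨_, Polynomial.X_sub_C_ne_zero s, f, hDf⟩
  have hcop : IsCoprime (Polynomial.X - Polynomial.C s) d := by
    refine (Polynomial.irreducible_X_sub_C s).coprime_iff_not_dvd.mpr fun hdvd => hs ?_
    exact Polynomial.dvd_iff_isRoot.mp hdvd
  obtain ⟨a, b, hab⟩ := hcop
  have hf' : D (a • f + b • v) = g := by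
    rw [map_add, map_smul, map_smul, hDf, hv, smul_smul, smul_smul, ← add_smul, hab, one_smul]
  have h0 : hamDer P (f - φ (Polynomial.X - Polynomial.C s) * (a • f + b • v)) = 0 := by
    rw [map_sub, hamDer_aeval_mul]
    change hamDer P f - φ _ * D (a • f + b • v) = 0
    rw [hf', hφs, hfg, sub_self]
  obtain ⟨c, hc⟩ := exists_aeval_eq_of_hamDer_eq_zero hJ _ h0
  refine ⟨c.eval s, ?_⟩
  have h1 : P - C s ∣ φ c - C (c.eval s) := by
    obtain ⟨q, hq⟩ := Polynomial.X_sub_C_dvd_sub_C_eval (a := s) (p := c)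
    have := congrArg φ hq
    rw [map_mul, hφs, map_sub] at this
    have h2 : φ (Polynomial.C (c.eval s)) = C (c.eval s) := by simp [φ, algebraMap_eq]
    rw [h2] at this
    exact ⟨_, this⟩
  have : f - C (c.eval s) = (φ c - C (c.eval s)) + (P - C s) * (a • f + b • v) := by
    rw [hφs] at hc
    linear_combination hc
  rw [this]
  exact dvd_add h1 (dvd_mul_right _ _)

lemma totalDegree_pderiv_le {σ : Type*} (f : MvPolynomial σ k) (i : σ) :
    (pderiv i f).totalDegree ≤ f.totalDegree := by
  by_cases h : pderiv i f = 0
  · simp [h]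
  · exact (totalDegree_pderiv_lt h).le

lemma totalDegree_hamDer_le (P f : MvPolynomial (Fin 2) k) :
    (hamDer P f).totalDegree ≤ P.totalDegree + f.totalDegree := by
  rw [hamDer_apply]
  refine (totalDegree_sub _ _).trans (max_le ?_ ?_) <;>
  exact (totalDegree_mul _ _).trans
    (add_le_add (totalDegree_pderiv_le _ _) (totalDegree_pderiv_le _ _))

lemma sub_C_ne_zero_of_hamDer {P Q : MvPolynomial (Fin 2) k} (hJ : hamDer P Q = 1) (s : k) :
    P - C s ≠ 0 := by
  intro h
  rw [sub_eq_zero.mp h, hamDer_apply] at hJ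
  simp at hJ

lemma not_isUnit_sub_C_of_hamDer {P Q : MvPolynomial (Fin 2) k} (hJ : hamDer P Q = 1) (s : k) :
    ¬ IsUnit (P - C s) := by
  intro h
  obtain ⟨c, -, hc⟩ := MvPolynomial.isUnit_iff_eq_C_of_isReduced.mp h
  have : P = C (c + s) := by rw [C_add, ← hc]; ring
  rw [this, hamDer_apply] at hJ
  simp at hJ

/-- All but finitely many fibres of `P` are irreducible. -/
theorem exists_irreducible_sub_C {P Q : MvPolynomial (Fin 2) k} (hJ : hamDer P Q = 1) :
    ∃ d : Polynomial k, d ≠ 0 ∧ ∀ s : k, d.eval s ≠ 0 → Irreducible (P - C s) := by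
  obtain ⟨d, hd, h⟩ := exists_dvd_sub_C_of_hamDer_eq hJ (P.totalDegree + (Q.totalDegree + P.totalDegree))
  refine ⟨d, hd, fun s hs => ⟨not_isUnit_sub_C_of_hamDer hJ s, ?_⟩⟩
  intro A B hAB
  have hEP : -hamDer Q A * B + A * -hamDer Q B = 1 := by
    have h1 : hamDer Q (P - C s) = -1 := by
      rw [map_sub, ← algebraMap_eq, Derivation.map_algebraMap, sub_zero, hamDer_swap, hJ]
    rw [hAB, Derivation.leibniz, smul_eq_mul, smul_eq_mul] at h1
    linear_combination -h1
  have hp0 := sub_C_ne_zero_of_hamDer hJ s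
  have hA0 : A ≠ 0 := by rintro rfl; simp [hAB] at hp0
  have hB0 : B ≠ 0 := by rintro rfl; simp [hAB] at hp0
  set a' := -hamDer Q A with ha'
  set b' := -hamDer Q B with hb'
  have hDp : hamDer P (P - C s) = 0 := by
    rw [map_sub, ← algebraMap_eq, Derivation.map_algebraMap, hamDer_self, sub_zero]
  have hεw : (a' * B) * (a' * B) - a' * B = (P - C s) * (-(a' * b')) := by
    rw [hAB]; linear_combination (a' * B) * hEP
  have hDε : hamDer P (a' * B) = (P - C s) *
      ((2 * (a' * B) - 1) * hamDer P (-(a' * b')) - 4 * (-(a' * b')) * hamDer P (a' * B)) := by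
    have h1 := congrArg (hamDer P) hεw
    rw [map_sub, (hamDer P).leibniz (a' * B) (a' * B), (hamDer P).leibniz (P - C s), hDp] at h1
    simp only [smul_eq_mul, mul_zero, add_zero] at h1
    linear_combination (2 * (a' * B) - 1) * h1 - 4 * hamDer P (a' * B) * hεw
  have hdeg : ((2 * (a' * B) - 1) * hamDer P (-(a' * b')) -
      4 * (-(a' * b')) * hamDer P (a' * B)).totalDegree
      ≤ P.totalDegree + (Q.totalDegree + P.totalDegree) := by
    generalize (2 * (a' * B) - 1) * hamDer P (-(a' * b')) -
      4 * (-(a' * b')) * hamDer P (a' * B) = g at hDε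
    by_cases hg : g = 0
    · simp [hg]
    have h1 := totalDegree_mul_of_isDomain hp0 hg
    rw [← hDε] at h1
    have h2 := totalDegree_hamDer_le P (a' * B)
    have h3 : (a' * B).totalDegree ≤ Q.totalDegree + P.totalDegree := by
      refine (totalDegree_mul _ _).trans ?_
      have h4 : a'.totalDegree ≤ Q.totalDegree + A.totalDegree := by
        rw [ha', totalDegree_neg]; exact totalDegree_hamDer_le _ _
      have h5 := totalDegree_mul_of_isDomain hA0 hB0
      rw [← hAB] at h5
      have h6 := totalDegree_sub_C_le P s
      omega
    omega
  obtain ⟨a, haε⟩ := h s _ _ hs hdeg hDε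
  have haa : a * a - a = 0 := by
    by_contra hne
    have h1 : P - C s ∣ C (a * a - a) := by
      have : C (a * a - a) = ((a' * B) * (a' * B) - a' * B)
          - (a' * B - C a) * (a' * B + C a - 1) := by
        rw [C_sub, C_mul]; ring
      rw [this]
      exact dvd_sub (hεw ▸ dvd_mul_right _ _) (haε.mul_right _)
    exact not_isUnit_sub_C_of_hamDer hJ s
      (isUnit_of_dvd_unit h1 ((isUnit_iff_ne_zero.mpr hne).map C))
  rw [hAB] at haε
  rcases mul_self_eq_mul_self_iff.mp (show (2 * a - 1) * (2 * a - 1) = 1 * 1 by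
    linear_combination 4 * haa) with h1 | h1
  · right
    have ha1 : a = 1 := by
      have : 2 * (a - 1) = 0 := by linear_combination h1
      simpa [sub_eq_zero] using this
    rw [ha1, C_1, show a' * B - 1 = A * (-b') by linear_combination hEP] at haε
    have h2 : B ∣ b' := (dvd_neg.mp ((mul_dvd_mul_iff_left hA0).mp haε))
    exact isUnit_of_dvd_one (hEP ▸ dvd_add (dvd_mul_left _ _) (h2.mul_left _))
  · left
    have ha0 : a = 0 := by
      have : 2 * a = 0 := by linear_combination h1
      simpa using this
    rw [ha0, C_0, sub_zero] at haε
    have h2 : A ∣ a' := (mul_dvd_mul_iff_right hB0).mp haε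
    exact isUnit_of_dvd_one (hEP ▸ dvd_add (h2.mul_right _) (dvd_mul_right _ _))

end GenericIrreducibility
end

section
open MvPolynomial NumberField

section Omitted

lemma RingHom.mem_of_map_eq_top_of_isIntegralElem {R T : Type*} [CommRing R] [CommRing T]
    (φ : R →+* T) (g : R) (hg : ∀ t, ∃ M : ℕ, φ.IsIntegralElem (φ g ^ M * t)) (m : Ideal R)
    [hm : m.IsMaximal] (hker : RingHom.ker φ ≤ m) (htop : m.map φ = ⊤) : g ∈ m := by
  letI := φ.toAlgebra
  let A := integralClosure R T
  have key : ∀ t ∈ m.map φ, ∃ M : ℕ, ∃ a : A, a ∈ m.map (algebraMap R A) ∧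
      (a : T) = φ g ^ M * t := by
    intro t ht
    refine Submodule.span_induction (p := fun t _ => ∃ M : ℕ, ∃ a : A,
      a ∈ m.map (algebraMap R A) ∧ (a : T) = φ g ^ M * t) ?_ ?_ ?_ ?_ ht
    · rintro _ ⟨r, hr, rfl⟩
      exact ⟨0, algebraMap R A r, Ideal.mem_map_of_mem _ hr, by simp; rfl⟩
    · exact ⟨0, 0, Ideal.zero_mem _, by simp⟩
    · rintro x y - - ⟨M, a, ha, hax⟩ ⟨N, b, hb, hby⟩
      refine ⟨M + N, algebraMap R A (g ^ N) * a + algebraMap R A (g ^ M) * b,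
        Ideal.add_mem _ (Ideal.mul_mem_left _ _ ha) (Ideal.mul_mem_left _ _ hb), ?_⟩
      change φ (g ^ N) * (a : T) + φ (g ^ M) * (b : T) = _
      rw [hax, hby, map_pow, map_pow]; ring
    · rintro c x - ⟨M, a, ha, hax⟩
      obtain ⟨N, hN⟩ := hg c
      refine ⟨N + M, (⟨φ g ^ N * c, hN⟩ : A) * a, Ideal.mul_mem_left _ _ ha, ?_⟩
      change φ g ^ N * c * (a : T) = _
      rw [hax, smul_eq_mul]; ring
  obtain ⟨M, a, ha, haM⟩ := key 1 (htop ▸ Submodule.mem_top)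
  have hA : a = algebraMap R A (g ^ M) := by
    apply Subtype.ext
    rw [haM, mul_one, ← map_pow]; rfl
  obtain ⟨n, hn, hnm⟩ := Ideal.exists_ideal_over_maximal_of_isIntegral (S := A) m (by
    intro r hr
    apply hker
    rw [RingHom.mem_ker] at hr ⊢
    exact congrArg Subtype.val hr)
  have h1 : g ^ M ∈ n.comap (algebraMap R A) := by
    rw [Ideal.mem_comap, ← hA]
    refine (Ideal.map_le_iff_le_comap.mpr hnm.ge) ha
  rw [hnm] at h1
  exact hm.isPrime.mem_of_pow_mem _ h1

variable {k : Type*} [Field k]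

lemma exists_isIntegralElem_pow_mul {σ R T : Type*} [CommRing R] [CommRing T]
    (φ : R →+* T) (π : MvPolynomial σ k →+* T) (hπ : Function.Surjective π)
    (hC : ∀ c, φ.IsIntegralElem (π (C c))) (g : R) (hX : ∀ i, φ.IsIntegralElem (φ g * π (X i)))
    (t : T) : ∃ M : ℕ, φ.IsIntegralElem (φ g ^ M * t) := by
  have hpow : ∀ M : ℕ, φ.IsIntegralElem (φ g ^ M) := fun M => by
    rw [← map_pow]; exact φ.isIntegralElem_map
  obtain ⟨f, rfl⟩ := hπ t
  induction f using MvPolynomial.induction_on with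
  | C a => exact ⟨0, by simpa using hC a⟩
  | add p q hp hq =>
    obtain ⟨M, hM⟩ := hp
    obtain ⟨N, hN⟩ := hq
    refine ⟨M + N, ?_⟩
    have : φ g ^ (M + N) * π (p + q) = φ g ^ N * (φ g ^ M * π p) + φ g ^ M * (φ g ^ N * π q) := by
      rw [map_add]; ring
    rw [this]
    exact ((hpow N).mul φ hM).add φ ((hpow M).mul φ hN)
  | mul_X p i hp =>
    obtain ⟨M, hM⟩ := hp
    refine ⟨M + 1, ?_⟩
    have : φ g ^ (M + 1) * π (p * X i) = (φ g ^ M * π p) * (φ g * π (X i)) := by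
      rw [map_mul]; ring
    rw [this]
    exact hM.mul φ (hX i)

lemma exists_isIntegralElem_mul {R T : Type*} [CommRing R] [IsDomain R] [CommRing T] [IsDomain T]
    (φ : R →+* T) (hφ : Function.Injective φ) (z : T) {G : Polynomial R} (hG : G ≠ 0)
    (hz : G.eval₂ φ z = 0) : ∃ g : R, g ≠ 0 ∧ φ.IsIntegralElem (φ g * z) := by
  letI := φ.toAlgebra
  have : IsAlgebraic R z := ⟨G, hG, hz⟩
  obtain ⟨g, hg, h⟩ := this.exists_integral_multiple
  exact ⟨g, hg, by rw [Algebra.smul_def] at h; exact h⟩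

lemma exists_polynomial_relation (z f₁ f₂ : MvPolynomial (Fin 2) k) :
    ∃ G : Polynomial (MvPolynomial (Fin 2) k), G ≠ 0 ∧
      G.eval₂ (aeval ![f₁, f₂] : MvPolynomial (Fin 2) k →ₐ[k] MvPolynomial (Fin 2) k).toRingHom z
        = 0 := by
  have h : ¬ AlgebraicIndependent k ![z, f₁, f₂] := by
    intro h
    have := h.lift_cardinalMk_le_trdeg
    rw [MvPolynomial.trdeg_of_isDomain] at this
    simp at this
    norm_cast at this
  rw [algebraicIndependent_iff] at h
  push Not at h
  obtain ⟨G, hG, hG0⟩ := h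
  refine ⟨finSuccEquiv k 2 G, by simpa using hG0, ?_⟩
  have : (Polynomial.eval₂RingHom (aeval ![f₁, f₂] : MvPolynomial (Fin 2) k →ₐ[k]
      MvPolynomial (Fin 2) k).toRingHom z).comp (finSuccEquiv k 2 : _ →+* _)
      = (aeval ![z, f₁, f₂] : MvPolynomial (Fin 3) k →ₐ[k] _).toRingHom := by
    refine MvPolynomial.ringHom_ext (fun r => ?_) fun i => ?_
    · simp [finSuccEquiv_apply, algebraMap_eq]
    · refine Fin.cases ?_ (fun i => ?_) i
      · simp [finSuccEquiv_apply]
      · have hi : (finSuccEquiv k 2) (X i.succ) = Polynomial.C (X i) := by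
          simp [finSuccEquiv_apply]
        change Polynomial.eval₂ _ z (finSuccEquiv k 2 (X i.succ)) =
          aeval ![z, f₁, f₂] (X i.succ)
        rw [hi, Polynomial.eval₂_C, aeval_X]
        change aeval ![f₁, f₂] (X i) = _
        rw [aeval_X]
        rfl
  exact (RingHom.congr_fun this G).trans hG

lemma exists_eval₂_eq_zero_coeff_zero_ne_zero {R T : Type*} [CommRing R] [CommRing T]
    (φ : R →+* T) {I : Ideal T} [I.IsPrime] {z : T} (hz : z ∉ I) {G : Polynomial R} (hG : G ≠ 0)
    (h : G.eval₂ φ z ∈ I) : ∃ H : Polynomial R, H.coeff 0 ≠ 0 ∧ H.eval₂ φ z ∈ I := by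
  induction' hn : G.natDegree using Nat.strong_induction_on with n ih generalizing G
  by_cases h0 : G.coeff 0 = 0
  · have hX : G = Polynomial.X * G.divX := by
      conv_lhs => rw [← G.X_mul_divX_add, h0]
      simp
    have hd : G.divX ≠ 0 := by
      intro hd; rw [hd, mul_zero] at hX; exact hG hX
    have hlt : G.divX.natDegree < n := by
      rw [Polynomial.natDegree_divX_eq_natDegree_tsub_one, hn]
      have : n ≠ 0 := by
        rintro rfl
        rw [Polynomial.eq_C_of_natDegree_eq_zero hn, h0] at hG
        simp at hG
      omega
    refine ih _ hlt hd ?_ rfl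
    rw [hX, Polynomial.eval₂_mul, Polynomial.eval₂_X] at h
    exact (Ideal.IsPrime.mem_or_mem ‹_› h).resolve_left hz
  · exact ⟨G, h0, h⟩

/-- Two polynomials in two variables are dependent modulo a nonzero polynomial. -/
lemma exists_relation_mod {ℓ : MvPolynomial (Fin 2) k} (hℓ : ℓ ≠ 0)
    (f q : MvPolynomial (Fin 2) k) :
    ∃ G : Polynomial (Polynomial k), G ≠ 0 ∧
      ℓ ∣ G.eval₂ (Polynomial.aeval f : Polynomial k →ₐ[k] _).toRingHom q := by
  obtain ⟨G, hG, hG0⟩ := exists_polynomial_relation ℓ q f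
  obtain ⟨H, hH, hH0⟩ := exists_eval₂_eq_zero_coeff_zero_ne_zero (I := ⊥) _
    (fun h => hℓ (Ideal.mem_bot.mp h)) hG (Ideal.mem_bot.mpr hG0)
  refine ⟨toBi k (H.coeff 0), by simpa using hH, ?_⟩
  have h1 : Polynomial.eval₂ (Polynomial.aeval f : Polynomial k →ₐ[k] _).toRingHom q
      (toBi k (H.coeff 0)) = aeval ![q, f] (H.coeff 0) := by
    have : (Polynomial.eval₂RingHom (Polynomial.aeval f : Polynomial k →ₐ[k] _).toRingHom q).comp
        (toBi k : MvPolynomial (Fin 2) k →+* _)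
        = (aeval ![q, f] : MvPolynomial (Fin 2) k →ₐ[k] _).toRingHom := by
      refine MvPolynomial.ringHom_ext (fun r => ?_) fun i => ?_
      · simp
      · fin_cases i <;> simp
    exact RingHom.congr_fun this _
  rw [h1]
  rw [← H.X_mul_divX_add, Polynomial.eval₂_add, Polynomial.eval₂_mul, Polynomial.eval₂_X,
    Polynomial.eval₂_C, Ideal.mem_bot] at hH0
  have h2 : aeval ![q, f] (H.coeff 0) = ℓ * -(Polynomial.eval₂ (aeval ![q, f] :
      MvPolynomial (Fin 2) k →ₐ[k] MvPolynomial (Fin 2) k).toRingHom ℓ H.divX) := by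
    have e : (aeval ![q, f] : MvPolynomial (Fin 2) k →ₐ[k] _) (H.coeff 0) =
      (aeval ![q, f] : MvPolynomial (Fin 2) k →ₐ[k] _).toRingHom (H.coeff 0) := rfl
    rw [e]
    linear_combination hH0
  exact ⟨_, h2⟩

/-- Elimination for two plane curves without common component. -/
lemma exists_aeval_eq_of_not_dvd {h q : MvPolynomial (Fin 2) k} (hh : Prime h) (hq : ¬ h ∣ q)
    (f : MvPolynomial (Fin 2) k) :
    ∃ α : Polynomial k, α ≠ 0 ∧ ∃ u w, Polynomial.aeval f α = u * h + w * q := by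
  haveI : (Ideal.span {h}).IsPrime := (Ideal.span_singleton_prime hh.ne_zero).2 hh
  obtain ⟨G, hG, hG0⟩ := exists_relation_mod hh.ne_zero f q
  obtain ⟨H, hH, hH0⟩ := exists_eval₂_eq_zero_coeff_zero_ne_zero (I := Ideal.span {h}) _
    (by rwa [Ideal.mem_span_singleton]) hG (by rwa [Ideal.mem_span_singleton])
  rw [Ideal.mem_span_singleton] at hH0
  obtain ⟨c, hc⟩ := hH0
  rw [← H.X_mul_divX_add, Polynomial.eval₂_add, Polynomial.eval₂_mul, Polynomial.eval₂_X,
    Polynomial.eval₂_C] at hc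
  refine ⟨H.coeff 0, hH, c, -(Polynomial.eval₂ (Polynomial.aeval f : Polynomial k →ₐ[k] _).toRingHom
    q H.divX), ?_⟩
  have : Polynomial.aeval f (H.coeff 0) =
    (Polynomial.aeval f : Polynomial k →ₐ[k] _).toRingHom (H.coeff 0) := rfl
  rw [this]
  linear_combination hc

lemma exists_dvd_sub_C_of_dvd_aeval [IsAlgClosed k] {ℓ : MvPolynomial (Fin 2) k} (hℓ : Prime ℓ)
    {α : Polynomial k} (hα : α ≠ 0) {f : MvPolynomial (Fin 2) k}
    (h : ℓ ∣ Polynomial.aeval f α) : ∃ a : k, ℓ ∣ f - C a := by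
  induction' hn : α.natDegree using Nat.strong_induction_on with n ih generalizing α
  by_cases hd : α.degree = 0
  · rw [Polynomial.eq_C_of_degree_eq_zero hd] at h hα
    rw [Polynomial.aeval_C, algebraMap_eq] at h
    refine absurd (isUnit_of_dvd_unit h (IsUnit.map C ?_)) hℓ.not_unit
    exact isUnit_iff_ne_zero.mpr fun h0 => hα (by rw [h0, map_zero])
  · obtain ⟨a, ha⟩ := IsAlgClosed.exists_root α hd
    obtain ⟨β, rfl⟩ := Polynomial.dvd_iff_isRoot.mpr ha
    rw [map_mul] at h
    rcases hℓ.dvd_or_dvd h with h1 | h1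
    · exact ⟨a, by simpa [algebraMap_eq] using h1⟩
    · have hβ : β ≠ 0 := right_ne_zero_of_mul hα
      refine ih _ ?_ hβ h1 rfl
      rw [← hn, Polynomial.natDegree_mul (Polynomial.X_sub_C_ne_zero a) hβ,
        Polynomial.natDegree_X_sub_C]
      omega

end Omitted
end

section
open MvPolynomial NumberField

section OmittedFinite

variable {k : Type*} [Field k]

lemma eval_eq_zero_of_omitted {P Q : MvPolynomial (Fin 2) k} {T : Type*} [CommRing T]
    (π : MvPolynomial (Fin 2) k →+* T) (hπ : Function.Surjective π)
    (φ : MvPolynomial (Fin 2) k →+* T) (hφ : ∀ f, φ f = π (aeval ![P, Q] f))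
    (g : MvPolynomial (Fin 2) k) (hX : ∀ i, φ.IsIntegralElem (φ g * π (X i)))
    {s β : k} {u : MvPolynomial (Fin 2) k} (hu : P - C s ∣ u * (Q - C β) - 1)
    (hker : ∀ f, φ f = 0 → eval ![s, β] f = 0) : eval ![s, β] g = 0 := by
  have hsurj : Function.Surjective (eval ![s, β]) := fun c => ⟨C c, by simp⟩
  haveI : (RingHom.ker (eval ![s, β])).IsMaximal := RingHom.ker_isMaximal_of_surjective _ hsurj
  have hC : ∀ c, φ.IsIntegralElem (π (C c)) := by
    intro c
    have : π (C c) = φ (C c) := by rw [hφ, ← algebraMap_eq, AlgHom.commutes]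
    rw [this]
    exact φ.isIntegralElem_map
  refine RingHom.mem_of_map_eq_top_of_isIntegralElem φ g
    (exists_isIntegralElem_pow_mul φ π hπ hC g hX) (RingHom.ker (eval ![s, β]))
    (fun f hf => hker f hf) ?_
  rw [Ideal.eq_top_iff_one]
  obtain ⟨w, hw⟩ := hu
  have h1 : (1 : T) = π u * φ (X 1 - C β) - π w * φ (X 0 - C s) := by
    have e1 : φ (X 1 - C β) = π (Q - C β) := by
      rw [hφ, map_sub, aeval_X, ← algebraMap_eq, AlgHom.commutes]; rfl
    have e0 : φ (X 0 - C s) = π (P - C s) := by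
      rw [hφ, map_sub, aeval_X, ← algebraMap_eq, AlgHom.commutes]; rfl
    rw [e1, e0, ← map_mul, ← map_mul, ← map_sub, ← map_one π]
    congr 1
    linear_combination -hw
  rw [h1]
  refine Ideal.sub_mem _ (Ideal.mul_mem_left _ _ (Ideal.mem_map_of_mem _ ?_))
    (Ideal.mul_mem_left _ _ (Ideal.mem_map_of_mem _ ?_)) <;> simp [RingHom.mem_ker]

lemma dvd_hamDer {ℓ f g : MvPolynomial (Fin 2) k} (hf : ℓ ∣ f) (hg : ℓ ∣ g) :
    ℓ ∣ hamDer f g := by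
  obtain ⟨a, rfl⟩ := hf
  obtain ⟨b, rfl⟩ := hg
  refine ⟨a * (pderiv 0 ℓ * pderiv 1 b - pderiv 1 ℓ * pderiv 0 b)
    + ℓ * (pderiv 0 a * pderiv 1 b - pderiv 1 a * pderiv 0 b)
    + b * (pderiv 0 a * pderiv 1 ℓ - pderiv 1 a * pderiv 0 ℓ), ?_⟩
  simp only [hamDer_apply, Derivation.leibniz, smul_eq_mul]
  ring

variable [CharZero k]

lemma hamDer_sub_C {P Q : MvPolynomial (Fin 2) k} (a b : k) :
    hamDer (P - C a) (Q - C b) = hamDer P Q := by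
  simp [hamDer_apply]

lemma exists_ne_zero_eval_eq_zero_of_omitted {P Q : MvPolynomial (Fin 2) k}
    (hJ : hamDer P Q = 1) :
    ∃ g : MvPolynomial (Fin 2) k, g ≠ 0 ∧ ∀ s β u, P - C s ∣ u * (Q - C β) - 1 →
      eval ![s, β] g = 0 := by
  let φ := (aeval ![P, Q] : MvPolynomial (Fin 2) k →ₐ[k] MvPolynomial (Fin 2) k).toRingHom
  have hφ : Function.Injective φ := aeval_pair_injective hJ
  have h : ∀ i : Fin 2, ∃ g, g ≠ 0 ∧ φ.IsIntegralElem (φ g * X i) := fun i => by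
    obtain ⟨G, hG, hG0⟩ := exists_polynomial_relation (X i) P Q
    exact exists_isIntegralElem_mul φ hφ (X i) hG hG0
  choose g hg hgi using h
  refine ⟨g 0 * g 1, mul_ne_zero (hg 0) (hg 1), fun s β u hu => ?_⟩
  refine eval_eq_zero_of_omitted (RingHom.id _) Function.surjective_id φ (fun _ => rfl) _ ?_ hu ?_
  · rw [map_mul, Fin.forall_fin_two]
    constructor
    · have : φ (g 0) * φ (g 1) * X 0 = φ (g 1) * (φ (g 0) * X 0) := by ring
      rw [RingHom.id_apply, this]
      exact RingHom.IsIntegralElem.mul φ (φ.isIntegralElem_map (x := g 1)) (hgi 0)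
    · have : φ (g 0) * φ (g 1) * X 1 = φ (g 0) * (φ (g 1) * X 1) := by ring
      rw [RingHom.id_apply, this]
      exact RingHom.IsIntegralElem.mul φ (φ.isIntegralElem_map (x := g 0)) (hgi 1)
  · intro f hf
    rw [(map_eq_zero_iff φ hφ).mp hf, map_zero]

lemma finite_omitted_of_prime [IsAlgClosed k] {P Q : MvPolynomial (Fin 2) k}
    (hJ : hamDer P Q = 1) {h : MvPolynomial (Fin 2) k} (hh : Prime h) :
    {s : k | ∃ β u, P - C s ∣ u * (Q - C β) - 1 ∧ eval ![s, β] h = 0}.Finite := by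
  have hinj := aeval_pair_injective hJ
  by_cases hcase : ∃ a : k, h ∣ X 0 - C a
  · obtain ⟨a, w, hw⟩ := hcase
    refine (Set.finite_singleton a).subset ?_
    rintro s ⟨β, u, -, h0⟩
    have := congrArg (eval ![s, β]) hw
    rw [map_mul, h0, zero_mul] at this
    simpa [sub_eq_zero] using this
  push Not at hcase
  have hne : aeval ![P, Q] h ≠ 0 := (map_ne_zero_iff _ hinj).mpr hh.ne_zero
  have hnu : ¬ IsUnit (aeval ![P, Q] h) := by
    intro hu
    obtain ⟨c, hc, hc'⟩ := MvPolynomial.isUnit_iff_eq_C_of_isReduced.mp hu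
    have : h = C c := hinj (by rw [hc', ← algebraMap_eq, AlgHom.commutes])
    exact hh.not_unit (this ▸ hc.map C)
  obtain ⟨ℓ, hℓi, hℓh⟩ := WfDvdMonoid.exists_irreducible_factor hnu hne
  have hℓ : Prime ℓ := hℓi.prime
  have haev : ∀ (f : MvPolynomial (Fin 2) k) (α : Polynomial k),
      aeval ![P, Q] (Polynomial.aeval f α) = Polynomial.aeval (aeval ![P, Q] f) α := fun f α =>
    (Polynomial.aeval_algHom_apply _ _ _).symm
  have elim : ∀ q f : MvPolynomial (Fin 2) k, ¬ h ∣ q → ℓ ∣ aeval ![P, Q] q →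
      ∃ a : k, ℓ ∣ aeval ![P, Q] f - C a := by
    intro q f hq hℓq
    obtain ⟨α, hα, u, w, huw⟩ := exists_aeval_eq_of_not_dvd hh hq f
    refine exists_dvd_sub_C_of_dvd_aeval hℓ hα ?_
    rw [← haev, huw, map_add, map_mul, map_mul]
    exact dvd_add (hℓh.mul_left _) (hℓq.mul_left _)
  have hPa : ∀ a : k, ¬ ℓ ∣ P - C a := by
    intro a ha
    have h1 : aeval ![P, Q] (X 0 - C a) = P - C a := by
      rw [map_sub, aeval_X, ← algebraMap_eq, AlgHom.commutes]; rfl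
    obtain ⟨b, hb⟩ := elim (X 0 - C a) (X 1) (hcase a) (h1 ▸ ha)
    rw [aeval_X] at hb
    have h2 := dvd_hamDer ha (show ℓ ∣ Q - C b from hb)
    rw [hamDer_sub_C, hJ] at h2
    exact hℓ.not_unit (isUnit_of_dvd_one h2)
  have hker : ∀ q, ℓ ∣ aeval ![P, Q] q → h ∣ q := by
    intro q hq
    by_contra hhq
    obtain ⟨a, ha⟩ := elim q (X 0) hhq hq
    rw [aeval_X] at ha
    exact hPa a ha
  haveI : (Ideal.span {ℓ}).IsPrime := (Ideal.span_singleton_prime hℓ.ne_zero).2 hℓ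
  let π := Ideal.Quotient.mk (Ideal.span {ℓ})
  have hπ : ∀ f, π f = 0 ↔ ℓ ∣ f := fun f => by
    rw [Ideal.Quotient.eq_zero_iff_mem, Ideal.mem_span_singleton]
  let φ := π.comp (aeval ![P, Q] : MvPolynomial (Fin 2) k →ₐ[k] MvPolynomial (Fin 2) k).toRingHom
  let ψ : Polynomial k →+* _ := π.comp (Polynomial.aeval P : Polynomial k →ₐ[k] _).toRingHom
  have hψφ : ∀ α, ψ α = φ (Polynomial.aeval (X 0) α) := fun α => by
    change π (Polynomial.aeval P α) = π (aeval ![P, Q] (Polynomial.aeval (X 0) α))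
    rw [haev, aeval_X]; rfl
  have hψ : Function.Injective ψ := by
    rw [injective_iff_map_eq_zero]
    intro α hα
    by_contra hα0
    obtain ⟨a, ha⟩ := exists_dvd_sub_C_of_dvd_aeval hℓ hα0 ((hπ _).mp hα)
    exact hPa a ha
  have h_intgr : ∀ i : Fin 2, ∃ g, g ≠ 0 ∧ ψ.IsIntegralElem (ψ g * π (X i)) := fun i => by
    obtain ⟨G, hG, hG0⟩ := exists_relation_mod hℓ.ne_zero P (X i)
    refine exists_isIntegralElem_mul ψ hψ (π (X i)) hG ?_
    rw [← hπ, Polynomial.hom_eval₂] at hG0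
    exact hG0
  have trans : ∀ t, ψ.IsIntegralElem t → φ.IsIntegralElem t := by
    rintro t ⟨p, hp, hp0⟩
    refine ⟨p.map (Polynomial.aeval (X 0 : MvPolynomial (Fin 2) k)).toRingHom, hp.map _, ?_⟩
    rw [Polynomial.eval₂_map]
    have : φ.comp (Polynomial.aeval (X 0 : MvPolynomial (Fin 2) k)).toRingHom = ψ :=
      RingHom.ext fun α => (hψφ α).symm
    rw [this, hp0]
  choose g hg hgi using h_intgr
  refine (Polynomial.finite_setOf_isRoot (mul_ne_zero (hg 0) (hg 1))).subset ?_
  rintro s ⟨β, u, hu, h0⟩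
  have := eval_eq_zero_of_omitted π Ideal.Quotient.mk_surjective φ (fun _ => rfl)
    (Polynomial.aeval (X 0) (g 0 * g 1)) ?_ hu ?_
  · have he : eval ![s, β] (Polynomial.aeval (X 0) (g 0 * g 1)) = (g 0 * g 1).eval s := by
      rw [← Polynomial.coe_aeval_eq_eval]
      have := Polynomial.aeval_algHom_apply (aeval ![s, β] : MvPolynomial (Fin 2) k →ₐ[k] k) (X 0)
        (g 0 * g 1)
      rw [aeval_X] at this
      rw [← coe_aeval_eq_eval]
      exact this.symm
    rw [he] at this
    exact this
  · rw [← hψφ, map_mul, Fin.forall_fin_two]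
    constructor <;> refine trans _ ?_
    · have : ψ (g 0) * ψ (g 1) * π (X 0) = ψ (g 1) * (ψ (g 0) * π (X 0)) := by ring
      rw [this]
      exact RingHom.IsIntegralElem.mul ψ (ψ.isIntegralElem_map (x := g 1)) (hgi 0)
    · have : ψ (g 0) * ψ (g 1) * π (X 1) = ψ (g 0) * (ψ (g 1) * π (X 1)) := by ring
      rw [this]
      exact RingHom.IsIntegralElem.mul ψ (ψ.isIntegralElem_map (x := g 0)) (hgi 1)
  · intro f hf
    obtain ⟨w, rfl⟩ := hker f ((hπ _).mp hf)
    rw [map_mul, h0, zero_mul]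

/-- Only finitely many fibres of `P` contain a point of the target omitted by `(P, Q)`. -/
theorem finite_omitted [IsAlgClosed k] {P Q : MvPolynomial (Fin 2) k} (hJ : hamDer P Q = 1) :
    {s : k | ∃ β u, P - C s ∣ u * (Q - C β) - 1}.Finite := by
  obtain ⟨g, hg, h⟩ := exists_ne_zero_eval_eq_zero_of_omitted hJ
  have key : ∀ g : MvPolynomial (Fin 2) k, g ≠ 0 →
      {s : k | ∃ β u, P - C s ∣ u * (Q - C β) - 1 ∧ eval ![s, β] g = 0}.Finite := by
    intro g
    induction g using UniqueFactorizationMonoid.induction_on_prime with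
    | h₁ => exact fun h => absurd rfl h
    | h₂ x hx =>
      intro _
      convert Set.finite_empty
      ext s
      simp only [Set.mem_setOf_eq, Set.mem_empty_iff_false, iff_false]
      rintro ⟨β, u, -, h0⟩
      exact (hx.map (eval ![s, β])).ne_zero h0
    | h₃ a p ha hp ih =>
      intro _
      refine ((finite_omitted_of_prime hJ hp).union (ih ha)).subset ?_
      rintro s ⟨β, u, hu, h0⟩
      rw [map_mul, mul_eq_zero] at h0
      exact h0.imp (fun h => ⟨β, u, hu, h⟩) fun h => ⟨β, u, hu, h⟩
  exact (key g hg).subset fun s ⟨β, u, hu⟩ => ⟨β, u, hu, h s β u hu⟩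

end OmittedFinite
end

open MvPolynomial NumberField

section Fibres

variable {k : Type*} [Field k] [CharZero k]

lemma eq_zero_of_infinite_dvd {P Q f : MvPolynomial (Fin 2) k} (hJ : hamDer P Q = 1) {A : Set k}
    (hA : A.Infinite) (h : ∀ s ∈ A, P - C s ∣ f) : f = 0 := by
  induction' hn : f.totalDegree using Nat.strong_induction_on with n ih generalizing f A
  obtain ⟨s, hs⟩ := hA.nonempty
  obtain ⟨g, rfl⟩ := h s hs
  by_cases hg0 : g = 0
  · rw [hg0, mul_zero]
  have hdeg : 0 < (P - C s).totalDegree := by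
    rw [Nat.pos_iff_ne_zero]
    intro h0
    obtain ⟨c, hc⟩ : ∃ c, P - C s = C c := ⟨_, totalDegree_eq_zero_iff_eq_C.mp h0⟩
    refine not_isUnit_sub_C_of_hamDer hJ s ?_
    rw [hc]
    refine (isUnit_iff_ne_zero.mpr fun hc0 => ?_).map C
    rw [hc0, C_0] at hc
    exact sub_C_ne_zero_of_hamDer hJ s hc
  rw [totalDegree_mul_of_isDomain (sub_C_ne_zero_of_hamDer hJ s) hg0] at hn
  refine absurd (ih _ (by omega) (hA.diff (Set.finite_singleton s)) ?_ rfl) hg0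
  rintro t ⟨ht, hts⟩
  have hts' : t - s ≠ 0 := sub_ne_zero.mpr hts
  have hcop : IsCoprime (P - C t) (P - C s) := by
    refine ⟨-C (t - s)⁻¹, C (t - s)⁻¹, ?_⟩
    have : (C (t - s)⁻¹ : MvPolynomial (Fin 2) k) * (C t - C s) = 1 := by
      rw [← C_sub, ← C_mul, inv_mul_cancel₀ hts', C_1]
    linear_combination this
  exact hcop.dvd_of_dvd_mul_left (h t ht)

omit [CharZero k] in
lemma MonicIn.sub_C {P : MvPolynomial (Fin 2) k} {N : ℕ} (h : MonicIn P N) (hN : 0 < N) (s : k) :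
    MonicIn (P - C s) N := by
  obtain ⟨h1, c, hc, h2⟩ := h
  have e : toBi k (P - C s) = toBi k P - Polynomial.C (Polynomial.C s) := by
    rw [map_sub, toBi_C]
  have hd : (toBi k (P - C s)).natDegree = N := by rw [e, Polynomial.natDegree_sub_C, h1]
  refine ⟨hd, c, hc, ?_⟩
  rw [Polynomial.leadingCoeff, hd, e, Polynomial.coeff_sub, Polynomial.coeff_C_ne_zero hN.ne',
    sub_zero, ← h1]
  exact h2

omit [CharZero k] in
lemma exists_natDegree_coeff_le (P : MvPolynomial (Fin 2) k) :
    ∃ κ : ℕ, 1 ≤ κ ∧ ∀ s j, ((toBi k (P - C s)).coeff j).natDegree ≤ κ := by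
  refine ⟨(toBi k P).support.sup (fun j => ((toBi k P).coeff j).natDegree) + 1, by omega,
    fun s j => ?_⟩
  have h1 : ((toBi k P).coeff j).natDegree ≤
      (toBi k P).support.sup (fun j => ((toBi k P).coeff j).natDegree) := by
    by_cases hj : j ∈ (toBi k P).support
    · exact Finset.le_sup (f := fun j => ((toBi k P).coeff j).natDegree) hj
    · simp [Polynomial.notMem_support_iff.mp hj]
  rw [map_sub, toBi_C, Polynomial.coeff_sub, Polynomial.coeff_C]
  split_ifs
  · rw [Polynomial.natDegree_sub_C]; omega
  · rw [sub_zero]; omega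

end Fibres

section Assembly

variable {Ω : Type} [Field Ω] [CharZero Ω] [IsAlgClosed Ω] [Algebra.IsAlgebraic ℚ Ω]

/-- On an irreducible fibre with infinitely many integral points, either the Hamiltonian flow is
locally nilpotent on the coordinates, or the second component omits a value. -/
theorem dvd_iterate_or_omitted {K : Type*} [Field K] [NumberField K] (j : K →+* Ω)
    {p Q : MvPolynomial (Fin 2) Ω} {N κ : ℕ} (hp : Irreducible p) (hm : MonicIn p N) (hN : 0 < N)
    (hκ1 : 1 ≤ κ) (hκ : ∀ j, ((toBi Ω p).coeff j).natDegree ≤ κ) (hJ : hamDer p Q = 1)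
    (QK : MvPolynomial (Fin 2) (𝓞 K)) (hQ : map (j.comp (algebraMap (𝓞 K) K)) QK = Q)
    (hinf : {a : 𝓞 K × 𝓞 K | eval ![j a.1, j a.2] p = 0}.Infinite) :
    (∀ i, p ∣ (hamDer p)^[κ * N + 1] (X i)) ∨
      ∃ (β : Ω) (u : MvPolynomial (Fin 2) Ω), p ∣ u * (Q - C β) - 1 := by
  obtain ⟨A⟩ := exists_cusps hp hN hm
  obtain ⟨U, xK, yK, h, W, hW, hker⟩ := exists_cuspLimits_of_infinite A hp hm hN j hinf
  have hA : ∀ φ, (∀ c, OrdGe (A.e c φ) 1) → p ∣ φ := fun φ hφ =>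
    W.dvd_of_ordGe_one (xK := xK) (yK := yK) (fun _ => rfl) (fun _ => rfl) hker hW φ hφ
  have hE := W.sum_exponent_nonpos hp hJ (xK := xK) (yK := yK) (fun _ => rfl) (fun _ => rfl)
    hker hW hm hN hκ QK hQ
  rcases hE.lt_or_eq with hE | hE
  · exact Or.inl fun i => A.dvd_iterate_X hp hJ hm hN hA hκ1 hκ hE i
  · exact Or.inr (A.exists_omitted hp hJ hm hN hA hE)

lemma map_hamDer {k L : Type*} [Field k] [Field L] (j : k →+* L) (P f : MvPolynomial (Fin 2) k) :
    map j (hamDer P f) = hamDer (map j P) (map j f) := by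
  simp only [hamDer_apply, map_sub, map_mul, pderiv_map]

lemma hamDer_sub_C_left {k : Type*} [Field k] (P : MvPolynomial (Fin 2) k) (s : k) :
    hamDer (P - C s) = hamDer P := by
  ext i : 1
  simp [hamDer_apply]

theorem iterate_hamDer_eq_zero_of_monicIn {K : Type*} [Field K] [NumberField K] (j : K →+* Ω)
    (P Q : MvPolynomial (Fin 2) (𝓞 K))
    (hJ : pderiv 0 P * pderiv 1 Q - pderiv 1 P * pderiv 0 Q = 1)
    (hinf : ∀ s : 𝓞 K, {p : 𝓞 K × 𝓞 K | eval ![p.1, p.2] P = s}.Infinite) {N : ℕ} (hN : 0 < N)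
    (hm : MonicIn (map (j.comp (algebraMap (𝓞 K) K)) P) N) :
    ∃ a : ℕ, ∀ i, (hamDer (map (j.comp (algebraMap (𝓞 K) K)) P))^[a] (X i) = 0 := by
  set ι := j.comp (algebraMap (𝓞 K) K) with hι
  have hιi : Function.Injective ι := j.injective.comp RingOfIntegers.coe_injective
  set PΩ := map ι P with hP
  set QΩ := map ι Q with hQ
  have hJΩ : hamDer PΩ QΩ = 1 := by
    rw [hamDer_apply, hP, hQ, pderiv_map, pderiv_map, pderiv_map, pderiv_map, ← map_mul, ← map_mul,
      ← map_sub, hJ, map_one]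
  obtain ⟨κ, hκ1, hκ⟩ := exists_natDegree_coeff_le PΩ
  obtain ⟨d, hd, hirr⟩ := exists_irreducible_sub_C hJΩ
  refine ⟨κ * N + 1, fun i => ?_⟩
  let G : Set Ω := Set.range ι \ ({s | d.IsRoot s} ∪
    {s | ∃ β u, PΩ - C s ∣ u * (QΩ - C β) - 1})
  have hG : G.Infinite := (Set.infinite_range_of_injective hιi).diff
    ((Polynomial.finite_setOf_isRoot hd).union (finite_omitted hJΩ))
  refine eq_zero_of_infinite_dvd hJΩ hG ?_
  rintro _ ⟨⟨s, rfl⟩, hs⟩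
  rw [Set.mem_union, not_or] at hs
  have hJs : hamDer (PΩ - C (ι s)) QΩ = 1 := by rw [hamDer_sub_C_left, hJΩ]
  have h := dvd_iterate_or_omitted j (hirr _ hs.1) (hm.sub_C hN _) hN hκ1 (hκ _) hJs Q rfl (by
    refine (hinf s).mono fun a ha => ?_
    have e : eval ![ι a.1, ι a.2] PΩ = ι (eval ![a.1, a.2] P) := eval_map_pair ι a.1 a.2 P
    rw [Set.mem_setOf_eq] at ha ⊢
    change eval ![ι a.1, ι a.2] _ = 0
    rw [map_sub, e, ha, eval_C, sub_self])
  rw [hamDer_sub_C_left] at h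
  exact (h.resolve_right hs.2) i

end Assembly

section Shear

/-- The shear automorphism `x ↦ x + λ y`. -/
noncomputable def shear {R : Type*} [CommRing R] (c : R) :
    MvPolynomial (Fin 2) R →ₐ[R] MvPolynomial (Fin 2) R :=
  aeval ![X 0, X 1 + C c * X 0]

lemma shear_shear_neg {R : Type*} [CommRing R] (c : R) (f : MvPolynomial (Fin 2) R) :
    shear c (shear (-c) f) = f := by
  have : (shear c).comp (shear (-c)) = AlgHom.id R (MvPolynomial (Fin 2) R) := by
    refine MvPolynomial.algHom_ext fun i => ?_
    fin_cases i <;> simp [shear]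
  exact AlgHom.congr_fun this f

lemma eval_shear {R : Type*} [CommRing R] (c a b : R) (f : MvPolynomial (Fin 2) R) :
    eval ![a, b] (shear c f) = eval ![a, b + c * a] f := by
  have : (eval ![a, b]).comp (shear c : MvPolynomial (Fin 2) R →+* _) = eval ![a, b + c * a] := by
    refine MvPolynomial.ringHom_ext (fun r => ?_) fun i => ?_
    · simp [shear]
    · fin_cases i <;> simp [shear]
  exact RingHom.congr_fun this f

lemma map_shear {R S : Type*} [CommRing R] [CommRing S] (φ : R →+* S) (c : R)
    (f : MvPolynomial (Fin 2) R) : map φ (shear c f) = shear (φ c) (map φ f) := by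
  have : (map φ).comp (shear c : MvPolynomial (Fin 2) R →+* _) =
      (shear (φ c) : MvPolynomial (Fin 2) S →+* MvPolynomial (Fin 2) S).comp (map φ) := by
    refine MvPolynomial.ringHom_ext (fun r => ?_) fun i => ?_
    · simp [shear]
    · fin_cases i <;> simp [shear]
  exact RingHom.congr_fun this f

lemma pderiv_shear {R : Type*} [CommRing R] (c : R) (f : MvPolynomial (Fin 2) R) :
    pderiv 0 (shear c f) = shear c (pderiv 0 f) + C c * shear c (pderiv 1 f) ∧
      pderiv 1 (shear c f) = shear c (pderiv 1 f) := by
  constructor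
  · rw [shear, derivation_aeval_pair]
    simp [Derivation.leibniz, pderiv_X]
    ring
  · rw [shear, derivation_aeval_pair]
    simp [Derivation.leibniz, pderiv_X]

lemma jacobian_shear {R : Type*} [CommRing R] (c : R) (P Q : MvPolynomial (Fin 2) R) :
    pderiv 0 (shear c P) * pderiv 1 (shear c Q) - pderiv 1 (shear c P) * pderiv 0 (shear c Q)
      = shear c (pderiv 0 P * pderiv 1 Q - pderiv 1 P * pderiv 0 Q) := by
  rw [(pderiv_shear c P).1, (pderiv_shear c P).2, (pderiv_shear c Q).1, (pderiv_shear c Q).2]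
  simp only [map_sub, map_mul]
  ring

lemma coeff_toBi_shear_monomial {k : Type*} [Field k] (c r : k) (m : Fin 2 →₀ ℕ) :
    (toBi k (shear c (monomial m r))).natDegree ≤ m 0 + m 1 ∧
      (toBi k (shear c (monomial m r))).coeff (m 0 + m 1) = Polynomial.C (r * c ^ m 1) := by
  have e : toBi k (shear c (monomial m r)) = Polynomial.C (Polynomial.C r) *
      (Polynomial.X ^ m 0 * (Polynomial.C Polynomial.X +
        Polynomial.C (Polynomial.C c) * Polynomial.X) ^ m 1) := by
    rw [monomial_eq, Finsupp.prod_fintype _ _ (by simp)]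
    simp [shear, Fin.prod_univ_two]
  set ℓ : Polynomial (Polynomial k) := Polynomial.C Polynomial.X +
        Polynomial.C (Polynomial.C c) * Polynomial.X with hℓ
  have h1 : ℓ.natDegree ≤ 1 := by
    rw [hℓ, add_comm]; exact Polynomial.natDegree_linear_le
  have h2 : (ℓ ^ m 1).natDegree ≤ m 1 := by
    simpa using Polynomial.natDegree_pow_le_of_le (m 1) h1
  have h3 : (ℓ ^ m 1).coeff (m 1) = Polynomial.C c ^ m 1 := by
    have := Polynomial.coeff_pow_of_natDegree_le (m := m 1) h1
    rw [mul_one] at this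
    rw [this, hℓ]
    simp
  rw [e]
  constructor
  · refine (Polynomial.natDegree_C_mul_le _ _).trans ?_
    refine Polynomial.natDegree_mul_le_of_le (Polynomial.natDegree_X_pow_le _) h2
  · rw [Polynomial.coeff_C_mul, add_comm, Polynomial.coeff_X_pow_mul, h3, map_mul, map_pow]

lemma exists_monicIn_shear {k : Type*} [Field k] [CharZero k] (P : MvPolynomial (Fin 2) k)
    (hP : P.totalDegree ≠ 0) : ∃ c : ℕ, MonicIn (shear (c : k) P) P.totalDegree := by
  classical
  set d := P.totalDegree with hd
  let S := P.support.filter fun m => m 0 + m 1 = d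
  let q : Polynomial k := ∑ m ∈ S, Polynomial.monomial (m 1) (coeff m P)
  have hle : ∀ m ∈ P.support, m 0 + m 1 ≤ d := fun m hm => by
    have := le_totalDegree hm
    rwa [Finsupp.sum_fintype _ _ (by simp), Fin.sum_univ_two] at this
  have hq : q ≠ 0 := by
    obtain ⟨m, hm, hmd⟩ := Finset.exists_mem_eq_sup P.support
      (support_nonempty.mpr (by rintro rfl; simp at hd; exact hP hd)) (fun s => s.sum fun _ e => e)
    change P.totalDegree = _ at hmd
    rw [Finsupp.sum_fintype _ _ (by simp), Fin.sum_univ_two] at hmd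
    intro h0
    have h1 : q.coeff (m 1) = coeff m P := by
      rw [Polynomial.finset_sum_coeff, Finset.sum_eq_single m]
      · simp
      · intro b hb hbm
        rw [Polynomial.coeff_monomial, if_neg]
        intro hb1
        have hb2 := (Finset.mem_filter.mp hb).2
        refine hbm (Finsupp.ext fun i => ?_)
        fin_cases i
        · change b 0 = m 0; omega
        · exact hb1
      · intro h
        exact absurd (Finset.mem_filter.mpr ⟨hm, hmd.symm⟩) h
    rw [h0, Polynomial.coeff_zero] at h1
    exact mem_support_iff.mp hm h1.symm
  obtain ⟨c, hc⟩ : ∃ c : ℕ, q.eval (c : k) ≠ 0 := by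
    by_contra! hall
    refine (Set.infinite_range_of_injective (Nat.cast_injective (R := k))).mono ?_
      (Polynomial.finite_setOf_isRoot hq)
    rintro _ ⟨c, rfl⟩
    exact hall c
  have hsum : toBi k (shear (c : k) P) =
      ∑ m ∈ P.support, toBi k (shear (c : k) (monomial m (coeff m P))) := by
    conv_lhs => rw [P.as_sum]
    rw [map_sum, map_sum]
  have hco : (toBi k (shear (c : k) P)).coeff d = Polynomial.C (q.eval (c : k)) := by
    rw [hsum, Polynomial.finset_sum_coeff, Polynomial.eval_finset_sum, map_sum, Finset.sum_filter]
    refine Finset.sum_congr rfl fun m hm => ?_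
    obtain ⟨h1, h2⟩ := coeff_toBi_shear_monomial (c : k) (coeff m P) m
    split_ifs with h
    · rw [← h, h2, Polynomial.eval_monomial]
    · exact Polynomial.coeff_eq_zero_of_natDegree_lt
        (h1.trans_lt (lt_of_le_of_ne (hle m hm) h))
  have hnd : (toBi k (shear (c : k) P)).natDegree = d := by
    refine le_antisymm ?_ (Polynomial.le_natDegree_of_ne_zero (by simpa [hco] using hc))
    rw [hsum]
    exact Polynomial.natDegree_sum_le_of_forall_le _ _ fun m hm =>
      (coeff_toBi_shear_monomial _ _ m).1.trans (hle m hm)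
  exact ⟨c, hnd, _, hc, by rw [Polynomial.leadingCoeff, hnd, hco]⟩

end Shear

/-- If `F = (P,Q)` is a Jacobian pair over `𝓞 K` such that every fiber `P = k`,
`k ∈ 𝓞 K`, contains infinitely many integral points, then `F` is invertible over `K`. -/
theorem invertible_of_all_fibers_infinite
    (K : Type*) [Field K] [NumberField K]
    (P Q : MvPolynomial (Fin 2) (𝓞 K))
    (hJac : pderiv 0 P * pderiv 1 Q - pderiv 1 P * pderiv 0 Q = 1)
    (hinf : ∀ k : 𝓞 K, {p : 𝓞 K × 𝓞 K | eval ![p.1, p.2] P = k}.Infinite) :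
    ∃ U V : MvPolynomial (Fin 2) K,
      aeval ![MvPolynomial.map (algebraMap (𝓞 K) K) P,
              MvPolynomial.map (algebraMap (𝓞 K) K) Q] U = X 0 ∧
      aeval ![MvPolynomial.map (algebraMap (𝓞 K) K) P,
              MvPolynomial.map (algebraMap (𝓞 K) K) Q] V = X 1 ∧
      aeval ![U, V] (MvPolynomial.map (algebraMap (𝓞 K) K) P) = X 0 ∧
      aeval ![U, V] (MvPolynomial.map (algebraMap (𝓞 K) K) Q) = X 1 := by
  let j : K →+* AlgebraicClosure ℚ :=
    (IsAlgClosed.lift (R := ℚ) (S := K) : K →ₐ[ℚ] AlgebraicClosure ℚ).toRingHom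
  set PK := map (algebraMap (𝓞 K) K) P with hPK
  set QK := map (algebraMap (𝓞 K) K) Q with hQK
  have hJK : hamDer PK QK = 1 := by
    rw [hamDer_apply, hPK, hQK, pderiv_map, pderiv_map, pderiv_map, pderiv_map, ← map_mul,
      ← map_mul, ← map_sub, hJac, map_one]
  have hdeg : (map j PK).totalDegree ≠ 0 := by
    intro h0
    have h1 := congrArg (map j) hJK
    rw [map_hamDer, totalDegree_eq_zero_iff_eq_C.mp h0, hamDer_apply] at h1
    simp at h1
  obtain ⟨c, hc⟩ := exists_monicIn_shear (map j PK) hdeg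
  set P' := shear (c : 𝓞 K) P with hP'
  set Q' := shear (c : 𝓞 K) Q with hQ'
  have hmap : ∀ f : MvPolynomial (Fin 2) (𝓞 K), map (algebraMap (𝓞 K) K) (shear (c : 𝓞 K) f) =
      shear (c : K) (map (algebraMap (𝓞 K) K) f) := fun f => by rw [map_shear, map_natCast]
  have hmapj : map (j.comp (algebraMap (𝓞 K) K)) P' = map j (shear (c : K) PK) := by
    rw [← MvPolynomial.map_map, hP', hmap]
  have hJ' : pderiv 0 P' * pderiv 1 Q' - pderiv 1 P' * pderiv 0 Q' = 1 := by
    rw [jacobian_shear, hJac, map_one]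
  have hinf' : ∀ s : 𝓞 K, {p : 𝓞 K × 𝓞 K | eval ![p.1, p.2] P' = s}.Infinite := by
    intro s
    have hi : Function.Injective fun p : 𝓞 K × 𝓞 K => (p.1, p.2 - (c : 𝓞 K) * p.1) := by
      rintro ⟨a, b⟩ ⟨a', b'⟩ h
      obtain ⟨h1, h2⟩ := Prod.mk.inj h
      change a = a' at h1
      subst h1
      exact Prod.ext rfl (sub_left_inj.mp h2)
    refine ((hinf s).image hi.injOn).mono ?_
    rintro _ ⟨p, hp, rfl⟩
    rw [Set.mem_setOf_eq, eval_shear, sub_add_cancel]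
    exact hp
  haveI : Algebra.IsAlgebraic ℚ (AlgebraicClosure ℚ) := by
    have h := AlgebraicClosure.isAlgebraic ℚ
    have e : (AlgebraicClosure.instAlgebra ℚ : Algebra ℚ (AlgebraicClosure ℚ)) =
      DivisionRing.toRatAlgebra := Subsingleton.elim _ _
    rw [e] at h
    exact h
  obtain ⟨a, ha⟩ := iterate_hamDer_eq_zero_of_monicIn j P' Q' hJ' hinf' (Nat.pos_of_ne_zero hdeg)
    (by rw [hmapj, map_shear, map_natCast]; exact hc)
  set PS := shear (c : K) PK with hPS
  set QS := shear (c : K) QK with hQS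
  have hJS : hamDer PS QS = 1 := by
    have h := jacobian_shear (c : K) PK QK
    rw [← hamDer_apply, ← hamDer_apply, hJK, map_one] at h
    exact h
  have hit : ∀ (n : ℕ) (f : MvPolynomial (Fin 2) K),
      map j ((hamDer PS)^[n] f) = (hamDer (map j PS))^[n] (map j f) := by
    intro n
    induction n with
    | zero => intro f; rfl
    | succ n ih => intro f; rw [Function.iterate_succ_apply, ih, map_hamDer,
        Function.iterate_succ_apply]
  have hnil : ∀ i, (hamDer PS)^[a] (X i) = 0 := by
    intro i
    refine map_injective j j.injective ?_
    rw [hit, map_X, map_zero]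
    rw [hmapj] at ha
    exact ha i
  have hsurj := aeval_pair_surjective hJS hnil
  refine exists_inverse_of_surjective hJK fun f => ?_
  obtain ⟨U, hU⟩ := hsurj (shear (c : K) f)
  refine ⟨U, ?_⟩
  have h1 : aeval ![PS, QS] U = shear (c : K) (aeval ![PK, QK] U) := by
    have : aeval ![PS, QS] = (shear (c : K)).comp (aeval ![PK, QK]) := by
      refine MvPolynomial.algHom_ext fun i => ?_
      fin_cases i <;> simp [hPS, hQS]
    rw [this]; rfl
  have hinj : Function.Injective (shear (c : K)) := by
    refine Function.LeftInverse.injective (g := shear (-(c : K))) fun f => ?_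
    have := shear_shear_neg (-(c : K)) f
    rwa [neg_neg] at this
  exact hinj (by rw [← h1, hU])
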